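/- Let α∈(0,3/2] and suppose F satisfies the regular right tail condition (with exponent α) and the converging tail ratio condition, with q=P(X>0)∈(0,1); suppose Sₙ/aₙ converges in distribution, without centering, to a non-zero stable random variable ζ, and that αρ∈(0,1/2] where ρ=P(ζ>0). Suppose there exist L∈ℛ with L(x)≥1 for all x, T≥0 and η∈(0,1] such that, as x→∞: (a) F̄₊(x)·L(x)→0 and x·F̄₊(x)·∑_{n<L(x)} P(H_n∈(x,x+h]) → 0; (b) if αρ∈(0,1/2), then I_η(x,T) = o( ℓ₊(x)²·ℓ₊⁻(L(x)) / L(x)² ); (c) if αρ=1/2, then, setting u₊(x)=∫₁^x (ℓ₊(s)/s)² ds and k₊(x)=ℓ₊(x)²/u₊(x), one has I_η(x,T)=O(k₊(x)) in case u₊(x)/u₊(ℓ₊⁻(L(x)))→1, and I_η(x,T)=o(k₊(x)) otherwise. Then the SRT holds for F₊, namely lim_{x→∞} x·F̄₊(x)·U₊((x,x+h]) = h·sin(παρ)/π. -/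

import Mathlib

open MeasureTheory Filter Set Real Asymptotics

attribute [local instance] Classical.propDecidable

noncomputable section

namespace SRT

/-- Convolution of two measures on `ℝ`. -/
def mconv (μ ν : Measure ℝ) : Measure ℝ := μ.bind fun x => ν.map fun y => x + y

/-- `n`-fold self-convolution of `μ`, with the 0-th power the unit mass at `0`. -/
def convPow (μ : Measure ℝ) : ℕ → Measure ℝ
  | 0 => Measure.dirac 0
  | n + 1 => mconv (convPow μ n) μ

/-- The renewal measure `U = ∑ₙ F^{*n}`. -/
def renewal (μ : Measure ℝ) : Measure ℝ := Measure.sum fun n => convPow μ n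

/-- Right tail `F̄(x) = μ((x,∞))`. -/
def rtail (μ : Measure ℝ) (x : ℝ) : ℝ := (μ (Set.Ioi x)).toReal

/-- `f` is strictly positive on `(0,∞)` and regularly varying at `∞` with exponent `β`. -/
def RegVary (f : ℝ → ℝ) (β : ℝ) : Prop :=
  (∀ x > 0, 0 < f x) ∧
    ∀ c > 0, Tendsto (fun x => f (c * x) / f x) atTop (nhds (c ^ β))

/-- `f` is regularly varying at `∞` with some exponent. -/
def RegVaryAny (f : ℝ → ℝ) : Prop := ∃ β : ℝ, RegVary f β

/-- Regular right tail condition: `F̄(x) ∼ 1/ℓ(x)` as `x → ∞`. -/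
def RightTail (μ : Measure ℝ) (ℓ : ℝ → ℝ) : Prop :=
  Tendsto (fun x => rtail μ x * ℓ x) atTop (nhds 1)

/-- Converging tail ratio condition: `F(-x)/F̄(x)` converges to a finite limit. -/
def TailRatio (μ : Measure ℝ) : Prop :=
  ∃ p : ℝ, Tendsto (fun x => (μ (Set.Iic (-x))).toReal / rtail μ x) atTop (nhds p)

/-- `μ` is concentrated on `dℤ`. -/
def ConcOn (μ : Measure ℝ) (d : ℝ) : Prop := μ {x : ℝ | ∃ k : ℤ, x = k * d} = 1

/-- `μ` is arithmetic. -/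
def Arith (μ : Measure ℝ) : Prop := ∃ d > 0, ConcOn μ d

/-- `h` is admissible: any positive number if `μ` is non-arithmetic, and
the span of `μ` if `μ` is arithmetic. -/
def SpanOK (μ : Measure ℝ) (h : ℝ) : Prop :=
  0 < h ∧ (¬ Arith μ ∨ (ConcOn μ h ∧ ∀ d > 0, ConcOn μ d → d ≤ h))

/-- `μ` is concentrated on `a + dℤ`. -/
def ConcOnLat (μ : Measure ℝ) (a d : ℝ) : Prop :=
  μ {x : ℝ | ∃ k : ℤ, x = a + k * d} = 1

/-- `μ` is lattice. -/
def IsLattice (μ : Measure ℝ) : Prop := ∃ a d : ℝ, 0 ≤ a ∧ a < d ∧ ConcOnLat μ a d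

/-- `h` is admissible: any positive number if `μ` is non-lattice, and
the span of `μ` if `μ` is lattice. -/
def LatSpanOK (μ : Measure ℝ) (h : ℝ) : Prop :=
  0 < h ∧ (¬ IsLattice μ ∨
    ((∃ a, 0 ≤ a ∧ a < h ∧ ConcOnLat μ a h) ∧
      ∀ a d : ℝ, 0 ≤ a → a < d → ConcOnLat μ a d → d ≤ h))

/-- Generalized inverse `ℓ⁻(x) = inf {t ≥ 1 : ℓ(t) > x}`. -/
def linv (ℓ : ℝ → ℝ) (x : ℝ) : ℝ := sInf {t : ℝ | 1 ≤ t ∧ x < ℓ t}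

/-- `ω(x) = x F((x,x+h]) / F̄(x)`. -/
def omegaFn (μ : Measure ℝ) (h x : ℝ) : ℝ :=
  x * (μ (Set.Ioc x (x + h))).toReal / rtail μ x

/-- `I_η(x,T) = ∫_{(1-η)x}^x (ω(y)-T)⁺ dy`. -/
def Iof (μ : Measure ℝ) (h η x T : ℝ) : ℝ :=
  ∫ y in (1 - η) * x..x, max (omegaFn μ h y - T) 0

/-- `Î_{η,n,r}(x,T) = ∫_{(1-η)x}^x e^{-(x-y)/(r aₙ)} (ω(y)-T)⁺ dy`. -/
def IofHat (μ : Measure ℝ) (ℓ : ℝ → ℝ) (h η : ℝ) (n : ℕ) (r x T : ℝ) : ℝ :=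
  ∫ y in (1 - η) * x..x,
    Real.exp (-(x - y) / (r * linv ℓ (n : ℝ))) * max (omegaFn μ h y - T) 0

/-- `Sₙ/aₙ` converges in distribution to a law with density `g`. -/
def StableLimit (F : Measure ℝ) (ℓ : ℝ → ℝ) (g : ℝ → ℝ) : Prop :=
  ∀ f : BoundedContinuousFunction ℝ ℝ,
    Tendsto (fun n : ℕ =>
        ∫ x, f x ∂((convPow F n).map fun y => y / linv ℓ (n : ℝ))) atTop
      (nhds (∫ x, f x * g x))

/-- `Sₙ/aₙ` converges in distribution to the law `μζ`. -/
def WeakLimit (F : Measure ℝ) (ℓ : ℝ → ℝ) (μζ : Measure ℝ) : Prop :=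
  ∀ f : BoundedContinuousFunction ℝ ℝ,
    Tendsto (fun n : ℕ =>
        ∫ x, f x ∂((convPow F n).map fun y => y / linv ℓ (n : ℝ))) atTop
      (nhds (∫ x, f x ∂μζ))

/-- The law `μ` is stable: for each `n`, the `n`-fold convolution is the law of
`cₙ X + dₙ` for some `cₙ > 0`, `dₙ`. -/
def IsStable (μ : Measure ℝ) : Prop :=
  ∀ n : ℕ, 0 < n → ∃ c : ℝ, 0 < c ∧ ∃ d : ℝ, convPow μ n = μ.map fun x => c * x + d

/-- The strong renewal theorem:
`x F̄(x) U((x,x+h]) → α h ∫₀^∞ t^{-α} g(t) dt`. -/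
def SRTholds (F : Measure ℝ) (h α : ℝ) (g : ℝ → ℝ) : Prop :=
  Tendsto (fun x : ℝ => x * rtail F x * ((renewal F) (Set.Ioc x (x + h))).toReal)
    atTop (nhds (α * h * ∫ t in Set.Ioi (0:ℝ), t ^ (-α) * g t))

variable {Ω : Type*} [MeasurableSpace Ω]

/-- Partial sums `Sₙ = X₁ + ⋯ + Xₙ`. -/
def pSum (X : ℕ → Ω → ℝ) (n : ℕ) (ω : Ω) : ℝ := ∑ i ∈ Finset.range n, X i ω

/-- `X` is an i.i.d. sequence with common law `F` under `P`. -/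
def IIDseq (P : Measure Ω) (F : Measure ℝ) (X : ℕ → Ω → ℝ) : Prop :=
  (∀ i, Measurable (X i)) ∧ (∀ i, P.map (X i) = F) ∧
    ProbabilityTheory.iIndepFun X P

/-- `Nₙ = #{i ≤ n : Xᵢ > 0}`. -/
def Ncount (X : ℕ → Ω → ℝ) (n : ℕ) (ω : Ω) : ℕ :=
  ((Finset.range n).filter fun i => 0 < X i ω).card

/-- `Sₙ⁻ = ∑_{i ≤ n} Xᵢ⁻`. -/
def sMinus (X : ℕ → Ω → ℝ) (n : ℕ) (ω : Ω) : ℝ :=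
  ∑ i ∈ Finset.range n, max (-(X i ω)) 0

/-- The quantity `R_{T,η,r,c₁,c₂}(x,δ)` of Theorem `t:sum-small-n`, with
`xₙ = x + Sₙ⁻` and `κ = ⌊1/α⌋`. -/
def Rquant (F : Measure ℝ) (ℓ : ℝ → ℝ) (h α : ℝ) (P : Measure Ω) (X : ℕ → Ω → ℝ)
    (L : ℝ → ℝ) (T η r c₁ c₂ x δ : ℝ) : ℝ :=
  (x / ℓ x) * ∑ n ∈ Finset.Ico ⌈L x⌉₊ ⌈ℓ (δ * x)⌉₊,
    ∫ ω, ((Ncount X n ω : ℝ) / linv ℓ ((Ncount X n ω : ℕ) : ℝ)) *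
        (rtail F (x + sMinus X n ω) / (x + sMinus X n ω)) *
        sSup ((fun t => IofHat F ℓ h η (Ncount X n ω) r t T) ''
          Set.Icc (c₁ * (x + sMinus X n ω) / (⌊1/α⌋₊ : ℝ))
            (c₂ * (x + sMinus X n ω) + 2 * h)) ∂P

/-- Strict ascending ladder epochs. -/
def ladderTime (X : ℕ → Ω → ℝ) : ℕ → Ω → ℕ
  | 0 => fun _ => 0
  | k + 1 => fun ω =>
      sInf {n : ℕ | ladderTime X k ω < n ∧ pSum X (ladderTime X k ω) ω < pSum X n ω}

/-- Strict ascending ladder heights `H_k`. -/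
def ladderHeight (X : ℕ → Ω → ℝ) (k : ℕ) (ω : Ω) : ℝ := pSum X (ladderTime X k ω) ω

/-- Weak descending ladder epochs (weak ascending epochs of `-S`). -/
def wLadderTimeDesc (X : ℕ → Ω → ℝ) : ℕ → Ω → ℕ
  | 0 => fun _ => 0
  | k + 1 => fun ω =>
      sInf {n : ℕ | wLadderTimeDesc X k ω < n ∧
        pSum X n ω ≤ pSum X (wLadderTimeDesc X k ω) ω}

/-- Weak descending ladder heights (ladder heights of the walk `-S`). -/
def wLadderHeightDesc (X : ℕ → Ω → ℝ) (k : ℕ) (ω : Ω) : ℝ :=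
  - pSum X (wLadderTimeDesc X k ω) ω

/-- `X_{n:k}`, the `k`-th largest among `X₁,…,Xₙ`; by convention `0` if `k > n`. -/
def ordStat (X : ℕ → Ω → ℝ) (n k : ℕ) (ω : Ω) : ℝ :=
  sSup {t : ℝ | k ≤ ((Finset.range n).filter fun i => t ≤ X i ω).card}

/-- `S_{n:k} = X_{n:1} + ⋯ + X_{n:k}`. -/
def topSum (X : ℕ → Ω → ℝ) (n k : ℕ) (ω : Ω) : ℝ :=
  ∑ j ∈ Finset.Icc 1 k, ordStat X n j ω

/-- `ζ_{n,x} = aₙ^{1-γ} x^γ`. -/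
def zetaCut (ℓ : ℝ → ℝ) (γ : ℝ) (n : ℕ) (x : ℝ) : ℝ :=
  (linv ℓ (n : ℝ)) ^ (1 - γ) * x ^ γ

/-- The event `E_{n,k,x} = {Sₙ ∈ (x,x+h], X_{n:k} > ζ_{n,x} ≥ X_{n:k+1}}`,
with the convention `X_{n:0} = ∞`. -/
def Eevent (X : ℕ → Ω → ℝ) (ℓ : ℝ → ℝ) (h γ : ℝ) (n k : ℕ) (x : ℝ) : Set Ω :=
  {ω | pSum X n ω ∈ Set.Ioc x (x + h) ∧
    (k = 0 ∨ zetaCut ℓ γ n x < ordStat X n k ω) ∧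
    ordStat X n (k + 1) ω ≤ zetaCut ℓ γ n x}

end SRT

namespace SRT

open scoped Topology ENNReal

lemma mconv_eq_conv (μ ν : Measure ℝ) [SFinite ν] : mconv μ ν = μ.conv ν := by
  ext s hs
  have hm : Measurable fun x : ℝ => ν.map fun y => x + y := by
    refine Measure.measurable_of_measurable_coe _ fun t ht => ?_
    have : (fun x : ℝ => (ν.map fun y => x + y) t)
        = fun x => ν (Prod.mk x ⁻¹' ((fun p : ℝ × ℝ => p.1 + p.2) ⁻¹' t)) := by
      funext x
      rw [Measure.map_apply (by fun_prop) ht]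
      rfl
    rw [this]
    exact measurable_measure_prodMk_left (measurable_add ht)
  rw [mconv, Measure.bind_apply hs hm.aemeasurable, Measure.conv,
    Measure.map_apply measurable_add hs, Measure.prod_apply (measurable_add hs)]
  refine lintegral_congr fun x => ?_
  rw [Measure.map_apply (by fun_prop) hs]
  rfl

lemma conv_apply (μ ν : Measure ℝ) [SFinite ν] {s : Set ℝ} (hs : MeasurableSet s) :
    (μ.conv ν) s = ∫⁻ x, ν ((fun y => x + y) ⁻¹' s) ∂μ := by
  rw [Measure.conv, Measure.map_apply measurable_add hs, Measure.prod_apply (measurable_add hs)]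
  rfl

@[simp]
lemma convPow_zero (μ : Measure ℝ) : convPow μ 0 = Measure.dirac 0 := rfl

instance isFiniteMeasure_convPow (μ : Measure ℝ) [IsFiniteMeasure μ] (n : ℕ) :
    IsFiniteMeasure (convPow μ n) := by
  induction n with
  | zero => rw [convPow_zero]; infer_instance
  | succ n ih =>
    rw [convPow, mconv_eq_conv]
    infer_instance

lemma convPow_succ (μ : Measure ℝ) [SFinite μ] (n : ℕ) :
    convPow μ (n + 1) = (convPow μ n).conv μ := by
  rw [convPow, mconv_eq_conv]

instance isProbabilityMeasure_convPow (μ : Measure ℝ) [IsProbabilityMeasure μ] (n : ℕ) :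
    IsProbabilityMeasure (convPow μ n) := by
  induction n with
  | zero => rw [convPow_zero]; infer_instance
  | succ n ih =>
    rw [convPow_succ]
    infer_instance

lemma convPow_add (μ : Measure ℝ) [IsFiniteMeasure μ] (m n : ℕ) :
    convPow μ (m + n) = (convPow μ m).conv (convPow μ n) := by
  induction n with
  | zero => simp
  | succ n ih => rw [← add_assoc, convPow_succ, ih, convPow_succ, Measure.conv_assoc]

lemma charFun_convPow (μ : Measure ℝ) [IsProbabilityMeasure μ] (n : ℕ) (t : ℝ) :
    charFun (convPow μ n) t = charFun μ t ^ n := by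
  induction n with
  | zero => simp
  | succ n ih => rw [convPow_succ, charFun_conv, ih, pow_succ]

lemma conv_mono {μ μ' ν ν' : Measure ℝ} [SFinite ν] [SFinite ν'] (h : μ ≤ μ') (h' : ν ≤ ν') :
    μ.conv ν ≤ μ'.conv ν' := by
  refine Measure.le_iff.2 fun s hs => ?_
  rw [conv_apply _ _ hs, conv_apply _ _ hs]
  exact lintegral_mono' h fun x => h' _

lemma convPow_mono {μ ν : Measure ℝ} [IsFiniteMeasure μ] [IsFiniteMeasure ν] (h : μ ≤ ν) (n : ℕ) :
    convPow μ n ≤ convPow ν n := by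
  induction n with
  | zero => simp
  | succ n ih => rw [convPow_succ, convPow_succ]; exact conv_mono ih h

lemma lintegral_exp_convPow (μ : Measure ℝ) [IsFiniteMeasure μ] (l : ℝ) (n : ℕ) :
    ∫⁻ y, ENNReal.ofReal (exp (l * y)) ∂(convPow μ n)
      = (∫⁻ y, ENNReal.ofReal (exp (l * y)) ∂μ) ^ n := by
  induction n with
  | zero => rw [convPow_zero, lintegral_dirac' _ (by fun_prop)]; simp
  | succ n ih =>
    rw [convPow_succ, Measure.lintegral_conv (by fun_prop), pow_succ, ← ih,
      ← lintegral_mul_const _ (by fun_prop)]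
    refine lintegral_congr fun x => ?_
    rw [← lintegral_const_mul _ (by fun_prop)]
    refine lintegral_congr fun y => ?_
    rw [← ENNReal.ofReal_mul (exp_pos _).le, ← exp_add]
    ring_nf

/-- Splitting according to whether some summand exceeds the level `y`. -/
lemma convPow_succ_le_truncated (G : Measure ℝ) [IsFiniteMeasure G] (y : ℝ) (n : ℕ) :
    convPow G (n + 1) ≤ convPow (G.restrict (Iic y)) (n + 1)
      + ((n + 1 : ℕ) : ℝ≥0∞) • (convPow G n).conv (G.restrict (Ioi y)) := by
  have hG : G = G.restrict (Iic y) + G.restrict (Ioi y) := by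
    rw [← compl_Iic]; exact (Measure.restrict_add_restrict_compl measurableSet_Iic).symm
  set G1 := G.restrict (Iic y)
  set G2 := G.restrict (Ioi y)
  have h1 : G1 ≤ G := Measure.restrict_le_self
  induction n with
  | zero =>
    simp only [convPow_succ, convPow_zero, Measure.dirac_zero_conv]
    simpa using hG.le
  | succ n ih =>
    have hsplit : convPow G (n + 1 + 1)
        = (convPow G (n + 1)).conv G1 + (convPow G (n + 1)).conv G2 := by
      rw [convPow_succ G (n + 1), ← Measure.conv_add, ← hG]
    rw [hsplit, convPow_succ G1 (n + 1)]
    calc (convPow G (n + 1)).conv G1 + (convPow G (n + 1)).conv G2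
        ≤ (convPow G1 (n + 1) + ((n + 1 : ℕ) : ℝ≥0∞) • (convPow G n).conv G2).conv G1
          + (convPow G (n + 1)).conv G2 := by
          gcongr
          exact conv_mono ih le_rfl
      _ ≤ _ := by
          rw [Measure.add_conv, Measure.conv_smul_left, Measure.conv_assoc,
            Measure.conv_comm G2 G1, ← Measure.conv_assoc, add_assoc]
          gcongr
          have : (convPow G n).conv G1 ≤ convPow G (n + 1) := by
            rw [convPow_succ]; exact conv_mono le_rfl h1
          calc ((n + 1 : ℕ) : ℝ≥0∞) • ((convPow G n).conv G1).conv G2 + (convPow G (n + 1)).conv G2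
              ≤ ((n + 1 : ℕ) : ℝ≥0∞) • (convPow G (n + 1)).conv G2
                + (convPow G (n + 1)).conv G2 := by
                gcongr
                exact conv_mono this le_rfl
            _ = _ := by
                rw [Nat.cast_succ (n + 1), add_smul, one_smul]

/-- The right tail of `G` is everywhere positive and regularly varying with exponent `-a`. -/
structure RegTail (G : Measure ℝ) (a : ℝ) : Prop where
  pos : ∀ x, 0 < rtail G x
  lim : ∀ c > 0, Tendsto (fun x => rtail G (c * x) / rtail G x) atTop (nhds (c ^ (-a)))



lemma rtail_nonneg (μ : Measure ℝ) (x : ℝ) : 0 ≤ rtail μ x := ENNReal.toReal_nonneg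

lemma rtail_le_one (G : Measure ℝ) [IsProbabilityMeasure G] (x : ℝ) : rtail G x ≤ 1 :=
  measureReal_le_one

lemma rtail_antitone (G : Measure ℝ) [IsProbabilityMeasure G] : Antitone (rtail G) :=
  fun _ _ hxy => measureReal_mono (Ioi_subset_Ioi hxy)

lemma ofReal_rtail (G : Measure ℝ) [IsProbabilityMeasure G] (x : ℝ) :
    ENNReal.ofReal (rtail G x) = G (Ioi x) := ENNReal.ofReal_toReal (measure_ne_top _ _)

lemma measurable_rtail (G : Measure ℝ) [IsProbabilityMeasure G] : Measurable (rtail G) :=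
  (rtail_antitone G).measurable

lemma RegTail.of_regVary {G : Measure ℝ} [IsProbabilityMeasure G] {ℓ : ℝ → ℝ} {a : ℝ}
    (hℓ : RegVary ℓ a) (hG : RightTail G ℓ) : RegTail G a := by
  have hpos : ∀ᶠ x in atTop, 0 < rtail G x := by
    filter_upwards [hG.eventually (lt_mem_nhds one_pos)] with x hx
    rcases (rtail_nonneg G x).lt_or_eq with h | h
    · exact h
    · rw [← h, zero_mul] at hx; exact absurd hx (lt_irrefl _)
  refine ⟨fun x => ?_, fun c hc => ?_⟩
  · obtain ⟨y, hy, hxy⟩ := (hpos.and (eventually_ge_atTop x)).exists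
    exact hy.trans_le (rtail_antitone G hxy)
  · have h1 : Tendsto (fun x => rtail G (c * x) * ℓ (c * x)) atTop (nhds 1) :=
      hG.comp (tendsto_id.const_mul_atTop hc)
    have h2 := ((h1.div hG one_ne_zero).div (hℓ.2 c hc) (rpow_pos_of_pos hc _).ne')
    rw [div_one, one_div, ← rpow_neg hc.le] at h2
    refine h2.congr' ?_
    filter_upwards [eventually_gt_atTop 0, hpos] with x hx hv
    have := hℓ.1 x hx
    have := hℓ.1 (c * x) (by positivity)
    simp only [Pi.div_apply]
    field_simp

lemma RegTail.exists_le_mul_two {G : Measure ℝ} {a : ℝ} (hG : RegTail G a) {a2 : ℝ} (h2 : a < a2) :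
    ∃ x0 ≥ (1 : ℝ), ∀ x ≥ x0, rtail G x ≤ 2 ^ a2 * rtail G (2 * x) := by
  have h : (2 : ℝ) ^ (-a2) < 2 ^ (-a) := rpow_lt_rpow_of_exponent_lt (by norm_num) (by linarith)
  obtain ⟨x0, hx0⟩ := eventually_atTop.1 ((hG.lim 2 two_pos).eventually (lt_mem_nhds h))
  refine ⟨max x0 1, le_max_right _ _, fun x hx => ?_⟩
  have := (hx0 x ((le_max_left _ _).trans hx)).le
  rw [le_div_iff₀ (hG.pos x), rpow_neg two_pos.le] at this
  have h3 : (0 : ℝ) < 2 ^ a2 := by positivity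
  rwa [inv_mul_le_iff₀ h3] at this

lemma RegTail.exists_two_mul_le {G : Measure ℝ} {a : ℝ} (hG : RegTail G a) {a1 : ℝ} (h1 : a1 < a) :
    ∃ x0 ≥ (1 : ℝ), ∀ x ≥ x0, 2 ^ a1 * rtail G (2 * x) ≤ rtail G x := by
  have h : (2 : ℝ) ^ (-a) < 2 ^ (-a1) := rpow_lt_rpow_of_exponent_lt (by norm_num) (by linarith)
  obtain ⟨x0, hx0⟩ := eventually_atTop.1 ((hG.lim 2 two_pos).eventually (gt_mem_nhds h))
  refine ⟨max x0 1, le_max_right _ _, fun x hx => ?_⟩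
  have := (hx0 x ((le_max_left _ _).trans hx)).le
  rw [div_le_iff₀ (hG.pos x), rpow_neg two_pos.le] at this
  have h3 : (0 : ℝ) < 2 ^ a1 := by positivity
  rwa [le_inv_mul_iff₀ h3] at this

/-- Upper Potter bound. -/
lemma RegTail.potter_upper {G : Measure ℝ} [IsProbabilityMeasure G] {a : ℝ} (hG : RegTail G a)
    {a2 : ℝ} (h2 : a < a2) (h0 : 0 ≤ a2) :
    ∃ C ≥ (1 : ℝ), ∀ y x, 0 < y → y ≤ x → rtail G y ≤ C * (x / y) ^ a2 * rtail G x := by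
  obtain ⟨x0, hx01, hx0⟩ := hG.exists_le_mul_two h2
  have hx0p : 0 < x0 := by linarith
  have hiter : ∀ n : ℕ, ∀ y ≥ x0, rtail G y ≤ (2 ^ n : ℝ) ^ a2 * rtail G (2 ^ n * y) := by
    intro n
    induction n with
    | zero => intro y _; simp
    | succ n ih =>
      intro y hy
      have h1 : (1 : ℝ) ≤ 2 ^ n := one_le_pow₀ (by norm_num)
      have h3 : x0 ≤ 2 ^ n * y := by nlinarith
      calc rtail G y ≤ (2 ^ n : ℝ) ^ a2 * rtail G (2 ^ n * y) := ih y hy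
        _ ≤ (2 ^ n : ℝ) ^ a2 * (2 ^ a2 * rtail G (2 * (2 ^ n * y))) := by
            gcongr; exact hx0 _ h3
        _ = _ := by
            rw [pow_succ (2 : ℝ) n, mul_rpow (by positivity) (by positivity)]
            ring_nf
  have hmain : ∀ y x, x0 ≤ y → y ≤ x → rtail G y ≤ 2 ^ a2 * (x / y) ^ a2 * rtail G x := by
    intro y x hy hyx
    have hyp : 0 < y := by linarith
    obtain ⟨n, hn1, hn2⟩ := exists_nat_pow_near ((one_le_div hyp).2 hyx) (one_lt_two)
    rw [le_div_iff₀ hyp] at hn1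
    rw [div_lt_iff₀ hyp] at hn2
    have hxp : 0 < x := by linarith
    calc rtail G y ≤ (2 ^ (n + 1) : ℝ) ^ a2 * rtail G (2 ^ (n + 1) * y) := hiter _ y hy
      _ ≤ (2 * (x / y)) ^ a2 * rtail G x := by
          gcongr
          · exact rtail_nonneg _ _
          · rw [pow_succ, mul_comm]
            gcongr
            rwa [le_div_iff₀ hyp]
          · exact rtail_antitone G hn2.le
      _ = _ := by rw [mul_rpow two_pos.le (by positivity)]
  have hv0 := hG.pos x0
  have hv1 : 1 ≤ 1 / rtail G x0 := (one_le_div hv0).2 (rtail_le_one G _)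
  have h2a : (1 : ℝ) ≤ 2 ^ a2 := one_le_rpow (by norm_num) h0
  refine ⟨2 ^ a2 * (1 / rtail G x0), by nlinarith, fun y x hy hyx => ?_⟩
  have hxp : 0 < x := by linarith
  have hxy1 : (1 : ℝ) ≤ (x / y) ^ a2 := one_le_rpow ((one_le_div hy).2 hyx) h0
  rcases le_or_gt x0 y with h | h
  · refine (hmain y x h hyx).trans ?_
    have hvx := rtail_nonneg G x
    gcongr
    nlinarith
  rcases le_or_gt x0 x with h' | h'
  · have := hmain x0 x le_rfl h'
    have h3 : (x / x0) ^ a2 ≤ (x / y) ^ a2 := by gcongr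
    have hvx := rtail_nonneg G x
    calc rtail G y ≤ 1 := rtail_le_one G _
      _ = 1 / rtail G x0 * rtail G x0 := by field_simp
      _ ≤ 1 / rtail G x0 * (2 ^ a2 * (x / x0) ^ a2 * rtail G x) := by gcongr
      _ ≤ 1 / rtail G x0 * (2 ^ a2 * (x / y) ^ a2 * rtail G x) := by gcongr
      _ = _ := by ring
  · have hvx : rtail G x0 ≤ rtail G x := rtail_antitone G h'.le
    calc rtail G y ≤ 1 := rtail_le_one G _
      _ = 1 * 1 * (1 / rtail G x0 * rtail G x0) := by field_simp
      _ ≤ 2 ^ a2 * (x / y) ^ a2 * (1 / rtail G x0 * rtail G x) := by gcongr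
      _ = _ := by ring

/-- Lower Potter bound. -/
lemma RegTail.potter_lower {G : Measure ℝ} [IsProbabilityMeasure G] {a : ℝ} (hG : RegTail G a)
    {a1 : ℝ} (h1 : a1 < a) (h0 : 0 ≤ a1) {y1 : ℝ} (hy1 : 0 < y1) :
    ∃ C ≥ (1 : ℝ), ∀ y x, y1 ≤ y → y ≤ x → (x / y) ^ a1 * rtail G x ≤ C * rtail G y := by
  obtain ⟨x0, hx01, hx0⟩ := hG.exists_two_mul_le h1
  have hx0p : 0 < x0 := by linarith
  have hiter : ∀ n : ℕ, ∀ y ≥ x0, (2 ^ n : ℝ) ^ a1 * rtail G (2 ^ n * y) ≤ rtail G y := by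
    intro n
    induction n with
    | zero => intro y _; simp
    | succ n ih =>
      intro y hy
      have h1 : (1 : ℝ) ≤ 2 ^ n := one_le_pow₀ (by norm_num)
      have h3 : x0 ≤ 2 ^ n * y := by nlinarith
      calc _ = (2 ^ n : ℝ) ^ a1 * (2 ^ a1 * rtail G (2 * (2 ^ n * y))) := by
            rw [pow_succ (2 : ℝ) n, mul_rpow (by positivity) (by positivity)]
            ring_nf
        _ ≤ (2 ^ n : ℝ) ^ a1 * rtail G (2 ^ n * y) := by
            gcongr; exact hx0 _ h3
        _ ≤ _ := ih y hy
  have hmain : ∀ y x, x0 ≤ y → y ≤ x → (x / y) ^ a1 * rtail G x ≤ 2 ^ a1 * rtail G y := by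
    intro y x hy hyx
    have hyp : 0 < y := by linarith
    obtain ⟨n, hn1, hn2⟩ := exists_nat_pow_near ((one_le_div hyp).2 hyx) (one_lt_two)
    rw [le_div_iff₀ hyp] at hn1
    have hq : 0 ≤ x / y := div_nonneg (by linarith) hyp.le
    calc (x / y) ^ a1 * rtail G x ≤ (2 ^ (n + 1) : ℝ) ^ a1 * rtail G (2 ^ n * y) := by
          gcongr
          · exact rtail_nonneg _ _
          · exact rtail_antitone G hn1
      _ = 2 ^ a1 * ((2 ^ n : ℝ) ^ a1 * rtail G (2 ^ n * y)) := by
          rw [pow_succ (2 : ℝ) n, mul_rpow (by positivity) (by positivity)]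
          ring
      _ ≤ _ := by gcongr; exact hiter n y hy
  have h2a : (1 : ℝ) ≤ 2 ^ a1 := one_le_rpow (by norm_num) h0
  have hm1 : (1 : ℝ) ≤ (max x0 y1 / y1) ^ a1 :=
    one_le_rpow ((one_le_div hy1).2 (le_max_right _ _)) h0
  refine ⟨2 ^ a1 * (max x0 y1 / y1) ^ a1, by nlinarith, fun y x hy hyx => ?_⟩
  have hyp : 0 < y := by linarith
  have hxp : 0 < x := by linarith
  have hq : 0 ≤ x / y := div_nonneg (by linarith) hyp.le
  have hvy := rtail_nonneg G y
  have hvx := rtail_nonneg G x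
  rcases le_or_gt x0 y with h | h
  · refine (hmain y x h hyx).trans ?_
    gcongr
    nlinarith
  rcases le_or_gt x0 x with h' | h'
  · have h4 : (x / y) ^ a1 = (x / x0) ^ a1 * (x0 / y) ^ a1 := by
      rw [← mul_rpow (by positivity) (by positivity)]
      congr 1; field_simp
    have h5 : (x0 / y) ^ a1 ≤ (max x0 y1 / y1) ^ a1 := by
      gcongr; exact le_max_left _ _
    calc (x / y) ^ a1 * rtail G x = (x0 / y) ^ a1 * ((x / x0) ^ a1 * rtail G x) := by rw [h4]; ring
      _ ≤ (max x0 y1 / y1) ^ a1 * (2 ^ a1 * rtail G x0) := by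
          exact mul_le_mul h5 (hmain x0 x le_rfl h') (by positivity) (by positivity)
      _ ≤ (max x0 y1 / y1) ^ a1 * (2 ^ a1 * rtail G y) := by
          gcongr; exact rtail_antitone G h.le
      _ = _ := by ring
  · have h5 : (x / y) ^ a1 ≤ (max x0 y1 / y1) ^ a1 := by
      gcongr; exact h'.le.trans (le_max_left _ _)
    calc (x / y) ^ a1 * rtail G x ≤ (1 * (max x0 y1 / y1) ^ a1) * rtail G y := by
          rw [one_mul]; gcongr; exact rtail_antitone G hyx
      _ ≤ _ := by gcongr

lemma tendsto_rtail_atTop (G : Measure ℝ) [IsProbabilityMeasure G] :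
    Tendsto (rtail G) atTop (nhds 0) := by
  have h : Tendsto (fun x : ℝ => G (Ioi x)) atTop (nhds (G (⋂ x : ℝ, Ioi x))) :=
    tendsto_measure_iInter_atTop (fun _ => measurableSet_Ioi.nullMeasurableSet)
      (fun _ _ h => Ioi_subset_Ioi h) ⟨0, measure_ne_top _ _⟩
  have h0 : (⋂ x : ℝ, Ioi x) = ∅ := by
    ext y; simp only [mem_iInter, mem_Ioi, mem_empty_iff_false, iff_false, not_forall, not_lt]
    exact ⟨y, le_rfl⟩
  rw [h0, measure_empty] at h
  exact (ENNReal.tendsto_toReal ENNReal.zero_ne_top).comp h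

lemma re_charFun (μ : Measure ℝ) [IsFiniteMeasure μ] (t : ℝ) :
    (charFun μ t).re = ∫ y, cos (t * y) ∂μ := by
  rw [charFun_apply_real]
  have hi : Integrable (fun x : ℝ => Complex.exp (t * x * Complex.I)) μ := by
    refine Integrable.of_bound (by fun_prop) 1 (ae_of_all _ fun x => ?_)
    rw [← Complex.ofReal_mul, Complex.norm_exp_ofReal_mul_I]
  have := integral_re hi
  simp only [RCLike.re_eq_complex_re] at this
  rw [← this]
  congr 1 with x
  rw [← Complex.ofReal_mul, Complex.exp_ofReal_mul_I_re]

lemma one_sub_norm_charFun_sq (G : Measure ℝ) [IsProbabilityMeasure G] (t : ℝ) :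
    1 - ‖charFun G t‖ ^ 2 = ∫ y, (1 - cos (t * y)) ∂(G.conv (G.map (fun x => (-1) * x))) := by
  have : IsProbabilityMeasure (G.map (fun x => (-1) * x)) :=
    Measure.isProbabilityMeasure_map (by fun_prop)
  have hc : charFun (G.conv (G.map (fun x => (-1) * x))) t
      = ((‖charFun G t‖ ^ 2 : ℝ) : ℂ) := by
    rw [charFun_conv, charFun_map_mul, neg_one_mul, charFun_neg, Complex.mul_conj,
      Complex.normSq_eq_norm_sq]
  have h1 := re_charFun (G.conv (G.map (fun x => (-1) * x))) t
  rw [hc, Complex.ofReal_re] at h1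
  rw [integral_sub (integrable_const _), h1]
  · rw [integral_const, probReal_univ, one_smul]
  · refine Integrable.of_bound (by fun_prop) 1 (ae_of_all _ fun x => ?_)
    exact abs_cos_le_one _

lemma one_third_le_one_sub_cos {t : ℝ} (h1 : 1 ≤ t) (h3 : t ≤ 3) : 1 / 3 ≤ 1 - cos t := by
  have h : cos t ≤ cos 1 :=
    cos_le_cos_of_nonneg_of_le_pi (by norm_num) (by linarith [pi_gt_three]) h1
  linarith [cos_one_le]

lemma one_sub_norm_charFun_sq_ge (G : Measure ℝ) [IsProbabilityMeasure G] {t : ℝ} (ht : 0 < t) :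
    G.real (Ioc (2 / t) (3 / t)) * G.real (Icc 0 (1 / t)) / 3 ≤ 1 - ‖charFun G t‖ ^ 2 := by
  rw [one_sub_norm_charFun_sq]
  set G' := G.map (fun x => (-1) * x) with hG'
  have : IsProbabilityMeasure G' := Measure.isProbabilityMeasure_map (by fun_prop)
  set A := Icc (1 / t) (3 / t)
  have hA : MeasurableSet A := measurableSet_Icc
  have hle : (1 / 3) * (G.conv G').real A ≤ ∫ y, (1 - cos (t * y)) ∂(G.conv G') := by
    have : (1 / 3) * (G.conv G').real A = ∫ y, A.indicator (fun _ => (1 / 3 : ℝ)) y ∂(G.conv G') := by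
      rw [integral_indicator hA, integral_const]
      simp [mul_comm]
    rw [this]
    refine integral_mono ((integrable_const _).indicator hA) ?_ fun y => ?_
    · refine Integrable.of_bound (by fun_prop) 2 (ae_of_all _ fun x => ?_)
      rw [Real.norm_eq_abs, abs_le]
      constructor <;> linarith [neg_one_le_cos (t * x), cos_le_one (t * x)]
    · by_cases hy : y ∈ A
      · simp only [indicator_of_mem hy]
        refine one_third_le_one_sub_cos ?_ ?_
        · have := hy.1; rwa [div_le_iff₀' ht] at this
        · have := hy.2; rwa [le_div_iff₀' ht] at this
      · simp only [indicator_of_notMem hy]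
        linarith [cos_le_one (t * y)]
  have hprod : G.real (Ioc (2 / t) (3 / t)) * G.real (Icc 0 (1 / t)) ≤ (G.conv G').real A := by
    rw [measureReal_def, measureReal_def, measureReal_def, ← ENNReal.toReal_mul]
    refine ENNReal.toReal_mono (measure_ne_top _ _) ?_
    rw [conv_apply _ _ hA]
    calc G (Ioc (2 / t) (3 / t)) * G (Icc 0 (1 / t))
        = ∫⁻ x in Ioc (2 / t) (3 / t), G (Icc 0 (1 / t)) ∂G := by
          rw [setLIntegral_const, mul_comm]
      _ ≤ ∫⁻ x in Ioc (2 / t) (3 / t), G' ((fun y => x + y) ⁻¹' A) ∂G := by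
          refine setLIntegral_mono' measurableSet_Ioc fun x hx => ?_
          rw [hG', Measure.map_apply (by fun_prop) (hA.preimage (by fun_prop))]
          refine measure_mono fun y hy => ?_
          simp only [mem_preimage, A, mem_Icc, mem_Ioc] at hx hy ⊢
          have : (3 : ℝ) / t = 1 / t + 2 / t := by ring
          have : (2 : ℝ) / t = 1 / t + 1 / t := by ring
          constructor <;> linarith
      _ ≤ _ := setLIntegral_le_lintegral _ _
  linarith

/-- The modulus of the characteristic function near the origin. -/
lemma RegTail.norm_charFun_le {G : Measure ℝ} [IsProbabilityMeasure G] {a : ℝ} (hG : RegTail G a)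
    (ha : 0 < a) (hG0 : G (Iio 0) = 0) :
    ∃ c > 0, ∃ b > 0, ∀ t : ℝ, 0 < |t| → |t| ≤ b →
      ‖charFun G t‖ ≤ exp (-(c * rtail G (1 / |t|))) := by
  have h23 : (0 : ℝ) < 2 ^ (-a) - 3 ^ (-a) := by
    rw [sub_pos]
    exact rpow_lt_rpow_of_neg (by norm_num) (by norm_num) (by linarith)
  set d : ℝ := 2 ^ (-a) - 3 ^ (-a)
  have h1 : ∀ᶠ x in atTop, d / 2 < rtail G (2 * x) / rtail G x - rtail G (3 * x) / rtail G x :=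
    ((hG.lim 2 two_pos).sub (hG.lim 3 (by norm_num))).eventually (lt_mem_nhds (by linarith))
  have h2 : ∀ᶠ x in atTop, rtail G x < 1 / 2 :=
    (tendsto_rtail_atTop G).eventually (gt_mem_nhds (by norm_num))
  obtain ⟨x0, hx0⟩ := eventually_atTop.1 (h1.and (h2.and (eventually_gt_atTop 0)))
  have hx0p : 0 < x0 := (hx0 x0 le_rfl).2.2
  refine ⟨d / 24, by positivity, 1 / x0, by positivity, ?_⟩
  have main : ∀ t : ℝ, 0 < t → t ≤ 1 / x0 → ‖charFun G t‖ ≤ exp (-(d / 24 * rtail G (1 / t))) := by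
    intro t ht htb
    have hxt : x0 ≤ 1 / t := by rwa [le_div_iff₀ ht, mul_comm, ← le_div_iff₀ hx0p]
    obtain ⟨hd, hhalf, -⟩ := hx0 _ hxt
    have hv := hG.pos (1 / t)
    rw [← sub_div, lt_div_iff₀ hv] at hd
    have hge := one_sub_norm_charFun_sq_ge G ht
    have e1 : G.real (Ioc (2 / t) (3 / t)) = rtail G (2 * (1 / t)) - rtail G (3 * (1 / t)) := by
      have : Ioc (2 / t) (3 / t) = Ioi (2 * (1 / t)) \ Ioi (3 * (1 / t)) := by
        ext y; simp [div_eq_mul_inv]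
      rw [this, measureReal_sdiff _ measurableSet_Ioi]
      · rfl
      · refine Ioi_subset_Ioi ?_
        gcongr; norm_num
    have e2 : 1 / 2 ≤ G.real (Icc 0 (1 / t)) := by
      have h3 : G.real (Icc 0 (1 / t)) = 1 - rtail G (1 / t) := by
        have h4 : G.real ((Ioi (1 / t))ᶜ) = 1 - rtail G (1 / t) := by
          rw [measureReal_compl measurableSet_Ioi, probReal_univ]; rfl
        rw [← h4, measureReal_def, measureReal_def]
        congr 1
        have h5 : (Ioi (1 / t))ᶜ = Icc 0 (1 / t) ∪ Iio 0 := by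
          rw [compl_Ioi, union_comm, Iio_union_Icc_eq_Iic (by positivity)]
        rw [h5]
        exact le_antisymm (measure_mono subset_union_left)
          ((measure_union_le _ _).trans (by rw [hG0, add_zero]))
      linarith
    have hsq : ‖charFun G t‖ ^ 2 ≤ 1 - d / 12 * rtail G (1 / t) := by
      have : d / 2 * rtail G (1 / t) * (1 / 2) ≤
          G.real (Ioc (2 / t) (3 / t)) * G.real (Icc 0 (1 / t)) := by
        rw [e1]; exact mul_le_mul hd.le e2 (by norm_num) (by nlinarith)
      linarith
    have hexp : 1 - d / 12 * rtail G (1 / t) ≤ exp (-(d / 24 * rtail G (1 / t))) ^ 2 := by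
      rw [← exp_nat_mul]
      have := add_one_le_exp (((2 : ℕ) : ℝ) * -(d / 24 * rtail G (1 / t)))
      push_cast at this ⊢
      linarith
    exact (sq_le_sq₀ (norm_nonneg _) (exp_pos _).le).1 (hsq.trans hexp)
  intro t ht htb
  rcases lt_or_ge 0 t with h | h
  · rw [abs_of_pos h] at htb ⊢; exact main t h htb
  · rw [abs_of_nonpos h] at ht htb ⊢
    have := main (-t) ht htb
    rwa [charFun_neg, RCLike.norm_conj] at this

/-- The trigonometric integral with amplitude `g` on `[-b, b]`. -/
def trigInt (b : ℝ) (g : ℝ → ℂ) (y : ℝ) : ℂ :=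
  ∫ θ in Icc (-b) b, g θ * Complex.exp (θ * y * Complex.I)

lemma integral_trigInt (μ : Measure ℝ) [IsFiniteMeasure μ] {b : ℝ} {g : ℝ → ℂ}
    (hg : IntegrableOn g (Icc (-b) b)) (p : ℝ) :
    ∫ y, trigInt b g (y - p) ∂μ
      = ∫ θ in Icc (-b) b, g θ * Complex.exp (-(θ * p * Complex.I)) * charFun μ θ := by
  unfold trigInt
  rw [integral_integral_swap]
  · refine integral_congr_ae (ae_of_all _ fun θ => ?_)
    simp only [charFun_apply_real]
    rw [← integral_const_mul]
    refine integral_congr_ae (ae_of_all _ fun y => ?_)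
    simp only
    rw [mul_assoc (g θ), ← Complex.exp_add]
    push_cast
    ring_nf
  · have h1 : Integrable (fun z : ℝ × ℝ => g z.2) (μ.prod (volume.restrict (Icc (-b) b))) :=
      hg.integrable.comp_snd μ
    refine (h1.mul_bdd (c := 1) (g := fun z : ℝ × ℝ =>
      Complex.exp (z.2 * (z.1 - p : ℝ) * Complex.I)) ?_ ?_)
    · exact Continuous.aestronglyMeasurable (by fun_prop)
    · refine ae_of_all _ fun z => ?_
      rw [← Complex.ofReal_mul, Complex.norm_exp_ofReal_mul_I]

/-- The Fejér kernel. -/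
def fejer (b y : ℝ) : ℝ := if y = 0 then b else 2 * (1 - cos (b * y)) / (b * y ^ 2)

lemma fejer_nonneg {b : ℝ} (hb : 0 < b) (y : ℝ) : 0 ≤ fejer b y := by
  unfold fejer
  split_ifs with h
  · exact hb.le
  · have := cos_le_one (b * y)
    exact div_nonneg (by linarith) (by positivity)

lemma fejer_le {b : ℝ} (hb : 0 < b) (y : ℝ) : fejer b y ≤ b := by
  unfold fejer
  split_ifs with h
  · exact le_rfl
  · rw [div_le_iff₀ (by positivity)]
    nlinarith [one_sub_sq_div_two_le_cos (x := b * y)]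

lemma measurable_fejer (b : ℝ) : Measurable (fejer b) :=
  Measurable.ite (measurableSet_singleton 0) measurable_const (by fun_prop)

lemma fejer_ge {b : ℝ} (hb : 0 < b) {y : ℝ} (hy : |y| ≤ 1 / b) : b / 4 ≤ fejer b y := by
  unfold fejer
  split_ifs with h
  · linarith
  · have h1 : |b * y| ≤ π := by
      rw [abs_mul, abs_of_pos hb]
      rw [le_div_iff₀' hb] at hy
      linarith [pi_gt_three]
    have h2 := cos_le_one_sub_mul_cos_sq h1
    have hpos : 0 < b * y ^ 2 := by positivity
    rw [le_div_iff₀ hpos]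
    have h3 : 1 / 8 ≤ 2 / π ^ 2 := by
      rw [div_le_div_iff₀ (by norm_num) (by positivity)]
      nlinarith [pi_lt_four, pi_pos]
    have : 1 / 8 * (b * y) ^ 2 ≤ 2 / π ^ 2 * (b * y) ^ 2 := by gcongr
    nlinarith

lemma fejer_le_inv_sq {b : ℝ} (hb : 0 < b) {y : ℝ} (hy : y ≠ 0) :
    fejer b y ≤ 4 / (b * y ^ 2) := by
  rw [fejer, if_neg hy]
  gcongr
  linarith [neg_one_le_cos (b * y)]

lemma integral_zero_fejer {b : ℝ} (hb : 0 < b) (y : ℝ) :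
    ∫ θ in (0 : ℝ)..b, 2 * ((1 - θ / b) * cos (θ * y)) = fejer b y := by
  unfold fejer
  split_ifs with h
  · subst h
    have : ∀ θ ∈ uIcc 0 b, HasDerivAt (fun θ : ℝ => 2 * θ - θ ^ 2 / b)
        (2 * ((1 - θ / b) * cos (θ * 0))) θ := by
      intro θ _
      refine (((hasDerivAt_id θ).const_mul 2).sub
        (((hasDerivAt_id θ).pow 2).div_const b)).congr_deriv ?_
      simp
      ring
    rw [intervalIntegral.integral_eq_sub_of_hasDerivAt this
      (Continuous.intervalIntegrable (by fun_prop) _ _)]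
    field_simp
    ring
  · have : ∀ θ ∈ uIcc 0 b, HasDerivAt
        (fun θ : ℝ => 2 * ((1 - θ / b) * (sin (θ * y) / y) - cos (θ * y) / (b * y ^ 2)))
        (2 * ((1 - θ / b) * cos (θ * y))) θ := by
      intro θ _
      have h1 : HasDerivAt (fun θ : ℝ => θ * y) y θ := by
        simpa using (hasDerivAt_id θ).mul_const y
      have h2 : HasDerivAt (fun θ : ℝ => 1 - θ / b) (-(1 / b)) θ := by
        simpa using ((hasDerivAt_id θ).div_const b).const_sub 1
      refine (((h2.mul (h1.sin.div_const y)).sub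
        (h1.cos.div_const (b * y ^ 2))).const_mul 2).congr_deriv ?_
      field_simp
      ring
    rw [intervalIntegral.integral_eq_sub_of_hasDerivAt this
      (Continuous.intervalIntegrable (by fun_prop) _ _)]
    simp
    field_simp
    ring

lemma trigInt_fejer {b : ℝ} (hb : 0 < b) (y : ℝ) :
    trigInt b (fun θ => ((1 - |θ| / b : ℝ) : ℂ)) y = fejer b y := by
  unfold trigInt
  rw [integral_Icc_eq_integral_Ioc, ← intervalIntegral.integral_of_le (by linarith)]
  have hc : Continuous fun θ : ℝ => ((1 - |θ| / b : ℝ) : ℂ) * Complex.exp (θ * y * Complex.I) := by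
    fun_prop
  rw [← intervalIntegral.integral_add_adjacent_intervals (b := 0) (hc.intervalIntegrable _ _)
    (hc.intervalIntegrable _ _)]
  have h1 : ∫ θ in (-b)..0, ((1 - |θ| / b : ℝ) : ℂ) * Complex.exp (θ * y * Complex.I)
      = ∫ θ in (0 : ℝ)..b, ((1 - |θ| / b : ℝ) : ℂ) * Complex.exp (-(θ * y * Complex.I)) := by
    have := intervalIntegral.integral_comp_neg (a := 0) (b := b)
      (fun θ : ℝ => ((1 - |θ| / b : ℝ) : ℂ) * Complex.exp (θ * y * Complex.I))
    rw [neg_zero] at this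
    rw [← this]
    simp
  rw [h1, ← intervalIntegral.integral_add
    (Continuous.intervalIntegrable (by fun_prop) _ _) (hc.intervalIntegrable _ _),
    ← integral_zero_fejer hb, ← intervalIntegral.integral_ofReal]
  refine intervalIntegral.integral_congr fun θ hθ => ?_
  rw [uIcc_of_le hb.le] at hθ
  rw [abs_of_nonneg hθ.1]
  push_cast [Complex.ofReal_cos]
  rw [Complex.cos]
  ring_nf

/-- Concentration inequality. -/
lemma measureReal_Icc_le_integral_charFun (μ : Measure ℝ) [IsFiniteMeasure μ] {b : ℝ} (hb : 0 < b)
    (z : ℝ) : μ.real (Icc (z - 1 / b) (z + 1 / b))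
      ≤ 4 / b * ∫ θ in Icc (-b) b, ‖charFun μ θ‖ := by
  have hg : IntegrableOn (fun θ => ((1 - |θ| / b : ℝ) : ℂ)) (Icc (-b) b) :=
    Continuous.integrableOn_Icc (by fun_prop)
  have h1 := integral_trigInt μ hg z
  simp only [trigInt_fejer hb] at h1
  have h2 : ∫ y, fejer b (y - z) ∂μ ≤ ∫ θ in Icc (-b) b, ‖charFun μ θ‖ := by
    have h3 : ‖((∫ y, fejer b (y - z) ∂μ : ℝ) : ℂ)‖ ≤ ∫ θ in Icc (-b) b, ‖charFun μ θ‖ := by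
      rw [← integral_complex_ofReal, h1]
      refine norm_integral_le_of_norm_le ?_ ?_
      · refine (Integrable.of_bound (C := μ.real univ) (measurable_charFun.aestronglyMeasurable) ?_).norm
        exact ae_of_all _ fun θ => norm_charFun_le θ
      · filter_upwards [ae_restrict_mem measurableSet_Icc] with θ hθ
        rw [norm_mul, norm_mul]
        have e1 : ‖Complex.exp (-(θ * z * Complex.I))‖ = 1 := by
          rw [← Complex.ofReal_mul, ← neg_mul, ← Complex.ofReal_neg,
            Complex.norm_exp_ofReal_mul_I]
        have e2 : ‖((1 - |θ| / b : ℝ) : ℂ)‖ ≤ 1 := by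
          have hθ' : |θ| ≤ b := abs_le.2 hθ
          have : |θ| / b ≤ 1 := (div_le_one hb).2 hθ'
          have : 0 ≤ |θ| / b := by positivity
          rw [Complex.norm_real, Real.norm_eq_abs, abs_le]
          constructor <;> linarith
        rw [e1, mul_one]
        exact mul_le_of_le_one_left (norm_nonneg _) e2
    rw [Complex.norm_real] at h3
    exact (le_abs_self _).trans h3
  have hfi : Integrable (fun y => fejer b (y - z)) μ := by
    refine Integrable.of_bound (C := b)
      ((measurable_fejer b).comp (measurable_id.sub_const z)).aestronglyMeasurable
      (ae_of_all _ fun y => ?_)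
    rw [Real.norm_eq_abs, abs_of_nonneg (fejer_nonneg hb _)]
    exact fejer_le hb _
  have h4 : b / 4 * μ.real (Icc (z - 1 / b) (z + 1 / b)) ≤ ∫ y, fejer b (y - z) ∂μ := by
    have : b / 4 * μ.real (Icc (z - 1 / b) (z + 1 / b))
        = ∫ y, (Icc (z - 1 / b) (z + 1 / b)).indicator (fun _ => b / 4) y ∂μ := by
      rw [integral_indicator measurableSet_Icc, integral_const]
      simp [mul_comm]
    rw [this]
    refine integral_mono ((integrable_const _).indicator measurableSet_Icc) hfi fun y => ?_
    by_cases hy : y ∈ Icc (z - 1 / b) (z + 1 / b)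
    · simp only [indicator_of_mem hy]
      exact fejer_ge hb (abs_le.2 ⟨by linarith [hy.1], by linarith [hy.2]⟩)
    · simp only [indicator_of_notMem hy]
      exact fejer_nonneg hb _
  calc μ.real (Icc (z - 1 / b) (z + 1 / b))
      = 4 / b * (b / 4 * μ.real (Icc (z - 1 / b) (z + 1 / b))) := by field_simp
    _ ≤ _ := by gcongr; exact h4.trans h2

/-- The concentration integral `∫_0^b exp (-c s v(1/θ)) dθ`, with `v` the right tail of `G`. -/
def conc (G : Measure ℝ) (c b s : ℝ) : ℝ :=
  ∫ θ in Ioc 0 b, exp (-(c * s * rtail G (1 / θ)))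

/-- `∫_0^b min (1/v(1/θ), M) ^ N exp (-c L v(1/θ)) dθ`, with `v` the right tail of `G`. -/
def sigInt (G : Measure ℝ) (c b : ℝ) (N : ℕ) (L M : ℝ) : ℝ :=
  ∫ θ in Ioc 0 b, (min (1 / rtail G (1 / θ)) M) ^ N * exp (-(c * L * rtail G (1 / θ)))

lemma measurable_rtail_inv (G : Measure ℝ) [IsProbabilityMeasure G] :
    Measurable fun θ : ℝ => rtail G (1 / θ) :=
  (measurable_rtail G).comp (by fun_prop)

lemma integrable_conc (G : Measure ℝ) [IsProbabilityMeasure G] {c b s : ℝ} (hc : 0 ≤ c)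
    (hs : 0 ≤ s) :
    IntegrableOn (fun θ : ℝ => exp (-(c * s * rtail G (1 / θ)))) (Ioc 0 b) := by
  have hm := measurable_rtail_inv G
  refine Integrable.of_bound (C := 1) (Measurable.aestronglyMeasurable (by fun_prop)) (ae_of_all _ fun θ => ?_)
  rw [Real.norm_eq_abs, abs_exp, exp_le_one_iff, neg_nonpos]
  have := rtail_nonneg G (1 / θ)
  positivity

lemma conc_nonneg (G : Measure ℝ) (c b s : ℝ) : 0 ≤ conc G c b s :=
  integral_nonneg fun _ => (exp_pos _).le

lemma conc_anti (G : Measure ℝ) [IsProbabilityMeasure G] {c b s s' : ℝ} (hc : 0 ≤ c)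
    (hs : 0 ≤ s) (hss : s ≤ s') : conc G c b s' ≤ conc G c b s := by
  refine integral_mono (integrable_conc G hc (hs.trans hss)) (integrable_conc G hc hs) fun θ => ?_
  have := rtail_nonneg G (1 / θ)
  simp only
  gcongr

lemma conc_sub_one_le (G : Measure ℝ) [IsProbabilityMeasure G] {c b s : ℝ} (hc : 0 ≤ c)
    (hs : 1 ≤ s) : conc G c b (s - 1) ≤ exp c * conc G c b s := by
  unfold conc
  rw [← integral_const_mul]
  refine integral_mono (integrable_conc G hc (by linarith))
    ((integrable_conc G hc (by linarith)).const_mul _) fun θ => ?_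
  simp only
  rw [← exp_add]
  have := rtail_le_one G (1 / θ)
  gcongr
  nlinarith

lemma conc_half (G : Measure ℝ) (c b s : ℝ) :
    conc G c b (s / 2) = conc G (c / 2) b s := by
  unfold conc
  ring_nf

lemma convPow_Icc_le_conc {G : Measure ℝ} [IsProbabilityMeasure G] {c b : ℝ} (hb : 0 < b)
    (hc : 0 ≤ c)
    (hφ : ∀ t : ℝ, 0 < |t| → |t| ≤ b → ‖charFun G t‖ ≤ exp (-(c * rtail G (1 / |t|))))
    (n : ℕ) (z : ℝ) :
    (convPow G n).real (Icc (z - 1 / b) (z + 1 / b)) ≤ 8 / b * conc G c b n := by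
  refine (measureReal_Icc_le_integral_charFun _ hb z).trans ?_
  have hm := measurable_rtail_inv G
  set e : ℝ → ℝ := fun θ => exp (-(c * n * rtail G (1 / θ))) with he
  have hem : Measurable e := by fun_prop
  have he1 : ∀ θ, ‖e θ‖ ≤ 1 := fun θ => by
    rw [he, Real.norm_eq_abs, abs_exp, exp_le_one_iff, neg_nonpos]
    have := rtail_nonneg G (1 / θ)
    positivity
  have h1 : ∫ θ in Icc (-b) b, ‖charFun (convPow G n) θ‖ ≤ ∫ θ in Icc (-b) b, e |θ| := by
    refine integral_mono_ae ?_ ?_ ?_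
    · refine (Integrable.of_bound (C := 1) measurable_charFun.aestronglyMeasurable ?_).norm
      exact ae_of_all _ fun θ => norm_charFun_le_one θ
    · exact Integrable.of_bound (C := 1) (hem.comp measurable_norm).aestronglyMeasurable
        (ae_of_all _ fun θ => he1 _)
    · have h0 : ∀ᵐ θ : ℝ ∂(volume.restrict (Icc (-b) b)), θ ≠ 0 := by
        refine ae_restrict_of_ae ?_
        simp [ae_iff]
      filter_upwards [ae_restrict_mem measurableSet_Icc, h0] with θ hθ hθ0
      rw [charFun_convPow, norm_pow]
      calc ‖charFun G θ‖ ^ n ≤ exp (-(c * rtail G (1 / |θ|))) ^ n :=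
            pow_le_pow_left₀ (norm_nonneg _) (hφ θ (abs_pos.2 hθ0) (abs_le.2 hθ)) n
        _ = e |θ| := by rw [he, ← exp_nat_mul]; ring_nf
  have h2 : ∫ θ in Icc (-b) b, e |θ| = 2 * conc G c b n := by
    have h3 := integral_comp_abs (f := (Iic b).indicator e)
    have h4 : (fun x : ℝ => (Iic b).indicator e |x|) = (Icc (-b) b).indicator (fun θ => e |θ|) := by
      ext x
      by_cases hx : |x| ≤ b
      · rw [indicator_of_mem (show |x| ∈ Iic b from hx), indicator_of_mem (show x ∈ Icc (-b) b from abs_le.1 hx)]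
      · rw [indicator_of_notMem (show |x| ∉ Iic b from hx),
          indicator_of_notMem (show x ∉ Icc (-b) b from fun h => hx (abs_le.2 h))]
    rw [h4, integral_indicator measurableSet_Icc, setIntegral_indicator measurableSet_Iic,
      Ioi_inter_Iic] at h3
    exact h3
  calc 4 / b * ∫ θ in Icc (-b) b, ‖charFun (convPow G n) θ‖
      ≤ 4 / b * (2 * conc G c b n) := by rw [← h2]; gcongr
    _ = _ := by ring

lemma sum_pow_mul_exp_le (N : ℕ) {β : ℝ} (hβ : 0 < β) (s : Finset ℕ) (hs : ∀ n ∈ s, 1 ≤ n) :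
    ∑ n ∈ s, (n : ℝ) ^ N * exp (-(n * β)) ≤ N.factorial * (2 / β) ^ (N + 1) := by
  have hgeo : ∑ n ∈ s, exp (-(β / 2)) ^ n ≤ 2 / β := by
    set q := exp (-(β / 2))
    have hq0 : 0 < q := exp_pos _
    have hq1 : q < 1 := exp_lt_one_iff.2 (by linarith)
    have h0 : 0 ∉ s := fun h => absurd (hs 0 h) (by norm_num)
    have h1 : ∑ n ∈ insert 0 s, q ^ n ≤ (1 - q)⁻¹ := by
      rw [← tsum_geometric_of_lt_one hq0.le hq1]
      exact (summable_geometric_of_lt_one hq0.le hq1).sum_le_tsum _ (fun _ _ => by positivity)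
    rw [Finset.sum_insert h0, pow_zero] at h1
    have h2 : q ≤ (1 + β / 2)⁻¹ := by
      rw [show q = (exp (β / 2))⁻¹ from exp_neg _]
      gcongr
      linarith [add_one_le_exp (β / 2)]
    have h3 : (1 - q)⁻¹ ≤ 1 + 2 / β := by
      rw [inv_le_comm₀ (by linarith) (by positivity)]
      have : (1 + 2 / β)⁻¹ = 1 - (1 + β / 2)⁻¹ := by field_simp; ring
      linarith
    linarith
  calc ∑ n ∈ s, (n : ℝ) ^ N * exp (-(n * β))
      ≤ ∑ n ∈ s, N.factorial * (2 / β) ^ N * exp (-(β / 2)) ^ n := by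
        refine Finset.sum_le_sum fun n _ => ?_
        have h1 := pow_div_factorial_le_exp (n * (β / 2)) (by positivity) N
        rw [div_le_iff₀ (by positivity)] at h1
        have h2 : (n : ℝ) ^ N = (n * (β / 2)) ^ N * (2 / β) ^ N := by
          rw [← mul_pow]; congr 1; field_simp
        calc (n : ℝ) ^ N * exp (-(n * β))
            = (n * (β / 2)) ^ N * (2 / β) ^ N * (exp (-(n * (β / 2))) * exp (-(n * (β / 2)))) := by
              rw [h2, ← exp_add]; ring_nf
          _ ≤ (exp (n * (β / 2)) * N.factorial) * (2 / β) ^ N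
                * (exp (-(n * (β / 2))) * exp (-(n * (β / 2)))) := by gcongr
          _ = N.factorial * (2 / β) ^ N * exp (-(n * (β / 2)))
                * (exp (n * (β / 2)) * exp (-(n * (β / 2)))) := by ring
          _ = _ := by
              rw [← exp_add, add_neg_cancel, exp_zero, mul_one, ← exp_nat_mul]; ring_nf
    _ = N.factorial * (2 / β) ^ N * ∑ n ∈ s, exp (-(β / 2)) ^ n := by rw [Finset.mul_sum]
    _ ≤ N.factorial * (2 / β) ^ N * (2 / β) := by gcongr
    _ = _ := by ring

lemma integrable_sigInt (G : Measure ℝ) [IsProbabilityMeasure G] {c b L M : ℝ} (N : ℕ) (hc : 0 ≤ c)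
    (hL : 0 ≤ L) (hM : 0 ≤ M) :
    IntegrableOn (fun θ : ℝ => (min (1 / rtail G (1 / θ)) M) ^ N
      * exp (-(c * L * rtail G (1 / θ)))) (Ioc 0 b) := by
  have hm := measurable_rtail_inv G
  refine Integrable.of_bound (C := M ^ N) (by fun_prop) (ae_of_all _ fun θ => ?_)
  have h0 := rtail_nonneg G (1 / θ)
  have h1 : 0 ≤ min (1 / rtail G (1 / θ)) M := le_min (by positivity) hM
  rw [Real.norm_eq_abs, abs_of_nonneg (by positivity)]
  calc _ ≤ M ^ N * 1 := by
        gcongr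
        · exact min_le_right _ _
        · rw [exp_le_one_iff, neg_nonpos]; positivity
    _ = _ := mul_one _

lemma sigInt_nonneg (G : Measure ℝ) [IsProbabilityMeasure G] {c b L M : ℝ} (N : ℕ) (hM : 0 ≤ M) :
    0 ≤ sigInt G c b N L M := by
  refine integral_nonneg fun θ => ?_
  have h0 := rtail_nonneg G (1 / θ)
  have h1 : 0 ≤ min (1 / rtail G (1 / θ)) M := le_min (by positivity) hM
  positivity

lemma sum_conc_le_sigInt {G : Measure ℝ} [IsProbabilityMeasure G] (hv : ∀ x, 0 < rtail G x)
    {c : ℝ} (hc : 0 < c) (N : ℕ) :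
    ∃ C > 0, ∀ b M L : ℝ, 0 < M → 0 ≤ L → ∀ s : Finset ℕ, (∀ n ∈ s, 1 ≤ n ∧ L ≤ n) →
      ∑ n ∈ s, (n : ℝ) ^ N * exp (-(n / M)) * conc G c b n
        ≤ C * sigInt G (c / 2) b (N + 1) L M := by
  set k := max 1 (1 / c)
  have hk : 1 ≤ k := le_max_left _ _
  refine ⟨N.factorial * (4 * k) ^ (N + 1), by positivity, fun b M L hM hL s hs => ?_⟩
  unfold conc sigInt
  simp_rw [← integral_const_mul]
  rw [← integral_finsetSum]
  · refine integral_mono_ae (integrable_finsetSum _ fun n _ =>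
      (integrable_conc G hc.le (Nat.cast_nonneg n)).const_mul _)
      ((integrable_sigInt G (N + 1) (by positivity) hL hM.le).const_mul _) (ae_of_all _ fun θ => ?_)
    simp only
    set v := rtail G (1 / θ)
    have hvp : 0 < v := hv _
    set β := 1 / M + c * v with hβ
    have hβp : 0 < β := by positivity
    have hinv : 1 / β ≤ k * min (1 / v) M := by
      rw [mul_min_of_nonneg _ _ (by positivity : (0 : ℝ) ≤ k)]
      refine le_min ?_ ?_
      · calc 1 / β ≤ 1 / (c * v) := by
              gcongr; rw [hβ]; have : 0 < 1 / M := by positivity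
              linarith
          _ = 1 / c * (1 / v) := by field_simp
          _ ≤ _ := by gcongr; exact le_max_right _ _
      · calc 1 / β ≤ 1 / (1 / M) := by
              gcongr; rw [hβ]; have : 0 < c * v := by positivity
              linarith
          _ = 1 * M := by field_simp
          _ ≤ _ := by gcongr
    calc ∑ n ∈ s, (n : ℝ) ^ N * exp (-(n / M)) * exp (-(c * n * v))
        ≤ ∑ n ∈ s, exp (-(c / 2 * L * v)) * ((n : ℝ) ^ N * exp (-(n * (β / 2)))) := by
          refine Finset.sum_le_sum fun n hn => ?_
          obtain ⟨-, h2⟩ := hs n hn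
          rw [mul_left_comm, mul_assoc, ← exp_add, ← exp_add]
          refine mul_le_mul_of_nonneg_left (exp_le_exp.2 ?_) (by positivity)
          have e1 : 0 ≤ (n : ℝ) / M := by positivity
          have e2 : c / 2 * L * v ≤ c / 2 * n * v := by gcongr
          have e3 : (n : ℝ) * (β / 2) = n / M / 2 + c / 2 * n * v := by rw [hβ]; ring
          rw [e3]
          nlinarith
      _ = exp (-(c / 2 * L * v)) * ∑ n ∈ s, (n : ℝ) ^ N * exp (-(n * (β / 2))) := by
          rw [Finset.mul_sum]
      _ ≤ exp (-(c / 2 * L * v)) * (N.factorial * (2 / (β / 2)) ^ (N + 1)) := by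
          gcongr
          exact sum_pow_mul_exp_le N (by positivity) s fun n hn => (hs n hn).1
      _ ≤ exp (-(c / 2 * L * v)) * (N.factorial * (4 * (k * min (1 / v) M)) ^ (N + 1)) := by
          gcongr
          calc 2 / (β / 2) = 4 * (1 / β) := by field_simp; norm_num
            _ ≤ _ := by gcongr
      _ = _ := by rw [← mul_assoc 4, mul_pow (4 * k)]; ring
  · intro n _
    exact (integrable_conc G hc.le (Nat.cast_nonneg n)).const_mul _

/-- Estimate of `sigInt` without the exponential factor. -/
lemma RegTail.sigInt_zero_le {G : Measure ℝ} [IsProbabilityMeasure G] {a : ℝ} (hG : RegTail G a)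
    {a1 : ℝ} (h1 : a1 < a) (h0 : 0 ≤ a1) {N : ℕ} (hN : 1 < a1 * N) {b : ℝ} (hb : 0 < b) (c : ℝ) :
    ∃ C > 0, ∀ z M : ℝ, 1 / b ≤ z → 0 < M →
      sigInt G c b N 0 M ≤ C * ((1 / rtail G z) ^ N + M ^ N) / z := by
  obtain ⟨C, hC1, hC⟩ := hG.potter_lower h1 h0 (one_div_pos.2 hb)
  have hCN : 1 ≤ C ^ N := one_le_pow₀ hC1
  set p := a1 * N - 1 with hp
  have hp0 : 0 < p := by linarith
  refine ⟨C ^ N / p + 1, by positivity, fun z M hz hM => ?_⟩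
  have hzp : 0 < z := lt_of_lt_of_le (by positivity) hz
  have hzb : 1 / z ≤ b := by
    rw [div_le_iff₀ hzp]; rwa [div_le_iff₀ hb, mul_comm] at hz
  have hz0 : 0 < 1 / z := by positivity
  have hvz := hG.pos z
  unfold sigInt
  have hi := integrable_sigInt (b := b) G (c := 0) N le_rfl (le_refl 0) hM.le
  simp only [mul_zero, zero_mul, neg_zero, exp_zero, mul_one] at hi ⊢
  rw [← Ioc_union_Ioc_eq_Ioc hz0.le hzb, setIntegral_union (Ioc_disjoint_Ioc_of_le le_rfl)
    measurableSet_Ioc (hi.mono_set (Ioc_subset_Ioc_right hzb))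
    (hi.mono_set (Ioc_subset_Ioc_left hz0.le))]
  have hA : ∫ θ in Ioc 0 (1 / z), (min (1 / rtail G (1 / θ)) M) ^ N ≤ M ^ N / z := by
    calc _ ≤ ∫ θ in Ioc 0 (1 / z), M ^ N := by
          refine integral_mono (hi.mono_set (Ioc_subset_Ioc_right hzb)) (integrable_const _)
            fun θ => ?_
          have h0 := rtail_nonneg G (1 / θ)
          have h1 : 0 ≤ min (1 / rtail G (1 / θ)) M := le_min (by positivity) hM.le
          simp only
          gcongr
          exact min_le_right _ _
      _ = _ := by
          rw [integral_const]
          simp [hzp.le]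
          ring
  have hB : ∫ θ in Ioc (1 / z) b, (min (1 / rtail G (1 / θ)) M) ^ N
      ≤ C ^ N / p * (1 / rtail G z) ^ N / z := by
    have hrp : IntegrableOn (fun θ : ℝ => θ ^ (-(a1 * N))) (Ioi (1 / z)) :=
      integrableOn_Ioi_rpow_of_lt (by linarith) hz0
    calc _ ≤ ∫ θ in Ioc (1 / z) b, (C / rtail G z) ^ N * z ^ (-(a1 * N)) * θ ^ (-(a1 * N)) := by
          refine setIntegral_mono_on (hi.mono_set (Ioc_subset_Ioc_left hz0.le))
            ((hrp.mono_set Ioc_subset_Ioi_self).const_mul _) measurableSet_Ioc fun θ hθ => ?_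
          have hθ0 : 0 < θ := hz0.trans hθ.1
          have e1 : 1 / b ≤ 1 / θ := by gcongr; exact hθ.2
          have e2 : 1 / θ ≤ z := by
            rw [div_le_iff₀ hθ0, mul_comm, ← div_le_iff₀ hzp]; exact hθ.1.le
          have e3 := hC _ _ e1 e2
          have hv := hG.pos (1 / θ)
          have e4 : 1 / rtail G (1 / θ) ≤ C / rtail G z * (z * θ) ^ (-a1) := by
            rw [rpow_neg (by positivity), ← div_eq_mul_inv, div_div, div_le_div_iff₀ hv (by positivity)]
            calc _ = (z / (1 / θ)) ^ a1 * rtail G z := by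
                  rw [one_mul, mul_comm, div_div_eq_mul_div, div_one]
              _ ≤ _ := e3
          have h1 : 0 ≤ min (1 / rtail G (1 / θ)) M := le_min (by positivity) hM.le
          calc (min (1 / rtail G (1 / θ)) M) ^ N ≤ (C / rtail G z * (z * θ) ^ (-a1)) ^ N := by
                gcongr; exact (min_le_left _ _).trans e4
            _ = _ := by
                rw [mul_pow, ← rpow_natCast ((z * θ) ^ (-a1)), ← rpow_mul (by positivity),
                  mul_rpow hzp.le hθ0.le]
                ring_nf
      _ ≤ ∫ θ in Ioi (1 / z), (C / rtail G z) ^ N * z ^ (-(a1 * N)) * θ ^ (-(a1 * N)) := by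
          refine setIntegral_mono_set (hrp.const_mul _) ?_ (Ioc_subset_Ioi_self.eventuallyLE)
          filter_upwards [ae_restrict_mem measurableSet_Ioi] with θ hθ
          have : (0 : ℝ) < θ := hz0.trans hθ
          simp only [Pi.zero_apply]
          positivity
      _ = _ := by
          rw [integral_const_mul, integral_Ioi_rpow_of_lt (by linarith) hz0, one_div z,
            inv_rpow hzp.le, div_pow, ← rpow_neg hzp.le]
          have : z ^ (-(a1 * N)) * z ^ (-(-(a1 * (N : ℝ)) + 1)) = z ^ (-1 : ℝ) := by
            rw [← rpow_add hzp]; ring_nf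
          rw [show -(a1 * (N : ℝ)) + 1 = -p by rw [hp]; ring] at this ⊢
          rw [neg_div_neg_eq]
          calc _ = C ^ N / rtail G z ^ N * (z ^ (-(a1 * N)) * z ^ (- -p)) / p := by ring
            _ = _ := by rw [this, rpow_neg_one, one_div_pow]; field_simp
  calc _ ≤ M ^ N / z + C ^ N / p * (1 / rtail G z) ^ N / z := add_le_add hA hB
    _ = (1 * M ^ N + C ^ N / p * (1 / rtail G z) ^ N) / z := by ring
    _ ≤ ((C ^ N / p + 1) * M ^ N + (C ^ N / p + 1) * (1 / rtail G z) ^ N) / z := by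
        have : 0 < C ^ N / p := by positivity
        gcongr <;> linarith
    _ = _ := by ring

lemma conv_Ioc_le_of_concentration (μ ν : Measure ℝ) [IsFiniteMeasure μ] [IsFiniteMeasure ν]
    {h : ℝ} {A : ℝ≥0∞} (hμ : ∀ t, μ (Ioc t (t + h)) ≤ A) (hν : ∀ t, ν (Ioc t (t + h)) ≤ A) (x : ℝ) :
    (μ.conv ν) (Ioc x (x + h)) ≤ A * μ (Ioi (x / 2)) + A * ν (Ioi (x / 2)) := by
  set S : Set (ℝ × ℝ) := (fun p : ℝ × ℝ => p.1 + p.2) ⁻¹' Ioc x (x + h)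
  have hS : MeasurableSet S := measurable_add measurableSet_Ioc
  have hS1 : MeasurableSet (S ∩ (Ioi (x / 2) ×ˢ univ)) :=
    hS.inter (measurableSet_Ioi.prod MeasurableSet.univ)
  have hS2 : MeasurableSet (S ∩ (univ ×ˢ Ioi (x / 2))) :=
    hS.inter (MeasurableSet.univ.prod measurableSet_Ioi)
  rw [Measure.conv, Measure.map_apply measurable_add measurableSet_Ioc]
  have hsub : S ⊆ (S ∩ (Ioi (x / 2) ×ˢ univ)) ∪ (S ∩ (univ ×ˢ Ioi (x / 2))) := by
    intro p hp
    have hp' : x < p.1 + p.2 := hp.1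
    rcases lt_or_ge (x / 2) p.1 with h1 | h1
    · exact Or.inl ⟨hp, h1, mem_univ _⟩
    · exact Or.inr ⟨hp, mem_univ _, by simp only [mem_Ioi]; linarith⟩
  refine (measure_mono hsub).trans ((measure_union_le _ _).trans (add_le_add ?_ ?_))
  · rw [Measure.prod_apply hS1]
    calc _ ≤ ∫⁻ s, (Ioi (x / 2)).indicator (fun _ => A) s ∂μ := by
          refine lintegral_mono fun s => ?_
          by_cases hs : s ∈ Ioi (x / 2)
          · rw [indicator_of_mem hs]
            refine (measure_mono ?_).trans (hν (x - s))
            intro t ht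
            have := ht.1
            simp only [S, mem_preimage, mem_Ioc] at this
            constructor <;> linarith [this.1, this.2]
          · rw [indicator_of_notMem hs]
            refine (measure_mono_null ?_ measure_empty).le
            intro t ht
            exact hs ht.2.1
      _ = _ := by rw [lintegral_indicator measurableSet_Ioi, setLIntegral_const]
  · rw [Measure.prod_apply_symm hS2]
    calc _ ≤ ∫⁻ s, (Ioi (x / 2)).indicator (fun _ => A) s ∂ν := by
          refine lintegral_mono fun s => ?_
          by_cases hs : s ∈ Ioi (x / 2)
          · rw [indicator_of_mem hs]
            refine (measure_mono ?_).trans (hμ (x - s))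
            intro t ht
            have := ht.1
            simp only [S, mem_preimage, mem_Ioc] at this
            constructor <;> linarith [this.1, this.2]
          · rw [indicator_of_notMem hs]
            refine (measure_mono_null ?_ measure_empty).le
            intro t ht
            exact hs ht.2.2
      _ = _ := by rw [lintegral_indicator measurableSet_Ioi, setLIntegral_const]

lemma integral_exp_mul_rpow_le {a2 : ℝ} (h0 : 0 ≤ a2) (h1 : a2 < 1) {l y : ℝ} (hl : 0 ≤ l)
    (hy : 0 < y) :
    IntegrableOn (fun t => l * exp (l * t) * (y / t) ^ a2) (Ioc 0 y) ∧
    ∫ t in Ioc 0 y, l * exp (l * t) * (y / t) ^ a2 ≤ (2 + 2 / (1 - a2)) * exp (l * y) := by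
  have h1' : 0 < 1 - a2 := by linarith
  have hrp : IntegrableOn (fun t : ℝ => y ^ a2 * t ^ (-a2)) (Ioc 0 y) := by
    refine Integrable.const_mul ?_ _
    rw [← IntegrableOn, ← intervalIntegrable_iff_integrableOn_Ioc_of_le hy.le]
    exact intervalIntegral.intervalIntegrable_rpow' (by linarith)
  have hval : ∫ t in Ioc 0 y, y ^ a2 * t ^ (-a2) = y / (1 - a2) := by
    rw [integral_const_mul, ← intervalIntegral.integral_of_le hy.le,
      integral_rpow (Or.inl (by linarith)), zero_rpow (by linarith), sub_zero, mul_div_assoc',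
      ← rpow_add hy]
    ring_nf
    rw [rpow_one]
    ring
  have hexp : IntegrableOn (fun t : ℝ => l * exp (l * t)) (Ioc 0 y) :=
    (Continuous.integrableOn_Icc (by fun_prop)).mono_set Ioc_subset_Icc_self
  have hexpval : ∫ t in Ioc 0 y, l * exp (l * t) = exp (l * y) - 1 := by
    rw [← intervalIntegral.integral_of_le hy.le]
    have : ∀ t ∈ uIcc 0 y, HasDerivAt (fun t => exp (l * t)) (l * exp (l * t)) t := by
      intro t _
      have := ((hasDerivAt_id t).const_mul l).exp
      simpa [mul_comm] using this
    rw [intervalIntegral.integral_eq_sub_of_hasDerivAt this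
      (Continuous.intervalIntegrable (by fun_prop) _ _)]
    simp
  have hpt : ∀ t ∈ Ioc 0 y, l * exp (l * t) * (y / t) ^ a2
      ≤ 2 * (l * exp (l * t)) + l * exp (l * y / 2) * (y ^ a2 * t ^ (-a2)) := by
    intro t ht
    have ht0 := ht.1
    have e : (y / t) ^ a2 = y ^ a2 * t ^ (-a2) := by
      rw [div_rpow hy.le ht0.le, rpow_neg ht0.le, div_eq_mul_inv]
    rcases le_or_gt t (y / 2) with h | h
    · rw [e]
      have : l * exp (l * t) ≤ l * exp (l * y / 2) := by gcongr; nlinarith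
      have h3 : 0 ≤ 2 * (l * exp (l * t)) := by positivity
      have h4 : 0 ≤ y ^ a2 * t ^ (-a2) := by positivity
      nlinarith
    · have h5 : (y / t) ^ a2 ≤ 2 := by
        calc (y / t) ^ a2 ≤ 2 ^ a2 := by
              gcongr
              rw [div_le_iff₀ ht0]; linarith
          _ ≤ 2 ^ (1 : ℝ) := rpow_le_rpow_of_exponent_le (by norm_num) h1.le
          _ = 2 := rpow_one 2
      have h3 : 0 ≤ l * exp (l * t) := by positivity
      have h4 : 0 ≤ l * exp (l * y / 2) * (y ^ a2 * t ^ (-a2)) := by positivity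
      nlinarith
  have hdom : IntegrableOn (fun t => 2 * (l * exp (l * t))
      + l * exp (l * y / 2) * (y ^ a2 * t ^ (-a2))) (Ioc 0 y) :=
    (hexp.const_mul 2).add (hrp.const_mul _)
  have hintg : IntegrableOn (fun t => l * exp (l * t) * (y / t) ^ a2) (Ioc 0 y) := by
    refine Integrable.mono' hdom (Measurable.aestronglyMeasurable (by fun_prop)) ?_
    filter_upwards [ae_restrict_mem measurableSet_Ioc] with t ht
    have ht0 := ht.1
    rw [Real.norm_eq_abs, abs_of_nonneg (by positivity)]
    exact hpt t ht
  refine ⟨hintg, ?_⟩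
  calc _ ≤ _ := setIntegral_mono_on hintg hdom measurableSet_Ioc hpt
    _ = 2 * (exp (l * y) - 1) + l * exp (l * y / 2) * (y / (1 - a2)) := by
        rw [integral_add (hexp.const_mul 2) (hrp.const_mul _), integral_const_mul,
          integral_const_mul _ (fun t => y ^ a2 * t ^ (-a2)), hexpval, hval]
    _ ≤ 2 * exp (l * y) + 2 / (1 - a2) * exp (l * y) := by
        have h6 : l * y / 2 ≤ exp (l * y / 2) := by linarith [add_one_le_exp (l * y / 2)]
        have h7 : exp (l * y) = exp (l * y / 2) * exp (l * y / 2) := by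
          rw [← exp_add]; ring_nf
        have h8 : l * exp (l * y / 2) * (y / (1 - a2))
            = 2 / (1 - a2) * (l * y / 2 * exp (l * y / 2)) := by ring
        have h9 : l * y / 2 * exp (l * y / 2) ≤ exp (l * y) := by
          rw [h7]; gcongr
        rw [h8]
        gcongr
        linarith
    _ = _ := by ring

lemma RegTail.lintegral_exp_truncated_le {G : Measure ℝ} [IsProbabilityMeasure G] {a : ℝ}
    (hG : RegTail G a) (ha : 0 < a) (ha1 : a < 1) (hG0 : G (Iio 0) = 0) :
    ∃ C > 0, ∀ y l : ℝ, 0 < y → 0 ≤ l →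
      ∫⁻ z, ENNReal.ofReal (exp (l * z)) ∂(G.restrict (Iic y))
        ≤ ENNReal.ofReal (1 + C * exp (l * y) * rtail G y) := by
  obtain ⟨a2, h2, h21⟩ := exists_between ha1
  have h20 : 0 ≤ a2 := by linarith
  obtain ⟨C, hC1, hC⟩ := hG.potter_upper h2 h20
  have h1' : 0 < 1 - a2 := by linarith
  refine ⟨C * (2 + 2 / (1 - a2)), by positivity, fun y l hy hl => ?_⟩
  have hv := hG.pos y
  set ν := G.restrict (Iic y)
  have hnn : (0 : ℝ → ℝ) ≤ᵐ[ν] fun z => z := by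
    refine ae_restrict_of_ae ?_
    show ∀ᵐ z ∂G, (0 : ℝ) ≤ z
    rw [ae_iff]
    convert hG0 using 2
    ext z; simp
  have hlc := lintegral_comp_eq_lintegral_meas_lt_mul ν hnn measurable_id.aemeasurable
    (g := fun t => l * exp (l * t))
    (fun t _ => Continuous.intervalIntegrable (by fun_prop) _ _)
    (ae_of_all _ fun t => by positivity)
  have hprim : ∀ z, ∫ t in (0 : ℝ)..z, l * exp (l * t) = exp (l * z) - 1 := by
    intro z
    have : ∀ t ∈ uIcc 0 z, HasDerivAt (fun t => exp (l * t)) (l * exp (l * t)) t := by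
      intro t _
      have := ((hasDerivAt_id t).const_mul l).exp
      simpa [mul_comm] using this
    rw [intervalIntegral.integral_eq_sub_of_hasDerivAt this
      (Continuous.intervalIntegrable (by fun_prop) _ _)]
    simp
  simp only [hprim] at hlc
  obtain ⟨hi, hle⟩ := integral_exp_mul_rpow_le h20 h21 hl hy
  calc ∫⁻ z, ENNReal.ofReal (exp (l * z)) ∂ν
      ≤ ∫⁻ z, (1 + ENNReal.ofReal (exp (l * z) - 1)) ∂ν := by
        refine lintegral_mono fun z => ?_
        calc ENNReal.ofReal (exp (l * z)) = ENNReal.ofReal (1 + (exp (l * z) - 1)) := by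
              congr 1; ring
          _ ≤ ENNReal.ofReal 1 + ENNReal.ofReal (exp (l * z) - 1) := ENNReal.ofReal_add_le
          _ = _ := by rw [ENNReal.ofReal_one]
    _ = ν univ + ∫⁻ t in Ioi 0, ν {z | t < z} * ENNReal.ofReal (l * exp (l * t)) := by
        rw [lintegral_add_left measurable_const, hlc, lintegral_const, one_mul]
    _ ≤ 1 + ∫⁻ t in Ioc 0 y,
          ENNReal.ofReal (C * rtail G y * (l * exp (l * t) * (y / t) ^ a2)) := by
        refine add_le_add ((Measure.restrict_apply_le _ _).trans prob_le_one) ?_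
        rw [← lintegral_indicator measurableSet_Ioi, ← lintegral_indicator measurableSet_Ioc]
        refine lintegral_mono fun t => ?_
        by_cases ht : t ∈ Ioi (0 : ℝ)
        · rw [indicator_of_mem ht]
          by_cases hty : t ≤ y
          · rw [indicator_of_mem (show t ∈ Ioc 0 y from ⟨ht, hty⟩)]
            have ht0 : 0 < t := ht
            calc _ ≤ ENNReal.ofReal (rtail G t) * ENNReal.ofReal (l * exp (l * t)) := by
                  gcongr
                  rw [ofReal_rtail]
                  exact Measure.restrict_apply_le _ _
              _ = ENNReal.ofReal (rtail G t * (l * exp (l * t))) := by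
                  rw [ENNReal.ofReal_mul (rtail_nonneg _ _)]
              _ ≤ _ := by
                  refine ENNReal.ofReal_le_ofReal ?_
                  calc _ ≤ (C * (y / t) ^ a2 * rtail G y) * (l * exp (l * t)) := by
                        gcongr; exact hC t y ht0 hty
                    _ = _ := by ring
          · have : ν {z | t < z} = 0 := by
              show ν (Ioi t) = 0
              rw [Measure.restrict_apply measurableSet_Ioi]
              refine measure_mono_null (t := ∅) ?_ measure_empty
              intro z hz
              exact hty (hz.1.le.trans hz.2)
            rw [this, zero_mul]
            exact zero_le
        · rw [indicator_of_notMem ht]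
          exact zero_le
    _ = 1 + ENNReal.ofReal (C * rtail G y * ∫ t in Ioc 0 y, l * exp (l * t) * (y / t) ^ a2) := by
        rw [← integral_const_mul, ofReal_integral_eq_lintegral_ofReal (hi.const_mul _)]
        filter_upwards [ae_restrict_mem measurableSet_Ioc] with t ht
        have ht0 := ht.1
        simp only [Pi.zero_apply]
        positivity
    _ ≤ 1 + ENNReal.ofReal (C * rtail G y * ((2 + 2 / (1 - a2)) * exp (l * y))) := by gcongr
    _ = _ := by
        rw [← ENNReal.ofReal_one, ← ENNReal.ofReal_add zero_le_one (by positivity)]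
        congr 1; ring

lemma convPow_restrict_le (G : Measure ℝ) [IsProbabilityMeasure G] (s : Set ℝ) (n : ℕ) (t : Set ℝ) :
    convPow (G.restrict s) n t ≤ convPow G n t :=
  convPow_mono Measure.restrict_le_self n t

lemma convPow_Ioc_le_conc {G : Measure ℝ} [IsProbabilityMeasure G] {c b h : ℝ} (hb : 0 < b)
    (hc : 0 ≤ c) (hh : h / 2 ≤ 1 / b)
    (hφ : ∀ t : ℝ, 0 < |t| → |t| ≤ b → ‖charFun G t‖ ≤ exp (-(c * rtail G (1 / |t|))))
    (n : ℕ) (t : ℝ) :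
    convPow G n (Ioc t (t + h)) ≤ ENNReal.ofReal (8 / b * conc G c b n) := by
  refine (measure_mono (t := Icc (t + h / 2 - 1 / b) (t + h / 2 + 1 / b)) ?_).trans ?_
  · intro z hz
    exact ⟨by linarith [hz.1], by linarith [hz.2]⟩
  · rw [← ofReal_measureReal]
    exact ENNReal.ofReal_le_ofReal (convPow_Icc_le_conc hb hc hφ n _)

lemma RegTail.convPow_restrict_Ioi_le {G : Measure ℝ} [IsProbabilityMeasure G] {a : ℝ}
    (hG : RegTail G a) (ha : 0 < a) (ha1 : a < 1) (hG0 : G (Iio 0) = 0) :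
    ∃ C > 0, ∀ y : ℝ, 0 < y → ∀ N n m : ℕ, m ≤ n → 1 ≤ n →
      convPow (G.restrict (Iic y)) m (Ioi (N * y))
        ≤ ENNReal.ofReal (C * (n * rtail G y) ^ N) := by
  obtain ⟨C, hC0, hC⟩ := hG.lintegral_exp_truncated_le ha ha1 hG0
  refine ⟨exp C, exp_pos C, fun y hy N n m hmn hn => ?_⟩
  have hv := hG.pos y
  have hn0 : (0 : ℝ) < n := by exact_mod_cast hn
  have hnv : 0 < n * rtail G y := by positivity
  rcases le_or_gt 1 (n * rtail G y) with h1 | h1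
  · refine (convPow_restrict_le G _ m _).trans (prob_le_one.trans ?_)
    rw [← ENNReal.ofReal_one]
    refine ENNReal.ofReal_le_ofReal ?_
    exact one_le_mul_of_one_le_of_one_le (by linarith [add_one_le_exp C]) (one_le_pow₀ h1)
  · set l := -log (n * rtail G y) / y with hl
    have hl0 : 0 ≤ l := div_nonneg (neg_nonneg.2 (log_nonpos hnv.le h1.le)) hy.le
    have hly : exp (l * y) = (n * rtail G y)⁻¹ := by
      rw [hl, div_mul_cancel₀ _ hy.ne', exp_neg, exp_log hnv]
    have hlN : exp (l * (N * y)) = ((n * rtail G y) ^ N)⁻¹ := by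
      rw [show l * (N * y) = N * (l * y) by ring, exp_nat_mul, hly, inv_pow]
    set μ := convPow (G.restrict (Iic y)) m
    have hmk : ENNReal.ofReal (exp (l * (N * y))) * μ (Ioi (N * y))
        ≤ ∫⁻ z, ENNReal.ofReal (exp (l * z)) ∂μ := by
      refine le_trans ?_ (mul_meas_ge_le_lintegral (by fun_prop) (ENNReal.ofReal (exp (l * (N * y)))))
      gcongr
      intro z hz
      refine ENNReal.ofReal_le_ofReal (exp_le_exp.2 ?_)
      have : N * y < z := hz
      gcongr
    rw [lintegral_exp_convPow] at hmk
    have h2 : (∫⁻ z, ENNReal.ofReal (exp (l * z)) ∂(G.restrict (Iic y))) ^ m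
        ≤ ENNReal.ofReal (exp C) := by
      calc _ ≤ (ENNReal.ofReal (1 + C * exp (l * y) * rtail G y)) ^ m := by
            gcongr; exact hC y l hy hl0
        _ = ENNReal.ofReal ((1 + C * exp (l * y) * rtail G y) ^ m) := by
            rw [ENNReal.ofReal_pow (by positivity)]
        _ ≤ _ := by
            refine ENNReal.ofReal_le_ofReal ?_
            have e : C * exp (l * y) * rtail G y = C / n := by
              rw [hly]; field_simp
            rw [e]
            calc (1 + C / n) ^ m ≤ (1 + C / n) ^ n := by
                  gcongr; linarith [show 0 < C / n by positivity]
              _ ≤ (exp (C / n)) ^ n := by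
                  gcongr; linarith [add_one_le_exp (C / n)]
              _ = exp C := by rw [← exp_nat_mul]; congr 1; field_simp
    have h3 := hmk.trans h2
    rw [hlN] at h3
    have hp : 0 < (n * rtail G y) ^ N := by positivity
    calc μ (Ioi (N * y)) = ENNReal.ofReal ((n * rtail G y) ^ N) *
          (ENNReal.ofReal ((n * rtail G y) ^ N)⁻¹ * μ (Ioi (N * y))) := by
          rw [← mul_assoc, ← ENNReal.ofReal_mul hp.le, mul_inv_cancel₀ hp.ne', ENNReal.ofReal_one,
            one_mul]
      _ ≤ ENNReal.ofReal ((n * rtail G y) ^ N) * ENNReal.ofReal (exp C) := by gcongr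
      _ = _ := by rw [← ENNReal.ofReal_mul hp.le, mul_comm]

lemma RegTail.small_jumps_le {G : Measure ℝ} [IsProbabilityMeasure G] {a : ℝ}
    (hG : RegTail G a) (ha : 0 < a) (ha1 : a < 1) (hG0 : G (Iio 0) = 0)
    {c b h : ℝ} (hb : 0 < b) (hc : 0 ≤ c) (hh : h / 2 ≤ 1 / b)
    (hφ : ∀ t : ℝ, 0 < |t| → |t| ≤ b → ‖charFun G t‖ ≤ exp (-(c * rtail G (1 / |t|))))
    {N : ℕ} (hN : 1 ≤ N) :
    ∃ C > 0, ∀ x : ℝ, 0 < x → ∀ n : ℕ, 1 ≤ n →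
      convPow (G.restrict (Iic (x / (2 * N)))) n (Ioc x (x + h))
        ≤ ENNReal.ofReal (C * (n * rtail G x) ^ N * conc G (c / 2) b n) := by
  obtain ⟨C1, hC1, hT⟩ := hG.convPow_restrict_Ioi_le ha ha1 hG0
  obtain ⟨C2, hC2, hP⟩ := hG.potter_upper ha1 zero_le_one
  have hN0 : (0 : ℝ) < N := by exact_mod_cast hN
  have hN1 : (1 : ℝ) ≤ N := by exact_mod_cast hN
  have hC20 : 0 < C2 := by linarith
  set K := C2 * (2 * N) ^ (1 : ℝ)
  have hK : 0 < K := by positivity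
  refine ⟨2 * (8 / b * exp (c / 2)) * C1 * K ^ N, by positivity, fun x hx n hn => ?_⟩
  set y := x / (2 * N) with hy
  have hy0 : 0 < y := by positivity
  have hNy : N * y = x / 2 := by rw [hy]; field_simp
  have hv := hG.pos x
  have hvy : rtail G y ≤ K * rtail G x := by
    refine (hP y x hy0 ?_).trans (le_of_eq ?_)
    · rw [hy]; exact div_le_self hx.le (by linarith)
    · rw [hy]; congr 2; congr 1; field_simp
  have hn0 : (1 : ℝ) ≤ n := by exact_mod_cast hn
  set μ := G.restrict (Iic y)
  set A := ENNReal.ofReal (8 / b * exp (c / 2) * conc G (c / 2) b n) with hA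
  have hhalf : ∀ m : ℕ, (n - 1 : ℝ) / 2 ≤ m → ∀ t, convPow μ m (Ioc t (t + h)) ≤ A := by
    intro m hm t
    refine (convPow_restrict_le G _ m _).trans ((convPow_Ioc_le_conc hb hc hh hφ m t).trans ?_)
    refine ENNReal.ofReal_le_ofReal ?_
    rw [mul_assoc (8 / b)]
    gcongr
    calc conc G c b m ≤ conc G c b ((n - 1) / 2) := conc_anti G hc (by linarith) hm
      _ = conc G (c / 2) b (n - 1) := conc_half G c b _
      _ ≤ _ := conc_sub_one_le G (by positivity) hn0
  have htail : ∀ m : ℕ, m ≤ n → convPow μ m (Ioi (x / 2))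
      ≤ ENNReal.ofReal (C1 * K ^ N * (n * rtail G x) ^ N) := by
    intro m hm
    rw [← hNy]
    refine (hT y hy0 N n m hm hn).trans (ENNReal.ofReal_le_ofReal ?_)
    rw [mul_assoc, ← mul_pow]
    have := rtail_nonneg G y
    have hle : n * rtail G y ≤ K * (n * rtail G x) := by
      calc n * rtail G y ≤ n * (K * rtail G x) := by gcongr
        _ = _ := by ring
    exact mul_le_mul_of_nonneg_left (pow_le_pow_left₀ (by positivity) hle N) hC1.le
  have hsplit : convPow μ n = (convPow μ (n / 2)).conv (convPow μ (n - n / 2)) := by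
    rw [← convPow_add]; congr 1; omega
  have m1 : (n - 1 : ℝ) / 2 ≤ (n / 2 : ℕ) := by
    have : n ≤ 2 * (n / 2) + 1 := by omega
    have : (n : ℝ) ≤ 2 * (n / 2 : ℕ) + 1 := by exact_mod_cast this
    linarith
  have m2 : (n - 1 : ℝ) / 2 ≤ (n - n / 2 : ℕ) := by
    have : n ≤ 2 * (n - n / 2) + 1 := by omega
    have : (n : ℝ) ≤ 2 * (n - n / 2 : ℕ) + 1 := by exact_mod_cast this
    linarith
  rw [hsplit]
  have hcn := conc_nonneg G (c / 2) b n
  calc _ ≤ _ := conv_Ioc_le_of_concentration _ _ (hhalf _ m1) (hhalf _ m2) x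
    _ ≤ A * ENNReal.ofReal (C1 * K ^ N * (n * rtail G x) ^ N)
        + A * ENNReal.ofReal (C1 * K ^ N * (n * rtail G x) ^ N) := by
        gcongr
        · exact htail _ (Nat.div_le_self _ _)
        · exact htail _ (Nat.sub_le _ _)
    _ = _ := by
        rw [hA, ← ENNReal.ofReal_mul (by positivity), ← ENNReal.ofReal_add (by positivity) (by positivity)]
        congr 1; ring

/-- `∫_p^q (ω(w) - T)⁺ dw` as an extended nonnegative real. -/
def jint (G : Measure ℝ) (h T p q : ℝ) : ℝ≥0∞ :=
  ∫⁻ w in Ioc p q, ENNReal.ofReal (omegaFn G h w - T)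

lemma measurable_measure_Ioc (G : Measure ℝ) [IsFiniteMeasure G] (h : ℝ) :
    Measurable fun w => G (Ioc w (w + h)) := by
  have hS : MeasurableSet {p : ℝ × ℝ | p.1 < p.2 ∧ p.2 ≤ p.1 + h} :=
    (measurableSet_lt measurable_fst measurable_snd).inter
      (measurableSet_le measurable_snd (measurable_fst.add_const h))
  exact measurable_measure_prodMk_left hS

lemma measurable_omegaFn (G : Measure ℝ) [IsProbabilityMeasure G] (h : ℝ) :
    Measurable (omegaFn G h) := by
  unfold omegaFn
  exact (measurable_id.mul (measurable_measure_Ioc G h).ennreal_toReal).div (measurable_rtail G)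

lemma measure_Ioc_mul_le_lintegral (G : Measure ℝ) [IsFiniteMeasure G] (h w : ℝ) :
    G (Ioc w (w + h)) * ENNReal.ofReal h ≤ ∫⁻ s in Ioc (w - h) (w + h), G (Ioc s (s + h)) := by
  have hS : MeasurableSet {p : ℝ × ℝ | p.1 < p.2 ∧ p.2 ≤ p.1 + h} :=
    (measurableSet_lt measurable_fst measurable_snd).inter
      (measurableSet_le measurable_snd (measurable_fst.add_const h))
  have e := Measure.prod_apply_symm (μ := volume.restrict (Ioc (w - h) (w + h))) (ν := G) hS
  rw [Measure.prod_apply hS] at e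
  have e' : ∫⁻ s in Ioc (w - h) (w + h), G (Ioc s (s + h)) = _ := e
  rw [e', ← setLIntegral_one, ← lintegral_indicator measurableSet_Ioc,
    ← lintegral_mul_const' _ _ ENNReal.ofReal_ne_top]
  refine lintegral_mono fun z => ?_
  by_cases hz : z ∈ Ioc w (w + h)
  · rw [indicator_of_mem hz, one_mul]
    calc ENNReal.ofReal h = volume (Ico (z - h) z) := by rw [Real.volume_Ico]; congr 1; ring
      _ = (volume.restrict (Ioc (w - h) (w + h))) (Ico (z - h) z) := by
          rw [Measure.restrict_apply measurableSet_Ico, inter_eq_left.2]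
          intro s hs
          exact ⟨by linarith [hs.1, hz.1], by linarith [hs.2, hz.2]⟩
      _ ≤ _ := by
          refine measure_mono fun s hs => ?_
          exact ⟨hs.2, by linarith [hs.1]⟩
  · rw [indicator_of_notMem hz, zero_mul]
    exact zero_le

lemma RegTail.measure_Ioc_le_omegaFn {G : Measure ℝ} [IsProbabilityMeasure G] {a : ℝ}
    (hG : RegTail G a) (ha1 : a < 1) {κ h T : ℝ} (hκ : 0 < κ) (hκ1 : κ ≤ 1) :
    ∃ C > 0, ∀ x : ℝ, 0 < x → ∀ w ∈ Ioc (κ / 2 * x) (2 * x),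
      G (Ioc w (w + h)) ≤ ENNReal.ofReal (C * (rtail G x / x)) *
        (ENNReal.ofReal T + ENNReal.ofReal (omegaFn G h w - T)) := by
  obtain ⟨C, hC1, hC⟩ := hG.potter_upper ha1 zero_le_one
  have hC0 : 0 < C := by linarith
  refine ⟨C * (2 / κ) ^ (1 : ℝ) * (2 / κ), by positivity, fun x hx w hw => ?_⟩
  have hw0 : 0 < w := lt_trans (by positivity) hw.1
  have hvw := hG.pos w
  have hvx := hG.pos x
  rw [← ENNReal.ofReal_toReal (measure_ne_top G (Ioc w (w + h)))]
  have e : (G (Ioc w (w + h))).toReal = rtail G w / w * omegaFn G h w := by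
    unfold omegaFn
    field_simp
  have h1 : rtail G w / w ≤ C * (2 / κ) ^ (1 : ℝ) * (2 / κ) * (rtail G x / x) := by
    have h2 : rtail G w ≤ C * (2 / κ) ^ (1 : ℝ) * rtail G x := by
      refine (rtail_antitone G hw.1.le).trans ((hC (κ / 2 * x) x (by positivity) ?_).trans
        (le_of_eq ?_))
      · nlinarith
      · congr 3; field_simp
    calc rtail G w / w ≤ (C * (2 / κ) ^ (1 : ℝ) * rtail G x) / (κ / 2 * x) := by
          gcongr; exact hw.1.le
      _ = _ := by field_simp
  have hom : 0 ≤ omegaFn G h w := by unfold omegaFn; positivity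
  rw [e, ENNReal.ofReal_mul (by positivity)]
  gcongr
  calc ENNReal.ofReal (omegaFn G h w) = ENNReal.ofReal (T + (omegaFn G h w - T)) := by
        congr 1; ring
    _ ≤ _ := ENNReal.ofReal_add_le

lemma RegTail.big_jump_le {G : Measure ℝ} [IsProbabilityMeasure G] {a : ℝ}
    (hG : RegTail G a) (ha1 : a < 1) {κ h T : ℝ} (hκ : 0 < κ) (hκ1 : κ ≤ 1)
    (hh : 0 < h) :
    ∃ C > 0, ∀ x : ℝ, h ≤ x → 4 * h ≤ κ * x → ∀ (ν : Measure ℝ) [IsProbabilityMeasure ν],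
      ν (Iio 0) = 0 → ∀ A : ℝ≥0∞, (∀ z, ν (Icc (z - h) (z + h)) ≤ A) →
      (ν.conv (G.restrict (Ioi (κ * x)))) (Ioc x (x + h)) ≤
        ENNReal.ofReal (C * (rtail G x / x)) *
          (ENNReal.ofReal T + A * jint G h T (κ / 2 * x) (2 * x)) := by
  obtain ⟨C, hC0, hC⟩ := hG.measure_Ioc_le_omegaFn (h := h) ha1 hκ hκ1 (T := T)
  refine ⟨C * 2 * (1 + 1 / h), by positivity, fun x hhx hκx ν _ hν A hA => ?_⟩
  have hx : 0 < x := hh.trans_le hhx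
  have hvx := hG.pos x
  set j : ℝ → ℝ≥0∞ := fun w => ENNReal.ofReal (omegaFn G h w - T) with hj
  have hjm : Measurable j := ((measurable_omegaFn G h).sub_const T).ennreal_ofReal
  set B := ENNReal.ofReal (C * (rtail G x / x)) with hB
  set E := Ioc (κ / 2 * x) (2 * x) with hE
  have hEm : MeasurableSet E := measurableSet_Ioc
  have hpt : ∀ u, 0 ≤ u → (G.restrict (Ioi (κ * x))) ((fun y => u + y) ⁻¹' Ioc x (x + h))
      ≤ ENNReal.ofReal (1 / h) * (B * (ENNReal.ofReal (2 * h) * ENNReal.ofReal T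
        + ∫⁻ s, (Ioc (x - u - h) (x - u + h)).indicator 1 s * E.indicator j s)) := by
    intro u hu
    set w := x - u with hw
    have hpre : (fun y => u + y) ⁻¹' Ioc x (x + h) = Ioc w (w + h) := by
      ext y; simp only [mem_preimage, mem_Ioc]
      constructor <;> intro hy <;> constructor <;> linarith [hy.1, hy.2]
    rw [hpre]
    rcases le_or_gt (w + h) (κ * x) with h1 | h1
    · have : (G.restrict (Ioi (κ * x))) (Ioc w (w + h)) = 0 := by
        rw [Measure.restrict_apply measurableSet_Ioc]
        refine measure_mono_null (t := ∅) ?_ measure_empty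
        intro z hz
        have h2 : κ * x < z := hz.2
        linarith [hz.1.2]
      rw [this]
      exact zero_le
    · have hsub : Ioc (w - h) (w + h) ⊆ E := by
        intro s hs
        exact ⟨by linarith [hs.1], by linarith [hs.2]⟩
      calc (G.restrict (Ioi (κ * x))) (Ioc w (w + h)) ≤ G (Ioc w (w + h)) :=
            Measure.restrict_apply_le _ _
        _ = ENNReal.ofReal (1 / h) * (G (Ioc w (w + h)) * ENNReal.ofReal h) := by
            rw [mul_comm (G _), ← mul_assoc, ← ENNReal.ofReal_mul (by positivity),
              one_div_mul_cancel hh.ne', ENNReal.ofReal_one, one_mul]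
        _ ≤ ENNReal.ofReal (1 / h) * ∫⁻ s in Ioc (w - h) (w + h), G (Ioc s (s + h)) := by
            gcongr; exact measure_Ioc_mul_le_lintegral G h w
        _ ≤ ENNReal.ofReal (1 / h) * ∫⁻ s in Ioc (w - h) (w + h),
              B * (ENNReal.ofReal T + E.indicator j s) := by
            gcongr ENNReal.ofReal (1 / h) * ?_
            refine setLIntegral_mono' measurableSet_Ioc fun s hs => ?_
            rw [indicator_of_mem (hsub hs)]
            exact hC x hx s (hsub hs)
        _ = _ := by
            rw [lintegral_const_mul' _ _ ENNReal.ofReal_ne_top, lintegral_add_left measurable_const,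
              setLIntegral_const, Real.volume_Ioc, ← lintegral_indicator measurableSet_Ioc]
            congr 3
            · rw [mul_comm]; congr 2; ring
            · congr 1; ext s
              by_cases hs : s ∈ Ioc (w - h) (w + h)
              · simp [indicator_of_mem hs]
              · simp [indicator_of_notMem hs]
  have hae : ∀ᵐ u ∂ν, 0 ≤ u := by
    rw [ae_iff]; convert hν using 2; ext; simp
  rw [conv_apply _ _ measurableSet_Ioc]
  have hswap : ∫⁻ u, (∫⁻ s, (Ioc (x - u - h) (x - u + h)).indicator 1 s * E.indicator j s) ∂ν
      ≤ A * jint G h T (κ / 2 * x) (2 * x) := by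
    have hSm : MeasurableSet {p : ℝ × ℝ | x - p.1 - h < p.2 ∧ p.2 ≤ x - p.1 + h} :=
      (measurableSet_lt (by fun_prop) measurable_snd).inter
        (measurableSet_le measurable_snd (by fun_prop))
    have hm : Measurable fun p : ℝ × ℝ =>
        (Ioc (x - p.1 - h) (x - p.1 + h)).indicator (1 : ℝ → ℝ≥0∞) p.2 * E.indicator j p.2 := by
      refine Measurable.mul ?_ ((hjm.indicator hEm).comp measurable_snd)
      exact (measurable_const (a := (1 : ℝ≥0∞))).indicator hSm
    rw [lintegral_lintegral_swap hm.aemeasurable]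
    calc _ ≤ ∫⁻ s, A * E.indicator j s := by
          refine lintegral_mono fun s => ?_
          have hms : Measurable fun u : ℝ =>
              (Ioc (x - u - h) (x - u + h)).indicator (1 : ℝ → ℝ≥0∞) s :=
            (measurable_const (a := (1 : ℝ≥0∞))).indicator
              (hSm.preimage (measurable_id.prodMk measurable_const))
          show ∫⁻ u, (Ioc (x - u - h) (x - u + h)).indicator (1 : ℝ → ℝ≥0∞) s * E.indicator j s ∂ν
            ≤ _
          rw [lintegral_mul_const _ hms]
          · gcongr
            calc _ ≤ ∫⁻ u, (Icc (x - s - h) (x - s + h)).indicator 1 u ∂ν := by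
                  refine lintegral_mono fun u => ?_
                  by_cases hs : s ∈ Ioc (x - u - h) (x - u + h)
                  · rw [indicator_of_mem (show u ∈ Icc (x - s - h) (x - s + h) from
                      ⟨by linarith [hs.1], by linarith [hs.2]⟩)]
                    exact indicator_le_self' (by simp) _
                  · rw [indicator_of_notMem hs]; exact zero_le
              _ = ν (Icc (x - s - h) (x - s + h)) := by
                  rw [lintegral_indicator_one measurableSet_Icc]
              _ ≤ A := hA _
      _ = _ := by
          rw [lintegral_const_mul _ (hjm.indicator hEm), lintegral_indicator hEm]
          rfl
  calc _ ≤ ∫⁻ u, ENNReal.ofReal (1 / h) * (B * (ENNReal.ofReal (2 * h) * ENNReal.ofReal T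
        + ∫⁻ s, (Ioc (x - u - h) (x - u + h)).indicator 1 s * E.indicator j s)) ∂ν :=
        lintegral_mono_ae (hae.mono hpt)
    _ = ENNReal.ofReal (1 / h) * (B * (ENNReal.ofReal (2 * h) * ENNReal.ofReal T
        + ∫⁻ u, (∫⁻ s, (Ioc (x - u - h) (x - u + h)).indicator 1 s * E.indicator j s) ∂ν)) := by
        rw [lintegral_const_mul' _ _ ENNReal.ofReal_ne_top, hB,
          lintegral_const_mul' _ _ ENNReal.ofReal_ne_top, lintegral_add_left measurable_const,
          lintegral_const, measure_univ, mul_one]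
    _ ≤ ENNReal.ofReal (1 / h) * (B * (ENNReal.ofReal (2 * h) * ENNReal.ofReal T
        + A * jint G h T (κ / 2 * x) (2 * x))) := by gcongr
    _ ≤ ENNReal.ofReal (1 / h) * (B * (ENNReal.ofReal (2 * (1 + h)) * ENNReal.ofReal T
        + ENNReal.ofReal (2 * (1 + h)) * (A * jint G h T (κ / 2 * x) (2 * x)))) := by
        refine mul_le_mul_right (mul_le_mul_right (add_le_add ?_ ?_) _) _
        · gcongr; linarith
        · refine le_mul_of_one_le_left zero_le ?_
          rw [← ENNReal.ofReal_one]
          exact ENNReal.ofReal_le_ofReal (by linarith)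
    _ = _ := by
        rw [← mul_add, ← mul_assoc, ← mul_assoc, hB, ← ENNReal.ofReal_mul (by positivity),
          ← ENNReal.ofReal_mul (by positivity)]
        congr 2
        field_simp
        ring

lemma conv_Iio_zero {μ ν : Measure ℝ} [IsFiniteMeasure μ] [IsFiniteMeasure ν]
    (hμ : μ (Iio 0) = 0) (hν : ν (Iio 0) = 0) : (μ.conv ν) (Iio 0) = 0 := by
  rw [conv_apply _ _ measurableSet_Iio]
  have hae : ∀ᵐ u ∂μ, 0 ≤ u := by
    rw [ae_iff]; convert hμ using 2; ext; simp
  refine lintegral_eq_zero_of_ae_eq_zero ?_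
  filter_upwards [hae] with u hu
  refine measure_mono_null ?_ hν
  intro y hy
  simp only [mem_preimage, mem_Iio] at hy ⊢
  linarith

lemma convPow_Iio_zero {G : Measure ℝ} [IsProbabilityMeasure G] (hG0 : G (Iio 0) = 0) (n : ℕ) :
    convPow G n (Iio 0) = 0 := by
  induction n with
  | zero => simp [convPow_zero]
  | succ n ih => rw [convPow_succ]; exact conv_Iio_zero ih hG0

lemma conc_le_conc_half (G : Measure ℝ) [IsProbabilityMeasure G] {c b s : ℝ} (hc : 0 ≤ c)
    (hs : 0 ≤ s) : conc G c b s ≤ conc G (c / 2) b s := by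
  rw [← conc_half]
  exact conc_anti G hc (by linarith) (by linarith)

lemma RegTail.convPow_Ioc_le {G : Measure ℝ} [IsProbabilityMeasure G] {a : ℝ}
    (hG : RegTail G a) (ha : 0 < a) (ha1 : a < 1) (hG0 : G (Iio 0) = 0)
    {c b h T : ℝ} (hb : 0 < b) (hc : 0 ≤ c) (hh0 : 0 < h) (hh : h ≤ 1 / b) (hT : 0 ≤ T)
    (hφ : ∀ t : ℝ, 0 < |t| → |t| ≤ b → ‖charFun G t‖ ≤ exp (-(c * rtail G (1 / |t|))))
    {N : ℕ} (hN : 1 ≤ N) :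
    ∃ C > 0, ∀ᶠ x in atTop, ∀ J : ℝ, 0 ≤ J →
      jint G h T (1 / (2 * N) / 2 * x) (2 * x) ≤ ENNReal.ofReal J → ∀ n : ℕ, 1 ≤ n →
      (convPow G n).real (Ioc x (x + h))
        ≤ C * ((n * rtail G x) ^ N * conc G (c / 2) b n + n * (rtail G x / x) * T
          + n * (rtail G x / x) * conc G (c / 2) b n * J) := by
  have hN0 : (0 : ℝ) < N := by exact_mod_cast hN
  have hN1 : (1 : ℝ) ≤ N := by exact_mod_cast hN
  obtain ⟨C1, hC1, hs⟩ := hG.small_jumps_le ha ha1 hG0 hb hc (h := h) (by linarith) hφ hN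
  obtain ⟨C2, hC2, hbig⟩ := hG.big_jump_le ha1 (κ := 1 / (2 * N)) (h := h) (T := T) (by positivity)
    (by rw [div_le_one (by positivity)]; linarith) hh0
  set D := 8 / b * exp c
  have hD : 0 < D := by positivity
  refine ⟨C1 + C2 * (1 + D), by positivity, ?_⟩
  filter_upwards [eventually_ge_atTop h, eventually_ge_atTop (4 * h * (2 * N))]
    with x hx1 hx2 J hJ0 hJ n hn
  have hx : 0 < x := hh0.trans_le hx1
  have hv := hG.pos x
  obtain ⟨k, rfl⟩ : ∃ k, n = k + 1 := ⟨n - 1, by omega⟩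
  set n := k + 1
  have hn1 : (1 : ℝ) ≤ n := by exact_mod_cast hn
  have hcn := conc_nonneg G (c / 2) b n
  have hA : ∀ z, convPow G k (Icc (z - h) (z + h)) ≤ ENNReal.ofReal (D * conc G (c / 2) b n) := by
    intro z
    refine (measure_mono (Icc_subset_Icc (a₂ := z - 1 / b) (b₂ := z + 1 / b)
      (by linarith) (by linarith))).trans ?_
    rw [← ofReal_measureReal]
    refine ENNReal.ofReal_le_ofReal ((convPow_Icc_le_conc hb hc hφ k z).trans ?_)
    show _ ≤ 8 / b * exp c * _
    rw [mul_assoc]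
    gcongr
    have e : (k : ℝ) = (n : ℝ) - 1 := by simp [n]
    rw [e]
    refine (conc_sub_one_le G hc hn1).trans ?_
    gcongr
    exact conc_le_conc_half G hc (by linarith)
  have e : x / (2 * N) = 1 / (2 * N) * x := by ring
  have hbg := hbig x hx1 (by rw [← e, le_div_iff₀ (by positivity)]; linarith) (convPow G k)
    (convPow_Iio_zero hG0 k) _ hA
  have hsm := hs x hx n hn
  rw [e] at hsm
  have htot : convPow G n (Ioc x (x + h)) ≤ ENNReal.ofReal
      (C1 * (n * rtail G x) ^ N * conc G (c / 2) b n
        + n * (C2 * (rtail G x / x) * (T + D * conc G (c / 2) b n * J))) := by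
    calc convPow G n (Ioc x (x + h)) ≤ _ := convPow_succ_le_truncated G (1 / (2 * N) * x) k _
      _ = convPow (G.restrict (Iic (1 / (2 * N) * x))) n (Ioc x (x + h)) + (n : ℝ≥0∞) *
        ((convPow G k).conv (G.restrict (Ioi (1 / (2 * N) * x)))) (Ioc x (x + h)) := by
          simp [n]
      _ ≤ ENNReal.ofReal (C1 * (n * rtail G x) ^ N * conc G (c / 2) b n) + (n : ℝ≥0∞) *
        (ENNReal.ofReal (C2 * (rtail G x / x)) * (ENNReal.ofReal T +
          ENNReal.ofReal (D * conc G (c / 2) b n) * ENNReal.ofReal J)) := by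
          refine add_le_add hsm (mul_le_mul_right (hbg.trans ?_) _)
          gcongr
      _ = _ := by
          rw [← ENNReal.ofReal_natCast, ← ENNReal.ofReal_mul (by positivity),
            ← ENNReal.ofReal_add hT (by positivity), ← ENNReal.ofReal_mul (by positivity),
            ← ENNReal.ofReal_mul (by positivity), ← ENNReal.ofReal_add (by positivity) (by positivity)]
  have htr := ENNReal.toReal_le_of_le_ofReal (by positivity) htot
  refine htr.trans ?_
  have p1 : 0 ≤ (n * rtail G x) ^ N * conc G (c / 2) b n := by positivity
  have p2 : 0 ≤ n * (rtail G x / x) * T := by positivity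
  have p3 : 0 ≤ n * (rtail G x / x) * conc G (c / 2) b n * J := by positivity
  have q1 := mul_nonneg hC2.le p1
  have q2 := mul_nonneg (mul_nonneg hC2.le hD.le) p1
  have q3 := mul_nonneg hC1.le p2
  have q4 := mul_nonneg (mul_nonneg hC2.le hD.le) p2
  have q5 := mul_nonneg hC1.le p3
  have q6 := mul_nonneg hC2.le p3
  calc _ = C1 * ((n * rtail G x) ^ N * conc G (c / 2) b n) + C2 * (n * (rtail G x / x) * T)
        + C2 * D * (n * (rtail G x / x) * conc G (c / 2) b n * J) := by ring
    _ ≤ C1 * ((n * rtail G x) ^ N * conc G (c / 2) b n) + C2 * (n * (rtail G x / x) * T)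
        + C2 * D * (n * (rtail G x / x) * conc G (c / 2) b n * J)
        + (C2 * ((n * rtail G x) ^ N * conc G (c / 2) b n)
          + C2 * D * ((n * rtail G x) ^ N * conc G (c / 2) b n)
          + C1 * (n * (rtail G x / x) * T) + C2 * D * (n * (rtail G x / x) * T)
          + C1 * (n * (rtail G x / x) * conc G (c / 2) b n * J)
          + C2 * (n * (rtail G x / x) * conc G (c / 2) b n * J)) := by
        linarith
    _ = _ := by ring

lemma RegTail.sum_convPow_Ioc_le {G : Measure ℝ} [IsProbabilityMeasure G] {a : ℝ}
    (hG : RegTail G a) (ha : 0 < a) (ha1 : a < 1) (hG0 : G (Iio 0) = 0)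
    {h T : ℝ} (hh0 : 0 < h) (hT : 0 ≤ T) :
    ∃ c > 0, ∃ b > 0, ∃ κ > 0, ∃ C > 0, ∀ δ : ℝ, 0 < δ → δ ≤ 1 → ∀ᶠ x in atTop, ∀ J : ℝ, 0 ≤ J →
      jint G h T (κ * x) (2 * x) ≤ ENNReal.ofReal J → ∀ L : ℝ, 0 ≤ L → ∀ s : Finset ℕ,
      (∀ n ∈ s, 1 ≤ n ∧ L ≤ n) →
      x * rtail G x * ∑ n ∈ s, exp (-(n / (4 * δ / rtail G x))) * (convPow G n).real (Ioc x (x + h))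
        ≤ C * (δ + J * rtail G x ^ 2 * sigInt G c b 2 L (4 * δ / rtail G x)) := by
  obtain ⟨c, hc, b0, hb0, hφ0⟩ := hG.norm_charFun_le ha hG0
  set b := min b0 (1 / h)
  have hb : 0 < b := lt_min hb0 (by positivity)
  have hφ : ∀ t : ℝ, 0 < |t| → |t| ≤ b → ‖charFun G t‖ ≤ exp (-(c * rtail G (1 / |t|))) :=
    fun t h1 h2 => hφ0 t h1 (h2.trans (min_le_left _ _))
  have hhb : h ≤ 1 / b := by
    rw [le_div_iff₀ hb]
    calc h * b ≤ h * (1 / h) := by gcongr; exact min_le_right _ _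
      _ = 1 := by field_simp
  obtain ⟨a1, ha10, ha1a⟩ := exists_between ha
  obtain ⟨N, hN⟩ := exists_nat_gt (2 / a1)
  have hN0 : (0 : ℝ) < N := lt_trans (by positivity) hN
  have hN1 : 1 ≤ N := by exact_mod_cast hN0
  have hNa : 2 < a1 * N := by rwa [div_lt_iff₀ ha10, mul_comm] at hN
  have hNa' : 1 < a1 * (N + 1 : ℕ) := by push_cast; nlinarith
  have hc2 : 0 < c / 2 := by positivity
  obtain ⟨C1, hC1, hpt⟩ := hG.convPow_Ioc_le ha ha1 hG0 hb hc.le hh0 hhb hT hφ hN1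
  obtain ⟨C2, hC2, hsN⟩ := sum_conc_le_sigInt hG.pos hc2 N
  obtain ⟨C3, hC3, hs1⟩ := sum_conc_le_sigInt hG.pos hc2 1
  obtain ⟨C4, hC4, hz⟩ := hG.sigInt_zero_le ha1a ha10.le hNa' hb (c / 2 / 2)
  obtain ⟨C5, hC5, hpl⟩ := hG.potter_lower ha1a ha10.le (y1 := 1 / b) (by positivity)
  have hC50 : 0 < C5 := by linarith
  set K1 := C2 * (C4 * (C5 ^ (N + 1) + 4 ^ (N + 1)))
  have hK1 : 0 < K1 := by positivity
  refine ⟨c / 2 / 2, by positivity, b, hb, 1 / (2 * N) / 2, by positivity,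
    C1 * (K1 + 64 * T + C3), by positivity, fun δ hδ hδ1 => ?_⟩
  filter_upwards [hpt, eventually_gt_atTop 0, eventually_ge_atTop (1 / b / δ)]
    with x hptx hx hxδ J hJ0 hJ L hL s hs
  have hv := hG.pos x
  have hδx : 1 / b ≤ δ * x := by rw [div_le_iff₀ hδ] at hxδ; linarith
  have hvz := hG.pos (δ * x)
  set M := 4 * δ / rtail G x with hMdef
  have hM : 0 < M := by positivity
  have hterm : ∀ n ∈ s, exp (-(n / M)) * (convPow G n).real (Ioc x (x + h)) ≤
      C1 * (rtail G x ^ N * ((n : ℝ) ^ N * exp (-(n / M)) * conc G (c / 2) b n)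
        + rtail G x / x * T * ((n : ℝ) ^ 1 * exp (-(n * (1 / M))))
        + rtail G x / x * J * ((n : ℝ) ^ 1 * exp (-(n / M)) * conc G (c / 2) b n)) := by
    intro n hn
    calc _ ≤ exp (-(n / M)) * _ :=
          mul_le_mul_of_nonneg_left (hptx J hJ0 hJ n (hs n hn).1) (exp_pos _).le
      _ = _ := by rw [mul_pow, mul_one_div]; ring
  have hsum := Finset.sum_le_sum hterm
  rw [← Finset.mul_sum, Finset.sum_add_distrib, Finset.sum_add_distrib, ← Finset.mul_sum,
    ← Finset.mul_sum, ← Finset.mul_sum] at hsum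
  have b1 : ∑ n ∈ s, (n : ℝ) ^ N * exp (-(n / M)) * conc G (c / 2) b n
      ≤ K1 * (δ / (x * rtail G x ^ (N + 1))) := by
    refine (hsN b M 0 hM le_rfl s fun n hn => ⟨(hs n hn).1, n.cast_nonneg⟩).trans ?_
    rw [show K1 * (δ / (x * rtail G x ^ (N + 1)))
      = C2 * (C4 * (C5 ^ (N + 1) + 4 ^ (N + 1)) * (δ / (x * rtail G x ^ (N + 1)))) by
      simp only [K1]; ring]
    refine mul_le_mul_of_nonneg_left ((hz (δ * x) M hδx hM).trans ?_) hC2.le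
    have h1 : 1 / rtail G (δ * x) ≤ C5 * δ ^ a1 / rtail G x := by
      have := hpl (δ * x) x hδx (by nlinarith)
      rw [show x / (δ * x) = δ⁻¹ by field_simp, inv_rpow hδ.le] at this
      have hd : 0 < δ ^ a1 := by positivity
      rw [div_le_div_iff₀ hvz hv]
      rw [inv_mul_le_iff₀ hd] at this
      linarith
    have hδ2 : (δ ^ a1) ^ (N + 1) ≤ δ ^ 2 := by
      rw [← rpow_natCast, ← rpow_mul hδ.le, ← rpow_natCast]
      refine rpow_le_rpow_of_exponent_ge hδ hδ1 ?_
      push_cast; nlinarith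
    have hδ3 : δ ^ (N + 1) ≤ δ ^ 2 := pow_le_pow_of_le_one hδ.le hδ1 (by omega)
    calc C4 * ((1 / rtail G (δ * x)) ^ (N + 1) + M ^ (N + 1)) / (δ * x)
        ≤ C4 * ((C5 * δ ^ a1 / rtail G x) ^ (N + 1) + M ^ (N + 1)) / (δ * x) := by gcongr
      _ = C4 * (C5 ^ (N + 1) * (δ ^ a1) ^ (N + 1) + 4 ^ (N + 1) * δ ^ (N + 1))
          / rtail G x ^ (N + 1) / (δ * x) := by
          rw [hMdef, div_pow, div_pow, mul_pow, mul_pow]; ring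
      _ ≤ C4 * (C5 ^ (N + 1) * δ ^ 2 + 4 ^ (N + 1) * δ ^ 2)
          / rtail G x ^ (N + 1) / (δ * x) := by gcongr
      _ = _ := by field_simp
  have b2 : ∑ n ∈ s, (n : ℝ) ^ 1 * exp (-(n * (1 / M))) ≤ 64 * δ ^ 2 / rtail G x ^ 2 := by
    refine (sum_pow_mul_exp_le 1 (by positivity) s fun n hn => (hs n hn).1).trans (le_of_eq ?_)
    rw [hMdef]
    simp only [Nat.factorial_one, Nat.cast_one, one_mul]
    rw [show 2 / (1 / (4 * δ / rtail G x)) = 8 * δ / rtail G x by field_simp; norm_num, div_pow]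
    ring
  have b3 := hs1 b M L hM hL s hs
  have hsg := sigInt_nonneg G (c := c / 2 / 2) (b := b) (L := L) 2 hM.le
  have hδ2 : δ ^ 2 ≤ δ := by nlinarith
  calc _ ≤ x * rtail G x * (C1 * (rtail G x ^ N * (K1 * (δ / (x * rtail G x ^ (N + 1))))
        + rtail G x / x * T * (64 * δ ^ 2 / rtail G x ^ 2)
        + rtail G x / x * J * (C3 * sigInt G (c / 2 / 2) b 2 L M))) := by
        refine mul_le_mul_of_nonneg_left (hsum.trans (mul_le_mul_of_nonneg_left ?_ hC1.le))
          (by positivity)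
        gcongr
    _ = C1 * (K1 * δ + 64 * T * δ ^ 2 + C3 * (J * rtail G x ^ 2 * sigInt G (c / 2 / 2) b 2 L M)) := by
        field_simp
        ring
    _ ≤ C1 * (K1 * δ + 64 * T * δ + C3 * (J * rtail G x ^ 2 * sigInt G (c / 2 / 2) b 2 L M)) := by
        gcongr
    _ ≤ C1 * ((K1 + 64 * T + C3) * δ + (K1 + 64 * T + C3)
        * (J * rtail G x ^ 2 * sigInt G (c / 2 / 2) b 2 L M)) := by
        have q : 0 ≤ J * rtail G x ^ 2 * sigInt G (c / 2 / 2) b 2 L M := by positivity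
        have q1 := mul_nonneg hC3.le hδ.le
        have q2 := mul_nonneg (add_nonneg hK1.le (mul_nonneg (by norm_num : (0 : ℝ) ≤ 64) hT)) q
        refine mul_le_mul_of_nonneg_left ?_ hC1.le
        linarith
    _ = _ := by ring

/-- Iterated geometric averages of the constant sequence `1`; the generating function is
`((1 - s) / (1 - s z)) ^ k / (1 - z)`. -/
def wt (s : ℝ) : ℕ → ℕ → ℝ
  | 0, _ => 1
  | k + 1, n => ∑ i ∈ Finset.range (n + 1), (1 - s) * s ^ i * wt s k (n - i)

lemma wt_nonneg {s : ℝ} (h0 : 0 ≤ s) (h1 : s ≤ 1) (k n : ℕ) : 0 ≤ wt s k n := by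
  induction k generalizing n with
  | zero => exact zero_le_one
  | succ k ih =>
    refine Finset.sum_nonneg fun i _ => mul_nonneg (mul_nonneg (by linarith) (by positivity)) (ih _)

lemma geom_weight_sum (s : ℝ) (n : ℕ) :
    ∑ i ∈ Finset.range n, (1 - s) * s ^ i = 1 - s ^ n := by
  rw [← Finset.mul_sum, mul_neg_geom_sum]

lemma wt_le_one {s : ℝ} (h0 : 0 ≤ s) (h1 : s ≤ 1) (k n : ℕ) : wt s k n ≤ 1 := by
  induction k generalizing n with
  | zero => exact le_rfl
  | succ k ih =>
    calc wt s (k + 1) n ≤ ∑ i ∈ Finset.range (n + 1), (1 - s) * s ^ i := by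
          refine Finset.sum_le_sum fun i _ => mul_le_of_le_one_right ?_ (ih _)
          exact mul_nonneg (by linarith) (by positivity)
      _ = 1 - s ^ (n + 1) := geom_weight_sum s _
      _ ≤ 1 := by linarith [pow_nonneg h0 (n + 1)]

lemma one_sub_wt_le {q : ℝ} (h0 : 0 ≤ q) (h1 : q ≤ 1) (k n : ℕ) :
    1 - wt (q ^ 2) k n ≤ (2 ^ k - 1) * q ^ n := by
  induction k generalizing n with
  | zero => simp [wt]
  | succ k ih =>
    have hq2 : q ^ 2 ≤ 1 := pow_le_one₀ h0 h1
    have e : 1 - wt (q ^ 2) (k + 1) n = (q ^ 2) ^ (n + 1)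
        + ∑ i ∈ Finset.range (n + 1), (1 - q ^ 2) * (q ^ 2) ^ i * (1 - wt (q ^ 2) k (n - i)) := by
      simp only [mul_sub, mul_one, Finset.sum_sub_distrib, wt]
      have := geom_weight_sum (q ^ 2) (n + 1)
      simp only [sub_mul, one_mul, Finset.sum_sub_distrib] at this ⊢
      linarith
    have hk : (0 : ℝ) ≤ 2 ^ k - 1 := by linarith [one_le_pow₀ (M₀ := ℝ) (n := k) one_le_two]
    have h2 : ∑ i ∈ Finset.range (n + 1), (1 - q ^ 2) * (q ^ 2) ^ i * (1 - wt (q ^ 2) k (n - i))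
        ≤ (2 ^ k - 1) * q ^ n * 2 := by
      calc _ ≤ ∑ i ∈ Finset.range (n + 1), ((2 ^ k - 1) * q ^ n * (1 + q)) * ((1 - q) * q ^ i) := by
            refine Finset.sum_le_sum fun i hi => ?_
            have hi' : i ≤ n := by simpa [Nat.lt_succ_iff] using hi
            calc _ ≤ (1 - q ^ 2) * (q ^ 2) ^ i * ((2 ^ k - 1) * q ^ (n - i)) := by
                  refine mul_le_mul_of_nonneg_left (ih _) (mul_nonneg (by linarith) (by positivity))
              _ = _ := by
                  have : q ^ n = q ^ i * q ^ (n - i) := by rw [← pow_add]; congr 1; omega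
                  rw [this]; ring
        _ = (2 ^ k - 1) * q ^ n * (1 + q) * (1 - q ^ (n + 1)) := by
            rw [← Finset.mul_sum, geom_weight_sum]
        _ ≤ (2 ^ k - 1) * q ^ n * 2 * 1 := by
            have := pow_nonneg h0 (n + 1)
            gcongr
            · have : q ^ (n + 1) ≤ 1 := pow_le_one₀ h0 h1
              linarith
            · linarith
            · linarith
        _ = _ := by ring
    have h3 : (q ^ 2) ^ (n + 1) ≤ q ^ n := by
      rw [← pow_mul]; exact pow_le_pow_of_le_one h0 h1 (by omega)
    rw [e]
    calc _ ≤ q ^ n + (2 ^ k - 1) * q ^ n * 2 := add_le_add h3 h2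
      _ = _ := by ring

lemma one_sub_wt_le_exp {m : ℝ} (hm : 1 ≤ m) (k n : ℕ) :
    1 - wt (m / (1 + m)) k n ≤ 2 ^ k * exp (-(n / (4 * m))) := by
  have hm0 : 0 < m := by linarith
  set q := √(m / (1 + m)) with hq
  have hs0 : 0 ≤ m / (1 + m) := by positivity
  have hq2 : q ^ 2 = m / (1 + m) := sq_sqrt hs0
  have hq0 : 0 ≤ q := sqrt_nonneg _
  have hle : q ≤ exp (-(1 / (4 * m))) := by
    refine le_of_pow_le_pow_left₀ two_ne_zero (exp_pos _).le ?_
    rw [hq2, ← exp_nat_mul]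
    calc m / (1 + m) = -(1 / (1 + m)) + 1 := by field_simp; ring
      _ ≤ exp (-(1 / (1 + m))) := add_one_le_exp _
      _ ≤ _ := by
          rw [exp_le_exp]
          push_cast
          rw [mul_neg, neg_le_neg_iff, mul_one_div, div_le_div_iff₀ (by positivity) (by positivity)]
          linarith
  have hq1 : q ≤ 1 := hle.trans (exp_le_one_iff.2 (by rw [neg_nonpos]; positivity))
  rw [← hq2]
  refine (one_sub_wt_le hq0 hq1 k n).trans ?_
  have h2 : q ^ n ≤ exp (-(n / (4 * m))) := by
    calc q ^ n ≤ (exp (-(1 / (4 * m)))) ^ n := by gcongr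
      _ = _ := by rw [← exp_nat_mul]; congr 1; ring
  gcongr
  linarith

lemma hasSum_wt_mul_pow {s : ℝ} (h0 : 0 ≤ s) (h1 : s ≤ 1) (k : ℕ) {z : ℂ} (hz : ‖z‖ < 1) :
    HasSum (fun n => (wt s k n : ℂ) * z ^ n) (((1 - s) / (1 - s * z)) ^ k / (1 - z)) := by
  have hsum : ∀ k, Summable fun n => ‖(wt s k n : ℂ) * z ^ n‖ := by
    intro k
    refine Summable.of_nonneg_of_le (fun _ => norm_nonneg _) (fun n => ?_)
      (summable_geometric_of_lt_one (norm_nonneg z) hz)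
    rw [norm_mul, norm_pow, Complex.norm_real, Real.norm_of_nonneg (wt_nonneg h0 h1 k n)]
    exact mul_le_of_le_one_left (by positivity) (wt_le_one h0 h1 k n)
  induction k with
  | zero =>
    simpa [wt] using hasSum_geometric_of_norm_lt_one hz
  | succ k ih =>
    have hsz : ‖(s : ℂ) * z‖ < 1 := by
      rw [norm_mul, Complex.norm_real, Real.norm_of_nonneg h0]
      exact (mul_le_of_le_one_left (norm_nonneg z) h1).trans_lt hz
    have hg : HasSum (fun n => ((1 - s : ℝ) : ℂ) * (s * z) ^ n) ((1 - s) / (1 - s * z)) := by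
      have := (hasSum_geometric_of_norm_lt_one hsz).mul_left ((1 - s : ℝ) : ℂ)
      simpa [div_eq_mul_inv] using this
    have hgn : Summable fun n => ‖((1 - s : ℝ) : ℂ) * (s * z) ^ n‖ := by
      simp only [norm_mul, norm_pow]
      exact (summable_geometric_of_lt_one (by positivity) (by simpa using hsz)).mul_left _
    have hcp := tsum_mul_tsum_eq_tsum_sum_range_of_summable_norm hgn (hsum k)
    rw [hg.tsum_eq, ih.tsum_eq] at hcp
    have heq : ∀ n, ∑ i ∈ Finset.range (n + 1), ((1 - s : ℝ) : ℂ) * (s * z) ^ i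
        * ((wt s k (n - i) : ℂ) * z ^ (n - i)) = (wt s (k + 1) n : ℂ) * z ^ n := by
      intro n
      simp only [wt]
      push_cast
      rw [Finset.sum_mul]
      refine Finset.sum_congr rfl fun i hi => ?_
      have hi' : i ≤ n := by simpa [Nat.lt_succ_iff] using hi
      have : z ^ n = z ^ i * z ^ (n - i) := by rw [← pow_add]; congr 1; omega
      rw [this, mul_pow]; ring
    simp only [heq] at hcp
    have := (hsum (k + 1)).of_norm.hasSum
    rw [← hcp] at this
    rw [pow_succ, show ∀ p q r : ℂ, p * q / r = q * (p / r) from fun p q r => by ring]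
    exact this

lemma exists_tendsto_of_approx {β : Type*} {E : Type*} [NormedAddCommGroup E] [CompleteSpace E]
    {l : Filter β} [l.NeBot] {f : β → E}
    (H : ∀ ε > 0, ∃ g : β → E, ∃ y, Tendsto g l (𝓝 y) ∧ ∀ᶠ x in l, ‖f x - g x‖ ≤ ε) :
    ∃ y, Tendsto f l (𝓝 y) := by
  refine CompleteSpace.complete (f := map f l) (Metric.cauchy_iff.2 ⟨inferInstance, fun ε hε => ?_⟩)
  obtain ⟨g, y, hg, hfg⟩ := H (ε / 8) (by positivity)
  have hgy : ∀ᶠ x in l, dist (g x) y < ε / 8 := Metric.tendsto_nhds.1 hg _ (by positivity)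
  refine ⟨Metric.closedBall y (ε / 4), ?_, fun p hp q hq => ?_⟩
  · rw [mem_map]
    filter_upwards [hfg, hgy] with x h1 h2
    simp only [mem_preimage, Metric.mem_closedBall]
    rw [← dist_eq_norm] at h1
    linarith [dist_triangle (f x) (g x) y]
  · have := dist_triangle_right p q y
    simp only [Metric.mem_closedBall] at hp hq
    linarith

lemma integral_intervalIntegral_min_eq {G : Measure ℝ} [IsProbabilityMeasure G]
    (hG0 : G (Iio 0) = 0) {g : ℝ → ℂ} (hg : Continuous g) {M : ℝ} (hM : 0 ≤ M) :
    ∫ z, (∫ u in (0 : ℝ)..(min z M), g u) ∂G = ∫ u in Ioc 0 M, g u * rtail G u := by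
  have hae : ∀ᵐ z ∂G, 0 ≤ z := by
    rw [ae_iff]; convert hG0 using 2; ext; simp
  obtain ⟨K, hK⟩ := (isCompact_Icc (a := (0 : ℝ)) (b := M)).exists_bound_of_continuousOn
    hg.continuousOn
  have hSm : MeasurableSet {p : ℝ × ℝ | p.2 ≤ p.1} := measurableSet_le measurable_snd measurable_fst
  have hSm' : MeasurableSet {p : ℝ × ℝ | p.2 < p.1} := measurableSet_lt measurable_snd measurable_fst
  have hintg : Integrable (Function.uncurry fun z u => {p : ℝ × ℝ | p.2 < p.1}.indicator
      (fun p => g p.2) (z, u)) (G.prod (volume.restrict (Ioc 0 M))) := by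
    refine Integrable.of_bound (C := K) ?_ ?_
    · exact ((hg.comp continuous_snd).measurable.indicator hSm').aestronglyMeasurable
    · have h2 : ∀ᵐ p ∂(G.prod (volume.restrict (Ioc 0 M))), p.2 ∈ Ioc 0 M := by
        refine Measure.ae_prod_iff_ae_ae ?_ |>.2 (ae_of_all _ fun z => ae_restrict_mem measurableSet_Ioc)
        exact measurable_snd measurableSet_Ioc
      filter_upwards [h2] with p hp
      have hp' := hK p.2 ⟨hp.1.le, hp.2⟩
      simp only [Function.uncurry, Prod.mk.eta]
      exact (norm_indicator_le_norm_self (s := {p : ℝ × ℝ | p.2 < p.1}) (fun p : ℝ × ℝ => g p.2) p).trans hp'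
  calc _ = ∫ z, (∫ u in Ioc 0 M, {p : ℝ × ℝ | p.2 < p.1}.indicator (fun p => g p.2) (z, u)) ∂G := by
        refine integral_congr_ae ?_
        filter_upwards [hae] with z hz
        have e1 : (∫ u in (0 : ℝ)..(min z M), g u) = ∫ u in Ioc 0 (min z M), g u :=
          intervalIntegral.integral_of_le (le_min hz hM)
        have e2 : ∀ u, {p : ℝ × ℝ | p.2 < p.1}.indicator (fun p => g p.2) (z, u)
            = (Iio z).indicator g u := by
          intro u; simp only [indicator, mem_ofPred_eq, mem_Iio]
        simp only [e2]
        rw [e1, setIntegral_indicator measurableSet_Iio]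
        refine setIntegral_congr_set ?_
        have : Ioc 0 M ∩ Iic z = Ioc 0 (min z M) := by
          ext u; simp only [mem_inter_iff, mem_Ioc, mem_Iic, le_min_iff]; tauto
        rw [← this]
        exact (ae_eq_refl _).inter Iio_ae_eq_Iic.symm
    _ = ∫ u in Ioc 0 M, (∫ z, {p : ℝ × ℝ | p.2 < p.1}.indicator (fun p => g p.2) (z, u) ∂G) :=
        integral_integral_swap hintg
    _ = _ := by
        refine setIntegral_congr_fun measurableSet_Ioc fun u _ => ?_
        have e2 : ∀ z, {p : ℝ × ℝ | p.2 < p.1}.indicator (fun p => g p.2) (z, u)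
            = (Ioi u).indicator (fun _ => g u) z := by
          intro z; simp only [indicator, mem_ofPred_eq, mem_Ioi]
        simp only [e2]
        rw [integral_indicator measurableSet_Ioi, setIntegral_const]
        simp only [Measure.real, rtail, Complex.real_smul]
        ring

lemma RegTail.exists_tendsto_one_sub_charFun {G : Measure ℝ} [IsProbabilityMeasure G] {a : ℝ}
    (hG : RegTail G a) (ha : 0 < a) (ha1 : a < 1) (hG0 : G (Iio 0) = 0) (t : ℝ) :
    ∃ ψ : ℂ, Tendsto (fun x => (1 - charFun G (t / x)) / (rtail G x : ℂ)) atTop (𝓝 ψ) := by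
  obtain ⟨a2, h2, h21⟩ := exists_between ha1
  have h20 : 0 ≤ a2 := by linarith
  obtain ⟨C, hC1, hC⟩ := hG.potter_upper h2 h20
  have hC0 : 0 < C := by linarith
  refine exists_tendsto_of_approx fun ε hε => ?_
  obtain ⟨M, hM1, hM⟩ : ∃ M : ℝ, 1 ≤ M ∧ 2 * M ^ (-a) < ε := by
    have h := ((tendsto_rpow_neg_atTop ha).const_mul 2).eventually (gt_mem_nhds (show 2 * (0 : ℝ) < ε by simpa))
    obtain ⟨M, hM⟩ := (h.and (eventually_ge_atTop 1)).exists
    exact ⟨M, hM.2, hM.1⟩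
  have hM0 : 0 < M := by linarith
  set g : ℝ → ℝ → ℂ := fun x w => -(t * Complex.I) * Complex.exp (t * w * Complex.I)
    * ((rtail G (w * x) / rtail G x : ℝ) : ℂ)
  refine ⟨fun x => ∫ w in Ioc 0 M, g x w, ∫ w in Ioc 0 M, -(t * Complex.I)
    * Complex.exp (t * w * Complex.I) * ((w ^ (-a) : ℝ) : ℂ), ?_, ?_⟩
  · refine tendsto_integral_filter_of_dominated_convergence
      (fun w => |t| * (C * w ^ (-a2) + 1)) ?_ ?_ ?_ ?_
    · refine Eventually.of_forall fun x => Measurable.aestronglyMeasurable ?_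
      have hm := measurable_rtail G
      simp only [g]
      fun_prop
    · filter_upwards [eventually_gt_atTop 0] with x hx
      filter_upwards [ae_restrict_mem measurableSet_Ioc] with w hw
      have hw0 := hw.1
      have e : ‖Complex.exp (t * w * Complex.I)‖ = 1 := by
        rw [← Complex.ofReal_mul, Complex.norm_exp_ofReal_mul_I]
      simp only [g, norm_mul, norm_neg, Complex.norm_real, Complex.norm_I, mul_one, e,
        Real.norm_eq_abs]
      have hv := hG.pos x
      have hvw := hG.pos (w * x)
      rw [abs_of_pos (div_pos hvw hv)]
      gcongr
      rw [div_le_iff₀ hv]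
      have hp : 0 ≤ C * w ^ (-a2) := by positivity
      rcases le_or_gt w 1 with h1 | h1
      · have := hC (w * x) x (by positivity) (by nlinarith)
        rw [show x / (w * x) = w⁻¹ by field_simp, inv_rpow hw0.le, ← rpow_neg hw0.le] at this
        nlinarith
      · have := rtail_antitone G (show x ≤ w * x by nlinarith)
        nlinarith
    · refine Integrable.const_mul (Integrable.add (Integrable.const_mul ?_ _) ?_) _
      · rw [← IntegrableOn, ← intervalIntegrable_iff_integrableOn_Ioc_of_le hM0.le]
        exact intervalIntegral.intervalIntegrable_rpow' (by linarith)
      · simp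
    · filter_upwards [ae_restrict_mem measurableSet_Ioc] with w hw
      exact ((Complex.continuous_ofReal.tendsto _).comp (hG.lim w hw.1)).const_mul _
  · have hev := (hG.lim M hM0).const_mul 2
    filter_upwards [hev.eventually (gt_mem_nhds hM), eventually_gt_atTop 0] with x hxM hx
    have hv := hG.pos x
    have hxM0 : 0 < M * x := by positivity
    have hder : ∀ b : ℝ, ∫ u in (0 : ℝ)..b, -((t / x : ℝ) * Complex.I)
        * Complex.exp ((t / x : ℝ) * u * Complex.I) = 1 - Complex.exp ((t / x : ℝ) * b * Complex.I) := by
      intro b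
      have hd : ∀ u ∈ uIcc 0 b, HasDerivAt (fun u : ℝ => -Complex.exp ((t / x : ℝ) * u * Complex.I))
          (-((t / x : ℝ) * Complex.I) * Complex.exp ((t / x : ℝ) * u * Complex.I)) u := by
        intro u _
        have h1 : HasDerivAt (fun u : ℝ => ((t / x : ℝ) : ℂ) * u * Complex.I)
            ((t / x : ℝ) * Complex.I) u := by
          have := ((Complex.ofRealCLM.hasDerivAt (x := u)).const_mul (((t / x : ℝ) : ℂ))).mul_const Complex.I
          simpa using this
        have := h1.cexp.neg
        refine this.congr_deriv ?_
        ring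
      rw [intervalIntegral.integral_eq_sub_of_hasDerivAt hd
        (Continuous.intervalIntegrable (by fun_prop) _ _)]
      simp only [Complex.ofReal_zero, mul_zero, zero_mul, Complex.exp_zero]
      ring
    have hgx : (∫ w in Ioc 0 M, g x w) = (∫ z, (1 - Complex.exp ((t / x : ℝ) * (min z (M * x) : ℝ)
        * Complex.I)) ∂G) / rtail G x := by
      have := integral_intervalIntegral_min_eq hG0 (g := fun u => -((t / x : ℝ) * Complex.I)
        * Complex.exp ((t / x : ℝ) * u * Complex.I)) (by fun_prop) hxM0.le
      simp only [hder] at this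
      rw [this, ← intervalIntegral.integral_of_le hM0.le, ← intervalIntegral.integral_of_le hxM0.le]
      have hsub := intervalIntegral.integral_comp_mul_right (a := 0) (b := M)
        (fun u : ℝ => -((t / x : ℝ) * Complex.I) * Complex.exp ((t / x : ℝ) * u * Complex.I)
          * (rtail G u : ℂ)) hx.ne'
      rw [zero_mul] at hsub
      have hI : (∫ u in (0 : ℝ)..(M * x), -((t / x : ℝ) * Complex.I)
          * Complex.exp ((t / x : ℝ) * u * Complex.I) * (rtail G u : ℂ)) = x • ∫ w in (0 : ℝ)..M,
          (-((t / x : ℝ) * Complex.I) * Complex.exp ((t / x : ℝ) * (w * x : ℝ) * Complex.I)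
          * (rtail G (w * x) : ℂ)) := by
        rw [hsub, smul_smul, mul_inv_cancel₀ hx.ne', one_smul]
      rw [hI, Complex.real_smul, ← intervalIntegral.integral_const_mul, ← intervalIntegral.integral_div]
      refine intervalIntegral.integral_congr fun w _ => ?_
      have hxc : (x : ℂ) ≠ 0 := by exact_mod_cast hx.ne'
      have hvc : (rtail G x : ℂ) ≠ 0 := by exact_mod_cast hv.ne'
      simp only [g]
      push_cast
      rw [show (t : ℂ) / x * (w * x) = t * w by field_simp]
      field_simp
    have hnorm : ∀ r : ℝ, ‖Complex.exp ((t / x : ℝ) * (r : ℝ) * Complex.I)‖ = 1 := by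
      intro r
      rw [← Complex.ofReal_mul, Complex.norm_exp_ofReal_mul_I]
    have hi1 : Integrable (fun z : ℝ => Complex.exp ((t / x : ℝ) * (min z (M * x) : ℝ)
        * Complex.I)) G :=
      Integrable.of_bound (C := 1) (Measurable.aestronglyMeasurable (by fun_prop))
        (ae_of_all _ fun z => (hnorm _).le)
    have hi2 : Integrable (fun z : ℝ => Complex.exp ((t / x : ℝ) * z * Complex.I)) G :=
      Integrable.of_bound (C := 1) (Measurable.aestronglyMeasurable (by fun_prop))
        (ae_of_all _ fun z => (hnorm _).le)
    rw [hgx, ← sub_div, norm_div, Complex.norm_real, Real.norm_of_nonneg hv.le, div_le_iff₀ hv]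
    have e3 : (1 - charFun G (t / x)) - (∫ z, (1 - Complex.exp ((t / x : ℝ) * (min z (M * x) : ℝ)
        * Complex.I)) ∂G) = ∫ z, (Complex.exp ((t / x : ℝ) * (min z (M * x) : ℝ) * Complex.I)
          - Complex.exp ((t / x : ℝ) * z * Complex.I)) ∂G := by
      rw [integral_sub (integrable_const _) hi1, integral_sub hi1 hi2, charFun_apply_real]
      simp
    rw [e3]
    calc _ ≤ ∫ z, (Ioi (M * x)).indicator (fun _ => (2 : ℝ)) z ∂G := by
          refine norm_integral_le_of_norm_le ((integrable_const 2).indicator measurableSet_Ioi)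
            (ae_of_all _ fun z => ?_)
          by_cases hz : z ∈ Ioi (M * x)
          · rw [indicator_of_mem hz]
            refine (norm_sub_le _ _).trans ?_
            rw [hnorm, hnorm]; norm_num
          · rw [indicator_of_notMem hz, min_eq_left (not_lt.1 hz), sub_self, norm_zero]
      _ = 2 * rtail G (M * x) := by
          rw [integral_indicator measurableSet_Ioi, setIntegral_const]
          simp only [Measure.real, rtail, smul_eq_mul]
          ring
      _ ≤ ε * rtail G x := by
          have h5 : 2 * (rtail G (M * x) / rtail G x) < ε := hxM
          rw [← mul_div_assoc, div_lt_iff₀ hv] at h5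
          exact h5.le

lemma integrable_comp_abs {f : ℝ → ℝ} (hf : IntegrableOn f (Ioi 0)) :
    Integrable fun x : ℝ => f |x| := by
  have := (integrable_fun_norm_addHaar (E := ℝ) (F := ℝ) volume (f := f)).2 (by simpa using hf)
  simpa using this

lemma integrable_abs_rpow_piecewise {p q : ℝ} (hp : -1 < p) (hq : q < -1) :
    Integrable fun t : ℝ => if |t| ≤ 1 then |t| ^ p else |t| ^ q := by
  refine integrable_comp_abs (f := fun t => if t ≤ 1 then t ^ p else t ^ q) ?_
  rw [← Ioc_union_Ioi_eq_Ioi (zero_le_one (α := ℝ)), integrableOn_union]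
  constructor
  · refine IntegrableOn.congr_fun (f := fun t : ℝ => t ^ p) ?_ (fun t ht => ?_) measurableSet_Ioc
    · rw [← intervalIntegrable_iff_integrableOn_Ioc_of_le zero_le_one]
      exact intervalIntegral.intervalIntegrable_rpow' hp
    · simp [ht.2]
  · refine IntegrableOn.congr_fun (f := fun t : ℝ => t ^ q) ?_ (fun t ht => ?_) measurableSet_Ioi
    · exact integrableOn_Ioi_rpow_of_lt hq one_pos
    · simp [not_le.2 (mem_Ioi.1 ht)]

lemma integrableOn_abs_rpow {p B : ℝ} (hp : -1 < p) :
    IntegrableOn (fun t : ℝ => |t| ^ p) (Icc (-B) B) := by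
  have h := integrable_comp_abs (f := fun t => if t ≤ B then t ^ p else 0) ?_
  · refine (h.integrableOn (s := Icc (-B) B)).congr_fun (fun t ht => ?_) measurableSet_Icc
    simp [abs_le.2 ht]
  · rcases le_or_gt B 0 with hB | hB
    · refine IntegrableOn.congr_fun (f := fun t : ℝ => 0) integrableOn_zero (fun t ht => ?_)
        measurableSet_Ioi
      have : (0 : ℝ) < t := ht
      simp [not_le.2 (lt_of_le_of_lt hB this)]
    rw [← Ioc_union_Ioi_eq_Ioi hB.le, integrableOn_union]
    constructor
    · refine IntegrableOn.congr_fun (f := fun t : ℝ => t ^ p) ?_ (fun t ht => ?_) measurableSet_Ioc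
      · rw [← intervalIntegrable_iff_integrableOn_Ioc_of_le hB.le]
        exact intervalIntegral.intervalIntegrable_rpow' hp
      · simp [ht.2]
    · refine IntegrableOn.congr_fun (f := fun t : ℝ => 0) integrableOn_zero (fun t ht => ?_)
        measurableSet_Ioi
      have : B < t := ht
      simp [not_le.2 this]

/-- Lower bound for the real part of `1 - φ`. -/
lemma RegTail.exists_le_re_one_sub_charFun {G : Measure ℝ} [IsProbabilityMeasure G] {a : ℝ}
    (hG : RegTail G a) (ha : 0 < a) (hG0 : G (Iio 0) = 0) {B : ℝ}
    (hB : ∀ t : ℝ, t ≠ 0 → |t| ≤ B → charFun G t ≠ 1) :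
    ∃ c > 0, ∀ t : ℝ, t ≠ 0 → |t| ≤ B → c * rtail G (1 / |t|) ≤ 1 - (charFun G t).re := by
  obtain ⟨c, hc, b, hb, H⟩ := hG.norm_charFun_le ha hG0
  have hK : IsCompact {t : ℝ | b ≤ |t| ∧ |t| ≤ B} := by
    refine Metric.isCompact_of_isClosed_isBounded ?_ ?_
    · exact (isClosed_le continuous_const continuous_abs).inter
        (isClosed_le continuous_abs continuous_const)
    · refine (Metric.isBounded_closedBall (x := (0 : ℝ)) (r := B)).subset fun t ht => ?_
      simpa using ht.2
  have hcont : Continuous fun t => 1 - (charFun G t).re :=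
    continuous_const.sub (Complex.continuous_re.comp (continuous_charFun))
  have hpos : ∀ t ∈ {t : ℝ | b ≤ |t| ∧ |t| ≤ B}, 0 < 1 - (charFun G t).re := by
    intro t ht
    have ht0 : t ≠ 0 := by
      rintro rfl
      have := ht.1
      simp at this
      linarith
    have h1 := hB t ht0 ht.2
    have h2 : ‖charFun G t‖ ≤ 1 := by simpa using MeasureTheory.norm_charFun_le_one (μ := G) t
    have h3 : (charFun G t).re ≤ 1 := (Complex.re_le_norm _).trans h2
    refine sub_pos.2 (lt_of_le_of_ne h3 fun h4 => h1 ?_)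
    have h5 := Complex.sq_norm (charFun G t)
    rw [Complex.normSq_apply, h4] at h5
    have h6 : (charFun G t).im = 0 := by
      have : ‖charFun G t‖ ^ 2 ≤ 1 := pow_le_one₀ (norm_nonneg _) h2
      nlinarith
    exact Complex.ext (by simpa using h4) (by simpa using h6)
  obtain ⟨d, hd, hd'⟩ : ∃ d > 0, ∀ t ∈ {t : ℝ | b ≤ |t| ∧ |t| ≤ B}, d ≤ 1 - (charFun G t).re := by
    rcases eq_empty_or_nonempty {t : ℝ | b ≤ |t| ∧ |t| ≤ B} with he | hne
    · exact ⟨1, one_pos, by simp [he]⟩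
    · obtain ⟨t0, ht0, hmin⟩ := hK.exists_isMinOn hne hcont.continuousOn
      exact ⟨_, hpos t0 ht0, fun t ht => hmin ht⟩
  refine ⟨min (c / (1 + c)) d, by positivity, fun t ht htB => ?_⟩
  have hv0 := rtail_nonneg G (1 / |t|)
  have hv1 := rtail_le_one G (1 / |t|)
  rcases le_total |t| b with h | h
  · have h1 := H t (abs_pos.2 ht) h
    have h2 : (charFun G t).re ≤ exp (-(c * rtail G (1 / |t|))) := (Complex.re_le_norm _).trans h1
    set u := c * rtail G (1 / |t|) with hu
    have hu0 : 0 ≤ u := by positivity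
    have h3 : exp (-u) ≤ 1 / (1 + u) := by
      rw [exp_neg, ← one_div]
      gcongr
      linarith [add_one_le_exp u]
    have h4 : 1 - 1 / (1 + u) = u / (1 + u) := by field_simp; ring
    have h5 : u / (1 + c) ≤ u / (1 + u) := by
      gcongr
      nlinarith
    calc min (c / (1 + c)) d * rtail G (1 / |t|) ≤ c / (1 + c) * rtail G (1 / |t|) := by
          gcongr; exact min_le_left _ _
      _ = u / (1 + c) := by rw [hu]; ring
      _ ≤ _ := by linarith
  · have h1 := hd' t ⟨h, htB⟩
    calc min (c / (1 + c)) d * rtail G (1 / |t|) ≤ d * rtail G (1 / |t|) := by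
          gcongr; exact min_le_right _ _
      _ ≤ d := by nlinarith
      _ ≤ _ := h1

/-- The generating function of the weights, at `z`. -/
def resol (m : ℝ) (k : ℕ) (z : ℂ) : ℂ := 1 / ((1 - z) * (1 + m * (1 - z)) ^ k)

lemma resol_eq {m : ℝ} (hm : 0 ≤ m) (k : ℕ) (z : ℂ) :
    ((1 - (m / (1 + m) : ℝ)) / (1 - (m / (1 + m) : ℝ) * z)) ^ k / (1 - z) = resol m k z := by
  have h : (1 + m : ℂ) ≠ 0 := by
    have : (1 + m : ℝ) ≠ 0 := by positivity
    exact_mod_cast this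
  have h1 : (1 - (m / (1 + m) : ℝ) : ℂ) / (1 - (m / (1 + m) : ℝ) * z) = 1 / (1 + m * (1 - z)) := by
    push_cast
    have e1 : (1 - m / (1 + m) : ℂ) = 1 / (1 + m) := by field_simp; ring
    have e2 : (1 - m / (1 + m) * z : ℂ) = (1 + m * (1 - z)) / (1 + m) := by field_simp; ring
    rw [e1, e2]
    field_simp
  rw [h1, resol, div_pow, one_pow, div_div, mul_comm]

lemma re_le_norm_one_add {m : ℝ} (hm : 0 ≤ m) {z : ℂ} (hz : ‖z‖ ≤ 1) :
    1 ≤ ‖1 + m * (1 - z)‖ ∧ m * (1 - z.re) ≤ ‖1 + m * (1 - z)‖ := by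
  have h1 : z.re ≤ 1 := (Complex.re_le_norm z).trans hz
  have h2 := Complex.re_le_norm (1 + m * (1 - z))
  simp at h2
  constructor <;> nlinarith

lemma norm_resol_le {m : ℝ} (hm : 0 ≤ m) (k : ℕ) {z : ℂ} (hz : ‖z‖ ≤ 1) :
    ‖resol m k z‖ ≤ 1 / (1 - z.re) := by
  have h1 : z.re ≤ 1 := (Complex.re_le_norm z).trans hz
  have h3 : 1 - z.re ≤ ‖1 - z‖ := by simpa using Complex.re_le_norm (1 - z)
  have h4 : 1 ≤ ‖1 + m * (1 - z)‖ ^ k := one_le_pow₀ (re_le_norm_one_add hm hz).1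
  rw [resol, norm_div, norm_one, norm_mul, norm_pow]
  rcases h1.eq_or_lt with h | h
  · have hz1 : z = 1 := by
      have h5 := Complex.sq_norm z
      rw [Complex.normSq_apply, h] at h5
      have h6 : z.im = 0 := by
        have : ‖z‖ ^ 2 ≤ 1 := pow_le_one₀ (norm_nonneg _) hz
        nlinarith
      exact Complex.ext (by simpa using h) (by simpa using h6)
    simp [hz1]
  · have h0 : 0 < 1 - z.re := by linarith
    refine one_div_le_one_div_of_le h0 ?_
    nlinarith

lemma continuousAt_resol {m : ℝ} (hm : 0 ≤ m) (k : ℕ) {z : ℂ} (hz : ‖z‖ ≤ 1) (hz1 : z ≠ 1) :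
    ContinuousAt (resol m k) z := by
  unfold resol
  refine continuousAt_const.div (by fun_prop) (mul_ne_zero (sub_ne_zero.2 (Ne.symm hz1)) ?_)
  refine pow_ne_zero _ fun h => ?_
  have := (re_le_norm_one_add hm hz).1
  rw [h, norm_zero] at this
  linarith

/-- Abel summation for nonnegative terms. -/
lemma hasSum_of_abel {t : ℕ → ℝ} (ht : ∀ n, 0 ≤ t n) {S : ℝ → ℝ} {l : ℝ}
    (hS : ∀ r, 0 < r → r < 1 → HasSum (fun n => t n * r ^ n) (S r))
    (hl : Tendsto S (𝓝[<] 1) (𝓝 l)) : HasSum t l := by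
  have hev : ∀ᶠ r : ℝ in 𝓝[<] 1, 0 < r ∧ r < 1 :=
    Ioo_mem_nhdsLT (show (0 : ℝ) < 1 by norm_num)
  have hbd : ∀ s : Finset ℕ, ∑ n ∈ s, t n ≤ l := by
    intro s
    have h1 : Tendsto (fun r : ℝ => ∑ n ∈ s, t n * r ^ n) (𝓝[<] 1) (𝓝 (∑ n ∈ s, t n * 1 ^ n)) :=
      (Continuous.tendsto (f := fun r : ℝ => ∑ n ∈ s, t n * r ^ n) (by fun_prop) 1).mono_left
        nhdsWithin_le_nhds
    simp only [one_pow, mul_one] at h1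
    refine le_of_tendsto_of_tendsto h1 hl ?_
    filter_upwards [hev] with r hr
    exact sum_le_hasSum s (fun n _ => mul_nonneg (ht n) (pow_nonneg hr.1.le n)) (hS r hr.1 hr.2)
  have hsum : Summable t := summable_of_sum_le ht hbd
  have h2 : l ≤ ∑' n, t n := by
    refine le_of_tendsto hl ?_
    filter_upwards [hev] with r hr
    exact hasSum_le (fun n => mul_le_of_le_one_right (ht n) (pow_le_one₀ hr.1.le hr.2.le))
      (hS r hr.1 hr.2) hsum.hasSum
  have h3 : ∑' n, t n ≤ l := hsum.tsum_le_of_sum_le hbd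
  rw [← le_antisymm h3 h2]
  exact hsum.hasSum

/-- Abel summation for absolutely summable terms. -/
lemma hasSum_of_abel_of_summable {t : ℕ → ℂ} (ht : Summable fun n => ‖t n‖) {S : ℝ → ℂ} {l : ℂ}
    (hS : ∀ r : ℝ, 0 < r → r < 1 → HasSum (fun n => t n * (r : ℂ) ^ n) (S r))
    (hl : Tendsto S (𝓝[<] 1) (𝓝 l)) : HasSum t l := by
  have hev : ∀ᶠ r : ℝ in 𝓝[<] 1, 0 < r ∧ r < 1 :=
    Ioo_mem_nhdsLT (show (0 : ℝ) < 1 by norm_num)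
  have h1 : Tendsto (fun r : ℝ => ∑' n, t n * (r : ℂ) ^ n) (𝓝[<] 1) (𝓝 (∑' n, t n)) := by
    refine tendsto_tsum_of_dominated_convergence ht (fun n => ?_) ?_
    · have : Tendsto (fun r : ℝ => t n * (r : ℂ) ^ n) (𝓝 1) (𝓝 (t n * ((1 : ℝ) : ℂ) ^ n)) :=
        Continuous.tendsto (f := fun r : ℝ => t n * (r : ℂ) ^ n) (by fun_prop) 1
      simpa using this.mono_left nhdsWithin_le_nhds
    · filter_upwards [hev] with r hr n
      rw [norm_mul, norm_pow, Complex.norm_real, Real.norm_eq_abs, abs_of_pos hr.1]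
      exact mul_le_of_le_one_right (norm_nonneg _) (pow_le_one₀ hr.1.le hr.2.le)
  have h2 : S =ᶠ[𝓝[<] 1] fun r : ℝ => ∑' n, t n * (r : ℂ) ^ n := by
    filter_upwards [hev] with r hr
    exact (hS r hr.1 hr.2).tsum_eq.symm
  rw [tendsto_nhds_unique hl (h1.congr' h2.symm)]
  exact ht.of_norm.hasSum

lemma norm_exp_neg_mul_I (θ p : ℝ) : ‖Complex.exp (-(θ * p * Complex.I))‖ = 1 := by
  rw [← Complex.ofReal_mul, ← neg_mul, ← Complex.ofReal_neg, Complex.norm_exp_ofReal_mul_I]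

lemma integrableOn_of_bound_Icc {g : ℝ → ℂ} (hg : Measurable g) {K : ℝ} (hK : ∀ t, ‖g t‖ ≤ K)
    (B : ℝ) : IntegrableOn g (Icc (-B) B) :=
  Integrable.of_bound hg.aestronglyMeasurable K (ae_of_all _ hK)

/-- The weighted sum of the convolution powers, regularized by `rⁿ`. -/
lemma hasSum_wt_integral_mul_pow (G : Measure ℝ) [IsProbabilityMeasure G] {B : ℝ} {g : ℝ → ℂ}
    (hg : Measurable g) {K : ℝ} (hK : ∀ t, ‖g t‖ ≤ K) {m : ℝ} (hm : 0 ≤ m) (k : ℕ) (p : ℝ) {r : ℝ}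
    (hr0 : 0 < r) (hr1 : r < 1) :
    HasSum (fun n => (wt (m / (1 + m)) k n * ∫ y, trigInt B g (y - p) ∂(convPow G n)) * (r : ℂ) ^ n)
      (∫ θ in Icc (-B) B, g θ * Complex.exp (-(θ * p * Complex.I)) *
        resol m k (r * charFun G θ)) := by
  have hs0 : 0 ≤ m / (1 + m) := by positivity
  have hs1 : m / (1 + m) ≤ 1 := (div_le_one (by positivity)).2 (by linarith)
  have hφ : ∀ θ, ‖charFun G θ‖ ≤ 1 := fun θ => MeasureTheory.norm_charFun_le_one (μ := G) θ
  have hrn : ‖(r : ℂ)‖ = r := by rw [Complex.norm_real, Real.norm_eq_abs, abs_of_pos hr0]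
  have hz : ∀ θ, ‖(r : ℂ) * charFun G θ‖ < 1 := fun θ => by
    rw [norm_mul, hrn]
    exact lt_of_le_of_lt (mul_le_of_le_one_right hr0.le (hφ θ)) hr1
  have hK0 : 0 ≤ K := (norm_nonneg _).trans (hK 0)
  have key := hasSum_integral_of_dominated_convergence (μ := volume.restrict (Icc (-B) B))
    (F := fun n θ => g θ * Complex.exp (-(θ * p * Complex.I)) *
      ((wt (m / (1 + m)) k n : ℂ) * (r * charFun G θ) ^ n))
    (f := fun θ => g θ * Complex.exp (-(θ * p * Complex.I)) * resol m k (r * charFun G θ))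
    (fun n _ => K * r ^ n) ?_ ?_ ?_ ?_ ?_
  · refine key.congr_fun fun n => ?_
    rw [integral_trigInt _ (integrableOn_of_bound_Icc hg hK B), ← integral_const_mul,
      ← integral_mul_const]
    refine integral_congr_ae (ae_of_all _ fun θ => ?_)
    simp only [charFun_convPow]
    ring
  · intro n
    refine Measurable.aestronglyMeasurable ?_
    have := (measurable_charFun (μ := G))
    fun_prop
  · intro n
    refine ae_of_all _ fun θ => ?_
    rw [norm_mul, norm_mul, norm_exp_neg_mul_I, mul_one, norm_mul, norm_pow, Complex.norm_real,
      Real.norm_eq_abs, abs_of_nonneg (wt_nonneg hs0 hs1 k n), norm_mul, hrn]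
    refine mul_le_mul (hK θ) ?_ (by have := wt_nonneg hs0 hs1 k n; positivity) hK0
    calc wt (m / (1 + m)) k n * (r * ‖charFun G θ‖) ^ n ≤ 1 * (r * 1) ^ n := by
          gcongr
          · exact wt_le_one hs0 hs1 k n
          · exact hφ θ
      _ = r ^ n := by simp
  · exact ae_of_all _ fun θ => (summable_geometric_of_lt_one hr0.le hr1).mul_left K
  · exact integrable_const _
  · refine ae_of_all _ fun θ => ?_
    have := (hasSum_wt_mul_pow hs0 hs1 k (hz θ)).mul_left
      (g θ * Complex.exp (-(θ * p * Complex.I)))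
    rwa [resol_eq hm] at this

lemma RegTail.inv_rtail_inv_le {G : Measure ℝ} [IsProbabilityMeasure G] {a : ℝ}
    (hG : RegTail G a) {a2 : ℝ} (h2 : a < a2) (h0 : 0 ≤ a2) {B : ℝ} (hB : 0 < B) :
    ∃ C > 0, ∀ t : ℝ, t ≠ 0 → |t| ≤ B → 1 / rtail G (1 / |t|) ≤ C * |t| ^ (-a2) := by
  obtain ⟨C, hC1, hC⟩ := hG.potter_upper h2 h0
  have hvB := hG.pos (1 / B)
  refine ⟨C * B ^ a2 / rtail G (1 / B), by positivity, fun t ht htB => ?_⟩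
  have ht0 : 0 < |t| := abs_pos.2 ht
  have h1 := hC (1 / B) (1 / |t|) (by positivity) (by gcongr)
  have e : 1 / |t| / (1 / B) = B / |t| := by field_simp
  rw [e, div_rpow hB.le ht0.le] at h1
  have hv := hG.pos (1 / |t|)
  rw [rpow_neg ht0.le, div_le_iff₀ hv]
  have hp : 0 < |t| ^ a2 := rpow_pos_of_pos ht0 _
  calc (1 : ℝ) = rtail G (1 / B) / rtail G (1 / B) := (div_self hvB.ne').symm
    _ ≤ (C * (B ^ a2 / |t| ^ a2) * rtail G (1 / |t|)) / rtail G (1 / B) := by gcongr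
    _ = _ := by field_simp

/-- The regularization can be removed on the Fourier side. -/
lemma RegTail.tendsto_integral_resol {G : Measure ℝ} [IsProbabilityMeasure G] {a : ℝ}
    (hG : RegTail G a) (ha : 0 < a) (ha1 : a < 1) (hG0 : G (Iio 0) = 0) {B : ℝ} (hB0 : 0 < B)
    (hB : ∀ t : ℝ, t ≠ 0 → |t| ≤ B → charFun G t ≠ 1) {g : ℝ → ℂ}
    (hg : Measurable g) {K : ℝ} (hK : ∀ t, ‖g t‖ ≤ K) {m : ℝ} (hm : 0 ≤ m) (k : ℕ) (p : ℝ) :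
    Tendsto (fun r : ℝ => ∫ θ in Icc (-B) B, g θ * Complex.exp (-(θ * p * Complex.I)) *
        resol m k (r * charFun G θ)) (𝓝[<] 1)
      (𝓝 (∫ θ in Icc (-B) B, g θ * Complex.exp (-(θ * p * Complex.I)) *
        resol m k (charFun G θ))) := by
  obtain ⟨c, hc, hre⟩ := hG.exists_le_re_one_sub_charFun ha hG0 hB
  obtain ⟨a2, h2, h21⟩ := exists_between ha1
  obtain ⟨C, hC0, hC⟩ := hG.inv_rtail_inv_le h2 (by linarith) hB0
  have hK0 : 0 ≤ K := (norm_nonneg _).trans (hK 0)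
  have hφ : ∀ θ, ‖charFun G θ‖ ≤ 1 := fun θ => MeasureTheory.norm_charFun_le_one (μ := G) θ
  have hev : ∀ᶠ r : ℝ in 𝓝[<] 1, 0 < r ∧ r < 1 :=
    Ioo_mem_nhdsLT (show (0 : ℝ) < 1 by norm_num)
  have hne : ∀ᵐ θ : ℝ ∂(volume.restrict (Icc (-B) B)), θ ≠ 0 := by
    refine ae_restrict_of_ae ?_
    simp [ae_iff]
  refine tendsto_integral_filter_of_dominated_convergence
    (fun θ => K * (2 / c * (C * |θ| ^ (-a2)))) ?_ ?_ ?_ ?_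
  · refine Eventually.of_forall fun r => Measurable.aestronglyMeasurable ?_
    have := (measurable_charFun (μ := G))
    unfold resol
    fun_prop
  · filter_upwards [hev] with r hr
    filter_upwards [ae_restrict_mem measurableSet_Icc, hne] with θ hθ hθ0
    have hθB : |θ| ≤ B := abs_le.2 hθ
    rw [norm_mul, norm_mul, norm_exp_neg_mul_I, mul_one]
    refine mul_le_mul (hK θ) ?_ (norm_nonneg _) hK0
    have hrn : ‖(r : ℂ)‖ = r := by rw [Complex.norm_real, Real.norm_eq_abs, abs_of_pos hr.1]
    have hz : ‖(r : ℂ) * charFun G θ‖ ≤ 1 := by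
      rw [norm_mul, hrn]
      exact mul_le_one₀ hr.2.le (norm_nonneg _) (hφ θ)
    refine (norm_resol_le hm k hz).trans ?_
    have hv := hG.pos (1 / |θ|)
    have h1 := hre θ hθ0 hθB
    have hre1 : (charFun G θ).re ≤ 1 := (Complex.re_le_norm _).trans (hφ θ)
    have e1 : ((r : ℂ) * charFun G θ).re = r * (charFun G θ).re := by simp
    have h3 : (1 - (charFun G θ).re) / 2 ≤ 1 - ((r : ℂ) * charFun G θ).re := by
      rw [e1]
      rcases le_total 0 (charFun G θ).re with h | h
      · nlinarith [hr.1, hr.2]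
      · have : -1 ≤ (charFun G θ).re := by
          have := Complex.abs_re_le_norm (charFun G θ)
          linarith [abs_le.1 (this.trans (hφ θ))]
        nlinarith [hr.1, hr.2]
    have h4 : c * rtail G (1 / |θ|) / 2 ≤ 1 - ((r : ℂ) * charFun G θ).re := by linarith
    calc 1 / (1 - ((r : ℂ) * charFun G θ).re) ≤ 1 / (c * rtail G (1 / |θ|) / 2) :=
          one_div_le_one_div_of_le (by positivity) h4
      _ = 2 / c * (1 / rtail G (1 / |θ|)) := by field_simp
      _ ≤ _ := by gcongr; exact hC θ hθ0 hθB
  · exact (((integrableOn_abs_rpow (by linarith)).integrable.const_mul C).const_mul (2 / c)).const_mul K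
  · filter_upwards [ae_restrict_mem measurableSet_Icc, hne] with θ hθ hθ0
    refine Tendsto.const_mul _ ?_
    refine (continuousAt_resol hm k (hφ θ) (hB θ hθ0 (abs_le.2 hθ))).tendsto.comp ?_
    have : Tendsto (fun r : ℝ => (r : ℂ) * charFun G θ) (𝓝 1) (𝓝 (((1 : ℝ) : ℂ) * charFun G θ)) :=
      Continuous.tendsto (f := fun r : ℝ => (r : ℂ) * charFun G θ) (by fun_prop) 1
    simp only [Complex.ofReal_one, one_mul] at this
    exact this.mono_left nhdsWithin_le_nhds

/-- The weighted renewal measure. -/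
def wmeas (G : Measure ℝ) (s : ℝ) (k : ℕ) : Measure ℝ :=
  Measure.sum fun n => ENNReal.ofReal (wt s k n) • convPow G n

lemma continuous_trigInt {B : ℝ} {g : ℝ → ℂ} (hg : Measurable g) {K : ℝ} (hK : ∀ t, ‖g t‖ ≤ K) :
    Continuous (trigInt B g) := by
  unfold trigInt
  refine continuous_of_dominated (bound := fun _ => K) (fun y => ?_) (fun y => ?_) ?_ ?_
  · exact Measurable.aestronglyMeasurable (by fun_prop)
  · refine ae_of_all _ fun θ => ?_
    rw [norm_mul, ← Complex.ofReal_mul, Complex.norm_exp_ofReal_mul_I, mul_one]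
    exact hK θ
  · exact integrable_const _
  · exact ae_of_all _ fun θ => by fun_prop

lemma norm_trigInt_le {B : ℝ} {g : ℝ → ℂ} {K : ℝ} (hK : ∀ t, ‖g t‖ ≤ K)
    (y : ℝ) : ‖trigInt B g y‖ ≤ ∫ _ in Icc (-B) B, K := by
  unfold trigInt
  refine norm_integral_le_of_norm_le (integrable_const _) (ae_of_all _ fun θ => ?_)
  rw [norm_mul, ← Complex.ofReal_mul, Complex.norm_exp_ofReal_mul_I, mul_one]
  exact hK θ

/-- Fourier formula for the weighted renewal measure, nonnegative test functions. -/
lemma RegTail.integral_wmeas_nonneg {G : Measure ℝ} [IsProbabilityMeasure G] {a : ℝ}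
    (hG : RegTail G a) (ha : 0 < a) (ha1 : a < 1) (hG0 : G (Iio 0) = 0) {B : ℝ} (hB0 : 0 < B)
    (hB : ∀ t : ℝ, t ≠ 0 → |t| ≤ B → charFun G t ≠ 1) {g : ℝ → ℂ}
    (hg : Measurable g) {K : ℝ} (hK : ∀ t, ‖g t‖ ≤ K) {m : ℝ} (hm : 0 ≤ m) (k : ℕ) (p : ℝ)
    {f : ℝ → ℝ} (hf : ∀ n, ∀ᵐ y ∂(convPow G n), trigInt B g (y - p) = f y ∧ 0 ≤ f y)
    (hfm : Measurable f) :
    Integrable f (wmeas G (m / (1 + m)) k) ∧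
      ((∫ y, f y ∂(wmeas G (m / (1 + m)) k) : ℝ) : ℂ) =
        ∫ θ in Icc (-B) B, g θ * Complex.exp (-(θ * p * Complex.I)) * resol m k (charFun G θ) := by
  have hs0 : 0 ≤ m / (1 + m) := by positivity
  have hs1 : m / (1 + m) ≤ 1 := (div_le_one (by positivity)).2 (by linarith)
  set s := m / (1 + m) with hs
  have hintg : ∀ n, Integrable f (convPow G n) := fun n => by
    refine Integrable.of_bound (C := ∫ _ in Icc (-B) B, K) hfm.aestronglyMeasurable ?_
    filter_upwards [hf n] with y hy
    have := norm_trigInt_le (B := B) hK (y - p)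
    rwa [hy.1, Complex.norm_real] at this
  have e1 : ∀ n, ∫ y, trigInt B g (y - p) ∂(convPow G n) = ((∫ y, f y ∂(convPow G n) : ℝ) : ℂ) := by
    intro n
    rw [← integral_complex_ofReal]
    exact integral_congr_ae ((hf n).mono fun y hy => hy.1)
  set t : ℕ → ℝ := fun n => wt s k n * ∫ y, f y ∂(convPow G n) with ht
  have ht0 : ∀ n, 0 ≤ t n := fun n =>
    mul_nonneg (wt_nonneg hs0 hs1 k n) (integral_nonneg_of_ae ((hf n).mono fun y hy => hy.2))
  set R := ∫ θ in Icc (-B) B, g θ * Complex.exp (-(θ * p * Complex.I)) * resol m k (charFun G θ)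
    with hR
  set S : ℝ → ℂ := fun r => ∫ θ in Icc (-B) B, g θ * Complex.exp (-(θ * p * Complex.I)) *
    resol m k (r * charFun G θ) with hS
  have hSl : Tendsto S (𝓝[<] 1) (𝓝 R) :=
    hG.tendsto_integral_resol ha ha1 hG0 hB0 hB hg hK hm k p
  have hSr : ∀ r : ℝ, 0 < r → r < 1 → HasSum (fun n => (t n : ℂ) * (r : ℂ) ^ n) (S r) := by
    intro r hr0 hr1
    have := hasSum_wt_integral_mul_pow G (B := B) hg hK hm k p hr0 hr1
    rw [← hs] at this
    convert this using 2 with n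
    rw [e1 n, ht]
    push_cast
    rfl
  have hre : HasSum t R.re := by
    refine hasSum_of_abel ht0 (S := fun r => (S r).re) (fun r hr0 hr1 => ?_)
      ((Complex.continuous_re.tendsto R).comp hSl)
    have := Complex.hasSum_re (hSr r hr0 hr1)
    convert this using 2 with n
    rw [← Complex.ofReal_pow, ← Complex.ofReal_mul, Complex.ofReal_re]
  have hc : HasSum (fun n => (t n : ℂ)) R := by
    refine hasSum_of_abel_of_summable ?_ hSr hSl
    simpa [abs_of_nonneg (ht0 _)] using hre.summable
  have hI : Integrable f (wmeas G s k) := by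
    refine ⟨hfm.aestronglyMeasurable, ?_⟩
    unfold wmeas HasFiniteIntegral
    rw [lintegral_sum_measure]
    have e2 : ∀ n, ∫⁻ y, ‖f y‖ₑ ∂(ENNReal.ofReal (wt s k n) • convPow G n)
        = ENNReal.ofReal (t n) := by
      intro n
      rw [lintegral_smul_measure, smul_eq_mul, ht]
      simp only
      rw [ENNReal.ofReal_mul (wt_nonneg hs0 hs1 k n), ofReal_integral_eq_lintegral_ofReal (hintg n)
        ((hf n).mono fun y hy => hy.2)]
      congr 1
      refine lintegral_congr_ae ((hf n).mono fun y hy => ?_)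
      simp only
      rw [Real.enorm_eq_ofReal hy.2]
    simp only [e2]
    rw [← ENNReal.ofReal_tsum_of_nonneg ht0 hre.summable]
    exact ENNReal.ofReal_lt_top
  refine ⟨hI, ?_⟩
  have h1 := hasSum_integral_measure hI
  have h2 : HasSum t (∫ y, f y ∂(wmeas G s k)) := by
    refine HasSum.congr_fun (f := _) h1 fun n => ?_
    rw [integral_smul_measure, ENNReal.toReal_ofReal (wt_nonneg hs0 hs1 k n), smul_eq_mul]
  exact (Complex.hasSum_ofReal.2 h2).unique hc

/-- Fourier formula for the weighted renewal measure, dominated test functions. -/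
lemma RegTail.integral_wmeas_of_le {G : Measure ℝ} [IsProbabilityMeasure G] {a : ℝ}
    (hG : RegTail G a) (ha : 0 < a) (ha1 : a < 1) (hG0 : G (Iio 0) = 0) {B : ℝ} (hB0 : 0 < B)
    (hB : ∀ t : ℝ, t ≠ 0 → |t| ≤ B → charFun G t ≠ 1) {g : ℝ → ℂ}
    (hg : Measurable g) {K : ℝ} (hK : ∀ t, ‖g t‖ ≤ K) {m : ℝ} (hm : 0 ≤ m) (k : ℕ) (p : ℝ)
    {f : ℝ → ℝ} (hf : ∀ y, ‖trigInt B g (y - p)‖ ≤ f y)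
    (hfi : Integrable f (wmeas G (m / (1 + m)) k)) :
    ∫ y, trigInt B g (y - p) ∂(wmeas G (m / (1 + m)) k) =
        ∫ θ in Icc (-B) B, g θ * Complex.exp (-(θ * p * Complex.I)) * resol m k (charFun G θ) := by
  have hs0 : 0 ≤ m / (1 + m) := by positivity
  have hs1 : m / (1 + m) ≤ 1 := (div_le_one (by positivity)).2 (by linarith)
  have hI : Integrable (fun y => trigInt B g (y - p)) (wmeas G (m / (1 + m)) k) := by
    refine Integrable.mono' hfi ?_ (ae_of_all _ hf)
    exact ((continuous_trigInt hg hK).comp (continuous_id.sub continuous_const)).aestronglyMeasurable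
  have h1 := hasSum_integral_measure hI
  have h2 : HasSum (fun n => (wt (m / (1 + m)) k n : ℂ) * ∫ y, trigInt B g (y - p) ∂(convPow G n))
      (∫ y, trigInt B g (y - p) ∂(wmeas G (m / (1 + m)) k)) := by
    refine HasSum.congr_fun (f := _) h1 fun n => ?_
    rw [integral_smul_measure, ENNReal.toReal_ofReal (wt_nonneg hs0 hs1 k n), Complex.real_smul]
  refine h2.unique (hasSum_of_abel_of_summable ?_
    (fun r hr0 hr1 => hasSum_wt_integral_mul_pow G hg hK hm k p hr0 hr1)
    (hG.tendsto_integral_resol ha ha1 hG0 hB0 hB hg hK hm k p))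
  have h3 := hasSum_integral_measure hI.norm
  refine Summable.of_nonneg_of_le (fun _ => norm_nonneg _) (fun n => ?_) h3.summable
  rw [integral_smul_measure, norm_mul, Complex.norm_real, Real.norm_eq_abs,
    abs_of_nonneg (wt_nonneg hs0 hs1 k n), ENNReal.toReal_ofReal (wt_nonneg hs0 hs1 k n),
    smul_eq_mul]
  exact mul_le_mul_of_nonneg_left (norm_integral_le_integral_norm _) (wt_nonneg hs0 hs1 k n)

lemma norm_resol_le_pow {m : ℝ} (hm : 0 < m) (k : ℕ) {z : ℂ} (hz : ‖z‖ ≤ 1) {u : ℝ} (hu : 0 < u)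
    (huz : u ≤ 1 - z.re) : ‖resol m k z‖ ≤ 1 / u ∧ ‖resol m k z‖ ≤ 1 / (u * (m * u) ^ k) := by
  have h3 : u ≤ ‖1 - z‖ := huz.trans (by simpa using Complex.re_le_norm (1 - z))
  obtain ⟨h4, h5⟩ := re_le_norm_one_add hm.le hz
  rw [resol, norm_div, norm_one, norm_mul, norm_pow]
  constructor
  · refine one_div_le_one_div_of_le hu ?_
    nlinarith [one_le_pow₀ h4 (n := k)]
  · refine one_div_le_one_div_of_le (by positivity) ?_
    refine mul_le_mul h3 ?_ (by positivity) (by positivity)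
    refine pow_le_pow_left₀ (by positivity) (le_trans ?_ h5) k
    gcongr

/-- Local limit for the Fourier integrals attached to the weighted renewal measures. -/
lemma RegTail.exists_tendsto_resol_integral {G : Measure ℝ} [IsProbabilityMeasure G] {a : ℝ}
    (hG : RegTail G a) (ha : 0 < a) (ha1 : a < 1) (hG0 : G (Iio 0) = 0) {δ : ℝ} (hδ : 0 < δ)
    {k : ℕ} {a1 : ℝ} (h10 : 0 ≤ a1) (h1 : a1 < a) (hk : 1 < a1 * (k + 1)) :
    ∃ D : ℂ, ∀ B > 0, (∀ t : ℝ, t ≠ 0 → |t| ≤ B → charFun G t ≠ 1) → ∀ g : ℝ → ℂ, Measurable g →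
      ∀ K : ℝ, (∀ t, ‖g t‖ ≤ K) → ContinuousAt g 0 → ∀ p : ℝ → ℝ,
      Tendsto (fun x => p x / x) atTop (𝓝 1) →
      Tendsto (fun x => ((x * rtail G x : ℝ) : ℂ) * ∫ θ in Icc (-B) B,
        g θ * Complex.exp (-(θ * p x * Complex.I)) * resol (δ / rtail G x) k (charFun G θ))
        atTop (𝓝 (g 0 * D)) := by
  choose ψ hψ using fun t => hG.exists_tendsto_one_sub_charFun ha ha1 hG0 t
  refine ⟨∫ t : ℝ, Complex.exp (-(t * Complex.I)) * (1 / (ψ t * (1 + δ * ψ t) ^ k)), ?_⟩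
  intro B hB0 hB g hg K hK hg0 p hp
  obtain ⟨c, hc, hre⟩ := hG.exists_le_re_one_sub_charFun ha hG0 hB
  obtain ⟨a2, h2, h21⟩ := exists_between ha1
  obtain ⟨C2, hC21, hC2⟩ := hG.potter_upper h2 (by linarith)
  obtain ⟨C1, hC11, hC1⟩ := hG.potter_lower h1 h10 (show 0 < 1 / B by positivity)
  have hK0 : 0 ≤ K := (norm_nonneg _).trans (hK 0)
  have hφ : ∀ θ, ‖charFun G θ‖ ≤ 1 := fun θ => MeasureTheory.norm_charFun_le_one (μ := G) θ
  have hne : ∀ᵐ t : ℝ, t ≠ 0 := by simp [ae_iff]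
  set F : ℝ → ℝ → ℂ := fun x θ => (rtail G x : ℂ) * (g θ * Complex.exp (-(θ * p x * Complex.I)) *
    resol (δ / rtail G x) k (charFun G θ)) with hF
  have hchange : (fun x => ((x * rtail G x : ℝ) : ℂ) * ∫ θ in Icc (-B) B,
        g θ * Complex.exp (-(θ * p x * Complex.I)) * resol (δ / rtail G x) k (charFun G θ))
      =ᶠ[atTop] fun x => ∫ t : ℝ, (Icc (-B) B).indicator (F x) (t / x) := by
    filter_upwards [eventually_gt_atTop 0] with x hx
    rw [Measure.integral_comp_div (fun θ => (Icc (-B) B).indicator (F x) θ) x,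
      integral_indicator measurableSet_Icc, abs_of_pos hx, hF]
    simp only
    rw [integral_const_mul, Complex.real_smul]
    push_cast
    ring
  refine Tendsto.congr' hchange.symm ?_
  rw [← integral_const_mul]
  refine tendsto_integral_filter_of_dominated_convergence
    (fun t => K * (C2 / c + C1 ^ (k + 1) / (c * (δ * c) ^ k)) *
      (if |t| ≤ 1 then |t| ^ (-a2) else |t| ^ (-(a1 * (k + 1))))) ?_ ?_ ?_ ?_
  · refine Eventually.of_forall fun x => Measurable.aestronglyMeasurable ?_
    refine Measurable.comp (g := (Icc (-B) B).indicator (F x)) ?_ (by fun_prop)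
    refine Measurable.indicator ?_ measurableSet_Icc
    have := (measurable_charFun (μ := G))
    simp only [hF]
    unfold resol
    fun_prop
  · filter_upwards [eventually_gt_atTop 0] with x hx
    filter_upwards [hne] with t ht
    have htp : 0 < |t| := abs_pos.2 ht
    have hbn : 0 ≤ (if |t| ≤ 1 then |t| ^ (-a2) else |t| ^ (-(a1 * (k + 1)))) := by
      split_ifs <;> positivity
    have hC20 : 0 < C2 := by linarith
    have hC10 : 0 < C1 := by linarith
    by_cases hin : t / x ∈ Icc (-B) B
    swap
    · rw [indicator_of_notMem hin, norm_zero]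
      positivity
    rw [indicator_of_mem hin]
    have hin' : |t / x| ≤ B := abs_le.2 hin
    have habs : 1 / |t / x| = x / |t| := by rw [abs_div, abs_of_pos hx, one_div_div]
    have hu := hre (t / x) (div_ne_zero ht hx.ne') hin'
    rw [habs] at hu
    have hvx := hG.pos x
    have hvt := hG.pos (x / |t|)
    set q := rtail G x / rtail G (x / |t|) with hq
    have hq0 : 0 < q := by positivity
    obtain ⟨r1, r2⟩ := norm_resol_le_pow (m := δ / rtail G x) (by positivity) k (hφ (t / x))
      (show 0 < c * rtail G (x / |t|) by positivity) hu
    rw [hF]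
    simp only
    rw [norm_mul, norm_mul, norm_mul, norm_exp_neg_mul_I, mul_one, Complex.norm_real,
      Real.norm_eq_abs, abs_of_pos hvx]
    have e1 : rtail G x * ‖resol (δ / rtail G x) k (charFun G (t / x))‖ ≤ q / c := by
      calc _ ≤ rtail G x * (1 / (c * rtail G (x / |t|))) := by gcongr
        _ = q / c := by rw [hq]; field_simp
    have e2 : rtail G x * ‖resol (δ / rtail G x) k (charFun G (t / x))‖
        ≤ q ^ (k + 1) / (c * (δ * c) ^ k) := by
      calc _ ≤ rtail G x * (1 / (c * rtail G (x / |t|) *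
            (δ / rtail G x * (c * rtail G (x / |t|))) ^ k)) := by gcongr
        _ = q ^ (k + 1) / (c * (δ * c) ^ k) := by
          rw [hq, div_pow, mul_pow, div_pow, mul_pow, mul_pow, pow_succ, pow_succ]
          field_simp
    have e3 : rtail G x * ‖resol (δ / rtail G x) k (charFun G (t / x))‖ ≤
        (C2 / c + C1 ^ (k + 1) / (c * (δ * c) ^ k)) *
        (if |t| ≤ 1 then |t| ^ (-a2) else |t| ^ (-(a1 * (k + 1)))) := by
      have p1 : 0 ≤ C2 / c := by positivity
      have p2 : 0 ≤ C1 ^ (k + 1) / (c * (δ * c) ^ k) := by positivity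
      split_ifs with h
      · have h3 := hC2 x (x / |t|) hx (by rw [le_div_iff₀ htp]; nlinarith)
        have e4 : x / |t| / x = |t|⁻¹ := by field_simp
        rw [e4, inv_rpow htp.le, ← rpow_neg htp.le] at h3
        have h5 : q ≤ C2 * |t| ^ (-a2) := by rwa [hq, div_le_iff₀ hvt]
        have h6 : 0 ≤ |t| ^ (-a2) := by positivity
        calc _ ≤ q / c := e1
          _ ≤ C2 * |t| ^ (-a2) / c := by gcongr
          _ = C2 / c * |t| ^ (-a2) := by ring
          _ ≤ _ := by gcongr; linarith
      · have h3 := hC1 (x / |t|) x (by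
            rw [← habs]
            exact one_div_le_one_div_of_le (abs_pos.2 (div_ne_zero ht hx.ne')) hin')
          (by rw [div_le_iff₀ htp]; nlinarith [not_le.1 h])
        have e4 : x / (x / |t|) = |t| := by field_simp
        rw [e4] at h3
        have h5 : q ≤ C1 * |t| ^ (-a1) := by
          rw [hq, div_le_iff₀ hvt, rpow_neg htp.le]
          have : 0 < |t| ^ a1 := by positivity
          calc rtail G x = |t| ^ a1 * rtail G x / |t| ^ a1 := by field_simp
            _ ≤ C1 * rtail G (x / |t|) / |t| ^ a1 := by gcongr
            _ = _ := by field_simp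
        have h6 : (|t| ^ (-a1)) ^ (k + 1) = |t| ^ (-(a1 * (k + 1))) := by
          rw [← rpow_natCast, ← rpow_mul htp.le]
          congr 1
          push_cast
          ring
        calc _ ≤ q ^ (k + 1) / (c * (δ * c) ^ k) := e2
          _ ≤ (C1 * |t| ^ (-a1)) ^ (k + 1) / (c * (δ * c) ^ k) := by gcongr
          _ = C1 ^ (k + 1) / (c * (δ * c) ^ k) * |t| ^ (-(a1 * (k + 1))) := by
            rw [mul_pow, h6]; ring
          _ ≤ _ := by gcongr; linarith
    calc rtail G x * (‖g (t / x)‖ * ‖resol (δ / rtail G x) k (charFun G (t / x))‖)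
        = ‖g (t / x)‖ * (rtail G x * ‖resol (δ / rtail G x) k (charFun G (t / x))‖) := by ring
      _ ≤ K * _ := mul_le_mul (hK _) e3 (by positivity) hK0
      _ = _ := by ring
  · exact (integrable_abs_rpow_piecewise (by linarith) (by linarith)).const_mul _
  · filter_upwards [hne] with t ht
    have htp : 0 < |t| := abs_pos.2 ht
    have hdiv : Tendsto (fun x : ℝ => t / x) atTop (𝓝 0) := tendsto_const_nhds.div_atTop tendsto_id
    have hin : ∀ᶠ x : ℝ in atTop, |t / x| ≤ B := by
      have := hdiv.abs
      simp only [abs_zero] at this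
      exact this.eventually (ge_mem_nhds hB0)
    have hψre : 0 < (ψ t).re := by
      have l1 : Tendsto (fun x => c * (rtail G (|t|⁻¹ * x) / rtail G x)) atTop
          (𝓝 (c * (|t|⁻¹) ^ (-a))) := (hG.lim (|t|⁻¹) (by positivity)).const_mul c
      have l2 := (Complex.continuous_re.tendsto (ψ t)).comp (hψ t)
      refine lt_of_lt_of_le (show 0 < c * (|t|⁻¹) ^ (-a) by positivity)
        (le_of_tendsto_of_tendsto l1 l2 ?_)
      filter_upwards [hin, eventually_gt_atTop 0] with x hx hx0
      have hu := hre (t / x) (div_ne_zero ht hx0.ne') hx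
      have habs : 1 / |t / x| = |t|⁻¹ * x := by rw [abs_div, abs_of_pos hx0]; field_simp
      rw [habs] at hu
      have hvx := hG.pos x
      simp only [Function.comp]
      rw [Complex.div_ofReal_re, ← mul_div_assoc]
      gcongr
      simpa using hu
    have hψ0 : ψ t ≠ 0 := fun h => by simp [h] at hψre
    have hψ1 : (1 + δ * ψ t : ℂ) ≠ 0 := fun h => by
      have := congrArg Complex.re h
      simp at this
      nlinarith
    have m1 : Tendsto (fun x => g (t / x)) atTop (𝓝 (g 0)) := hg0.tendsto.comp hdiv
    have m2 : Tendsto (fun x => Complex.exp (-(t * ((p x / x : ℝ) : ℂ) * Complex.I))) atTop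
        (𝓝 (Complex.exp (-(t * ((1 : ℝ) : ℂ) * Complex.I)))) :=
      (Continuous.tendsto (f := fun u : ℝ => Complex.exp (-(t * (u : ℂ) * Complex.I)))
        (by fun_prop) 1).comp hp
    have m3 : Tendsto (fun x => 1 / (((1 - charFun G (t / x)) / (rtail G x : ℂ)) *
        (1 + δ * ((1 - charFun G (t / x)) / (rtail G x : ℂ))) ^ k)) atTop
        (𝓝 (1 / (ψ t * (1 + δ * ψ t) ^ k))) :=
      tendsto_const_nhds.div ((hψ t).mul ((((hψ t).const_mul _).const_add 1).pow k))
        (mul_ne_zero hψ0 (pow_ne_zero _ hψ1))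
    rw [Complex.ofReal_one, mul_one] at m2
    refine Tendsto.congr' ?_ (m1.mul (m2.mul m3))
    · filter_upwards [hin, eventually_gt_atTop 0] with x hx hx0
      have hmem : t / x ∈ Icc (-B) B := abs_le.1 hx
      rw [indicator_of_mem hmem, hF]
      simp only [resol]
      have hvx : (rtail G x : ℂ) ≠ 0 := by exact_mod_cast (hG.pos x).ne'
      have hxc : (x : ℂ) ≠ 0 := by exact_mod_cast hx0.ne'
      have e1 : ((t / x : ℝ) : ℂ) * p x = t * ((p x / x : ℝ) : ℂ) := by
        push_cast; field_simp
      rw [e1]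
      push_cast
      have e2 : (δ : ℂ) * ((1 - charFun G (t / x)) / (rtail G x : ℂ)) =
        δ / rtail G x * (1 - charFun G (t / x)) := by ring
      rw [e2, div_mul_eq_mul_div, one_div_div]
      ring

section

open scoped FourierTransform

/-- Lévy's continuity theorem for finite measures. -/
lemma tendsto_finiteMeasure_of_charFun {μs : ℕ → FiniteMeasure ℝ} {μ : FiniteMeasure ℝ}
    (h : ∀ t : ℝ, Tendsto (fun n => charFun (μs n : Measure ℝ) t) atTop
      (𝓝 (charFun (μ : Measure ℝ) t))) : Tendsto μs atTop (𝓝 μ) := by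
  have hmass : Tendsto (fun n => (μs n).mass) atTop (𝓝 μ.mass) := by
    have h0 := (Complex.continuous_re.tendsto _).comp (h 0)
    rw [← NNReal.tendsto_coe]
    have e : ∀ ν : FiniteMeasure ℝ, (charFun (ν : Measure ℝ) 0).re = ν.mass := by
      intro ν
      rw [charFun_zero, Complex.ofReal_re]
      rfl
    rw [e] at h0
    refine h0.congr fun n => ?_
    simp only [Function.comp]
    rw [e]
  by_cases hμ : μ = 0
  · subst hμ
    exact FiniteMeasure.tendsto_zero_of_tendsto_zero_mass (by simpa using hmass)
  have hev : ∀ᶠ n in atTop, μs n ≠ 0 := by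
    have := hmass.eventually_ne ((FiniteMeasure.mass_nonzero_iff μ).2 hμ)
    exact this.mono fun n hn => (FiniteMeasure.mass_nonzero_iff _).1 hn
  refine FiniteMeasure.tendsto_of_tendsto_normalize_testAgainstNN_of_tendsto_mass ?_ hmass
  refine ProbabilityMeasure.tendsto_iff_tendsto_charFun.2 fun t => ?_
  have e : ∀ ν : FiniteMeasure ℝ, ν ≠ 0 → charFun (ν.normalize : Measure ℝ) t
      = ((ν.mass⁻¹ : NNReal) : ℝ) * charFun (ν : Measure ℝ) t := by
    intro ν hν
    rw [ν.toMeasure_normalize_eq_of_nonzero hν, charFun_apply_real, charFun_apply_real]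
    have : ν.mass⁻¹ • (ν : Measure ℝ) = ((ν.mass⁻¹ : NNReal) : ENNReal) • (ν : Measure ℝ) := rfl
    rw [this, integral_smul_measure, ENNReal.coe_toReal, Complex.real_smul]
  rw [e μ hμ]
  have h2 : Tendsto (fun n => ((((μs n).mass⁻¹ : NNReal) : ℝ) : ℂ) * charFun (μs n : Measure ℝ) t)
      atTop (𝓝 ((((μ.mass⁻¹ : NNReal) : ℝ) : ℂ) * charFun (μ : Measure ℝ) t)) := by
    refine Tendsto.mul ?_ (h t)
    refine (Complex.continuous_ofReal.tendsto _).comp ?_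
    rw [NNReal.tendsto_coe]
    exact hmass.inv₀ ((FiniteMeasure.mass_nonzero_iff μ).2 hμ)
  exact h2.congr' (hev.mono fun n hn => (e _ hn).symm)

/-- The tent function. -/
def tent (b θ : ℝ) : ℂ := (max (1 - |θ| / b) 0 : ℝ)

lemma continuous_tent (b : ℝ) : Continuous (tent b) := by
  unfold tent
  fun_prop

lemma norm_tent_le {b : ℝ} (hb : 0 < b) (θ : ℝ) : ‖tent b θ‖ ≤ 1 := by
  unfold tent
  have : 0 ≤ |θ| / b := by positivity
  rw [Complex.norm_real, Real.norm_eq_abs, abs_of_nonneg (le_max_right _ _)]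
  exact max_le (by linarith) zero_le_one

lemma tent_eq_zero {b : ℝ} (hb : 0 < b) {θ : ℝ} (h : b ≤ |θ|) : tent b θ = 0 := by
  unfold tent
  have : 1 ≤ |θ| / b := (one_le_div hb).2 h
  rw [max_eq_right (by linarith), Complex.ofReal_zero]

lemma integral_tent {b : ℝ} (hb : 0 < b) (y : ℝ) :
    ∫ θ, tent b θ * Complex.exp (θ * y * Complex.I) = fejer b y := by
  rw [← trigInt_fejer hb, trigInt]
  rw [← setIntegral_eq_integral_of_forall_compl_eq_zero (s := Icc (-b) b)]
  · refine setIntegral_congr_fun measurableSet_Icc fun θ hθ => ?_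
    have : |θ| / b ≤ 1 := (div_le_one hb).2 (abs_le.2 hθ)
    simp only [tent]
    rw [max_eq_left (by linarith)]
  · intro θ hθ
    rw [tent_eq_zero hb, zero_mul]
    by_contra h
    exact hθ (abs_le.1 (not_le.1 h).le)

lemma trigInt_tent {b s B : ℝ} (hb : 0 < b) (hB : b + |s| ≤ B) (y : ℝ) :
    trigInt B (fun θ => tent b (θ - s)) y = Complex.exp (s * y * Complex.I) * fejer b y := by
  rw [trigInt, setIntegral_eq_integral_of_forall_compl_eq_zero]
  · rw [← integral_add_right_eq_self _ s, ← integral_tent hb, ← integral_const_mul]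
    refine integral_congr_ae (ae_of_all _ fun θ => ?_)
    simp only [add_sub_cancel_right]
    rw [mul_left_comm, ← Complex.exp_add]
    push_cast
    ring_nf
  · intro θ hθ
    rw [tent_eq_zero hb, zero_mul]
    by_contra h
    refine hθ (abs_le.1 ?_)
    have := abs_add_le (θ - s) s
    rw [sub_add_cancel] at this
    linarith [not_le.1 h]

lemma integrable_fejer {b : ℝ} (hb : 0 < b) : Integrable (fejer b) := by
  have hi : Integrable fun t : ℝ => (b + 4 / b) *
      (if |t| ≤ 1 then |t| ^ (0 : ℝ) else |t| ^ (-2 : ℝ)) :=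
    (integrable_abs_rpow_piecewise (by norm_num) (by norm_num)).const_mul _
  refine hi.mono' (measurable_fejer b).aestronglyMeasurable (ae_of_all _ fun y => ?_)
  rw [Real.norm_eq_abs, abs_of_nonneg (fejer_nonneg hb y)]
  have p1 : 0 < 4 / b := by positivity
  split_ifs with h
  · rw [rpow_zero, mul_one]
    linarith [fejer_le hb y]
  · have hy : y ≠ 0 := by rintro rfl; simp at h
    have h1 := fejer_le_inv_sq hb hy
    have h2 : |y| ^ (-2 : ℝ) = 1 / y ^ 2 := by
      rw [rpow_neg (abs_nonneg y), rpow_two, sq_abs, one_div]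
    rw [h2]
    calc fejer b y ≤ 4 / (b * y ^ 2) := h1
      _ = 4 / b * (1 / y ^ 2) := by field_simp
      _ ≤ _ := by gcongr; linarith

lemma integrable_tent {b : ℝ} (hb : 0 < b) : Integrable (tent b) := by
  have : IntegrableOn (tent b) (Icc (-b) b) := (continuous_tent b).integrableOn_Icc
  refine (integrableOn_iff_integrable_of_support_subset ?_).1 this
  intro θ hθ
  by_contra h
  refine hθ (tent_eq_zero hb ?_)
  by_contra h'
  exact h (abs_le.1 (not_le.1 h').le)

/-- Fourier inversion for the Fejér kernel. -/
lemma integral_exp_mul_fejer {b : ℝ} (hb : 0 < b) (s : ℝ) :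
    ∫ y : ℝ, Complex.exp (s * y * Complex.I) * fejer b y = 2 * π * tent b s := by
  have hF : 𝓕 (tent b) = fun w : ℝ => (fejer b (w * (-2 * π)) : ℂ) := by
    ext w
    rw [Real.fourier_real_eq_integral_exp_smul, ← integral_tent hb]
    refine integral_congr_ae (ae_of_all _ fun θ => ?_)
    simp only [smul_eq_mul]
    rw [mul_comm]
    push_cast
    ring_nf
  have hpi : (-2 * π) ≠ 0 := by have := pi_pos; positivity
  have hFi : Integrable (𝓕 (tent b)) := by
    rw [hF]
    exact ((integrable_fejer hb).comp_mul_right' hpi).ofReal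
  have h := congrFun ((continuous_tent b).fourierInv_fourier_eq (integrable_tent hb) hFi) s
  rw [Real.fourierInv_eq', hF] at h
  rw [← h]
  have h2 := Measure.integral_comp_mul_right
    (fun y : ℝ => Complex.exp ((-s : ℝ) * y * Complex.I) * fejer b y) (-2 * π)
  have h3 : ∫ v : ℝ, Complex.exp (↑(2 * π * inner ℝ v s) * Complex.I) •
      (fejer b (v * (-2 * π)) : ℂ) = ∫ x : ℝ, (fun y : ℝ => Complex.exp ((-s : ℝ) * y * Complex.I) *
        fejer b y) (x * (-2 * π)) := by
    refine integral_congr_ae (ae_of_all _ fun θ => ?_)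
    simp only [smul_eq_mul]
    congr 2
    simp
    ring
  have h4 : ∫ y : ℝ, Complex.exp ((-s : ℝ) * y * Complex.I) * fejer b y
      = ∫ y : ℝ, Complex.exp (s * y * Complex.I) * fejer b y := by
    rw [← integral_neg_eq_self]
    refine integral_congr_ae (ae_of_all _ fun θ => ?_)
    simp only [fejer]
    simp
  rw [h3, h2, h4, Complex.real_smul]
  have : |(-2 * π)⁻¹| = 1 / (2 * π) := by
    rw [abs_inv, abs_mul, abs_of_pos pi_pos]; norm_num
  rw [this]
  have hpc : (π : ℂ) ≠ 0 := by exact_mod_cast pi_ne_zero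
  push_cast
  rw [← mul_assoc, mul_one_div_cancel (mul_ne_zero two_ne_zero hpc), one_mul]

end

/-- Trapezoidal test function. -/
def trap (p q η y : ℝ) : ℝ := max 0 (min 1 (min ((y - p) / η) ((q - y) / η)))

lemma continuous_trap (p q η : ℝ) : Continuous (trap p q η) := by
  unfold trap
  fun_prop

lemma trap_nonneg (p q η y : ℝ) : 0 ≤ trap p q η y := le_max_left _ _

lemma trap_le_one (p q η y : ℝ) : trap p q η y ≤ 1 := max_le zero_le_one (min_le_left _ _)

lemma trap_eq_zero {p q η y : ℝ} (hη : 0 < η) (hy : y ∉ Ioo p q) : trap p q η y = 0 := by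
  unfold trap
  refine max_eq_left ((min_le_right _ _).trans ?_)
  rcases le_or_gt y p with h | h
  · exact (min_le_left _ _).trans (div_nonpos_of_nonpos_of_nonneg (by linarith) hη.le)
  · have : q ≤ y := by
      by_contra h'
      exact hy ⟨h, not_le.1 h'⟩
    exact (min_le_right _ _).trans (div_nonpos_of_nonpos_of_nonneg (by linarith) hη.le)

lemma trap_eq_one {p q η y : ℝ} (hη : 0 < η) (hy : y ∈ Icc (p + η) (q - η)) :
    trap p q η y = 1 := by
  unfold trap
  have h1 : 1 ≤ (y - p) / η := (one_le_div hη).2 (by linarith [hy.1])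
  have h2 : 1 ≤ (q - y) / η := (one_le_div hη).2 (by linarith [hy.2])
  rw [min_eq_left (le_min h1 h2), max_eq_right zero_le_one]

lemma integrable_trap {p q η : ℝ} (hη : 0 < η) (μ : Measure ℝ) [IsFiniteMeasureOnCompacts μ] :
    Integrable (trap p q η) μ := by
  refine (continuous_trap p q η).integrable_of_hasCompactSupport ?_
  refine HasCompactSupport.intro (isCompact_Icc (a := p) (b := q)) fun y hy => ?_
  exact trap_eq_zero hη fun h => hy ⟨h.1.le, h.2.le⟩

lemma measurable_fejer_ofReal (b : ℝ) : Measurable fun y => ENNReal.ofReal (fejer b y) :=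
  (measurable_fejer b).ennreal_ofReal

/-- Convergence of the Fejér-weighted characteristic functions implies convergence of the
masses of an interval. -/
lemma tendsto_measureReal_Ioc_of_fejer {M : ℕ → Measure ℝ} {h c b : ℝ} (hh : 0 < h) (hc : 0 ≤ c)
    (hb : b = 1 / (h + 1)) (hintg : ∀ n, Integrable (fejer b) (M n))
    (H : ∀ s : ℝ, Tendsto (fun n => ∫ y : ℝ, Complex.exp (s * y * Complex.I) * fejer b y ∂(M n)) atTop
      (𝓝 (c * ∫ y : ℝ, Complex.exp (s * y * Complex.I) * fejer b y))) :
    Tendsto (fun n => (M n).real (Ioc 0 h)) atTop (𝓝 (c * h)) := by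
  have hb0 : 0 < b := by rw [hb]; positivity
  have hfin : ∀ μ : Measure ℝ, Integrable (fejer b) μ →
      IsFiniteMeasure (μ.withDensity fun y => ENNReal.ofReal (fejer b y)) := fun μ hμ =>
    isFiniteMeasure_withDensity_ofReal hμ.2
  have hvol := hfin volume (integrable_fejer hb0)
  let μs : ℕ → FiniteMeasure ℝ := fun n => ⟨_, hfin (M n) (hintg n)⟩
  let ν : FiniteMeasure ℝ := ⟨_, hvol⟩
  let μ : FiniteMeasure ℝ := c.toNNReal • ν
  have hwd : ∀ (ν : Measure ℝ) (f : ℝ → ℂ),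
      ∫ y, f y ∂(ν.withDensity fun y => ENNReal.ofReal (fejer b y)) = ∫ y, f y * fejer b y ∂ν := by
    intro ν f
    rw [integral_withDensity_eq_integral_toReal_smul (measurable_fejer_ofReal b)
      (ae_of_all _ fun _ => ENNReal.ofReal_lt_top)]
    refine integral_congr_ae (ae_of_all _ fun y => ?_)
    simp only
    rw [ENNReal.toReal_ofReal (fejer_nonneg hb0 y), Complex.real_smul, mul_comm]
  have hwd' : ∀ (ν : Measure ℝ) (f : ℝ → ℝ),
      ∫ y, f y ∂(ν.withDensity fun y => ENNReal.ofReal (fejer b y)) = ∫ y, f y * fejer b y ∂ν := by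
    intro ν f
    rw [integral_withDensity_eq_integral_toReal_smul (measurable_fejer_ofReal b)
      (ae_of_all _ fun _ => ENNReal.ofReal_lt_top)]
    refine integral_congr_ae (ae_of_all _ fun y => ?_)
    simp only
    rw [ENNReal.toReal_ofReal (fejer_nonneg hb0 y), smul_eq_mul, mul_comm]
  have hμ : (μ : Measure ℝ) = ENNReal.ofReal c •
      volume.withDensity fun y => ENNReal.ofReal (fejer b y) := by
    have : (μ : Measure ℝ) = c.toNNReal •
      volume.withDensity fun y => ENNReal.ofReal (fejer b y) := rfl
    rw [this]
    rfl
  have hweak : Tendsto μs atTop (𝓝 μ) := by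
    refine tendsto_finiteMeasure_of_charFun fun t => ?_
    rw [hμ, charFun_apply_real, integral_smul_measure, ENNReal.toReal_ofReal hc, hwd,
      Complex.real_smul]
    refine (H t).congr fun n => ?_
    rw [charFun_apply_real]
    exact (hwd (M n) _).symm
  rw [FiniteMeasure.tendsto_iff_forall_integral_tendsto] at hweak
  have hk : ∀ y ∈ Icc (-(h + 1)) (h + 1), b / 4 ≤ fejer b y := fun y hy =>
    fejer_ge hb0 (by rw [hb, one_div_one_div]; exact abs_le.2 hy)
  have hcf : Continuous (fejer b) := by
    have h1 : Continuous fun y => (trigInt b (tent b) y).re :=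
      Complex.continuous_re.comp (continuous_trigInt (continuous_tent b).measurable
        (norm_tent_le hb0))
    refine h1.congr fun y => ?_
    have := trigInt_tent (s := 0) hb0 (B := b) (by simp) y
    simp only [sub_zero, Complex.ofReal_zero, zero_mul, Complex.exp_zero, one_mul] at this
    rw [this, Complex.ofReal_re]
  have hsub : ∀ {p q : ℝ}, -1 ≤ p → q ≤ h + 1 → Ioo p q ⊆ Icc (-(h + 1)) (h + 1) :=
    fun hp hq y hy => ⟨by linarith [hy.1], by linarith [hy.2]⟩
  have htrap : ∀ p q η : ℝ, 0 < η → -1 ≤ p → q ≤ h + 1 →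
      Tendsto (fun n => ∫ y, trap p q η y ∂(M n)) atTop (𝓝 (c * ∫ y, trap p q η y)) := by
    intro p q η hη hp hq
    let g : BoundedContinuousFunction ℝ ℝ := BoundedContinuousFunction.ofNormedAddCommGroup
      (fun y => trap p q η y / max (fejer b y) (b / 4))
      ((continuous_trap p q η).div (hcf.max continuous_const) fun y =>
        (lt_of_lt_of_le (by positivity) (le_max_right _ _)).ne') (4 / b) (fun y => by
          rw [Real.norm_eq_abs, abs_of_nonneg (div_nonneg (trap_nonneg _ _ _ _)
            (le_trans (by positivity) (le_max_right _ _)))]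
          calc trap p q η y / max (fejer b y) (b / 4) ≤ 1 / (b / 4) :=
                div_le_div₀ zero_le_one (trap_le_one _ _ _ _) (by positivity) (le_max_right _ _)
            _ = 4 / b := by field_simp)
    have hg : ∀ y, g y * fejer b y = trap p q η y := by
      intro y
      change trap p q η y / max (fejer b y) (b / 4) * fejer b y = _
      by_cases hy : y ∈ Ioo p q
      · have h1 := hk y (hsub hp hq hy)
        rw [max_eq_left h1, div_mul_cancel₀]
        exact (lt_of_lt_of_le (by positivity) h1).ne'
      · rw [trap_eq_zero hη hy]; simp
    have h1 := hweak g
    rw [hμ, integral_smul_measure, ENNReal.toReal_ofReal hc, hwd', smul_eq_mul] at h1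
    simp only [hg] at h1
    refine h1.congr fun n => ?_
    have := hwd' (M n) g
    simp only [hg] at this
    exact this
  have hti : ∀ n, ∀ p q η : ℝ, 0 < η → -1 ≤ p → q ≤ h + 1 → Integrable (trap p q η) (M n) := by
    intro n p q η hη hp hq
    refine ((hintg n).const_mul (4 / b)).mono' (continuous_trap p q η).aestronglyMeasurable
      (ae_of_all _ fun y => ?_)
    rw [Real.norm_eq_abs, abs_of_nonneg (trap_nonneg _ _ _ _)]
    by_cases hy : y ∈ Ioo p q
    · have h1 := hk y (hsub hp hq hy)
      calc trap p q η y ≤ 1 := trap_le_one _ _ _ _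
        _ = 4 / b * (b / 4) := by field_simp
        _ ≤ _ := by gcongr
    · rw [trap_eq_zero hη hy]
      have := fejer_nonneg hb0 y
      positivity
  have hMfin : ∀ n, M n (Ioc 0 h) ≠ ⊤ := by
    intro n
    have h1 := (hti n (-1) (h + 1) 1 one_pos le_rfl le_rfl).measure_norm_ge_lt_top one_pos
    refine (lt_of_le_of_lt (measure_mono fun y hy => ?_) h1).ne
    rw [mem_ofPred_eq, trap_eq_one one_pos ⟨by linarith [hy.1], by linarith [hy.2]⟩]
    simp
  have hlow : ∀ n η, 0 < η → ∫ y, trap 0 h η y ∂(M n) ≤ (M n).real (Ioc 0 h) := by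
    intro n η hη
    rw [← integral_indicator_one measurableSet_Ioc]
    refine integral_mono (hti n 0 h η hη (by linarith) (by linarith)) ?_ fun y => ?_
    · exact (integrable_indicator_iff measurableSet_Ioc).2 (integrableOn_const (hMfin n))
    · by_cases hy : y ∈ Ioc 0 h
      · rw [indicator_of_mem hy]; exact trap_le_one _ _ _ _
      · rw [indicator_of_notMem hy, trap_eq_zero hη fun hy' => hy ⟨hy'.1, hy'.2.le⟩]
  have hupp : ∀ n η, 0 < η → η ≤ 1 →
      (M n).real (Ioc 0 h) ≤ ∫ y, trap (-η) (h + η) η y ∂(M n) := by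
    intro n η hη hη1
    rw [← integral_indicator_one measurableSet_Ioc]
    refine integral_mono ?_ (hti n _ _ η hη (by linarith) (by linarith)) fun y => ?_
    · exact (integrable_indicator_iff measurableSet_Ioc).2 (integrableOn_const (hMfin n))
    · by_cases hy : y ∈ Ioc 0 h
      · rw [indicator_of_mem hy, trap_eq_one hη ⟨by linarith [hy.1], by linarith [hy.2]⟩]
        simp
      · rw [indicator_of_notMem hy]; exact trap_nonneg _ _ _ _
  have hvl : ∀ η, 0 < η → η ≤ h / 2 → h - 2 * η ≤ ∫ y, trap 0 h η y := by
    intro η hη hη1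
    have e : h - 2 * η = ∫ y, (Icc η (h - η)).indicator (1 : ℝ → ℝ) y := by
      rw [integral_indicator_one measurableSet_Icc, Measure.real, Real.volume_Icc,
        ENNReal.toReal_ofReal (by linarith)]
      ring
    rw [e]
    refine integral_mono ((integrable_indicator_iff measurableSet_Icc).2
      (integrableOn_const (by simp))) (integrable_trap hη _) fun y => ?_
    by_cases hy : y ∈ Icc η (h - η)
    · rw [indicator_of_mem hy, trap_eq_one hη (by simpa using hy)]; simp
    · rw [indicator_of_notMem hy]; exact trap_nonneg _ _ _ _
  have hvu : ∀ η, 0 < η → ∫ y, trap (-η) (h + η) η y ≤ h + 2 * η := by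
    intro η hη
    have e : h + 2 * η = ∫ y, (Icc (-η) (h + η)).indicator (1 : ℝ → ℝ) y := by
      rw [integral_indicator_one measurableSet_Icc, Measure.real, Real.volume_Icc,
        ENNReal.toReal_ofReal (by linarith)]
      ring
    rw [e]
    refine integral_mono (integrable_trap hη _) ((integrable_indicator_iff measurableSet_Icc).2
      (integrableOn_const (by simp))) fun y => ?_
    by_cases hy : y ∈ Icc (-η) (h + η)
    · rw [indicator_of_mem hy]; exact trap_le_one _ _ _ _
    · rw [indicator_of_notMem hy, trap_eq_zero hη fun h' => hy ⟨h'.1.le, h'.2.le⟩]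
  have hη0 : ∀ z, 0 < z → ∃ η > 0, η ≤ 1 ∧ η ≤ h / 2 ∧ c * (2 * η) < z := by
    intro z hz
    refine ⟨min (min 1 (h / 2)) (z / (4 * (c + 1))), by positivity,
      (min_le_left _ _).trans (min_le_left _ _), (min_le_left _ _).trans (min_le_right _ _), ?_⟩
    calc c * (2 * min (min 1 (h / 2)) (z / (4 * (c + 1)))) ≤ c * (2 * (z / (4 * (c + 1)))) := by
          gcongr; exact min_le_right _ _
      _ = z * (c / (2 * (c + 1))) := by field_simp; norm_num
      _ < z * 1 := by
          gcongr
          rw [div_lt_one (by positivity)]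
          linarith
      _ = z := mul_one z
  rw [tendsto_order]
  constructor
  · intro z hz
    obtain ⟨η, hη, hη1, hη2, hηz⟩ := hη0 (c * h - z) (by linarith)
    have h1 : z < c * ∫ y, trap 0 h η y := by
      nlinarith [mul_le_mul_of_nonneg_left (hvl η hη hη2) hc]
    filter_upwards [(htrap 0 h η hη (by linarith) (by linarith)).eventually (lt_mem_nhds h1)] with n hn
    exact hn.trans_le (hlow n η hη)
  · intro z hz
    obtain ⟨η, hη, hη1, hη2, hηz⟩ := hη0 (z - c * h) (by linarith)
    have h1 : c * ∫ y, trap (-η) (h + η) η y < z := by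
      nlinarith [mul_le_mul_of_nonneg_left (hvu η hη) hc]
    filter_upwards [(htrap (-η) (h + η) η hη (by linarith) (by linarith)).eventually
      (gt_mem_nhds h1)] with n hn
    exact (hupp n η hη hη1).trans_lt hn

/-- Local limit of the weighted renewal measure in the non-arithmetic case. -/
lemma RegTail.exists_tendsto_wmeas_nonarith {G : Measure ℝ} [IsProbabilityMeasure G] {a : ℝ}
    (hG : RegTail G a) (ha : 0 < a) (ha1 : a < 1) (hG0 : G (Iio 0) = 0) {δ : ℝ} (hδ : 0 < δ)
    {k : ℕ} {a1 : ℝ} (h10 : 0 ≤ a1) (h1 : a1 < a) (hk : 1 < a1 * (k + 1)) {h : ℝ} (hh : 0 < h)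
    (hna : ∀ t : ℝ, t ≠ 0 → charFun G t ≠ 1) :
    ∃ c : ℝ, Tendsto (fun x => x * rtail G x *
      (wmeas G (δ / rtail G x / (1 + δ / rtail G x)) k).real (Ioc x (x + h))) atTop (𝓝 c) := by
  obtain ⟨D, hD⟩ := hG.exists_tendsto_resol_integral ha ha1 hG0 hδ h10 h1 hk
  set b := 1 / (h + 1) with hb
  have hb0 : 0 < b := by positivity
  have hm : ∀ x, 0 ≤ δ / rtail G x := fun x => div_nonneg hδ.le (rtail_nonneg _ _)
  set W : ℝ → Measure ℝ := fun x => wmeas G (δ / rtail G x / (1 + δ / rtail G x)) k with hW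
  have hfej : ∀ x, Integrable (fun y => fejer b (y - x)) (W x) := fun x =>
    (hG.integral_wmeas_nonneg ha ha1 hG0 hb0 (fun t ht _ => hna t ht)
      (continuous_tent b).measurable (norm_tent_le hb0) (hm x) k x (f := fun y => fejer b (y - x))
      (fun n => ae_of_all _ fun y => by
        refine ⟨?_, fejer_nonneg hb0 _⟩
        have := trigInt_tent (s := 0) hb0 (B := b) (by simp) (y - x)
        simpa using this)
      ((measurable_fejer b).comp (measurable_id.sub_const x))).1
  have hlim : ∀ s : ℝ, Tendsto (fun x => ((x * rtail G x : ℝ) : ℂ) *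
      ∫ y : ℝ, Complex.exp (s * (y - x : ℝ) * Complex.I) * fejer b (y - x) ∂(W x)) atTop
      (𝓝 (tent b s * D)) := by
    intro s
    have hB : 0 < b + |s| := by positivity
    have hgm : Measurable fun θ => tent b (θ - s) :=
      (continuous_tent b).measurable.comp (measurable_id.sub_const s)
    have h2 := hD (b + |s|) hB (fun t ht _ => hna t ht) (fun θ => tent b (θ - s)) hgm
      1 (fun θ => norm_tent_le hb0 _)
      ((continuous_tent b).comp (continuous_id.sub continuous_const)).continuousAt id (by
        refine tendsto_const_nhds.congr' ?_
        filter_upwards [eventually_gt_atTop 0] with x hx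
        rw [id, div_self hx.ne'])
    have e0 : tent b (0 - s) = tent b s := by simp [tent]
    rw [e0] at h2
    refine h2.congr fun x => ?_
    congr 1
    have h3 := hG.integral_wmeas_of_le ha ha1 hG0 hB (fun t ht _ => hna t ht) hgm
      (fun θ => norm_tent_le hb0 _) (hm x) k x (f := fun y => fejer b (y - x))
      (fun y => by
        rw [trigInt_tent hb0 le_rfl, norm_mul, ← Complex.ofReal_mul, Complex.norm_exp_ofReal_mul_I,
          one_mul, Complex.norm_real, Real.norm_eq_abs, abs_of_nonneg (fejer_nonneg hb0 _)])
      (hfej x)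
    rw [id, ← h3]
    refine integral_congr_ae (ae_of_all _ fun y => ?_)
    exact trigInt_tent hb0 le_rfl _
  have hD0 := hlim 0
  simp only [Complex.ofReal_zero, zero_mul, Complex.exp_zero, one_mul, integral_complex_ofReal,
    ← Complex.ofReal_mul] at hD0
  have ht0 : tent b 0 = 1 := by simp [tent]
  rw [ht0, one_mul] at hD0
  have hre := (Complex.continuous_re.tendsto _).comp hD0
  have him := (Complex.continuous_im.tendsto _).comp hD0
  have hDre : 0 ≤ D.re := by
    refine ge_of_tendsto hre ?_
    filter_upwards [eventually_ge_atTop 0] with x hx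
    simp only [Function.comp, Complex.ofReal_re]
    exact mul_nonneg (mul_nonneg hx (rtail_nonneg _ _)) (integral_nonneg fun y => fejer_nonneg hb0 _)
  have hDim : D.im = 0 := by
    refine tendsto_nhds_unique him ?_
    simp only [Function.comp_def, Complex.ofReal_im]
    exact tendsto_const_nhds
  have hDr : (D.re : ℂ) = D := Complex.ext (by simp) (by simp [hDim])
  have hc : 0 ≤ D.re / (2 * π) := by positivity
  refine ⟨D.re / (2 * π) * h, ?_⟩
  refine tendsto_of_seq_tendsto fun u hu => ?_
  let M : ℕ → Measure ℝ := fun n => ENNReal.ofReal (u n * rtail G (u n)) •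
    (W (u n)).map fun y => y - u n
  have hsub : ∀ n, Measurable fun y : ℝ => y - u n := fun n => measurable_id.sub_const _
  have hupos : ∀ᶠ n in atTop, 0 ≤ u n * rtail G (u n) := by
    filter_upwards [hu.eventually_ge_atTop 0] with n hn using mul_nonneg hn (rtail_nonneg _ _)
  have key := tendsto_measureReal_Ioc_of_fejer (M := M) hh hc hb (fun n => by
      refine Integrable.smul_measure ?_ ENNReal.ofReal_ne_top
      rw [integrable_map_measure (measurable_fejer b).aestronglyMeasurable (hsub n).aemeasurable]
      exact hfej (u n)) (fun s => by
      rw [integral_exp_mul_fejer hb0]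
      have e : ((D.re / (2 * π) : ℝ) : ℂ) * (2 * π * tent b s) = tent b s * D := by
        push_cast
        rw [hDr]
        have : (π : ℂ) ≠ 0 := by exact_mod_cast Real.pi_ne_zero
        field_simp
      rw [e]
      refine ((hlim s).comp hu).congr' ?_
      filter_upwards [hupos] with n hn
      rw [integral_smul_measure, ENNReal.toReal_ofReal hn, integral_map (hsub n).aemeasurable,
        Complex.real_smul]
      · rfl
      · refine Measurable.aestronglyMeasurable ?_
        have := measurable_fejer b
        fun_prop)
  refine key.congr' ?_
  filter_upwards [hupos] with n hn
  simp only [M, Measure.real, Measure.smul_apply, smul_eq_mul, ENNReal.toReal_mul,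
    ENNReal.toReal_ofReal hn]
  rw [Measure.map_apply (hsub n) measurableSet_Ioc, Set.preimage_sub_const_Ioc, zero_add,
    add_comm h]
  rfl

lemma measurableSet_lattice (d : ℝ) : MeasurableSet {x : ℝ | ∃ k : ℤ, x = k * d} := by
  have : {x : ℝ | ∃ k : ℤ, x = k * d} = ⋃ k : ℤ, {(k * d : ℝ)} := by
    ext x
    simp [eq_comm]
  rw [this]
  exact MeasurableSet.iUnion fun k => measurableSet_singleton _

lemma ConcOn.ae {μ : Measure ℝ} [IsProbabilityMeasure μ] {d : ℝ} (hμ : ConcOn μ d) :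
    ∀ᵐ x ∂μ, ∃ k : ℤ, x = k * d :=
  (mem_ae_iff_prob_eq_one (measurableSet_lattice d)).2 hμ

lemma ConcOn.convPow_ae {μ : Measure ℝ} [IsProbabilityMeasure μ] {d : ℝ} (hμ : ConcOn μ d)
    (n : ℕ) : ∀ᵐ x ∂(convPow μ n), ∃ k : ℤ, x = k * d := by
  induction n with
  | zero =>
    rw [convPow_zero, ae_dirac_iff (measurableSet_lattice d)]
    exact ⟨0, by simp⟩
  | succ n ih =>
    change convPow μ (n + 1) {x : ℝ | ∃ k : ℤ, x = k * d}ᶜ = 0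
    rw [convPow_succ, conv_apply _ _ (measurableSet_lattice d).compl, lintegral_eq_zero_iff' ?_]
    · filter_upwards [ih] with x ⟨j, hj⟩
      refine measure_mono_null ?_ (ae_iff.1 hμ.ae)
      rintro y hy ⟨i, hi⟩
      exact hy ⟨j + i, by push_cast; rw [hj, hi]; ring⟩
    · refine Measurable.aemeasurable ?_
      exact measurable_measure_prodMk_left (s := {p : ℝ × ℝ | p.1 + p.2 ∈
        {x : ℝ | ∃ k : ℤ, x = k * d}ᶜ}) ((measurable_fst.add measurable_snd)
          (measurableSet_lattice d).compl)

lemma trigInt_lattice {d : ℝ} (hd : 0 < d) (j : ℤ) :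
    trigInt (π / d) (fun _ => ((d / (2 * π) : ℝ) : ℂ)) (j * d) = if j = 0 then 1 else 0 := by
  have hpi := Real.pi_pos
  have hp : -(π / d) ≤ π / d := by have : 0 < π / d := by positivity
                                   linarith
  unfold trigInt
  rw [integral_const_mul, integral_Icc_eq_integral_Ioc, ← intervalIntegral.integral_of_le hp]
  have hpc : (π : ℂ) ≠ 0 := by exact_mod_cast hpi.ne'
  have hdc : (d : ℂ) ≠ 0 := by exact_mod_cast hd.ne'
  split_ifs with hj
  · subst hj
    simp only [Int.cast_zero, zero_mul, Complex.ofReal_zero, mul_zero, Complex.exp_zero,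
      intervalIntegral.integral_const]
    rw [Complex.real_smul]
    push_cast
    field_simp
    ring
  · have hjc : (j : ℂ) ≠ 0 := by exact_mod_cast hj
    have e : ∀ θ : ℝ, Complex.exp (θ * ((j * d : ℝ) : ℂ) * Complex.I)
        = Complex.exp ((j * d * Complex.I) * θ) := by
      intro θ
      push_cast
      ring_nf
    simp only [e]
    rw [integral_exp_mul_complex (by simp [hjc, hdc])]
    have e2 : Complex.exp (j * d * Complex.I * ((π / d : ℝ) : ℂ))
        = Complex.exp (j * d * Complex.I * ((-(π / d) : ℝ) : ℂ)) := by
      rw [Complex.exp_eq_exp_iff_exists_int]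
      refine ⟨j, ?_⟩
      push_cast
      field_simp
      ring
    rw [e2, sub_self, zero_div, mul_zero]

/-- Local limit of the weighted renewal measure in the arithmetic case. -/
lemma RegTail.exists_tendsto_wmeas_arith {G : Measure ℝ} [IsProbabilityMeasure G] {a : ℝ}
    (hG : RegTail G a) (ha : 0 < a) (ha1 : a < 1) (hG0 : G (Iio 0) = 0) {δ : ℝ} (hδ : 0 < δ)
    {k : ℕ} {a1 : ℝ} (h10 : 0 ≤ a1) (h1 : a1 < a) (hk : 1 < a1 * (k + 1)) {h : ℝ} (hh : 0 < h)
    (hconc : ConcOn G h) (hna : ∀ t : ℝ, t ≠ 0 → |t| ≤ π / h → charFun G t ≠ 1) :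
    ∃ c : ℝ, Tendsto (fun x => x * rtail G x *
      (wmeas G (δ / rtail G x / (1 + δ / rtail G x)) k).real (Ioc x (x + h))) atTop (𝓝 c) := by
  obtain ⟨D, hD⟩ := hG.exists_tendsto_resol_integral ha ha1 hG0 hδ h10 h1 hk
  have hm : ∀ x, 0 ≤ δ / rtail G x := fun x => div_nonneg hδ.le (rtail_nonneg _ _)
  set p : ℝ → ℝ := fun x => ((⌊x / h⌋ + 1 : ℤ) : ℝ) * h with hp
  have hp1 : ∀ x, x < p x := fun x => by
    have := Int.lt_floor_add_one (x / h)
    rw [div_lt_iff₀ hh] at this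
    simp only [hp]; push_cast; exact this
  have hp2 : ∀ x, p x ≤ x + h := fun x => by
    have := Int.floor_le (x / h)
    rw [le_div_iff₀ hh] at this
    simp only [hp]; push_cast; linarith
  have hB : 0 < π / h := div_pos Real.pi_pos hh
  have hpx : Tendsto (fun x => p x / x) atTop (𝓝 1) := by
    have hu : Tendsto (fun x : ℝ => 1 + h * x⁻¹) atTop (𝓝 1) := by
      simpa using (tendsto_inv_atTop_zero.const_mul h).const_add 1
    refine tendsto_of_tendsto_of_tendsto_of_le_of_le' tendsto_const_nhds hu ?_ ?_
    · filter_upwards [eventually_gt_atTop 0] with x hx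
      exact (one_le_div hx).2 (hp1 x).le
    · filter_upwards [eventually_gt_atTop 0] with x hx
      rw [div_le_iff₀ hx, add_mul, mul_assoc, inv_mul_cancel₀ hx.ne']
      linarith [hp2 x]
  have h2 := hD (π / h) hB hna (fun _ => ((h / (2 * π) : ℝ) : ℂ)) measurable_const _
    (fun _ => le_rfl) continuousAt_const p hpx
  have h3 := (Complex.continuous_re.tendsto _).comp h2
  refine ⟨_, h3.congr fun x => ?_⟩
  have h4 := (hG.integral_wmeas_nonneg ha ha1 hG0 hB hna (g := fun _ => ((h / (2 * π) : ℝ) : ℂ))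
    measurable_const (fun _ => le_rfl) (hm x) k (p x) (f := (Ioc x (x + h)).indicator 1)
    (fun n => by
      filter_upwards [hconc.convPow_ae n] with y ⟨j, hj⟩
      refine ⟨?_, indicator_nonneg (fun _ _ => zero_le_one) _⟩
      have e : y - p x = ((j - (⌊x / h⌋ + 1) : ℤ) : ℝ) * h := by
        rw [hj, hp]; push_cast; ring
      rw [e, trigInt_lattice hh]
      by_cases hy : y ∈ Ioc x (x + h)
      · rw [indicator_of_mem hy, if_pos]
        · simp
        · have a1 : x / h < j := by rw [div_lt_iff₀ hh, ← hj]; exact hy.1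
          have a2 : (j : ℝ) - 1 ≤ x / h := by
            rw [le_div_iff₀ hh, sub_mul, ← hj]; linarith [hy.2]
          have a3 := Int.floor_lt.2 a1
          have a4 : j - 1 ≤ ⌊x / h⌋ := Int.le_floor.2 (by exact_mod_cast a2)
          omega
      · rw [indicator_of_notMem hy, if_neg]
        · simp
        · intro h0
          refine hy ?_
          have : y = p x := by
            rw [h0] at e
            simpa [sub_eq_zero] using e
          rw [this]
          exact ⟨hp1 x, hp2 x⟩)
    (measurable_one.indicator measurableSet_Ioc)).2
  simp only [Function.comp]
  rw [← h4, ← Complex.ofReal_mul, Complex.ofReal_re, integral_indicator_one measurableSet_Ioc]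

/-- Laplace transform at `1 / x`. -/
def lap (G : Measure ℝ) (x : ℝ) : ℝ := ∫ y, exp (-(y / x)) ∂G

lemma integrable_exp_neg_div {G : Measure ℝ} [IsProbabilityMeasure G] (hG0 : G (Iio 0) = 0) {x : ℝ}
    (hx : 0 < x) : Integrable (fun y => exp (-(y / x))) G := by
  refine Integrable.of_bound (C := 1) (by fun_prop) ?_
  have : ∀ᵐ y ∂G, 0 ≤ y := by rw [ae_iff]; convert hG0 using 2; ext; simp
  filter_upwards [this] with y hy
  rw [Real.norm_eq_abs, abs_exp]
  exact exp_le_one_iff.2 (neg_nonpos.2 (by positivity))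

lemma integrable_exp_neg_mul_rtail (G : Measure ℝ) [IsProbabilityMeasure G] (x : ℝ) :
    IntegrableOn (fun t => exp (-t) * rtail G (t * x)) (Ioi 0) := by
  have hm := measurable_rtail G
  refine (integrableOn_exp_neg_Ioi 0).mono' (by fun_prop) (ae_of_all _ fun t => ?_)
  rw [Real.norm_eq_abs, abs_of_nonneg (mul_nonneg (exp_nonneg _) (rtail_nonneg _ _))]
  exact mul_le_of_le_one_right (exp_nonneg _) (rtail_le_one _ _)

lemma one_sub_lap {G : Measure ℝ} [IsProbabilityMeasure G] (hG0 : G (Iio 0) = 0) {x : ℝ}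
    (hx : 0 < x) : 1 - lap G x = ∫ t in Ioi 0, exp (-t) * rtail G (t * x) := by
  have hae : ∀ᵐ y ∂G, 0 ≤ y := by rw [ae_iff]; convert hG0 using 2; ext; simp
  have h1 := lintegral_comp_eq_lintegral_meas_lt_mul (f := fun y => y / x) (g := fun t => exp (-t)) G
    (hae.mono fun y hy => div_nonneg hy hx.le) (by fun_prop)
    (fun t _ => Continuous.intervalIntegrable (by fun_prop) _ _) (ae_of_all _ fun t => exp_nonneg _)
  have e1 : ∀ y : ℝ, ∫ t in (0 : ℝ)..(y / x), exp (-t) = 1 - exp (-(y / x)) := by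
    intro y
    rw [intervalIntegral.integral_comp_neg (fun t => exp t), integral_exp]
    simp
  have e2 : 1 - lap G x = ∫ y, (1 - exp (-(y / x))) ∂G := by
    rw [integral_sub (integrable_const _) (integrable_exp_neg_div hG0 hx)]
    simp [lap]
  rw [e2, integral_eq_lintegral_of_nonneg_ae, integral_eq_lintegral_of_nonneg_ae]
  · congr 1
    simp only [e1] at h1
    rw [h1]
    refine lintegral_congr fun t => ?_
    rw [ENNReal.ofReal_mul (exp_nonneg _), ofReal_rtail, mul_comm]
    congr 2
    ext y
    simp only [mem_ofPred_eq, mem_Ioi]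
    rw [lt_div_iff₀ hx]
  · exact ae_of_all _ fun t => mul_nonneg (exp_nonneg _) (rtail_nonneg _ _)
  · exact (integrable_exp_neg_mul_rtail G x).aestronglyMeasurable
  · filter_upwards [hae] with y hy
    simp only [Pi.zero_apply, sub_nonneg]
    exact exp_le_one_iff.2 (neg_nonpos.2 (by positivity))
  · exact Measurable.aestronglyMeasurable (by fun_prop)

lemma RegTail.tendsto_one_sub_lap {G : Measure ℝ} [IsProbabilityMeasure G] {a : ℝ}
    (hG : RegTail G a) (ha : 0 < a) (ha1 : a < 1) (hG0 : G (Iio 0) = 0) :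
    Tendsto (fun x => (1 - lap G x) / rtail G x) atTop (𝓝 (Gamma (1 - a))) := by
  obtain ⟨a2, h2, h21⟩ := exists_between ha1
  obtain ⟨C, hC1, hC⟩ := hG.potter_upper h2 (by linarith)
  have hC0 : 0 < C := by linarith
  have hm := measurable_rtail G
  rw [Real.Gamma_eq_integral (by linarith)]
  have key : Tendsto (fun x => ∫ t in Ioi 0, exp (-t) * (rtail G (t * x) / rtail G x)) atTop
      (𝓝 (∫ t in Ioi 0, exp (-t) * t ^ (1 - a - 1))) := by
    refine tendsto_integral_filter_of_dominated_convergence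
      (fun t => C * (exp (-t) * t ^ (1 - a2 - 1)) + exp (-t)) ?_ ?_ ?_ ?_
    · exact Eventually.of_forall fun x => Measurable.aestronglyMeasurable (by fun_prop)
    · filter_upwards [eventually_gt_atTop 0] with x hx
      filter_upwards [ae_restrict_mem measurableSet_Ioi] with t ht
      have ht0 : 0 < t := ht
      have hv := hG.pos x
      have hvt := hG.pos (t * x)
      rw [Real.norm_eq_abs, abs_of_pos (by positivity)]
      have : rtail G (t * x) / rtail G x ≤ C * t ^ (1 - a2 - 1) + 1 := by
        rw [div_le_iff₀ hv]
        have hp : 0 ≤ C * t ^ (1 - a2 - 1) := by positivity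
        rcases le_or_gt t 1 with h1 | h1
        · have := hC (t * x) x (by positivity) (by nlinarith)
          rw [show x / (t * x) = t⁻¹ by field_simp, inv_rpow ht0.le, ← rpow_neg ht0.le,
            show -a2 = 1 - a2 - 1 by ring] at this
          nlinarith
        · have := rtail_antitone G (show x ≤ t * x by nlinarith)
          nlinarith
      calc exp (-t) * (rtail G (t * x) / rtail G x) ≤ exp (-t) * (C * t ^ (1 - a2 - 1) + 1) := by gcongr
        _ = _ := by ring
    · exact ((Real.GammaIntegral_convergent (by linarith)).const_mul C).add
        (integrableOn_exp_neg_Ioi 0)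
    · filter_upwards [ae_restrict_mem measurableSet_Ioi] with t ht
      have := (hG.lim t ht).const_mul (exp (-t))
      rwa [show -a = 1 - a - 1 by ring] at this
  refine key.congr' ?_
  filter_upwards [eventually_gt_atTop 0] with x hx
  rw [one_sub_lap hG0 hx, ← integral_div]
  exact integral_congr_ae (ae_of_all _ fun t => by simp only; ring)

lemma RegTail.one_sub_lap_pos {G : Measure ℝ} [IsProbabilityMeasure G] {a : ℝ}
    (hG : RegTail G a) (hG0 : G (Iio 0) = 0) {x : ℝ} (hx : 0 < x) : 0 < 1 - lap G x := by
  rw [one_sub_lap hG0 hx, setIntegral_pos_iff_support_of_nonneg_ae]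
  · have : Function.support (fun t => exp (-t) * rtail G (t * x)) = univ := by
      ext t
      simp [(hG.pos (t * x)).ne']
    rw [this]
    simp
  · exact ae_of_all _ fun t => mul_nonneg (exp_nonneg _) (rtail_nonneg _ _)
  · exact integrable_exp_neg_mul_rtail G x

lemma lintegral_exp_renewal {G : Measure ℝ} [IsProbabilityMeasure G] (hG0 : G (Iio 0) = 0) {x : ℝ}
    (hx : 0 < x) : ∫⁻ y, ENNReal.ofReal (exp (-(y / x))) ∂(renewal G) =
      (ENNReal.ofReal (1 - lap G x))⁻¹ := by
  have e : ∀ y : ℝ, -(y / x) = -(1 / x) * y := fun y => by ring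
  have h1 := lintegral_exp_convPow G (-(1 / x))
  simp only [← e] at h1
  rw [renewal, lintegral_sum_measure]
  simp only [h1, ENNReal.tsum_geometric]
  rw [lap, ENNReal.ofReal_sub _ (integral_nonneg fun y => exp_nonneg _), ENNReal.ofReal_one,
    ofReal_integral_eq_lintegral_ofReal (integrable_exp_neg_div hG0 hx)
      (ae_of_all _ fun y => exp_nonneg _)]

lemma RegTail.renewal_Iic_lt_top {G : Measure ℝ} [IsProbabilityMeasure G] {a : ℝ}
    (hG : RegTail G a) (hG0 : G (Iio 0) = 0) (M : ℝ) : renewal G (Iic M) < ⊤ := by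
  have h1 : ENNReal.ofReal (exp (-M)) * renewal G (Iic M) ≤ (ENNReal.ofReal (1 - lap G 1))⁻¹ := by
    rw [← lintegral_exp_renewal hG0 one_pos]
    have := mul_meas_ge_le_lintegral (μ := renewal G) (f := fun y => ENNReal.ofReal (exp (-(y / 1))))
      (by fun_prop) (ENNReal.ofReal (exp (-M)))
    refine le_trans ?_ this
    gcongr
    intro y hy
    have hy' : y ≤ M := hy
    simp only [div_one, mem_ofPred_eq]
    exact ENNReal.ofReal_le_ofReal (exp_le_exp.2 (by linarith))
  have h2 : (ENNReal.ofReal (1 - lap G 1))⁻¹ < ⊤ := by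
    rw [ENNReal.inv_lt_top, ENNReal.ofReal_pos]
    exact hG.one_sub_lap_pos hG0 one_pos
  by_contra h3
  rw [not_lt, top_le_iff] at h3
  rw [h3, ENNReal.mul_top (by simp [exp_pos])] at h1
  exact absurd (h1.trans_lt h2) (lt_irrefl _)

lemma renewal_Iio_zero {G : Measure ℝ} [IsProbabilityMeasure G] (hG0 : G (Iio 0) = 0) :
    renewal G (Iio 0) = 0 := by
  rw [renewal, Measure.sum_apply _ measurableSet_Iio]
  simp [convPow_Iio_zero hG0]

instance (G : Measure ℝ) [IsProbabilityMeasure G] : SFinite (renewal G) := by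
  unfold renewal
  infer_instance

lemma lintegral_exp_mul_measure_Ioc (U : Measure ℝ) [SFinite U] {x h : ℝ} (hx : 0 < x) (hh : 0 < h) :
    ∫⁻ t : ℝ, ENNReal.ofReal (exp (-(t / x))) * U (Ioc t (t + h)) =
      ENNReal.ofReal (x * (exp (h / x) - 1)) * ∫⁻ y, ENNReal.ofReal (exp (-(y / x))) ∂U := by
  have hS : MeasurableSet {p : ℝ × ℝ | p.2 ∈ Ioc p.1 (p.1 + h)} :=
    (measurableSet_lt measurable_fst measurable_snd).inter
      (measurableSet_le measurable_snd (measurable_fst.add_const h))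
  calc ∫⁻ t : ℝ, ENNReal.ofReal (exp (-(t / x))) * U (Ioc t (t + h))
      = ∫⁻ t : ℝ, (∫⁻ y, {p : ℝ × ℝ | p.2 ∈ Ioc p.1 (p.1 + h)}.indicator
          (fun p => ENNReal.ofReal (exp (-(p.1 / x)))) (t, y) ∂U) := by
        refine lintegral_congr fun t => ?_
        have : ∀ y, {p : ℝ × ℝ | p.2 ∈ Ioc p.1 (p.1 + h)}.indicator
          (fun p => ENNReal.ofReal (exp (-(p.1 / x)))) (t, y) = (Ioc t (t + h)).indicator
            (fun _ => ENNReal.ofReal (exp (-(t / x)))) y := by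
          intro y
          simp only [indicator, mem_ofPred_eq]
        simp only [this]
        rw [lintegral_indicator_const measurableSet_Ioc]
    _ = ∫⁻ y, (∫⁻ t : ℝ, {p : ℝ × ℝ | p.2 ∈ Ioc p.1 (p.1 + h)}.indicator
          (fun p => ENNReal.ofReal (exp (-(p.1 / x)))) (t, y)) ∂U := by
        refine lintegral_lintegral_swap ?_
        refine (Measurable.indicator ?_ hS).aemeasurable
        fun_prop
    _ = _ := by
        rw [← lintegral_const_mul _ (by fun_prop)]
        refine lintegral_congr fun y => ?_
        have : ∀ t, {p : ℝ × ℝ | p.2 ∈ Ioc p.1 (p.1 + h)}.indicator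
          (fun p => ENNReal.ofReal (exp (-(p.1 / x)))) (t, y) = (Ico (y - h) y).indicator
            (fun t => ENNReal.ofReal (exp (-(t / x)))) t := by
          intro t
          have : y ∈ Ioc t (t + h) ↔ t ∈ Ico (y - h) y := by
            simp only [mem_Ioc, mem_Ico, sub_le_iff_le_add]; tauto
          simp only [indicator, mem_ofPred_eq, this]
        simp only [this]
        rw [lintegral_indicator measurableSet_Ico, setLIntegral_congr Ico_ae_eq_Ioc,
          ← ofReal_integral_eq_lintegral_ofReal, ← intervalIntegral.integral_of_le (by linarith),
          ← ENNReal.ofReal_mul]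
        · congr 1
          have hd : ∀ t ∈ uIcc (y - h) y, HasDerivAt (fun t => -x * exp (-(t / x))) (exp (-(t / x))) t := by
            intro t _
            have h0 : HasDerivAt (fun t : ℝ => -(t / x)) (-(1 / x)) t :=
              ((hasDerivAt_id t).div_const x).neg
            refine ((h0.exp).const_mul (-x)).congr_deriv ?_
            field_simp
          rw [intervalIntegral.integral_eq_sub_of_hasDerivAt hd
            (Continuous.intervalIntegrable (by fun_prop) _ _)]
          rw [show -((y - h) / x) = h / x + -(y / x) by ring, exp_add]
          ring
        · have : 1 ≤ exp (h / x) := one_le_exp (by positivity)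
          exact mul_nonneg hx.le (by linarith)
        · exact (Continuous.integrableOn_Icc (by fun_prop)).mono_set Ioc_subset_Icc_self
        · exact ae_of_all _ fun t => exp_nonneg _

/-- Identification of the constant in the strong renewal theorem. -/
lemma RegTail.renewal_limit_eq {G : Measure ℝ} [IsProbabilityMeasure G] {a : ℝ}
    (hG : RegTail G a) (ha : 0 < a) (ha1 : a < 1) (hG0 : G (Iio 0) = 0) {h : ℝ} (hh : 0 < h) {c : ℝ}
    (hc : Tendsto (fun x => x * rtail G x * ((renewal G) (Ioc x (x + h))).toReal) atTop (𝓝 c)) :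
    c = h * sin (π * a) / π := by
  set U := renewal G with hU
  set f : ℝ → ℝ := fun t => (U (Ioc t (t + h))).toReal with hf
  have hUfin : ∀ t, U (Ioc t (t + h)) ≠ ⊤ := fun t =>
    (lt_of_le_of_lt (measure_mono Ioc_subset_Iic_self) (hG.renewal_Iic_lt_top hG0 (t + h))).ne
  have hf0 : ∀ t, 0 ≤ f t := fun t => ENNReal.toReal_nonneg
  have hfo : ∀ t, ENNReal.ofReal (f t) = U (Ioc t (t + h)) := fun t => ENNReal.ofReal_toReal (hUfin t)
  have hSm : MeasurableSet {p : ℝ × ℝ | p.2 ∈ Ioc p.1 (p.1 + h)} :=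
    (measurableSet_lt measurable_fst measurable_snd).inter
      (measurableSet_le measurable_snd (measurable_fst.add_const h))
  have hfm : Measurable f := (measurable_measure_prodMk_left hSm).ennreal_toReal
  have hneg : ∀ t, t < -h → f t = 0 := by
    intro t ht
    have : U (Ioc t (t + h)) = 0 :=
      measure_mono_null (fun y hy => show y < 0 by linarith [hy.2]) (renewal_Iio_zero hG0)
    simp [hf, this]
  have hm := measurable_rtail G
  have hlin : ∀ x, 0 < x → ∫⁻ t, ENNReal.ofReal (exp (-(t / x)) * f t) =
      ENNReal.ofReal (x * (exp (h / x) - 1) / (1 - lap G x)) := by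
    intro x hx
    have h1 := lintegral_exp_mul_measure_Ioc U hx hh
    rw [lintegral_exp_renewal hG0 hx] at h1
    rw [ENNReal.ofReal_div_of_pos (hG.one_sub_lap_pos hG0 hx), div_eq_mul_inv, ← h1]
    refine lintegral_congr fun t => ?_
    rw [ENNReal.ofReal_mul (exp_nonneg _), hfo]
  have hI : ∀ x, 0 < x → Integrable (fun t => exp (-(t / x)) * f t) := by
    intro x hx
    refine ⟨Measurable.aestronglyMeasurable (by fun_prop), ?_⟩
    rw [hasFiniteIntegral_iff_ofReal (ae_of_all _ fun t => mul_nonneg (exp_nonneg _) (hf0 t)), hlin x hx]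
    exact ENNReal.ofReal_lt_top
  have hIv : ∀ x, 0 < x → ∫ t, exp (-(t / x)) * f t = x * (exp (h / x) - 1) / (1 - lap G x) := by
    intro x hx
    rw [integral_eq_lintegral_of_nonneg_ae (ae_of_all _ fun t => mul_nonneg (exp_nonneg _) (hf0 t))
      (hI x hx).aestronglyMeasurable, hlin x hx, ENNReal.toReal_ofReal]
    have : 1 ≤ exp (h / x) := one_le_exp (by positivity)
    exact div_nonneg (mul_nonneg hx.le (by linarith)) (hG.one_sub_lap_pos hG0 hx).le
  have hGa := Real.Gamma_pos_of_pos (show 0 < 1 - a by linarith)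
  -- the total mass
  have htot : Tendsto (fun x => rtail G x * ∫ t, exp (-(t / x)) * f t) atTop
      (𝓝 (h / Gamma (1 - a))) := by
    have h1 := (hG.tendsto_one_sub_lap ha ha1 hG0).inv₀ hGa.ne'
    have h2 : Tendsto (fun x : ℝ => x * (exp (h / x) - 1)) atTop (𝓝 h) := by
      have hd : HasDerivAt (fun u : ℝ => exp (h * u)) h 0 := by
        have := ((hasDerivAt_id (0 : ℝ)).const_mul h).exp
        simpa using this
      have := hd.tendsto_slope_zero_right.comp tendsto_inv_atTop_nhdsGT_zero
      refine this.congr fun x => ?_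
      simp only [Function.comp, inv_inv, zero_add, mul_zero, exp_zero, smul_eq_mul]
      rw [div_eq_mul_inv]
    refine (h2.mul h1).congr' ?_
    filter_upwards [eventually_gt_atTop 0] with x hx
    rw [hIv x hx]
    have p1 := (hG.one_sub_lap_pos hG0 hx).ne'
    have p2 := (hG.pos x).ne'
    field_simp
  -- bounds for large arguments
  obtain ⟨t0, ht1, ht0⟩ : ∃ t0 : ℝ, 1 ≤ t0 ∧ ∀ t ≥ t0, t * rtail G t * f t ≤ |c| + 1 := by
    have := hc.eventually (gt_mem_nhds (show c < |c| + 1 by linarith [le_abs_self c]))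
    obtain ⟨t0, ht0⟩ := eventually_atTop.1 this
    exact ⟨max t0 1, le_max_right _ _, fun t ht => (ht0 t ((le_max_left _ _).trans ht)).le⟩
  set K := |c| + 1 with hK
  have hK0 : 0 < K := by positivity
  have hsmall : Tendsto (fun x => rtail G x * ∫ t in Iic t0, exp (-(t / x)) * f t) atTop (𝓝 0) := by
    set B := exp (h + t0) * ∫ t, exp (-(t / 1)) * f t with hB
    have hB' : Tendsto (fun x => rtail G x * B) atTop (𝓝 0) := by
      simpa using (tendsto_rtail_atTop G).mul_const B
    refine tendsto_of_tendsto_of_tendsto_of_le_of_le' tendsto_const_nhds hB' ?_ ?_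
    · exact Eventually.of_forall fun x => mul_nonneg (rtail_nonneg _ _)
        (integral_nonneg fun t => mul_nonneg (exp_nonneg _) (hf0 t))
    · filter_upwards [eventually_ge_atTop 1] with x hx
      have hx0 : 0 < x := by linarith
      refine mul_le_mul_of_nonneg_left ?_ (rtail_nonneg _ _)
      rw [hB, ← integral_const_mul]
      calc ∫ t in Iic t0, exp (-(t / x)) * f t
          ≤ ∫ t in Iic t0, exp (h + t0) * (exp (-(t / 1)) * f t) := by
            refine setIntegral_mono_on (hI x hx0).integrableOn
              ((hI 1 one_pos).const_mul _).integrableOn measurableSet_Iic fun t ht => ?_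
            rcases lt_or_ge t (-h) with h1 | h1
            · simp [hneg t h1]
            · rw [← mul_assoc, ← exp_add]
              refine mul_le_mul_of_nonneg_right (exp_le_exp.2 ?_) (hf0 t)
              have ht' : t ≤ t0 := ht
              have : -(t / x) ≤ h := by
                rw [← neg_div, div_le_iff₀ hx0]; nlinarith
              linarith
        _ ≤ _ := setIntegral_le_integral ((hI 1 one_pos).const_mul _) (ae_of_all _ fun t =>
            mul_nonneg (exp_nonneg _) (mul_nonneg (exp_nonneg _) (hf0 t)))
  have hlarge : Tendsto (fun x => rtail G x * ∫ t in Ioi t0, exp (-(t / x)) * f t) atTop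
      (𝓝 (c * Gamma a)) := by
    obtain ⟨C1, hC11, hC1⟩ := hG.potter_lower (a1 := a / 2) (by linarith) (by linarith)
      (show 0 < t0 by linarith)
    obtain ⟨C2, hC21, hC2⟩ := hG.potter_upper (a2 := a + 1) (by linarith) (by linarith)
    have key : Tendsto (fun x => ∫ s in Ioi 0, (Ioi (t0 / x)).indicator
        (fun s => exp (-s) * (x * rtail G x * f (s * x))) s) atTop
        (𝓝 (∫ s in Ioi 0, c * (exp (-s) * s ^ (a - 1)))) := by
      refine tendsto_integral_filter_of_dominated_convergence
        (fun s => K * (C1 * (exp (-s) * s ^ (a / 2 - 1)) + C2 * (exp (-s) * s ^ (a + 1 - 1)))) ?_ ?_ ?_ ?_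
      · exact Eventually.of_forall fun x => (Measurable.indicator (by fun_prop)
          measurableSet_Ioi).aestronglyMeasurable
      · filter_upwards [eventually_gt_atTop 0] with x hx
        filter_upwards [ae_restrict_mem measurableSet_Ioi] with s hs
        have hs0 : 0 < s := hs
        by_cases hst : s ∈ Ioi (t0 / x)
        · rw [indicator_of_mem hst, Real.norm_eq_abs, abs_of_nonneg (mul_nonneg (exp_nonneg _)
            (mul_nonneg (mul_nonneg hx.le (rtail_nonneg _ _)) (hf0 _)))]
          have hst' : t0 ≤ s * x := by
            have : t0 / x < s := hst
            rw [div_lt_iff₀ hx] at this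
            exact this.le
          have p1 := hG.pos x
          have p2 := hG.pos (s * x)
          have b1 := ht0 _ hst'
          have b2 : rtail G x ≤ (C1 * s ^ (a / 2) + C2 * s ^ (a + 1)) * rtail G (s * x) := by
            rcases le_or_gt s 1 with h1 | h1
            · have := hC1 (s * x) x hst' (by nlinarith)
              rw [show x / (s * x) = s⁻¹ by field_simp, inv_rpow hs0.le,
                inv_mul_le_iff₀ (by positivity)] at this
              have q : 0 ≤ C2 * s ^ (a + 1) * rtail G (s * x) := by positivity
              nlinarith
            · have := hC2 x (s * x) hx (by nlinarith)
              rw [show s * x / x = s by field_simp] at this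
              have q : 0 ≤ C1 * s ^ (a / 2) * rtail G (s * x) := by positivity
              nlinarith
          have b3 : x * rtail G x * f (s * x) ≤
              K * (C1 * s ^ (a / 2 - 1) + C2 * s ^ (a + 1 - 1)) := by
            rw [rpow_sub_one hs0.ne', rpow_sub_one hs0.ne' (a + 1)]
            calc x * rtail G x * f (s * x)
                ≤ x * ((C1 * s ^ (a / 2) + C2 * s ^ (a + 1)) * rtail G (s * x)) * f (s * x) := by
                  have := hf0 (s * x)
                  gcongr
              _ = (C1 * s ^ (a / 2) + C2 * s ^ (a + 1)) / s * (s * x * rtail G (s * x) * f (s * x)) := by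
                  field_simp
              _ ≤ (C1 * s ^ (a / 2) + C2 * s ^ (a + 1)) / s * K := by gcongr
              _ = _ := by ring
          calc exp (-s) * (x * rtail G x * f (s * x)) ≤ exp (-s) *
                (K * (C1 * s ^ (a / 2 - 1) + C2 * s ^ (a + 1 - 1))) := by gcongr
            _ = _ := by ring
        · rw [indicator_of_notMem hst, norm_zero]
          positivity
      · exact (((Real.GammaIntegral_convergent (by linarith)).const_mul C1).add
          ((Real.GammaIntegral_convergent (by linarith)).const_mul C2)).const_mul K
      · filter_upwards [ae_restrict_mem measurableSet_Ioi] with s hs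
        have hs0 : 0 < s := hs
        have h1 := hc.comp (tendsto_id.const_mul_atTop hs0)
        have h2 := (hG.lim s hs0).inv₀ (by positivity)
        have h3 := ((h1.mul h2).const_mul (exp (-s))).div_const s
        have e : exp (-s) * (c * (s ^ (-a))⁻¹) / s = c * (exp (-s) * s ^ (a - 1)) := by
          rw [rpow_neg hs0.le, inv_inv, rpow_sub_one hs0.ne']
          ring
        rw [e] at h3
        refine h3.congr' ?_
        filter_upwards [eventually_gt_atTop 0, eventually_gt_atTop (t0 / s)] with x hx hxs
        rw [indicator_of_mem]
        · have p1 := (hG.pos x).ne'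
          have p2 := (hG.pos (s * x)).ne'
          simp only [Function.comp, id]
          field_simp
          rfl
        · rw [div_lt_iff₀ hs0] at hxs
          rw [mem_Ioi, div_lt_iff₀ hx]
          linarith
    rw [integral_const_mul, ← Real.Gamma_eq_integral ha] at key
    refine key.congr' ?_
    filter_upwards [eventually_gt_atTop 0] with x hx
    rw [setIntegral_indicator measurableSet_Ioi]
    have hI2 : Ioi 0 ∩ Ioi (t0 / x) = Ioi (t0 / x) :=
      inter_eq_right.2 (Ioi_subset_Ioi (by positivity))
    rw [hI2]
    have h1 := integral_comp_mul_right_Ioi (fun t => exp (-(t / x)) * f t) (t0 / x) hx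
    rw [div_mul_cancel₀ _ hx.ne'] at h1
    have h2 : ∫ t in Ioi t0, exp (-(t / x)) * f t
        = x * ∫ s in Ioi (t0 / x), exp (-(s * x / x)) * f (s * x) := by
      rw [h1, smul_eq_mul, ← mul_assoc, mul_inv_cancel₀ hx.ne', one_mul]
    rw [h2, ← mul_assoc, ← integral_const_mul]
    refine integral_congr_ae (ae_of_all _ fun s => ?_)
    simp only
    rw [mul_div_cancel_right₀ _ hx.ne']
    ring
  have hsum := hsmall.add hlarge
  rw [zero_add] at hsum
  have heq : c * Gamma a = h / Gamma (1 - a) := by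
    refine tendsto_nhds_unique hsum (htot.congr' ?_)
    filter_upwards [eventually_gt_atTop 0] with x hx
    rw [← mul_add, ← compl_Iic, integral_add_compl measurableSet_Iic (hI x hx)]
  have hg := Real.Gamma_mul_Gamma_one_sub a
  have hg0 := Real.Gamma_pos_of_pos ha
  have hs : 0 < sin (π * a) := sin_pos_of_pos_of_lt_pi (by positivity) (by
    nlinarith [Real.pi_pos])
  have hpi := Real.pi_pos
  rw [eq_div_iff hs.ne'] at hg
  rw [eq_div_iff hGa.ne'] at heq
  rw [eq_div_iff hpi.ne', ← heq]
  linear_combination (-c) * hg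

lemma renewal_real_sub_wmeas_le {G : Measure ℝ} [IsProbabilityMeasure G] {s : ℝ} (hs0 : 0 ≤ s)
    (hs1 : s ≤ 1) (k : ℕ) {I : Set ℝ} (hI : MeasurableSet I) (hfin : renewal G I ≠ ⊤) {R : ℝ}
    (hR : ∀ t : Finset ℕ, ∑ n ∈ t, (1 - wt s k n) * (convPow G n).real I ≤ R) :
    (wmeas G s k).real I ≤ (renewal G I).toReal ∧
      (renewal G I).toReal ≤ (wmeas G s k).real I + R := by
  have hR0 : 0 ≤ R := by simpa using hR ∅
  have eU : renewal G I = ∑' n, convPow G n I := by rw [renewal, Measure.sum_apply _ hI]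
  have eW : wmeas G s k I = ∑' n, ENNReal.ofReal (wt s k n) * convPow G n I := by
    rw [wmeas, Measure.sum_apply _ hI]
    simp
  have hle : wmeas G s k I ≤ renewal G I := by
    rw [eU, eW]
    refine ENNReal.tsum_le_tsum fun n => ?_
    refine mul_le_of_le_one_left (zero_le) ?_
    rw [ENNReal.ofReal_le_one]
    exact wt_le_one hs0 hs1 k n
  have hWfin : wmeas G s k I ≠ ⊤ := (lt_of_le_of_lt hle hfin.lt_top).ne
  refine ⟨ENNReal.toReal_mono hfin hle, ?_⟩
  have hup : renewal G I ≤ wmeas G s k I + ENNReal.ofReal R := by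
    have e : renewal G I = wmeas G s k I + ∑' n, ENNReal.ofReal (1 - wt s k n) * convPow G n I := by
      rw [eU, eW, ← ENNReal.tsum_add]
      refine tsum_congr fun n => ?_
      rw [← add_mul, ← ENNReal.ofReal_add (wt_nonneg hs0 hs1 k n)
        (by linarith [wt_le_one hs0 hs1 k n])]
      simp
    rw [e]
    gcongr
    rw [ENNReal.tsum_eq_iSup_sum]
    refine iSup_le fun t => ?_
    calc ∑ n ∈ t, ENNReal.ofReal (1 - wt s k n) * convPow G n I
        = ENNReal.ofReal (∑ n ∈ t, (1 - wt s k n) * (convPow G n).real I) := by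
          have hw : ∀ n, 0 ≤ 1 - wt s k n := fun n => by linarith [wt_le_one hs0 hs1 k n]
          rw [ENNReal.ofReal_sum_of_nonneg fun n _ => mul_nonneg (hw n) measureReal_nonneg]
          refine Finset.sum_congr rfl fun n _ => ?_
          rw [ENNReal.ofReal_mul (hw n), ofReal_measureReal]
      _ ≤ _ := ENNReal.ofReal_le_ofReal (hR t)
  have := ENNReal.toReal_mono (ENNReal.add_ne_top.2 ⟨hWfin, ENNReal.ofReal_ne_top⟩) hup
  rwa [ENNReal.toReal_add hWfin ENNReal.ofReal_ne_top, ENNReal.toReal_ofReal hR0] at this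

/-- The strong renewal theorem for a positive law, under a smallness condition on the integral of
the local tail ratio. -/
theorem RegTail.srt {G : Measure ℝ} [IsProbabilityMeasure G] {a : ℝ}
    (hG : RegTail G a) (ha : 0 < a) (ha1 : a < 1) (hG0 : G (Iio 0) = 0)
    {h T : ℝ} (hh : 0 < h) (hT : 0 ≤ T)
    (har : (∀ t : ℝ, t ≠ 0 → charFun G t ≠ 1) ∨
      (ConcOn G h ∧ ∀ t : ℝ, t ≠ 0 → |t| ≤ π / h → charFun G t ≠ 1))
    {L : ℝ → ℝ} (hL : ∀ x, 1 ≤ L x)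
    (hsmall : Tendsto (fun x => x * rtail G x * ∑ n ∈ Finset.range ⌈L x⌉₊,
      (convPow G n).real (Ioc x (x + h))) atTop (𝓝 0))
    (hJ : ∀ c > 0, ∀ b > 0, ∀ κ > 0, ∀ ε > 0, ∃ δ0 > 0, ∀ δ : ℝ, 0 < δ → δ ≤ δ0 → ∀ᶠ x in atTop,
      ∃ J : ℝ, 0 ≤ J ∧ jint G h T (κ * x) (2 * x) ≤ ENNReal.ofReal J ∧
        J * rtail G x ^ 2 * sigInt G c b 2 (L x) (4 * δ / rtail G x) ≤ ε) :
    Tendsto (fun x => x * rtail G x * ((renewal G) (Ioc x (x + h))).toReal) atTop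
      (𝓝 (h * sin (π * a) / π)) := by
  obtain ⟨k, hk⟩ := exists_nat_gt (1 / (a / 2))
  have hk' : 1 < a / 2 * (k + 1) := by
    rw [div_lt_iff₀ (by positivity)] at hk
    nlinarith
  have hW : ∀ δ : ℝ, 0 < δ → ∃ c : ℝ, Tendsto (fun x => x * rtail G x *
      (wmeas G (δ / rtail G x / (1 + δ / rtail G x)) k).real (Ioc x (x + h))) atTop (𝓝 c) := by
    intro δ hδ
    rcases har with h1 | ⟨h1, h2⟩
    · exact hG.exists_tendsto_wmeas_nonarith ha ha1 hG0 hδ (by positivity) (by linarith) hk' hh h1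
    · exact hG.exists_tendsto_wmeas_arith ha ha1 hG0 hδ (by positivity) (by linarith) hk' hh h1 h2
  obtain ⟨c, hc, b, hb, κ, hκ, C, hC, hsum⟩ := hG.sum_convPow_Ioc_le ha ha1 hG0 hh hT
  obtain ⟨y, hy⟩ : ∃ y, Tendsto (fun x => x * rtail G x * ((renewal G) (Ioc x (x + h))).toReal) atTop
      (𝓝 y) := by
    refine exists_tendsto_of_approx fun ε hε => ?_
    set ε' := ε / (4 * C * 2 ^ k) with hε'
    have hε'0 : 0 < ε' := by positivity
    obtain ⟨δ0, hδ0, hδJ⟩ := hJ c hc b hb κ hκ ε' hε'0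
    set δ := min (min δ0 1) ε' with hδ
    have hδp : 0 < δ := by positivity
    have hδ1 : δ ≤ 1 := (min_le_left _ _).trans (min_le_right _ _)
    have hδ2 : δ ≤ δ0 := (min_le_left _ _).trans (min_le_left _ _)
    have hδ3 : δ ≤ ε' := min_le_right _ _
    obtain ⟨y, hy⟩ := hW δ hδp
    refine ⟨_, y, hy, ?_⟩
    filter_upwards [hsum δ hδp hδ1, hδJ δ hδp hδ2, eventually_gt_atTop 0,
      (tendsto_rtail_atTop G).eventually (gt_mem_nhds hδp),
      hsmall.eventually (gt_mem_nhds (show (0 : ℝ) < ε / 2 by positivity))]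
      with x hx1 ⟨J, hJ0, hJ1, hJ2⟩ hx hxv hxs
    have hv := hG.pos x
    have hm : 1 ≤ δ / rtail G x := (one_le_div hv).2 hxv.le
    set m := δ / rtail G x with hmdef
    have hm0 : 0 < m := by linarith
    have hs0 : 0 ≤ m / (1 + m) := by positivity
    have hs1 : m / (1 + m) ≤ 1 := (div_le_one (by positivity)).2 (by linarith)
    have hxv0 : 0 < x * rtail G x := by positivity
    have hfin : renewal G (Ioc x (x + h)) ≠ ⊤ :=
      (lt_of_le_of_lt (measure_mono Ioc_subset_Iic_self) (hG.renewal_Iic_lt_top hG0 (x + h))).ne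
    have h4 : 4 * δ / rtail G x = 4 * m := by rw [hmdef]; ring
    have hR : ∀ t : Finset ℕ, ∑ n ∈ t, (1 - wt (m / (1 + m)) k n) * (convPow G n).real (Ioc x (x + h))
        ≤ ε / (x * rtail G x) := by
      intro t
      rw [le_div_iff₀ hxv0, mul_comm, ← Finset.sum_filter_add_sum_filter_not t (fun n => n < ⌈L x⌉₊),
        mul_add]
      have hw0 : ∀ n, 0 ≤ 1 - wt (m / (1 + m)) k n := fun n => by linarith [wt_le_one hs0 hs1 k n]
      have p1 : x * rtail G x * ∑ n ∈ t.filter (fun n => n < ⌈L x⌉₊),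
          (1 - wt (m / (1 + m)) k n) * (convPow G n).real (Ioc x (x + h)) ≤ ε / 2 := by
        refine le_trans ?_ hxs.le
        gcongr
        calc _ ≤ ∑ n ∈ t.filter (fun n => n < ⌈L x⌉₊), (convPow G n).real (Ioc x (x + h)) := by
              refine Finset.sum_le_sum fun n _ => mul_le_of_le_one_left measureReal_nonneg ?_
              linarith [wt_nonneg hs0 hs1 k n]
          _ ≤ _ := by
              refine Finset.sum_le_sum_of_subset_of_nonneg ?_ fun _ _ _ => measureReal_nonneg
              intro n hn
              exact Finset.mem_range.2 (Finset.mem_filter.1 hn).2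
      have p2 : x * rtail G x * ∑ n ∈ t.filter (fun n => ¬ n < ⌈L x⌉₊),
          (1 - wt (m / (1 + m)) k n) * (convPow G n).real (Ioc x (x + h)) ≤ ε / 2 := by
        have q := hx1 J hJ0 hJ1 (L x) (by linarith [hL x]) (t.filter (fun n => ¬ n < ⌈L x⌉₊))
          (fun n hn => by
            have h1 := not_lt.1 (Finset.mem_filter.1 hn).2
            have h2 : L x ≤ n := Nat.ceil_le.1 h1
            refine ⟨?_, h2⟩
            exact_mod_cast (hL x).trans h2)
        have q2 : ∑ n ∈ t.filter (fun n => ¬ n < ⌈L x⌉₊),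
            (1 - wt (m / (1 + m)) k n) * (convPow G n).real (Ioc x (x + h)) ≤
            2 ^ k * ∑ n ∈ t.filter (fun n => ¬ n < ⌈L x⌉₊),
              exp (-(n / (4 * δ / rtail G x))) * (convPow G n).real (Ioc x (x + h)) := by
          rw [Finset.mul_sum]
          refine Finset.sum_le_sum fun n _ => ?_
          rw [← mul_assoc, h4]
          exact mul_le_mul_of_nonneg_right (one_sub_wt_le_exp hm k n) measureReal_nonneg
        calc _ ≤ x * rtail G x * (2 ^ k * ∑ n ∈ t.filter (fun n => ¬ n < ⌈L x⌉₊),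
              exp (-(n / (4 * δ / rtail G x))) * (convPow G n).real (Ioc x (x + h))) := by gcongr
          _ = 2 ^ k * (x * rtail G x * ∑ n ∈ t.filter (fun n => ¬ n < ⌈L x⌉₊),
              exp (-(n / (4 * δ / rtail G x))) * (convPow G n).real (Ioc x (x + h))) := by ring
          _ ≤ 2 ^ k * (C * (ε' + ε')) := by
              refine mul_le_mul_of_nonneg_left (q.trans ?_) (by positivity)
              gcongr
          _ = ε / 2 := by rw [hε']; field_simp; norm_num
      linarith
    obtain ⟨r1, r2⟩ := renewal_real_sub_wmeas_le hs0 hs1 k measurableSet_Ioc hfin hR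
    rw [← mul_sub, Real.norm_eq_abs, abs_of_nonneg (mul_nonneg hxv0.le (by linarith))]
    calc _ ≤ x * rtail G x * (ε / (x * rtail G x)) := by gcongr; linarith
      _ = ε := by field_simp
  rwa [hG.renewal_limit_eq ha ha1 hG0 hh hy] at hy

lemma norm_charFun_lt_one {F : Measure ℝ} [IsProbabilityMeasure F] {a : ℝ} (hF : RegTail F a)
    (ha : 0 < a) : ∃ b > 0, ∀ t : ℝ, 0 < t → t ≤ b → ‖charFun F t‖ < 1 := by
  have h23 : (0 : ℝ) < 2 ^ (-a) - 3 ^ (-a) := by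
    rw [sub_pos]
    exact rpow_lt_rpow_of_neg (by norm_num) (by norm_num) (by linarith)
  have h1 : ∀ᶠ x in atTop, 0 < rtail F (2 * x) / rtail F x - rtail F (3 * x) / rtail F x :=
    ((hF.lim 2 two_pos).sub (hF.lim 3 (by norm_num))).eventually (lt_mem_nhds h23)
  have h2 : ∀ᶠ x in atTop, rtail F x < rtail F 0 :=
    (tendsto_rtail_atTop F).eventually (gt_mem_nhds (hF.pos 0))
  obtain ⟨x0, hx0⟩ := eventually_atTop.1 (h1.and (h2.and (eventually_gt_atTop 0)))
  have hx0p : 0 < x0 := (hx0 x0 le_rfl).2.2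
  refine ⟨1 / x0, by positivity, fun t ht htb => ?_⟩
  have hxt : x0 ≤ 1 / t := by rwa [le_div_iff₀ ht, mul_comm, ← le_div_iff₀ hx0p]
  obtain ⟨hd, hhalf, hpos⟩ := hx0 _ hxt
  have hv := hF.pos (1 / t)
  rw [← sub_div] at hd
  have hd' := (div_pos_iff_of_pos_right hv).1 hd
  have hge := one_sub_norm_charFun_sq_ge F ht
  have e (p q : ℝ) (hpq : p ≤ q) : F.real (Ioc p q) = rtail F p - rtail F q := by
    have : Ioc p q = Ioi p \ Ioi q := by ext y; simp
    rw [this, measureReal_sdiff (Ioi_subset_Ioi hpq) measurableSet_Ioi]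
    rfl
  have e1 : 0 < F.real (Ioc (2 / t) (3 / t)) := by
    rw [e _ _ (by gcongr; norm_num), div_eq_mul_one_div 2 t, div_eq_mul_one_div 3 t]
    exact hd'
  have e2 : 0 < F.real (Icc 0 (1 / t)) := by
    have h := e 0 (1 / t) hpos.le
    have : F.real (Ioc 0 (1 / t)) ≤ F.real (Icc 0 (1 / t)) := measureReal_mono Ioc_subset_Icc_self
    linarith
  have : 0 < F.real (Ioc (2 / t) (3 / t)) * F.real (Icc 0 (1 / t)) := mul_pos e1 e2
  by_contra! hc
  nlinarith [hc]

section

variable {F : Measure ℝ} [IsProbabilityMeasure F] {ℓ : ℝ → ℝ}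

lemma RightTail.exists_lt (hRT : RightTail F ℓ) (y : ℝ) : ∃ t, 1 ≤ t ∧ y < ℓ t := by
  have h1 : ∀ᶠ x in atTop, 1 / 2 < rtail F x * ℓ x := hRT.eventually (lt_mem_nhds (by norm_num))
  have h2 : ∀ᶠ x in atTop, rtail F x < 1 / (2 * (|y| + 1)) :=
    (tendsto_rtail_atTop F).eventually (gt_mem_nhds (by positivity))
  obtain ⟨t, ht1, ht2, ht⟩ := (h1.and (h2.and (eventually_ge_atTop 1))).exists
  refine ⟨t, ht, lt_of_not_ge fun hle => ?_⟩
  have h0 := rtail_nonneg F t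
  rw [lt_div_iff₀ (by positivity)] at ht2
  have : rtail F t * ℓ t ≤ rtail F t * (|y| + 1) :=
    mul_le_mul_of_nonneg_left (by linarith [le_abs_self y]) h0
  nlinarith

lemma RightTail.one_le_linv (hRT : RightTail F ℓ) (y : ℝ) : 1 ≤ linv ℓ y :=
  le_csInf (hRT.exists_lt y) fun _ ht => ht.1

lemma RightTail.linv_mono (hRT : RightTail F ℓ) : Monotone (linv ℓ) := fun _ y hxy =>
  csInf_le_csInf ⟨1, fun _ ht => ht.1⟩ (hRT.exists_lt y) fun _ ht => ⟨ht.1, hxy.trans_lt ht.2⟩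

lemma WeakLimit.tendsto_linv {a : ℝ} (hF : RegTail F a) (ha : 0 < a) (hRT : RightTail F ℓ)
    {μ : Measure ℝ} [IsProbabilityMeasure μ] (hw : WeakLimit F ℓ μ) :
    Tendsto (fun n : ℕ => linv ℓ n) atTop atTop := by
  have hmono : Monotone fun n : ℕ => linv ℓ (n : ℝ) := fun m n hmn =>
    hRT.linv_mono (by exact_mod_cast hmn)
  rcases tendsto_atTop_of_monotone hmono with h | ⟨A, hA⟩
  · exact h
  exfalso
  have hA1 : 1 ≤ A := ge_of_tendsto' hA fun n => hRT.one_le_linv _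
  obtain ⟨b, hb, hlt⟩ := norm_charFun_lt_one hF ha
  have hcont : ∀ᶠ t in 𝓝 (0 : ℝ), 1 / 2 < (charFun μ t).re := by
    have hc : Continuous fun t => (charFun μ t).re := by fun_prop
    exact hc.continuousAt.eventually (lt_mem_nhds (by simp; norm_num))
  obtain ⟨ε, hε, hball⟩ := Metric.eventually_nhds_iff.1 hcont
  set t := min (ε / 2) (b * A) with ht
  have htp : 0 < t := by positivity
  have h12 : 1 / 2 < (charFun μ t).re := by
    refine hball ?_
    rw [Real.dist_eq, sub_zero, abs_of_pos htp]
    exact (min_le_left _ _).trans_lt (by linarith)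
  have hφA : ‖charFun F (t / A)‖ < 1 :=
    hlt _ (by positivity) ((div_le_iff₀ (by positivity)).2 (min_le_right _ _))
  set f : BoundedContinuousFunction ℝ ℝ := BoundedContinuousFunction.ofNormedAddCommGroup
    (fun x => cos (t * x)) (by fun_prop) 1 (fun x => by
      rw [Real.norm_eq_abs]; exact abs_cos_le_one _)
  have hfw := hw f
  have hlim : ∫ x, f x ∂μ = (charFun μ t).re := by rw [re_charFun]; rfl
  have hseq (n : ℕ) : ‖∫ x, f x ∂((convPow F n).map fun y => y / linv ℓ (n : ℝ))‖
      ≤ ‖charFun F (t / linv ℓ n)‖ ^ n := by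
    have e : ∫ x, f x ∂((convPow F n).map fun y => y / linv ℓ (n : ℝ))
        = (charFun (convPow F n) (t / linv ℓ n)).re := by
      rw [re_charFun, integral_map (by fun_prop) (by fun_prop)]
      refine integral_congr_ae (ae_of_all _ fun y => ?_)
      show cos (t * (y / _)) = _
      congr 1; ring
    rw [e, charFun_convPow, ← norm_pow]
    exact Complex.abs_re_le_norm _
  have hφn : Tendsto (fun n : ℕ => ‖charFun F (t / linv ℓ n)‖) atTop (𝓝 ‖charFun F (t / A)‖) := by
    have hc : Continuous fun t => ‖charFun F t‖ := by fun_prop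
    exact (hc.tendsto _).comp (tendsto_const_nhds.div hA (by positivity))
  obtain ⟨r, hr1, hr2⟩ := exists_between hφA
  have hzero : Tendsto (fun n : ℕ => ∫ x, f x ∂((convPow F n).map fun y => y / linv ℓ (n : ℝ)))
      atTop (𝓝 0) := by
    refine squeeze_zero_norm' ?_ (tendsto_pow_atTop_nhds_zero_of_lt_one
      ((norm_nonneg _).trans hr1.le) hr2)
    filter_upwards [hφn.eventually (gt_mem_nhds hr1)] with n hn
    exact (hseq n).trans (pow_le_pow_left₀ (norm_nonneg _) hn.le n)
  have := tendsto_nhds_unique hfw hzero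
  rw [hlim] at this
  linarith

lemma WeakLimit.exists_le_measure_Ioi {a : ℝ} (hF : RegTail F a) (ha : 0 < a)
    (hRT : RightTail F ℓ) {μ : Measure ℝ} [IsProbabilityMeasure μ] (hw : WeakLimit F ℓ μ)
    (hμ : 0 < μ (Ioi 0)) : ∃ c > 0, ∀ M : ℝ, ∃ n, c ≤ (convPow F n).real (Ioi M) := by
  have hδ : ∃ δ > 0, 0 < μ (Ioi δ) := by
    by_contra! hcon
    have : Ioi (0 : ℝ) = ⋃ n : ℕ, Ioi (1 / (n + 1 : ℝ)) := by
      ext x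
      simp only [mem_Ioi, mem_iUnion]
      exact ⟨fun hx => exists_nat_one_div_lt hx,
        fun ⟨n, hn⟩ => lt_trans (by positivity) hn⟩
    rw [this] at hμ
    refine hμ.ne' (measure_iUnion_null fun n => ?_)
    simpa using hcon (1 / (n + 1 : ℝ)) (by positivity)
  obtain ⟨δ, hδ, hμδ⟩ := hδ
  set f : BoundedContinuousFunction ℝ ℝ := BoundedContinuousFunction.ofNormedAddCommGroup
    (fun x => max 0 (min 1 (x - δ / 2))) (by fun_prop) 1 (fun x => by
      rw [Real.norm_eq_abs, abs_of_nonneg (le_max_left _ _)]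
      exact max_le zero_le_one (min_le_left _ _)) with hf
  have hf' (x : ℝ) : f x = max 0 (min 1 (x - δ / 2)) := rfl
  have hfpos : 0 < ∫ x, f x ∂μ := by
    rw [integral_pos_iff_support_of_nonneg (fun x => by rw [hf']; exact le_max_left _ _)
      (f.integrable μ)]
    refine hμδ.trans_le (measure_mono fun x hx => ?_)
    rw [Function.mem_support, hf']
    have : δ < x := hx
    exact (lt_max_of_lt_right (lt_min one_pos (by linarith))).ne'
  refine ⟨(∫ x, f x ∂μ) / 2, by positivity, fun M => ?_⟩
  have h1 := (hw f).eventually (lt_mem_nhds (half_lt_self hfpos))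
  have h2 := (hw.tendsto_linv hF ha hRT).eventually (eventually_ge_atTop (2 * |M| / δ))
  obtain ⟨n, hn1, hn2⟩ := (h1.and h2).exists
  refine ⟨n, hn1.le.trans ?_⟩
  have hlp : 0 < linv ℓ n := one_pos.trans_le (hRT.one_le_linv _)
  rw [integral_map (by fun_prop) (by fun_prop)]
  rw [← integral_indicator_one measurableSet_Ioi]
  have hi : Integrable ((Ioi M).indicator (1 : ℝ → ℝ)) (convPow F n) :=
    (integrable_const (1 : ℝ)).indicator measurableSet_Ioi
  refine integral_mono ?_ hi fun y => ?_
  · refine Integrable.of_bound (by fun_prop) 1 (ae_of_all _ fun x => ?_)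
    rw [hf', Real.norm_eq_abs, abs_of_nonneg (le_max_left _ _)]
    exact max_le zero_le_one (min_le_left _ _)
  · dsimp only
    rw [hf']
    by_cases hy : y ∈ Ioi M
    · rw [indicator_of_mem hy]
      exact max_le zero_le_one (min_le_left _ _)
    · rw [indicator_of_notMem hy]
      refine max_le le_rfl ((min_le_right _ _).trans ?_)
      rw [sub_nonpos, div_le_iff₀ hlp]
      rw [div_le_iff₀ hδ] at hn2
      have : y ≤ M := not_lt.1 hy
      linarith [le_abs_self M]

end

section Ladder

open ProbabilityTheory

variable {Ω : Type*}

lemma measurable_pSum [MeasurableSpace Ω] {X : ℕ → Ω → ℝ} {n : ℕ}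
    (hX : ∀ i < n, Measurable (X i)) : Measurable (pSum X n) :=
  Finset.measurable_fun_sum _ fun i hi => hX i (Finset.mem_range.1 hi)

lemma measurable_sInf_nat [MeasurableSpace Ω] {A : Ω → Set ℕ}
    (hA : ∀ n, MeasurableSet {ω | n ∈ A ω}) : Measurable fun ω => sInf (A ω) := by
  refine measurable_to_countable' fun k => ?_
  have : (fun ω => sInf (A ω)) ⁻¹' {k} =
      ({ω | k ∈ A ω} ∩ ⋂ j ∈ Iio k, {ω | j ∈ A ω}ᶜ) ∪ (⋂ j, {ω | j ∈ A ω}ᶜ ∩ {_ω | k = 0}) := by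
    ext ω
    simp only [mem_preimage, mem_singleton_iff, mem_union, mem_inter_iff, mem_iInter, mem_compl_iff,
      mem_ofPred_eq, mem_Iio]
    constructor
    · rintro rfl
      rcases (A ω).eq_empty_or_nonempty with h | h
      · right; intro i; simp [h]
      · left; exact ⟨Nat.sInf_mem h, fun j hj => Nat.notMem_of_lt_sInf hj⟩
    · rintro (⟨h1, h2⟩ | h)
      · refine le_antisymm (Nat.sInf_le h1) ?_
        by_contra! hlt
        exact h2 _ hlt (Nat.sInf_mem ⟨k, h1⟩)
      · have : A ω = ∅ := by ext j; simp [(h j).1]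
        rw [this, Nat.sInf_empty, (h 0).2]
  rw [this]
  refine ((hA k).inter (MeasurableSet.biInter (to_countable _) fun j _ => (hA j).compl)).union
    (MeasurableSet.iInter fun j => (hA j).compl.inter (MeasurableSet.const _))

lemma measurable_pSum_comp [MeasurableSpace Ω] {X : ℕ → Ω → ℝ} (hX : ∀ i, Measurable (X i))
    {N : Ω → ℕ} (hN : Measurable N) : Measurable fun ω => pSum X (N ω) ω := by
  have : Measurable fun p : ℕ × Ω => pSum X p.1 p.2 :=
    measurable_from_prod_countable_right fun n => measurable_pSum fun i _ => hX i
  exact this.comp (hN.prodMk measurable_id)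

lemma measurable_ladderTime [MeasurableSpace Ω] {X : ℕ → Ω → ℝ} (hX : ∀ i, Measurable (X i)) :
    ∀ k, Measurable (ladderTime X k)
  | 0 => measurable_const
  | k + 1 => by
    have ih := measurable_ladderTime hX k
    refine measurable_sInf_nat fun n => ?_
    refine MeasurableSet.inter (measurableSet_lt ih measurable_const) ?_
    exact measurableSet_lt (measurable_pSum_comp hX ih) (measurable_pSum fun i _ => hX i)

lemma measurable_ladderHeight [MeasurableSpace Ω] {X : ℕ → Ω → ℝ} (hX : ∀ i, Measurable (X i))
    (k : ℕ) : Measurable (ladderHeight X k) :=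
  measurable_pSum_comp hX (measurable_ladderTime hX k)

lemma measurable_measure_add_preimage (ν : Measure ℝ) [SFinite ν] {B : Set ℝ}
    (hB : MeasurableSet B) : Measurable fun x : ℝ => ν ((fun y => x + y) ⁻¹' B) :=
  measurable_measure_prodMk_left (measurable_add hB)

/-- Integrating out one of two independent summands. -/
lemma measure_inter_add_mem {m1 m2 : MeasurableSpace Ω} [m0 : MeasurableSpace Ω] {P : Measure Ω}
    [IsProbabilityMeasure P] (h1 : m1 ≤ m0) (h2 : m2 ≤ m0) (hind : Indep m1 m2 P)
    {D : Set Ω} (hD : MeasurableSet[m1] D) {S W : Ω → ℝ} (hS : Measurable[m1] S)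
    (hW : Measurable[m2] W) {B : Set ℝ} (hB : MeasurableSet B) :
    P (D ∩ {ω | S ω + W ω ∈ B}) = ∫⁻ ω in D, P.map W ((fun y => S ω + y) ⁻¹' B) ∂P := by
  have hS0 : Measurable S := hS.mono h1 le_rfl
  have hW0 : Measurable W := hW.mono h2 le_rfl
  have hD0 : MeasurableSet D := h1 _ hD
  set Y : Ω → ℝ × ℝ := fun ω => (D.indicator 1 ω, S ω) with hY
  have hY1 : Measurable[m1] Y :=
    Measurable.prodMk (Measurable.indicator (measurable_const : Measurable[m1] (1 : Ω → ℝ)) hD) hS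
  have hY0 : Measurable Y := hY1.mono h1 le_rfl
  have hYW : IndepFun Y W P :=
    indep_of_indep_of_le_left (indep_of_indep_of_le_right hind hW.comap_le) hY1.comap_le
  have hmap := (indepFun_iff_map_prod_eq_prod_map_map hY0.aemeasurable hW0.aemeasurable).1 hYW
  have : IsProbabilityMeasure (P.map W) := Measure.isProbabilityMeasure_map hW0.aemeasurable
  set A : Set ((ℝ × ℝ) × ℝ) := {p | p.1.1 = 1 ∧ p.1.2 + p.2 ∈ B}
  have hA : MeasurableSet A :=
    (measurableSet_eq_fun (by fun_prop) measurable_const).inter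
      (hB.preimage (by fun_prop : Measurable fun p : (ℝ × ℝ) × ℝ => p.1.2 + p.2))
  have hDi (ω : Ω) : D.indicator (1 : Ω → ℝ) ω = 1 ↔ ω ∈ D := by
    by_cases h : ω ∈ D <;> simp [h]
  have e1 : P (D ∩ {ω | S ω + W ω ∈ B}) = P.map (fun ω => (Y ω, W ω)) A := by
    rw [Measure.map_apply (hY0.prodMk hW0) hA]
    congr 1; ext ω
    simp [A, Y, hDi]
  rw [e1, hmap, Measure.prod_apply hA, lintegral_map (measurable_measure_prodMk_left hA) hY0,
    ← lintegral_indicator hD0]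
  refine lintegral_congr fun ω => ?_
  by_cases h : ω ∈ D
  · rw [indicator_of_mem h]
    congr 1; ext y; simp [A, Y, h]
  · rw [indicator_of_notMem h]
    have : Prod.mk (Y ω) ⁻¹' A = ∅ := by ext y; simp [A, Y, h]
    rw [this, measure_empty]

section

variable [MeasurableSpace Ω] {P : Measure Ω} [IsProbabilityMeasure P] {F : Measure ℝ}
  {X : ℕ → Ω → ℝ}

/-- The σ-algebra generated by the steps with index in `s`. -/
@[reducible]
def stepSigma (X : ℕ → Ω → ℝ) (s : Set ℕ) : MeasurableSpace Ω :=
  ⨆ i ∈ s, MeasurableSpace.comap (X i) inferInstance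

lemma measurable_stepSigma (X : ℕ → Ω → ℝ) {s : Set ℕ} {i : ℕ} (hi : i ∈ s) :
    Measurable[stepSigma X s] (X i) :=
  (comap_measurable (X i)).mono
    (le_iSup₂ (f := fun i (_ : i ∈ s) => MeasurableSpace.comap (X i) inferInstance) i hi) le_rfl

lemma IIDseq.stepSigma_le (hX : IIDseq P F X) (s : Set ℕ) : stepSigma X s ≤ ‹MeasurableSpace Ω› :=
  iSup₂_le fun i _ => (hX.1 i).comap_le

lemma IIDseq.indep_stepSigma (hX : IIDseq P F X) (m : ℕ) :
    Indep (stepSigma X (Iio m)) (stepSigma X (Ici m)) P :=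
  indep_iSup_of_disjoint (fun i => (hX.1 i).comap_le) hX.2.2
    (Iio_disjoint_Ici le_rfl)

lemma IIDseq.measure_inter_pSum_add_mem (hX : IIDseq P F X) {m : ℕ} {D : Set Ω}
    (hD : MeasurableSet[stepSigma X (Iio m)] D) {W : Ω → ℝ}
    (hW : Measurable[stepSigma X (Ici m)] W) {B : Set ℝ} (hB : MeasurableSet B) :
    P (D ∩ {ω | pSum X m ω + W ω ∈ B}) =
      ∫⁻ ω in D, P.map W ((fun y => pSum X m ω + y) ⁻¹' B) ∂P :=
  measure_inter_add_mem (hX.stepSigma_le _) (hX.stepSigma_le _) (hX.indep_stepSigma m) hD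
    (@measurable_pSum _ (stepSigma X (Iio m)) _ _ fun _ hi => measurable_stepSigma X hi) hW hB

lemma pSum_succ (X : ℕ → Ω → ℝ) (n : ℕ) (ω : Ω) : pSum X (n + 1) ω = pSum X n ω + X n ω :=
  Finset.sum_range_succ _ _

lemma IIDseq.map_pSum (hX : IIDseq P F X) [IsProbabilityMeasure F] (n : ℕ) :
    P.map (pSum X n) = convPow F n := by
  induction n with
  | zero =>
    have : pSum X 0 = fun _ => 0 := by ext ω; simp [pSum]
    rw [this, Measure.map_const, measure_univ, one_smul]; rfl
  | succ n ih =>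
    have hm (n) : Measurable (pSum X n) := measurable_pSum fun i _ => hX.1 i
    ext B hB
    rw [convPow_succ, ← ih, conv_apply _ _ hB, Measure.map_apply (hm _) hB]
    have := hX.measure_inter_pSum_add_mem (m := n) MeasurableSet.univ
      (measurable_stepSigma X (mem_Ici.2 le_rfl)) hB
    rw [univ_inter, Measure.restrict_univ, hX.2.1] at this
    rw [lintegral_map (measurable_measure_add_preimage F hB) (hm n), ← this]
    congr 1; ext ω
    simp [pSum_succ]

end

lemma pSum_add [MeasurableSpace Ω] (X : ℕ → Ω → ℝ) (m n : ℕ) (ω : Ω) :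
    pSum X (m + n) ω = pSum X m ω + pSum (fun i => X (m + i)) n ω :=
  Finset.sum_range_add _ _ _

lemma exists_pSum_le [MeasurableSpace Ω] (X : ℕ → Ω → ℝ) (k : ℕ) (ω : Ω) :
    ∃ M : ℕ, ∀ j ≤ k, pSum X j ω ≤ M := by
  obtain ⟨M, hM⟩ := exists_nat_ge (∑ j ∈ Finset.range (k + 1), |pSum X j ω|)
  refine ⟨M, fun j hj => (le_abs_self _).trans (le_trans ?_ hM)⟩
  exact Finset.single_le_sum (f := fun j => |pSum X j ω|) (fun _ _ => abs_nonneg _)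
    (Finset.mem_range.2 (by omega))

lemma pSum_unbounded_iff [MeasurableSpace Ω] (X : ℕ → Ω → ℝ) (k : ℕ) (ω : Ω) :
    (∀ M : ℕ, ∃ n, (M : ℝ) < pSum X n ω) ↔
      ∀ M : ℕ, ∃ n, (M : ℝ) < pSum (fun i => X (k + i)) n ω := by
  obtain ⟨K, hK⟩ := exists_pSum_le X k ω
  constructor <;> intro h M
  · obtain ⟨M', hM'⟩ := exists_nat_ge (M + pSum X k ω)
    obtain ⟨n, hn⟩ := h (max M' K)
    have hn' : max (M' : ℝ) K < pSum X n ω := by exact_mod_cast hn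
    have hkn : k < n := by
      by_contra! hle
      exact absurd (hK n hle) (not_le.2 ((le_max_right _ _).trans_lt hn'))
    refine ⟨n - k, ?_⟩
    have := pSum_add X k (n - k) ω
    rw [Nat.add_sub_of_le hkn.le] at this
    linarith [le_max_left (M' : ℝ) K]
  · obtain ⟨M', hM'⟩ := exists_nat_ge (M - pSum X k ω)
    obtain ⟨n, hn⟩ := h M'
    exact ⟨k + n, by rw [pSum_add]; linarith⟩

section

variable [MeasurableSpace Ω] {P : Measure Ω} [IsProbabilityMeasure P] {F : Measure ℝ}
  {X : ℕ → Ω → ℝ}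

/-- A walk that exceeds every level with a probability bounded below is unbounded above. -/
lemma IIDseq.ae_unbounded [IsProbabilityMeasure F] (hX : IIDseq P F X)
    (hc : ∃ c > 0, ∀ M : ℝ, ∃ n, c ≤ (convPow F n).real (Ioi M)) :
    ∀ᵐ ω ∂P, ∀ M : ℕ, ∃ n, (M : ℝ) < pSum X n ω := by
  obtain ⟨c, hc, hcM⟩ := hc
  have hmeas (n : ℕ) : Measurable (pSum X n) := measurable_pSum fun i _ => hX.1 i
  set E : ℕ → Set Ω := fun M => ⋃ n, {ω | (M : ℝ) < pSum X n ω}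
  have hE (M) : MeasurableSet (E M) :=
    MeasurableSet.iUnion fun n => measurableSet_lt measurable_const (hmeas n)
  have hset : {ω | ∀ M : ℕ, ∃ n, (M : ℝ) < pSum X n ω} = ⋂ M, E M := by
    ext ω; simp [E]
  have htail : MeasurableSet[limsup (fun i => MeasurableSpace.comap (X i) inferInstance) atTop]
      (⋂ M, E M) := by
    rw [limsup_eq_iInf_iSup_of_nat, MeasurableSpace.measurableSet_iInf]
    intro k
    have : (⋂ M, E M) = ⋂ M : ℕ, ⋃ n, {ω | (M : ℝ) < pSum (fun i => X (k + i)) n ω} := by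
      rw [← hset]
      ext ω
      rw [mem_ofPred_eq, pSum_unbounded_iff X k]
      simp
    rw [this]
    refine MeasurableSet.iInter fun M => MeasurableSet.iUnion fun n => ?_
    refine Measurable.prodMk (f := fun _ => (M : ℝ)) measurable_const ?_ measurableSet_lt'
    exact @measurable_pSum _ (stepSigma X (Ici k)) _ _ fun i _ =>
      measurable_stepSigma X (mem_Ici.2 (Nat.le_add_right k i))
  have hge : ENNReal.ofReal c ≤ P (⋂ M, E M) := by
    have hanti : Antitone E := fun M N hMN => iUnion_mono fun n ω (hω : (N : ℝ) < _) =>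
      lt_of_le_of_lt (by exact_mod_cast hMN) hω
    rw [hanti.measure_iInter (fun M => (hE M).nullMeasurableSet) ⟨0, measure_ne_top _ _⟩]
    refine le_iInf fun M => ?_
    obtain ⟨n, hn⟩ := hcM M
    rw [← hX.map_pSum n] at hn
    refine (ENNReal.ofReal_le_ofReal hn).trans ?_
    rw [measureReal_def, ENNReal.ofReal_toReal (measure_ne_top _ _),
      Measure.map_apply (hmeas n) measurableSet_Ioi]
    exact measure_mono (subset_iUnion (fun n => {ω | (M : ℝ) < pSum X n ω}) n)
  have h01 := measure_zero_or_one_of_measurableSet_limsup_atTop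
    (fun i => (hX.1 i).comap_le) hX.2.2 htail
  have h1 : P (⋂ M, E M) = 1 := h01.resolve_left fun h => by
    rw [h] at hge
    exact (ENNReal.ofReal_pos.2 hc).not_ge hge
  rw [← hset] at h1
  exact (prob_compl_eq_zero_iff (hset ▸ MeasurableSet.iInter hE)).2 h1

/-- The event that the `k`-th ladder epoch is `m`. -/
def ladderEvent (X : ℕ → Ω → ℝ) : ℕ → ℕ → Set Ω
  | 0, m => {_ω | m = 0}
  | k + 1, m => ⋃ j ∈ Iio m, ladderEvent X k j ∩
      ({ω | pSum X j ω < pSum X m ω} ∩ ⋂ i ∈ Ioo j m, {ω | pSum X i ω ≤ pSum X j ω})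

lemma measurableSet_ladderEvent (X : ℕ → Ω → ℝ) (k : ℕ) :
    ∀ m, MeasurableSet[stepSigma X (Iio m)] (ladderEvent X k m) := by
  induction k with
  | zero => exact fun m => MeasurableSet.const _
  | succ k ih =>
    intro m
    have hp (j) (hj : j ≤ m) : Measurable[stepSigma X (Iio m)] (pSum X j) :=
      @measurable_pSum _ (stepSigma X (Iio m)) _ _ fun i hi =>
        measurable_stepSigma X (mem_Iio.2 (lt_of_lt_of_le hi hj))
    refine MeasurableSet.biUnion (to_countable _) fun j hj => ?_
    have hjm : j ≤ m := (mem_Iio.1 hj).le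
    refine MeasurableSet.inter ?_ (MeasurableSet.inter ?_ ?_)
    · refine (?_ : stepSigma X (Iio j) ≤ stepSigma X (Iio m)) _ (ih j)
      exact biSup_mono fun i hi => lt_of_lt_of_le hi hjm
    · exact Measurable.prodMk (hp j hjm) (hp m le_rfl) measurableSet_lt'
    · refine MeasurableSet.biInter (to_countable _) fun i hi => ?_
      exact Measurable.prodMk (hp i hi.2.le) (hp j hjm) measurableSet_le'

lemma ladderTime_succ_mem {ω : Ω} (hω : ∀ M : ℕ, ∃ n, (M : ℝ) < pSum X n ω) (k : ℕ) :
    ladderTime X (k + 1) ω ∈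
      {n : ℕ | ladderTime X k ω < n ∧ pSum X (ladderTime X k ω) ω < pSum X n ω} := by
  refine Nat.sInf_mem ?_
  obtain ⟨K, hK⟩ := exists_pSum_le X (ladderTime X k ω) ω
  obtain ⟨n, hn⟩ := hω K
  refine ⟨n, ?_, (hK _ le_rfl).trans_lt hn⟩
  by_contra! hle
  exact absurd (hK n hle) (not_le.2 hn)

lemma pSum_le_of_lt_ladderTime {ω : Ω} {k i : ℕ} (h1 : ladderTime X k ω < i)
    (h2 : i < ladderTime X (k + 1) ω) : pSum X i ω ≤ pSum X (ladderTime X k ω) ω := by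
  by_contra! h
  exact Nat.notMem_of_lt_sInf h2 ⟨h1, h⟩

lemma mem_ladderEvent_iff {ω : Ω} (hω : ∀ M : ℕ, ∃ n, (M : ℝ) < pSum X n ω) (k : ℕ) :
    ∀ m, ω ∈ ladderEvent X k m ↔ ladderTime X k ω = m := by
  induction k with
  | zero => exact fun m => eq_comm
  | succ k ih =>
    intro m
    simp only [ladderEvent, mem_iUnion, mem_inter_iff, ih, mem_iInter, mem_ofPred_eq, exists_prop,
      mem_Iio, mem_Ioo]
    have hmem := ladderTime_succ_mem hω k
    constructor
    · rintro ⟨j, hj, rfl, h1, h2⟩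
      refine le_antisymm (Nat.sInf_le ⟨hj, h1⟩) ?_
      by_contra! hlt
      exact absurd (h2 _ ⟨hmem.1, hlt⟩) (not_le.2 hmem.2)
    · rintro rfl
      exact ⟨_, hmem.1, rfl, hmem.2, fun i hi => pSum_le_of_lt_ladderTime hi.1 hi.2⟩

lemma ladderHeight_one_pos {ω : Ω} (hω : ∀ M : ℕ, ∃ n, (M : ℝ) < pSum X n ω) :
    0 < ladderHeight X 1 ω := by
  have := (ladderTime_succ_mem hω 0).2
  simpa [ladderHeight, ladderTime, pSum] using this

lemma ladderHeight_succ {ω : Ω} (hω : ∀ M : ℕ, ∃ n, (M : ℝ) < pSum X n ω) {k m : ℕ}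
    (hm : ladderTime X k ω = m) :
    ladderHeight X (k + 1) ω = pSum X m ω + ladderHeight (fun i => X (m + i)) 1 ω := by
  have hω' := (pSum_unbounded_iff X m ω).1 hω
  have h0 : pSum (fun i => X (m + i)) 0 ω = 0 := Finset.sum_range_zero _
  have hT : ladderTime X (k + 1) ω = m + ladderTime (fun i => X (m + i)) 1 ω := by
    have hmem := ladderTime_succ_mem hω' 0
    have hmem' := ladderTime_succ_mem hω k
    rw [hm] at hmem'
    obtain ⟨h1, h2⟩ := hmem
    obtain ⟨h3, h4⟩ := hmem'
    refine le_antisymm ?_ ?_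
    · refine Nat.sInf_le ⟨?_, ?_⟩ <;> rw [hm]
      · have : 0 < ladderTime (fun i => X (m + i)) 1 ω := h1
        omega
      · rw [pSum_add]
        change pSum _ 0 ω < pSum _ (ladderTime _ 1 ω) ω at h2
        linarith
    · have : ladderTime (fun i => X (m + i)) 1 ω ≤ ladderTime X (k + 1) ω - m := by
        refine Nat.sInf_le ⟨?_, ?_⟩
        · show 0 < _
          omega
        · show pSum _ 0 ω < _
          have := pSum_add X m (ladderTime X (k + 1) ω - m) ω
          rw [Nat.add_sub_of_le h3.le] at this
          linarith
      omega
  rw [ladderHeight, hT, pSum_add]; rfl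

lemma IIDseq.map_ladderHeight_shift (hX : IIDseq P F X) [IsProbabilityMeasure F] (m k : ℕ) :
    P.map (ladderHeight (fun i => X (m + i)) k) = P.map (ladderHeight X k) := by
  have hlaw (g : ℕ → ℕ) (hg : g.Injective) :
      P.map (fun ω i => X (g i) ω) = Measure.infinitePi fun _ : ℕ => F := by
    rw [(hX.2.2.precomp hg).map_fun_eq_infinitePi_map (fun i => hX.1 (g i))]
    simp_rw [hX.2.1]
  have hcoord (Y : ℕ → Ω → ℝ) : ∀ k ω, ladderTime Y k ω =
      ladderTime (fun i (x : ℕ → ℝ) => x i) k (fun i => Y i ω) := by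
    intro k
    induction k with
    | zero => intro ω; rfl
    | succ k ih => intro ω; simp only [ladderTime, ih, pSum]
  have hH (Y : ℕ → Ω → ℝ) (hY : ∀ i, Measurable (Y i)) : P.map (ladderHeight Y k) =
      (P.map fun ω i => Y i ω).map (ladderHeight (fun i (x : ℕ → ℝ) => x i) k) := by
    rw [Measure.map_map (measurable_ladderHeight (fun i => measurable_pi_apply i) k)
      (measurable_pi_lambda _ hY)]
    congr 1; ext ω
    simp only [ladderHeight, hcoord Y k ω, Function.comp, pSum]
  rw [hH _ (fun i => hX.1 _), hH _ hX.1, hlaw (fun i => m + i) (fun i j h => by simpa using h),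
    ← hlaw id Function.injective_id]
  rfl

lemma measure_eq_tsum_inter {N : Ω → ℕ} (hN : Measurable N) {A : Set Ω} (hA : MeasurableSet A) :
    P A = ∑' m, P (N ⁻¹' {m} ∩ A) := by
  rw [← measure_iUnion]
  · congr 1; ext ω; simp
  · intro i j hij
    refine Disjoint.mono inter_subset_left inter_subset_left ?_
    exact (disjoint_singleton.2 hij).preimage _
  · exact fun m => (hN (measurableSet_singleton m)).inter hA

lemma IIDseq.map_ladderHeight (hX : IIDseq P F X) [IsProbabilityMeasure F]
    (hunb : ∀ᵐ ω ∂P, ∀ M : ℕ, ∃ n, (M : ℝ) < pSum X n ω) (k : ℕ) :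
    P.map (ladderHeight X k) = convPow (P.map (ladderHeight X 1)) k := by
  have hHm (k) : Measurable (ladderHeight X k) := measurable_ladderHeight hX.1 k
  have hTm (k) : Measurable (ladderTime X k) := measurable_ladderTime hX.1 k
  have : IsProbabilityMeasure (P.map (ladderHeight X 1)) :=
    Measure.isProbabilityMeasure_map (hHm 1).aemeasurable
  induction k with
  | zero =>
    have : ladderHeight X 0 = fun _ => 0 := by ext ω; simp [ladderHeight, ladderTime, pSum]
    rw [this, Measure.map_const, measure_univ, one_smul]; rfl
  | succ k ih =>
    ext B hB
    rw [convPow_succ, ← ih, conv_apply _ _ hB, Measure.map_apply (hHm _) hB,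
      lintegral_map (measurable_measure_add_preimage _ hB) (hHm k),
      measure_eq_tsum_inter (hTm k) (hHm _ hB)]
    have hsum : ∫⁻ ω, P.map (ladderHeight X 1) ((fun y => ladderHeight X k ω + y) ⁻¹' B) ∂P
        = ∑' m, ∫⁻ ω in ladderTime X k ⁻¹' {m},
          P.map (ladderHeight X 1) ((fun y => ladderHeight X k ω + y) ⁻¹' B) ∂P := by
      rw [← lintegral_iUnion (fun m => hTm k (measurableSet_singleton m))]
      · have : ⋃ i, ladderTime X k ⁻¹' {i} = univ := by ext ω; simp
        rw [this, Measure.restrict_univ]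
      · exact fun i j hij => (disjoint_singleton.2 hij).preimage _
    rw [hsum]
    refine tsum_congr fun m => ?_
    have hae : ladderEvent X k m =ᵐ[P] ladderTime X k ⁻¹' {m} := by
      filter_upwards [hunb] with ω hω
      exact propext (mem_ladderEvent_iff hω k m)
    have hW : Measurable[stepSigma X (Ici m)] (ladderHeight (fun i => X (m + i)) 1) :=
      @measurable_ladderHeight _ (stepSigma X (Ici m)) _ (fun i =>
        measurable_stepSigma X (mem_Ici.2 (Nat.le_add_right m i))) 1
    have hkey := hX.measure_inter_pSum_add_mem (measurableSet_ladderEvent X k m) hW hB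
    rw [hX.map_ladderHeight_shift, setLIntegral_congr hae] at hkey
    have e2 : ∫⁻ ω in ladderTime X k ⁻¹' {m},
          P.map (ladderHeight X 1) ((fun y => ladderHeight X k ω + y) ⁻¹' B) ∂P =
        ∫⁻ ω in ladderTime X k ⁻¹' {m},
          P.map (ladderHeight X 1) ((fun y => pSum X m ω + y) ⁻¹' B) ∂P := by
      refine setLIntegral_congr_fun (hTm k (measurableSet_singleton m)) fun ω hω => ?_
      have hω' : ladderTime X k ω = m := hω
      simp only [ladderHeight, hω']
    rw [e2, ← hkey]
    refine measure_congr ?_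
    filter_upwards [hunb] with ω hω
    refine propext ?_
    show (ladderTime X k ω = m ∧ ladderHeight X (k + 1) ω ∈ B) ↔ (ω ∈ ladderEvent X k m ∧ _)
    rw [mem_ladderEvent_iff hω]
    refine and_congr_right fun hm => ?_
    rw [ladderHeight_succ hω hm]; rfl

end

section

variable [MeasurableSpace Ω] {P : Measure Ω} [IsProbabilityMeasure P] {F : Measure ℝ}
  {X : ℕ → Ω → ℝ}

/-- The measure `∑ₘ P(-Sₘ ∈ ·, S₀ ≤ 0, …, Sₘ ≤ 0)`. -/
def preLadder (P : Measure Ω) (X : ℕ → Ω → ℝ) : Measure ℝ :=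
  Measure.sum fun m => (P.restrict {ω | ∀ j ≤ m, pSum X j ω ≤ 0}).map fun ω => -pSum X m ω

instance : SFinite (preLadder P X) := by unfold preLadder; infer_instance

lemma preimage_ladderHeight_one {B : Set ℝ} (hB : B ⊆ Ioi 0) :
    ladderHeight X 1 ⁻¹' B =
      ⋃ m, {ω | ∀ j ≤ m, pSum X j ω ≤ 0} ∩ {ω | pSum X m ω + X m ω ∈ B} := by
  have h0 (ω : Ω) : pSum X 0 ω = 0 := Finset.sum_range_zero _
  ext ω
  simp only [mem_preimage, mem_iUnion, mem_inter_iff, mem_ofPred_eq, ← pSum_succ]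
  have hT : ladderTime X 1 ω = sInf {n : ℕ | 0 < n ∧ pSum X 0 ω < pSum X n ω} := rfl
  constructor
  · intro hω
    rw [ladderHeight] at hω
    rcases Nat.eq_zero_or_pos (ladderTime X 1 ω) with hz | hp
    · rw [hz, h0] at hω
      exact absurd (hB hω) (lt_irrefl (0 : ℝ))
    · refine ⟨ladderTime X 1 ω - 1, fun j hj => ?_, by rwa [Nat.sub_add_cancel hp]⟩
      rcases Nat.eq_zero_or_pos j with rfl | hjp
      · rw [h0]
      · by_contra! hlt
        have : j < sInf {n : ℕ | 0 < n ∧ pSum X 0 ω < pSum X n ω} := by rw [← hT]; omega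
        exact Nat.notMem_of_lt_sInf this ⟨hjp, by rwa [h0]⟩
  · rintro ⟨m, hm, hmB⟩
    have : ladderTime X 1 ω = m + 1 := by
      rw [hT]
      have hmem : m + 1 ∈ {n : ℕ | 0 < n ∧ pSum X 0 ω < pSum X n ω} :=
        ⟨Nat.succ_pos m, by rw [h0]; exact hB hmB⟩
      refine le_antisymm (Nat.sInf_le hmem) ?_
      by_contra! hlt
      have h2 := (Nat.sInf_mem ⟨_, hmem⟩).2
      exact absurd (hm _ (Nat.lt_succ_iff.1 hlt)) (not_le.2 ((h0 ω).symm.trans_lt h2))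
    rwa [ladderHeight, this]

lemma IIDseq.map_ladderHeight_one_apply (hX : IIDseq P F X) [IsProbabilityMeasure F] {B : Set ℝ}
    (hB : MeasurableSet B) (hB0 : B ⊆ Ioi 0) :
    P.map (ladderHeight X 1) B = ∫⁻ y, F ((fun z => -y + z) ⁻¹' B) ∂(preLadder P X) := by
  have hp (m : ℕ) : Measurable (pSum X m) := measurable_pSum fun i _ => hX.1 i
  have hfm : Measurable fun y : ℝ => F ((fun z => -y + z) ⁻¹' B) :=
    (measurable_measure_add_preimage F hB).comp measurable_neg
  have hD (m : ℕ) : MeasurableSet[stepSigma X (Iio m)] {ω | ∀ j ≤ m, pSum X j ω ≤ 0} := by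
    have : {ω | ∀ j ≤ m, pSum X j ω ≤ 0} = ⋂ j ∈ Iic m, {ω | pSum X j ω ≤ 0} := by
      ext; simp
    rw [this]
    refine MeasurableSet.biInter (to_countable _) fun j hj => ?_
    refine Measurable.prodMk (g := fun _ => (0 : ℝ)) ?_ measurable_const measurableSet_le'
    exact @measurable_pSum _ (stepSigma X (Iio m)) _ _ fun i hi =>
      measurable_stepSigma X (lt_of_lt_of_le hi hj)
  have hD0 (m : ℕ) := hX.stepSigma_le _ _ (hD m)
  rw [Measure.map_apply (measurable_ladderHeight hX.1 1) hB, preimage_ladderHeight_one hB0,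
    measure_iUnion, preLadder, lintegral_sum_measure]
  · refine tsum_congr fun m => ?_
    rw [hX.measure_inter_pSum_add_mem (hD m) (measurable_stepSigma X (mem_Ici.2 le_rfl)) hB,
      hX.2.1, lintegral_map (g := fun ω => -pSum X m ω) hfm (hp m).neg]
    simp
  · have key : ∀ m n, m < n → Disjoint
        ({ω | ∀ j ≤ m, pSum X j ω ≤ 0} ∩ {ω | pSum X m ω + X m ω ∈ B})
        ({ω | ∀ j ≤ n, pSum X j ω ≤ 0} ∩ {ω | pSum X n ω + X n ω ∈ B}) := by
      intro m n hmn
      refine disjoint_left.2 fun ω h1 h2 => ?_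
      have h3 : pSum X (m + 1) ω ≤ 0 := h2.1 _ hmn
      rw [pSum_succ] at h3
      exact absurd (hB0 h1.2) (not_lt.2 h3)
    intro m n hmn
    rcases lt_or_gt_of_ne hmn with h | h
    · exact key m n h
    · exact (key n m h).symm
  · exact fun m => (hD0 m).inter (((hp m).add (hX.1 m)) hB)

lemma ae_preLadder_nonneg (hX : ∀ i, Measurable (X i)) : ∀ᵐ y ∂(preLadder P X), 0 ≤ y := by
  have hp (m : ℕ) : Measurable (pSum X m) := measurable_pSum fun i _ => hX i
  rw [preLadder, Measure.ae_sum_iff' measurableSet_Ici]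
  intro m
  rw [ae_map_iff (f := fun ω => -pSum X m ω) (hp m).neg.aemeasurable measurableSet_Ici]
  have hm : MeasurableSet {ω | ∀ j ≤ m, pSum X j ω ≤ 0} := by
    have : {ω | ∀ j ≤ m, pSum X j ω ≤ 0} = ⋂ j ∈ Iic m, {ω | pSum X j ω ≤ 0} := by
      ext; simp
    rw [this]
    exact MeasurableSet.biInter (to_countable _) fun j _ => measurableSet_le (hp j) measurable_const
  filter_upwards [ae_restrict_mem hm] with ω hω
  linarith [hω m le_rfl]

/-- A ladder height law carried by a lattice forces the step law onto the same lattice. -/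
lemma IIDseq.concOn_of_ladder (hX : IIDseq P F X) [IsProbabilityMeasure F]
    (hF : ∀ x, 0 < rtail F x) {d : ℝ} (hd : ConcOn (P.map (ladderHeight X 1)) d) :
    ConcOn F d := by
  set Λ : Set ℝ := {x : ℝ | ∃ k : ℤ, x = k * d} with hΛ
  have hΛm : MeasurableSet Λ := measurableSet_lattice d
  have hΛsub : ∀ x ∈ Λ, ∀ y ∈ Λ, x - y ∈ Λ := by
    rintro x ⟨k, rfl⟩ y ⟨l, rfl⟩
    exact ⟨k - l, by push_cast; ring⟩
  have hHm : Measurable (ladderHeight X 1) := measurable_ladderHeight hX.1 1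
  have : IsProbabilityMeasure (P.map (ladderHeight X 1)) :=
    Measure.isProbabilityMeasure_map hHm.aemeasurable
  have hB : MeasurableSet (Ioi 0 \ Λ) := measurableSet_Ioi.diff hΛm
  have h0 : P.map (ladderHeight X 1) (Ioi 0 \ Λ) = 0 :=
    measure_mono_null (fun x hx => hx.2) ((prob_compl_eq_zero_iff hΛm).2 hd)
  have hfm : Measurable fun y : ℝ => F ((fun z => -y + z) ⁻¹' (Ioi 0 \ Λ)) :=
    (measurable_measure_add_preimage F hB).comp measurable_neg
  rw [hX.map_ladderHeight_one_apply hB sdiff_subset, lintegral_eq_zero_iff hfm] at h0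
  have hp (m : ℕ) : Measurable (pSum X m) := measurable_pSum fun i _ => hX.1 i
  have hall (m : ℕ) : ∀ᵐ ω ∂P, (∀ j ≤ m, pSum X j ω ≤ 0) →
      F ((fun z => pSum X m ω + z) ⁻¹' (Ioi 0 \ Λ)) = 0 := by
    have hDm : MeasurableSet {ω | ∀ j ≤ m, pSum X j ω ≤ 0} := by
      have : {ω | ∀ j ≤ m, pSum X j ω ≤ 0} = ⋂ j ∈ Iic m, {ω | pSum X j ω ≤ 0} := by
        ext; simp
      rw [this]
      exact MeasurableSet.biInter (to_countable _) fun j _ =>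
        measurableSet_le (hp j) measurable_const
    have h := (ae_mono (Measure.le_sum (fun m =>
      (P.restrict {ω | ∀ j ≤ m, pSum X j ω ≤ 0}).map fun ω => -pSum X m ω) m)) h0
    have h' := (ae_restrict_iff' hDm).1
      (ae_of_ae_map (f := fun ω => -pSum X m ω) (hp m).neg.aemeasurable h)
    filter_upwards [h'] with ω hω hD
    simpa using hω hD
  have hpos : F (Ioi 0 \ Λ) = 0 := by
    obtain ⟨ω, hω⟩ := (hall 0).exists
    have h00 : pSum X 0 ω = 0 := Finset.sum_range_zero _
    have := hω fun j hj => by rw [Nat.le_zero.1 hj, h00]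
    simpa [h00] using this
  have hneg : ∀ᵐ w ∂F, w ≤ 0 → F ((fun z => w + z) ⁻¹' (Ioi 0 \ Λ)) = 0 := by
    have hh : ∀ᵐ ω ∂P, X 0 ω ≤ 0 → F ((fun z => X 0 ω + z) ⁻¹' (Ioi 0 \ Λ)) = 0 := by
      filter_upwards [hall 1] with ω hω hle
      have h1 : pSum X 1 ω = X 0 ω := by simp [pSum]
      rw [h1] at hω
      refine hω fun j hj => ?_
      interval_cases j <;> simp [pSum, hle]
    rw [← hX.2.1 0] at hh ⊢
    rw [ae_map_iff (hX.1 0).aemeasurable]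
    · exact hh
    · have : {w : ℝ | w ≤ 0 → P.map (X 0) ((fun z => w + z) ⁻¹' (Ioi 0 \ Λ)) = 0} =
          (Iic 0)ᶜ ∪ {w | P.map (X 0) ((fun z => w + z) ⁻¹' (Ioi 0 \ Λ)) = 0} := by
        ext w; simp only [mem_ofPred_eq, mem_union, mem_compl_iff, mem_Iic]; tauto
      rw [this]
      exact measurableSet_Iic.compl.union
        (measurable_measure_add_preimage _ hB (measurableSet_singleton 0))
  have hae : ∀ᵐ w ∂F, w ∈ Λ := by
    have h1 : ∀ᵐ w ∂F, w ∉ Ioi 0 \ Λ := measure_eq_zero_iff_ae_notMem.1 hpos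
    filter_upwards [h1, hneg] with w hw1 hw2
    by_contra hw
    have hw0 : w ≤ 0 := by
      by_contra! hlt
      exact hw1 ⟨hlt, hw⟩
    have hz := hw2 hw0
    have hsub : Ioi (-w) ⊆ (Ioi 0 \ Λ) ∪ (fun z => w + z) ⁻¹' (Ioi 0 \ Λ) := by
      intro z (hz : -w < z)
      by_cases hzΛ : z ∈ Λ
      · refine Or.inr ⟨show 0 < w + z by linarith, fun hwz => hw ?_⟩
        have := hΛsub _ hwz _ hzΛ
        rwa [add_sub_cancel_right] at this
      · exact Or.inl ⟨show 0 < z by linarith, hzΛ⟩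
    have : F (Ioi (-w)) = 0 := measure_mono_null hsub (measure_union_null hpos hz)
    have h3 := hF (-w)
    rw [rtail, this] at h3
    exact lt_irrefl _ h3
  exact (prob_compl_eq_zero_iff hΛm).1 hae

lemma IIDseq.concOn_ladder (hX : IIDseq P F X) [IsProbabilityMeasure F] {d : ℝ}
    (hd : ConcOn F d) : ConcOn (P.map (ladderHeight X 1)) d := by
  have hΛm := measurableSet_lattice d
  have hHm : Measurable (ladderHeight X 1) := measurable_ladderHeight hX.1 1
  have : IsProbabilityMeasure (P.map (ladderHeight X 1)) :=
    Measure.isProbabilityMeasure_map hHm.aemeasurable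
  have hae : ∀ᵐ ω ∂P, ∀ i, ∃ k : ℤ, X i ω = k * d := by
    rw [ae_all_iff]
    intro i
    have h : ∀ᵐ x ∂F, ∃ k : ℤ, x = k * d := (prob_compl_eq_zero_iff hΛm).2 hd
    rw [← hX.2.1 i] at h
    exact ae_of_ae_map (hX.1 i).aemeasurable h
  refine (prob_compl_eq_zero_iff hΛm).1 ?_
  have hgoal : ∀ᵐ x ∂(P.map (ladderHeight X 1)), ∃ k : ℤ, x = k * d := by
    rw [ae_map_iff hHm.aemeasurable hΛm]
    filter_upwards [hae] with ω hω
    choose k hk using hω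
    exact ⟨∑ i ∈ Finset.range (ladderTime X 1 ω), k i, by
      simp [ladderHeight, pSum, hk, Finset.sum_mul]⟩
  exact hgoal

lemma concOn_of_charFun_eq_one {μ : Measure ℝ} [IsProbabilityMeasure μ] {t : ℝ} (ht : t ≠ 0)
    (h : charFun μ t = 1) : ConcOn μ (2 * π / |t|) := by
  have hre := re_charFun μ t
  rw [h, Complex.one_re] at hre
  have hintg : Integrable (fun y => cos (t * y)) μ :=
    Integrable.of_bound (by fun_prop) 1 (ae_of_all _ fun x => abs_cos_le_one _)
  have h0 : ∫ y, (1 - cos (t * y)) ∂μ = 0 := by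
    rw [integral_sub (integrable_const _) hintg, ← hre]; simp
  rw [integral_eq_zero_iff_of_nonneg (f := fun y => 1 - cos (t * y))
    (fun y => by simpa using cos_le_one _) ((integrable_const _).sub hintg)] at h0
  refine (prob_compl_eq_zero_iff (measurableSet_lattice _)).1 ?_
  have : ∀ᵐ y ∂μ, ∃ k : ℤ, y = k * (2 * π / |t|) := by
    filter_upwards [h0] with y hy
    have : cos (t * y) = 1 := by
      have : 1 - cos (t * y) = 0 := hy
      linarith
    obtain ⟨n, hn⟩ := (cos_eq_one_iff _).1 this
    rcases abs_choice t with h | h <;> rw [h]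
    · exact ⟨n, by field_simp; linarith⟩
    · exact ⟨-n, by push_cast; field_simp; linarith⟩
  exact this

lemma IIDseq.ladder_charFun_ne_one (hX : IIDseq P F X) [IsProbabilityMeasure F]
    (hF : ∀ x, 0 < rtail F x) {h : ℝ} (hspan : SpanOK F h) :
    (∀ t ≠ 0, charFun (P.map (ladderHeight X 1)) t ≠ 1) ∨
      (ConcOn (P.map (ladderHeight X 1)) h ∧
        ∀ t ≠ 0, |t| ≤ π / h → charFun (P.map (ladderHeight X 1)) t ≠ 1) := by
  have hHm : Measurable (ladderHeight X 1) := measurable_ladderHeight hX.1 1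
  have : IsProbabilityMeasure (P.map (ladderHeight X 1)) :=
    Measure.isProbabilityMeasure_map hHm.aemeasurable
  have key (t : ℝ) (ht : t ≠ 0) (h1 : charFun (P.map (ladderHeight X 1)) t = 1) :
      ConcOn F (2 * π / |t|) :=
    hX.concOn_of_ladder hF (concOn_of_charFun_eq_one ht h1)
  obtain ⟨hh, hn | ⟨hc, hmax⟩⟩ := hspan
  · exact Or.inl fun t ht h1 => hn ⟨_, by positivity, key t ht h1⟩
  · refine Or.inr ⟨hX.concOn_ladder hc, fun t ht hle h1 => ?_⟩
    have ht' : 0 < |t| := abs_pos.2 ht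
    have := hmax _ (by positivity) (key t ht h1)
    rw [div_le_iff₀ ht'] at this
    rw [le_div_iff₀ hh] at hle
    linarith [pi_pos]

end

end Ladder

section

variable {F G V : Measure ℝ} [IsProbabilityMeasure F] [IsProbabilityMeasure G] [SFinite V]

lemma ofReal_omegaFn_sub_le {h T z : ℝ} (hF : ∀ x, 0 < rtail F x) (hG : ∀ x, 0 < rtail G x)
    (hT : 0 ≤ T) (hV : ∀ᵐ y ∂V, 0 ≤ y)
    (hGV : ∀ B, MeasurableSet B → B ⊆ Ioi 0 → G B = ∫⁻ y, F ((fun z => -y + z) ⁻¹' B) ∂V)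
    (hz : 0 < z) :
    ENNReal.ofReal (omegaFn G h z - T) ≤ ENNReal.ofReal (z / rtail G z) *
      ∫⁻ y, ENNReal.ofReal (rtail F (z + y) / (z + y)) *
        ENNReal.ofReal (omegaFn F h (z + y) - T) ∂V := by
  have hvz := hG z
  have hpre (y p q : ℝ) : (fun z => -y + z) ⁻¹' Ioc p q = Ioc (p + y) (q + y) := by
    rw [preimage_const_add_Ioc]; simp
  have hpre' (y p : ℝ) : (fun z => -y + z) ⁻¹' Ioi p = Ioi (p + y) := by
    rw [preimage_const_add_Ioi]; simp
  have hIoc : G (Ioc z (z + h)) = ∫⁻ y, F (Ioc (z + y) (z + y + h)) ∂V := by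
    rw [hGV _ measurableSet_Ioc fun x hx => hz.trans hx.1]
    refine lintegral_congr fun y => ?_
    rw [hpre, add_right_comm]
  have hIoi : G (Ioi z) = ∫⁻ y, F (Ioi (z + y)) ∂V := by
    rw [hGV _ measurableSet_Ioi fun x hx => hz.trans hx]
    exact lintegral_congr fun y => by rw [hpre']
  set R := ∫⁻ y, ENNReal.ofReal (rtail F (z + y) / (z + y)) *
        ENNReal.ofReal (omegaFn F h (z + y) - T) ∂V with hR
  have hle : G (Ioc z (z + h)) ≤ ENNReal.ofReal (T / z) * G (Ioi z) + R := by
    have hm : Measurable fun y => F (Ioi (z + y)) := by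
      have : (fun y => F (Ioi (z + y))) = fun y => ENNReal.ofReal (rtail F (z + y)) := by
        ext y; rw [ofReal_rtail]
      rw [this]
      exact ((measurable_rtail F).comp (measurable_const_add z)).ennreal_ofReal
    rw [hIoc, hIoi, ← lintegral_const_mul _ hm, hR, ← lintegral_add_left (hm.const_mul _)]
    refine lintegral_mono_ae ?_
    filter_upwards [hV] with y hy
    have hw : 0 < z + y := by linarith
    have hvw := hF (z + y)
    rw [← ENNReal.ofReal_toReal (measure_ne_top F (Ioc (z + y) (z + y + h)))]
    have e : (F (Ioc (z + y) (z + y + h))).toReal =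
        rtail F (z + y) / (z + y) * omegaFn F h (z + y) := by
      unfold omegaFn
      field_simp
    rw [e, ← ofReal_rtail, ← ENNReal.ofReal_mul (by positivity),
      ← ENNReal.ofReal_mul (by positivity)]
    refine le_trans (ENNReal.ofReal_le_ofReal ?_) ENNReal.ofReal_add_le
    have h1 : rtail F (z + y) / (z + y) * T ≤ T / z * rtail F (z + y) := by
      have : T / (z + y) ≤ T / z := by gcongr; linarith
      calc rtail F (z + y) / (z + y) * T = T / (z + y) * rtail F (z + y) := by ring
        _ ≤ _ := by gcongr
    have : rtail F (z + y) / (z + y) * omegaFn F h (z + y) = rtail F (z + y) / (z + y) * T +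
      rtail F (z + y) / (z + y) * (omegaFn F h (z + y) - T) := by ring
    linarith
  rw [ENNReal.ofReal_sub _ hT, tsub_le_iff_left]
  have e1 : ENNReal.ofReal (omegaFn G h z) = ENNReal.ofReal (z / rtail G z) * G (Ioc z (z + h)) := by
    rw [← ENNReal.ofReal_toReal (measure_ne_top G (Ioc z (z + h))),
      ← ENNReal.ofReal_mul (by positivity)]
    unfold omegaFn
    congr 1; ring
  have e2 : ENNReal.ofReal (z / rtail G z) * (ENNReal.ofReal (T / z) * G (Ioi z)) =
      ENNReal.ofReal T := by
    rw [← ofReal_rtail, ← ENNReal.ofReal_mul (by positivity), ← ENNReal.ofReal_mul (by positivity)]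
    congr 1; field_simp
  rw [e1, ← e2, ← mul_add]
  gcongr

lemma iUnion_Ioc_pow_mul {b p : ℝ} (hb : 1 < b) (hp : 0 < p) :
    Ioi p ⊆ ⋃ i : ℕ, Ioc (b ^ i * p) (b ^ (i + 1) * p) := by
  intro w (hw : p < w)
  have hbig : ∃ n : ℕ, w ≤ b ^ n * p := by
    obtain ⟨n, hn⟩ := pow_unbounded_of_one_lt (w / p) hb
    exact ⟨n, by rw [div_lt_iff₀ hp] at hn; exact hn.le⟩
  have h0 : Nat.find hbig ≠ 0 := fun h => by
    have := Nat.find_spec hbig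
    rw [h, pow_zero, one_mul] at this
    linarith
  obtain ⟨i, hi⟩ := Nat.exists_eq_succ_of_ne_zero h0
  refine mem_iUnion.2 ⟨i, ?_, ?_⟩
  · by_contra! hle
    exact Nat.find_min hbig (m := i) (by omega) hle
  · have := Nat.find_spec hbig
    rwa [hi] at this

/-- Local fluctuations of the ladder height law are controlled by those of the step law on a
geometric grid of scales. -/
lemma jint_ladder_le {aF h T : ℝ} (hF : RegTail F aF) (haF : 0 ≤ aF) (hG : ∀ x, 0 < rtail G x)
    (hT : 0 ≤ T) (hV : ∀ᵐ y ∂V, 0 ≤ y)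
    (hGV : ∀ B, MeasurableSet B → B ⊆ Ioi 0 → G B = ∫⁻ y, F ((fun z => -y + z) ⁻¹' B) ∂V) :
    ∃ C > 0, ∀ b p q : ℝ, 1 < b → 0 < p → p ≤ q →
      jint G h T p q ≤ ENNReal.ofReal (q / rtail G q) *
        ∑' i : ℕ, ENNReal.ofReal (C * (rtail G (b ^ i * p) / (b ^ i * p))) *
          jint F h T (b ^ i * p) (b ^ (i + 1) * p) := by
  obtain ⟨C0, hC0, hpot⟩ := hF.potter_upper (lt_add_one aF) (by linarith)
  set C := C0 * 2 ^ (aF + 1) with hC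
  have hCp : 0 < C := by positivity
  have hhalf (u : ℝ) (hu : 0 < u) : rtail F (u / 2) ≤ C * rtail F u := by
    refine (hpot (u / 2) u (by positivity) (by linarith)).trans (le_of_eq ?_)
    congr 3; field_simp
  refine ⟨C, hCp, fun b p q hb hp hpq => ?_⟩
  have hb0 : 0 < b := by linarith
  set k : ℝ → ℝ≥0∞ := fun w => ENNReal.ofReal (rtail F w / w) *
    ENNReal.ofReal (omegaFn F h w - T) with hk
  have hkm : Measurable k :=
    ((measurable_rtail F).div measurable_id).ennreal_ofReal.mul
      ((measurable_omegaFn F h).sub_const T).ennreal_ofReal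
  have hinner (y : ℝ) (hy : 0 ≤ y) : ∫⁻ z in Ioc p q, k (z + y) ≤
      ∑' i : ℕ, ENNReal.ofReal (C / (b ^ i * p)) * F (Ioi (b ^ i * p + y)) *
        jint F h T (b ^ i * p) (b ^ (i + 1) * p) := by
    calc ∫⁻ z in Ioc p q, k (z + y)
        ≤ ∫⁻ z, (Ioi (p + y)).indicator k (z + y) := by
          rw [← lintegral_indicator measurableSet_Ioc]
          refine lintegral_mono fun z => ?_
          by_cases hz : z ∈ Ioc p q
          · rw [indicator_of_mem hz, indicator_of_mem (show z + y ∈ Ioi (p + y) from mem_Ioi.2 (by linarith [hz.1]))]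
          · rw [indicator_of_notMem hz]; exact zero_le
      _ = ∫⁻ w, (Ioi (p + y)).indicator k w := lintegral_add_right_eq_self _ y
      _ = ∫⁻ w in Ioi p, (Ioi (p + y)).indicator k w := by
          rw [← lintegral_indicator measurableSet_Ioi, indicator_indicator, inter_eq_right.2]
          exact Ioi_subset_Ioi (by linarith)
      _ ≤ ∫⁻ w in ⋃ i : ℕ, Ioc (b ^ i * p) (b ^ (i + 1) * p), (Ioi (p + y)).indicator k w :=
          lintegral_mono_set (iUnion_Ioc_pow_mul hb hp)
      _ ≤ ∑' i : ℕ, ∫⁻ w in Ioc (b ^ i * p) (b ^ (i + 1) * p), (Ioi (p + y)).indicator k w :=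
          lintegral_iUnion_le _ _
      _ ≤ _ := by
          refine ENNReal.tsum_le_tsum fun i => ?_
          have hbi : 0 < b ^ i * p := by positivity
          rw [jint, ← lintegral_const_mul' _ _ (ENNReal.mul_ne_top ENNReal.ofReal_ne_top
            (measure_ne_top _ _))]
          refine setLIntegral_mono' measurableSet_Ioc fun w hw => ?_
          by_cases hwy : w ∈ Ioi (p + y)
          · rw [indicator_of_mem hwy, hk, ← ofReal_rtail, ← ENNReal.ofReal_mul (by positivity)]
            have hwy' : p + y < w := hwy
            have hw1 : b ^ i * p < w := hw.1
            have hw0 : 0 < w := hbi.trans hw1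
            refine mul_le_mul_left (ENNReal.ofReal_le_ofReal ?_) _
            have h1 : rtail F w ≤ C * rtail F (b ^ i * p + y) :=
              (rtail_antitone F (by linarith)).trans (hhalf (b ^ i * p + y) (by positivity))
            calc rtail F w / w ≤ (C * rtail F (b ^ i * p + y)) / (b ^ i * p) := by
                  gcongr
                  exact mul_nonneg hCp.le (rtail_nonneg F _)
              _ = _ := by ring
          · rw [indicator_of_notMem hwy]; exact zero_le
  have hIoi (z : ℝ) (hz : 0 < z) : ∫⁻ y, F (Ioi (z + y)) ∂V = G (Ioi z) := by
    rw [hGV _ measurableSet_Ioi fun x hx => hz.trans hx]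
    refine lintegral_congr fun y => ?_
    rw [preimage_const_add_Ioi]; simp
  have hFm (z : ℝ) : Measurable fun y => F (Ioi (z + y)) := by
    have : (fun y => F (Ioi (z + y))) = fun y => ENNReal.ofReal (rtail F (z + y)) := by
      ext y; rw [ofReal_rtail]
    rw [this]
    exact ((measurable_rtail F).comp (measurable_const_add z)).ennreal_ofReal
  have hq : 0 < q := hp.trans_le hpq
  calc jint G h T p q
      ≤ ∫⁻ z in Ioc p q, ENNReal.ofReal (q / rtail G q) * ∫⁻ y, k (z + y) ∂V := by
        refine setLIntegral_mono' measurableSet_Ioc fun z hz => ?_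
        have hz0 : 0 < z := hp.trans hz.1
        refine (ofReal_omegaFn_sub_le hF.pos hG hT hV hGV hz0).trans ?_
        refine mul_le_mul_left (ENNReal.ofReal_le_ofReal ?_) _
        have := hG q
        exact div_le_div₀ hq.le hz.2 this (rtail_antitone G hz.2)
    _ = ENNReal.ofReal (q / rtail G q) * ∫⁻ y, (∫⁻ z in Ioc p q, k (z + y)) ∂V := by
        rw [lintegral_const_mul' _ _ ENNReal.ofReal_ne_top, lintegral_lintegral_swap]
        exact (hkm.comp measurable_add).aemeasurable
    _ ≤ ENNReal.ofReal (q / rtail G q) * ∫⁻ y, (∑' i : ℕ,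
          ENNReal.ofReal (C / (b ^ i * p)) * F (Ioi (b ^ i * p + y)) *
            jint F h T (b ^ i * p) (b ^ (i + 1) * p)) ∂V := by
        refine mul_le_mul_right (lintegral_mono_ae ?_) _
        filter_upwards [hV] with y hy using hinner y hy
    _ = _ := by
        congr 1
        rw [lintegral_tsum fun i => (((hFm _).const_mul _).mul_const _).aemeasurable]
        refine tsum_congr fun i => ?_
        have hbi : 0 < b ^ i * p := by positivity
        rw [lintegral_mul_const _ ((hFm _).const_mul _), lintegral_const_mul _ (hFm _),
          hIoi _ hbi, ← ofReal_rtail, ← ENNReal.ofReal_mul (by positivity)]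
        congr 2; ring

lemma jint_le_Iof {h η T x p : ℝ} (hF : ∀ x, 0 < rtail F x) (hη : η ≤ 1)
    (hη0 : 0 ≤ η) (hx : 0 < x) (hp : (1 - η) * x ≤ p) :
    jint F h T p x ≤ ENNReal.ofReal (Iof F h η x T) := by
  have hle : (1 - η) * x ≤ x := by nlinarith
  have h0 : 0 ≤ (1 - η) * x := mul_nonneg (by linarith) hx.le
  have hvx := hF x
  rw [Iof, intervalIntegral.integral_of_le hle, ofReal_integral_eq_lintegral_ofReal]
  · calc jint F h T p x ≤ ∫⁻ w in Ioc ((1 - η) * x) x, ENNReal.ofReal (omegaFn F h w - T) :=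
          lintegral_mono_set (Ioc_subset_Ioc_left hp)
      _ = _ := by
          refine lintegral_congr fun w => ?_
          rw [ENNReal.ofReal_max, ENNReal.ofReal_zero, max_eq_left zero_le]
  · have hm : Measurable fun y => max (omegaFn F h y - T) 0 :=
      ((measurable_omegaFn F h).sub_const T).max measurable_const
    refine Measure.integrableOn_of_bounded (M := x / rtail F x + |T|) (by simp)
      hm.aestronglyMeasurable ?_
    refine (ae_restrict_iff' measurableSet_Ioc).2 (ae_of_all _ fun w hw => ?_)
    have hw0 : 0 ≤ w := h0.trans hw.1.le
    have hvw := hF w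
    rw [Real.norm_eq_abs, abs_of_nonneg (le_max_right _ _)]
    refine max_le ?_ (by positivity)
    have : omegaFn F h w ≤ x / rtail F x := by
      unfold omegaFn
      refine div_le_div₀ hx.le ?_ hvx (rtail_antitone F hw.2)
      calc w * (F (Ioc w (w + h))).toReal ≤ w * 1 :=
            mul_le_mul_of_nonneg_left measureReal_le_one hw0
        _ ≤ x := by linarith [hw.2]
    linarith [neg_abs_le T]
  · exact ae_of_all _ fun w => le_max_right _ _

end

section

variable {F G V : Measure ℝ} [IsProbabilityMeasure F] [IsProbabilityMeasure G] [SFinite V]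

/-- Transfer of an integral criterion from the step law to the ladder height law. -/
lemma jint_le_of_Iof {aF a a2 η h T b q κ : ℝ} (hF : RegTail F aF) (haF : 0 ≤ aF)
    (hG : RegTail G a) (h02 : 0 ≤ a2) (ha2 : a < a2) (hT : 0 ≤ T) (hV : ∀ᵐ y ∂V, 0 ≤ y)
    (hGV : ∀ B, MeasurableSet B → B ⊆ Ioi 0 → G B = ∫⁻ y, F ((fun z => -y + z) ⁻¹' B) ∂V)
    (hη0 : 0 ≤ η) (hη : η ≤ 1) (hb : 1 < b) (hbη : (1 - η) * b ≤ 1) (hq0 : 0 < q)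
    (hq : b ^ (a2 - 1) < q) (hκ : 0 < κ) (hκ2 : κ ≤ 2) {W : ℝ → ℝ} (hWpos : ∀ᶠ x in atTop, 0 < W x)
    (hW1 : ∃ c0 > 0, ∀ᶠ x in atTop, ∀ j : ℕ, c0 * q ^ j * W x ≤ W (b ^ j * x))
    (hW2 : ∃ C2 > 0, ∀ᶠ x in atTop, W x ≤ C2 * W (κ * x)) :
    ∃ C1 > 0, ∀ e : ℝ, 0 ≤ e → (∀ᶠ x in atTop, Iof F h η x T ≤ e / (rtail G x ^ 2 * W x)) →
      ∀ᶠ x in atTop, jint G h T (κ * x) (2 * x) ≤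
        ENNReal.ofReal (C1 * e / (rtail G x ^ 2 * W x)) := by
  obtain ⟨C0, hC0, hlad⟩ := jint_ladder_le (h := h) hF haF hG.pos hT hV hGV
  obtain ⟨C, hC1, hpot⟩ := hG.potter_upper ha2 h02
  obtain ⟨c0, hc0, hW1⟩ := hW1
  obtain ⟨C2, hC2, hW2⟩ := hW2
  have hb0 : 0 < b := by linarith
  set r := b ^ a2 / (b * q) with hr
  have hr0 : 0 < r := by positivity
  have hr1 : r < 1 := by
    rw [rpow_sub_one hb0.ne', div_lt_iff₀ hb0] at hq
    rw [hr, div_lt_one (by positivity)]; linarith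
  have hr1' : 0 < 1 - r := by linarith
  have hCp : 0 < C := by linarith
  set B := C0 * C ^ 2 * b ^ a2 * b ^ a2 / (c0 * q) with hB
  have hBp : 0 < B := by positivity
  refine ⟨2 / κ * (B / (1 - r)) * (C * 2 ^ a2) ^ 2 * C2, by positivity, fun e he hI => ?_⟩
  have hlim : Tendsto (fun x : ℝ => κ * x) atTop atTop := tendsto_id.const_mul_atTop hκ
  obtain ⟨x0, hx0⟩ := eventually_atTop.1 (hI.and (hWpos.and hW1))
  filter_upwards [hlim.eventually_ge_atTop (max x0 1), hW2, hWpos, eventually_gt_atTop 0] with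
    x hx hW2 hWx hxp
  set p := κ * x with hp
  have hpx : x0 ≤ p := (le_max_left _ _).trans hx
  have hp0 : 0 < p := by positivity
  have hterm (i : ℕ) : ENNReal.ofReal (C0 * (rtail G (b ^ i * p) / (b ^ i * p))) *
      jint F h T (b ^ i * p) (b ^ (i + 1) * p) ≤
      ENNReal.ofReal (B * e / (p * rtail G p * W p) * r ^ i) := by
    have hbi : 1 ≤ b ^ (i + 1) := one_le_pow₀ hb.le
    have hbp : p ≤ b ^ (i + 1) * p := le_mul_of_one_le_left hp0.le hbi
    have hj : jint F h T (b ^ i * p) (b ^ (i + 1) * p) ≤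
        ENNReal.ofReal (e / (rtail G (b ^ (i + 1) * p) ^ 2 * W (b ^ (i + 1) * p))) := by
      refine (jint_le_Iof hF.pos hη hη0 (by positivity) ?_).trans
        (ENNReal.ofReal_le_ofReal (hx0 _ (hpx.trans hbp)).1)
      calc (1 - η) * (b ^ (i + 1) * p) = ((1 - η) * b) * (b ^ i * p) := by ring
        _ ≤ 1 * (b ^ i * p) := by gcongr
        _ = _ := one_mul _
    have hv0 := hG.pos (b ^ i * p)
    refine (mul_le_mul_right hj _).trans ?_
    rw [← ENNReal.ofReal_mul (by positivity)]
    refine ENNReal.ofReal_le_ofReal ?_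
    have hv1 := hG.pos (b ^ (i + 1) * p)
    have hvp := hG.pos p
    have hWp := (hx0 p hpx).2.1
    have hWi := (hx0 p hpx).2.2 (i + 1)
    have hWi0 : 0 < W (b ^ (i + 1) * p) := lt_of_lt_of_le (by positivity) hWi
    have e1 : rtail G (b ^ i * p) ≤ C * b ^ a2 * rtail G (b ^ (i + 1) * p) := by
      have := hpot (b ^ i * p) (b ^ (i + 1) * p) (by positivity)
        (by rw [pow_succ, mul_right_comm]; exact le_mul_of_one_le_right (by positivity) hb.le)
      rwa [show b ^ (i + 1) * p / (b ^ i * p) = b by field_simp; ring] at this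
    have e2 : rtail G p ≤ C * (b ^ a2) ^ (i + 1) * rtail G (b ^ (i + 1) * p) := by
      have := hpot p (b ^ (i + 1) * p) hp0 hbp
      rwa [mul_div_cancel_right₀ _ hp0.ne', ← rpow_pow_comm hb0.le] at this
    set v0 := rtail G (b ^ i * p)
    set v1 := rtail G (b ^ (i + 1) * p)
    set W1 := W (b ^ (i + 1) * p)
    set vp := rtail G p
    set β := b ^ a2 with hβ
    have hβ0 : 0 < β := by positivity
    calc C0 * (v0 / (b ^ i * p)) * (e / (v1 ^ 2 * W1))
        ≤ C0 * (C * β * v1 / (b ^ i * p)) * (e / (v1 ^ 2 * W1)) := by gcongr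
      _ = C0 * (C * β / (b ^ i * p)) * e * (1 / v1) * (1 / W1) := by field_simp
      _ ≤ C0 * (C * β / (b ^ i * p)) * e * (C * β ^ (i + 1) / vp) *
          (1 / (c0 * q ^ (i + 1) * W p)) := by
          have e3 : 1 / v1 ≤ C * β ^ (i + 1) / vp := by
            rw [div_le_div_iff₀ hv1 hvp, one_mul]; exact e2
          have e4 : 1 / W1 ≤ 1 / (c0 * q ^ (i + 1) * W p) := by gcongr
          exact mul_le_mul (mul_le_mul_of_nonneg_left e3 (by positivity)) e4 (by positivity)
            (by positivity)
      _ = _ := by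
          rw [hB, hr, div_pow, mul_pow]; field_simp; ring
  have hvx := hG.pos x
  have hvp := hG.pos p
  have hv2 := hG.pos (2 * x)
  have hWp := (hx0 p hpx).2.1
  refine (hlad b p (2 * x) hb hp0 (by rw [hp]; gcongr)).trans ?_
  calc _ ≤ ENNReal.ofReal (2 * x / rtail G (2 * x)) *
        ∑' i : ℕ, ENNReal.ofReal (B * e / (p * rtail G p * W p) * r ^ i) :=
        mul_le_mul_right (ENNReal.tsum_le_tsum hterm) _
    _ = ENNReal.ofReal (2 * x / rtail G (2 * x) * (B * e / (p * rtail G p * W p) * (1 - r)⁻¹)) := by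
        rw [← ENNReal.ofReal_tsum_of_nonneg (fun i => by positivity)
          ((summable_geometric_of_lt_one hr0.le hr1).mul_left _), tsum_mul_left,
          tsum_geometric_of_lt_one hr0.le hr1, ← ENNReal.ofReal_mul (by positivity)]
    _ ≤ _ := by
        refine ENNReal.ofReal_le_ofReal ?_
        have e1 : rtail G x ≤ C * 2 ^ a2 * rtail G (2 * x) := by
          have := hpot x (2 * x) hxp (by linarith)
          rwa [mul_div_cancel_right₀ _ hxp.ne'] at this
        have e2 : rtail G (2 * x) ≤ rtail G p := rtail_antitone G (by rw [hp]; gcongr)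
        have e3 : 1 / rtail G (2 * x) ≤ C * 2 ^ a2 / rtail G x := by
          rw [div_le_div_iff₀ hv2 hvx, one_mul]; exact e1
        have e4 : 1 / rtail G p ≤ C * 2 ^ a2 / rtail G x :=
          (one_div_le_one_div_of_le hv2 e2).trans e3
        have e5 : 1 / W p ≤ C2 / W x := by
          rw [div_le_div_iff₀ hWp hWx, one_mul]; exact hW2
        calc _ = 2 / κ * (B / (1 - r)) * e * (1 / rtail G (2 * x)) * (1 / rtail G p) * (1 / W p) := by
              rw [hp]; field_simp
          _ ≤ 2 / κ * (B / (1 - r)) * e * (C * 2 ^ a2 / rtail G x) * (C * 2 ^ a2 / rtail G x) *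
              (C2 / W x) := by gcongr
          _ = _ := by field_simp

end

section

variable {G : Measure ℝ} [IsProbabilityMeasure G] {a : ℝ}

/-- Laplace-type integral of the squared reciprocal tail. -/
def dInt (G : Measure ℝ) (c b L : ℝ) : ℝ :=
  ∫ θ in Ioc 0 b, (1 / rtail G (1 / θ)) ^ 2 * exp (-(c * L * rtail G (1 / θ)))

lemma RegTail.inv_sq_le (hG : RegTail G a) {a2 : ℝ} (h02 : 0 ≤ a2) (ha2 : a < a2) :
    ∃ C ≥ 1, ∀ y θ : ℝ, 0 < y → 0 < θ → θ ≤ 1 / y →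
      (1 / rtail G (1 / θ)) ^ 2 ≤ (C / rtail G y) ^ 2 * y ^ (-(2 * a2)) * θ ^ (-(2 * a2)) := by
  obtain ⟨C, hC1, hC⟩ := hG.potter_upper ha2 h02
  refine ⟨C, hC1, fun y θ hy hθ hθy => ?_⟩
  have hle : y ≤ 1 / θ := by
    rw [le_div_iff₀ hθ, mul_comm]; rwa [le_div_iff₀ hy] at hθy
  have h1 := hC y (1 / θ) hy hle
  have hv := hG.pos (1 / θ)
  have hvy := hG.pos y
  have hC0 : 0 < C := by linarith
  have e : (1 / θ / y) ^ a2 = y ^ (-a2) * θ ^ (-a2) := by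
    rw [div_rpow (by positivity) hy.le, one_div, inv_rpow hθ.le, rpow_neg hy.le, rpow_neg hθ.le]
    ring
  rw [e] at h1
  have h2 : 1 / rtail G (1 / θ) ≤ C / rtail G y * (y ^ (-a2) * θ ^ (-a2)) := by
    rw [div_mul_eq_mul_div, div_le_div_iff₀ hv hvy, one_mul]; exact h1
  calc _ ≤ (C / rtail G y * (y ^ (-a2) * θ ^ (-a2))) ^ 2 := by gcongr
    _ = (C / rtail G y) ^ 2 * (y ^ (-a2)) ^ 2 * (θ ^ (-a2)) ^ 2 := by ring
    _ = _ := by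
      rw [← rpow_mul_natCast hy.le, ← rpow_mul_natCast hθ.le]
      congr 2 <;> [congr 1; skip] <;> push_cast <;> ring_nf

lemma RegTail.integrable_dInt (hG : RegTail G a) (ha0 : 0 ≤ a) (ha : a < 1 / 2) {b c L : ℝ}
    (hb : 0 < b) (hc : 0 ≤ c) (hL : 0 ≤ L) :
    IntegrableOn (fun θ => (1 / rtail G (1 / θ)) ^ 2 * exp (-(c * L * rtail G (1 / θ))))
      (Ioc 0 b) := by
  obtain ⟨a2, h1, h2⟩ := exists_between ha
  obtain ⟨C, hC1, hC⟩ := hG.inv_sq_le (ha0.trans h1.le) h1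
  have hm := measurable_rtail_inv G
  have hi : IntegrableOn (fun θ : ℝ => (C / rtail G (1 / b)) ^ 2 * (1 / b) ^ (-(2 * a2)) *
      θ ^ (-(2 * a2))) (Ioc 0 b) := by
    refine Integrable.const_mul ?_ _
    exact (intervalIntegrable_iff_integrableOn_Ioc_of_le hb.le).1
      (intervalIntegral.intervalIntegrable_rpow' (by linarith))
  refine Integrable.mono' hi (by fun_prop) ?_
  filter_upwards [ae_restrict_mem measurableSet_Ioc] with θ hθ
  have hv := hG.pos (1 / θ)
  rw [Real.norm_eq_abs, abs_of_nonneg (by positivity)]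
  calc _ ≤ (1 / rtail G (1 / θ)) ^ 2 * 1 := by
        gcongr; rw [exp_le_one_iff, neg_nonpos]; positivity
    _ ≤ _ := by
        rw [mul_one]
        exact hC _ _ (by positivity) hθ.1 (by rw [one_div_one_div]; exact hθ.2)

lemma RegTail.sigInt_le_dInt (hG : RegTail G a) (ha0 : 0 ≤ a) (ha : a < 1 / 2) {b b' c L M : ℝ}
    (hb : b ≤ b') (hb' : 0 < b') (hc : 0 ≤ c) (hL : 0 ≤ L) (hM : 0 ≤ M) :
    sigInt G c b 2 L M ≤ dInt G c b' L := by
  have hi := hG.integrable_dInt ha0 ha hb' hc hL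
  calc sigInt G c b 2 L M
      ≤ ∫ θ in Ioc 0 b, (1 / rtail G (1 / θ)) ^ 2 * exp (-(c * L * rtail G (1 / θ))) := by
        refine integral_mono (integrable_sigInt G 2 hc hL hM)
          (hi.mono_set (Ioc_subset_Ioc_right hb)) fun θ => ?_
        have hv := hG.pos (1 / θ)
        have h0 : 0 ≤ min (1 / rtail G (1 / θ)) M := le_min (by positivity) hM
        simp only
        gcongr
        exact min_le_left _ _
    _ ≤ _ := setIntegral_mono_set hi
        (ae_of_all _ fun θ => by simp only [Pi.zero_apply]; positivity)
        (Ioc_subset_Ioc_right hb).eventuallyLE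

lemma RegTail.dInt_pos (hG : RegTail G a) (ha0 : 0 ≤ a) (ha : a < 1 / 2) {b c L : ℝ}
    (hb : 0 < b) (hc : 0 ≤ c) (hL : 0 ≤ L) : 0 < dInt G c b L := by
  rw [dInt, setIntegral_pos_iff_support_of_nonneg_ae
    (ae_of_all _ fun θ => by simp only [Pi.zero_apply]; positivity)
    (hG.integrable_dInt ha0 ha hb hc hL)]
  have : (Function.support fun θ : ℝ => (1 / rtail G (1 / θ)) ^ 2 *
      exp (-(c * L * rtail G (1 / θ)))) = univ := by
    ext θ
    have hv := hG.pos (1 / θ)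
    simp only [Function.mem_support, mem_univ, iff_true]
    positivity
  rw [this, univ_inter]
  simpa using hb

lemma RegTail.dInt_anti (hG : RegTail G a) (ha0 : 0 ≤ a) (ha : a < 1 / 2) {b c L L' : ℝ}
    (hb : 0 < b) (hc : 0 ≤ c) (hL : 0 ≤ L) (hLL : L ≤ L') : dInt G c b L' ≤ dInt G c b L := by
  refine integral_mono (hG.integrable_dInt ha0 ha hb hc (hL.trans hLL))
    (hG.integrable_dInt ha0 ha hb hc hL) fun θ => ?_
  have hv := hG.pos (1 / θ)
  simp only
  gcongr

lemma RegTail.dInt_le_mul (hG : RegTail G a) (ha : a < 1 / 2) {a1 b c : ℝ} (h0 : 0 < a1)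
    (h1 : a1 < a) (hb : 0 < b) (hc : 0 ≤ c) :
    ∃ C > 0, ∀ L lam : ℝ, 0 ≤ L → 1 ≤ lam →
      dInt G c b L ≤ C * lam ^ (1 / a1 - 2) * dInt G c b (lam * L) := by
  obtain ⟨C, hC1, hC⟩ := hG.potter_lower h1 h0.le (one_div_pos.2 hb)
  have hC0 : 0 < C := by linarith
  refine ⟨C ^ (1 / a1), by positivity, fun L lam hL hlam => ?_⟩
  have hlam0 : 0 < lam := by linarith
  set m := (C * lam) ^ (1 / a1) with hm
  have hm0 : 0 < m := by positivity
  have hm1 : 1 ≤ m := one_le_rpow (by nlinarith) (by positivity)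
  have hma : m ^ a1 = C * lam := by
    rw [hm, ← rpow_mul (by positivity), one_div_mul_cancel h0.ne', rpow_one]
  set f : ℝ → ℝ := fun θ => (1 / rtail G (1 / θ)) ^ 2 * exp (-(c * (lam * L) * rtail G (1 / θ)))
    with hf
  have hi : IntegrableOn f (Ioc 0 b) :=
    hG.integrable_dInt (h0.le.trans h1.le) ha hb hc (by positivity)
  have hmb : b / m ≤ b := div_le_self hb.le hm1
  have hi2 : IntervalIntegrable (fun φ => f (φ / m)) volume 0 b := by
    have h := (intervalIntegrable_iff_integrableOn_Ioc_of_le (by positivity : (0 : ℝ) ≤ b / m)).2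
      (hi.mono_set (Ioc_subset_Ioc_right hmb))
    have h2 := h.comp_mul_left (c := m⁻¹)
    simpa [div_eq_mul_inv, mul_comm, hm0.ne', mul_assoc] using h2
  have hkey : lam ^ 2 * dInt G c b L ≤ ∫ φ in (0 : ℝ)..b, f (φ / m) := by
    rw [intervalIntegral.integral_of_le hb.le, dInt, ← integral_const_mul]
    refine setIntegral_mono_on
      ((hG.integrable_dInt (h0.le.trans h1.le) ha hb hc hL).const_mul _)
      ((intervalIntegrable_iff_integrableOn_Ioc_of_le hb.le).1 hi2) measurableSet_Ioc fun φ hφ => ?_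
    have hφ0 : 0 < φ := hφ.1
    have e1 : 1 / b ≤ 1 / φ := by gcongr; exact hφ.2
    have e2 : 1 / φ ≤ 1 / (φ / m) := by gcongr; exact div_le_self hφ0.le hm1
    have e3 := hC _ _ e1 e2
    rw [show 1 / (φ / m) / (1 / φ) = m by field_simp, hma, mul_assoc] at e3
    have e4 := le_of_mul_le_mul_left e3 hC0
    have hv1 := hG.pos (1 / φ)
    have hv2 := hG.pos (1 / (φ / m))
    simp only [hf]
    rw [← mul_assoc, ← mul_pow]
    gcongr ?_ ^ 2 * rexp (-?_)
    · rw [mul_one_div, div_le_div_iff₀ hv1 hv2, one_mul]; exact e4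
    · calc c * (lam * L) * rtail G (1 / (φ / m)) = c * L * (lam * rtail G (1 / (φ / m))) := by ring
        _ ≤ _ := by gcongr
  rw [intervalIntegral.integral_comp_div _ hm0.ne', zero_div, smul_eq_mul,
    intervalIntegral.integral_of_le (by positivity)] at hkey
  have hle : ∫ θ in Ioc 0 (b / m), f θ ≤ dInt G c b (lam * L) :=
    setIntegral_mono_set hi (ae_of_all _ fun θ => by simp only [Pi.zero_apply, hf]; positivity)
      (Ioc_subset_Ioc_right hmb).eventuallyLE
  have hfin : lam ^ 2 * dInt G c b L ≤ m * dInt G c b (lam * L) := hkey.trans (by gcongr)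
  rw [rpow_sub hlam0, rpow_two]
  rw [hm, mul_rpow hC0.le hlam0.le] at hfin
  calc dInt G c b L = lam ^ 2 * dInt G c b L / lam ^ 2 := by field_simp
    _ ≤ C ^ (1 / a1) * lam ^ (1 / a1) * dInt G c b (lam * L) / lam ^ 2 := by gcongr
    _ = _ := by ring

end

section

variable {G : Measure ℝ} [IsProbabilityMeasure G] {a : ℝ} {ℓ : ℝ → ℝ}

lemma RightTail.inv_rtail_le (hRT : RightTail G ℓ) (hG : ∀ x, 0 < rtail G x) :
    ∀ᶠ x in atTop, 1 / rtail G x ≤ 2 * ℓ x ∧ ℓ x ≤ 2 * (1 / rtail G x) := by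
  filter_upwards [hRT.eventually (lt_mem_nhds (by norm_num : (1 / 2 : ℝ) < 1)),
    hRT.eventually (gt_mem_nhds (by norm_num : (1 : ℝ) < 2))] with x h1 h2
  have := hG x
  constructor
  · rw [div_le_iff₀ this]; linarith
  · rw [mul_one_div, le_div_iff₀ this]; linarith

lemma RightTail.inv_rtail_linv_le (hRT : RightTail G ℓ) (hG : RegTail G a) (ha : 0 ≤ a) :
    ∃ C > 0, ∀ L : ℝ, 1 ≤ L → 1 / rtail G (linv ℓ L) ≤ C * L := by
  obtain ⟨t0, ht0⟩ := eventually_atTop.1 ((hRT.inv_rtail_le hG.pos).and (eventually_ge_atTop 1))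
  obtain ⟨C, hC1, hC⟩ := hG.potter_upper (lt_add_one a) (by linarith)
  have hC0 : 0 < C := by linarith
  have hv0 := hG.pos (2 * t0)
  refine ⟨C * 2 ^ (a + 1) * 2 + 1 / rtail G (2 * t0), by positivity, fun L hL => ?_⟩
  have hL0 : 0 < L := by linarith
  set A := linv ℓ L with hA
  have hA1 : 1 ≤ A := hRT.one_le_linv L
  have hvA := hG.pos A
  rw [add_mul]
  rcases le_total (2 * t0) A with h | h
  · have h1 := ht0 (A / 2) (by linarith)
    have h2 : ℓ (A / 2) ≤ L := by
      by_contra! hlt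
      have : A ≤ A / 2 := csInf_le ⟨1, fun _ ht => ht.1⟩ ⟨h1.2, hlt⟩
      linarith
    have h3 := hC (A / 2) A (by linarith) (by linarith)
    rw [show A / (A / 2) = 2 by field_simp] at h3
    have hv2 := hG.pos (A / 2)
    have h4 : 1 / rtail G A ≤ C * 2 ^ (a + 1) * (1 / rtail G (A / 2)) := by
      rw [mul_one_div, div_le_div_iff₀ hvA hv2, one_mul]; exact h3
    have h5 : 1 / rtail G (A / 2) ≤ 2 * L := by linarith [h1.1.1]
    have h6 : 0 ≤ 1 / rtail G (2 * t0) * L := by positivity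
    calc _ ≤ C * 2 ^ (a + 1) * (2 * L) := h4.trans (by gcongr)
      _ ≤ _ := by linarith
  · have h1 : 1 / rtail G A ≤ 1 / rtail G (2 * t0) :=
      one_div_le_one_div_of_le hv0 (rtail_antitone G h)
    have h2 : 1 / rtail G (2 * t0) * 1 ≤ 1 / rtail G (2 * t0) * L := by gcongr
    have h3 : 0 ≤ C * 2 ^ (a + 1) * 2 * L := by positivity
    linarith

lemma RegTail.dInt_le_linv (hG : RegTail G a) (hRT : RightTail G ℓ) (ha0 : 0 < a) (ha : a < 1 / 2)
    {b c : ℝ} (hb : 1 ≤ b) (hc : 0 < c) :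
    ∃ C > 0, ∀ L : ℝ, 1 ≤ L → dInt G c b L ≤ C * (L ^ 2 / linv ℓ L) := by
  obtain ⟨C0, hC0, hA⟩ := hRT.inv_rtail_linv_le hG ha0.le
  obtain ⟨a2, h1, h2⟩ := exists_between ha
  obtain ⟨C1, hC1, hC1'⟩ := hG.inv_sq_le (ha0.le.trans h1.le) h1
  obtain ⟨k, hk⟩ := exists_nat_gt (1 / (a / 2))
  have hN : 1 < a / 2 * (k + 2 : ℕ) := by
    rw [div_lt_iff₀ (by positivity)] at hk
    push_cast; nlinarith
  obtain ⟨C2, hC2, hC2'⟩ := hG.sigInt_zero_le (by linarith : a / 2 < a) (by positivity) hN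
    (by linarith : 0 < b) c
  have h12 : 0 < 1 - 2 * a2 := by linarith
  have hC1p : 0 < C1 := by linarith
  refine ⟨C1 ^ 2 * C0 ^ 2 / (1 - 2 * a2) + k.factorial / c ^ k * (C2 * 2 * C0 ^ (k + 2)),
    by positivity, fun L hL => ?_⟩
  have hL0 : 0 < L := by linarith
  set A := linv ℓ L
  have hA1 : 1 ≤ A := hRT.one_le_linv L
  have hA0 : 0 < A := by linarith
  have hvA := hG.pos A
  have hAL := hA L hL
  have hAb : 1 / A ≤ b := ((div_le_one hA0).2 hA1).trans hb
  have hi := hG.integrable_dInt ha0.le ha (by linarith : 0 < b) hc.le hL0.le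
  have hlow : ∫ θ in Ioc 0 (1 / A), (1 / rtail G (1 / θ)) ^ 2 * exp (-(c * L * rtail G (1 / θ))) ≤
      C1 ^ 2 * C0 ^ 2 / (1 - 2 * a2) * (L ^ 2 / A) := by
    have hr : IntervalIntegrable (fun θ : ℝ => θ ^ (-(2 * a2))) volume 0 (1 / A) :=
      intervalIntegral.intervalIntegrable_rpow' (by linarith)
    calc _ ≤ ∫ θ in Ioc 0 (1 / A), (C1 / rtail G A) ^ 2 * A ^ (-(2 * a2)) * θ ^ (-(2 * a2)) := by
          refine setIntegral_mono_on (hi.mono_set (Ioc_subset_Ioc_right hAb))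
            (((intervalIntegrable_iff_integrableOn_Ioc_of_le (by positivity)).1 hr).const_mul _)
            measurableSet_Ioc fun θ hθ => ?_
          have hv := hG.pos (1 / θ)
          calc _ ≤ (1 / rtail G (1 / θ)) ^ 2 * 1 := by
                gcongr; rw [exp_le_one_iff, neg_nonpos]; positivity
            _ ≤ _ := by rw [mul_one]; exact hC1' _ _ hA0 hθ.1 hθ.2
      _ = (C1 / rtail G A) ^ 2 * (A ^ (-(2 * a2)) * (1 / A) ^ (1 - 2 * a2)) / (1 - 2 * a2) := by
          rw [integral_const_mul, ← intervalIntegral.integral_of_le (by positivity),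
            integral_rpow (Or.inl (by linarith)), show -(2 * a2) + 1 = 1 - 2 * a2 by ring,
            zero_rpow h12.ne']
          ring
      _ = C1 ^ 2 * (1 / rtail G A) ^ 2 * (1 / A) / (1 - 2 * a2) := by
          rw [one_div A, inv_rpow hA0.le, ← rpow_neg hA0.le, ← rpow_add hA0,
            show -(2 * a2) + -(1 - 2 * a2) = -1 by ring, rpow_neg_one]
          ring
      _ ≤ C1 ^ 2 * (C0 * L) ^ 2 * (1 / A) / (1 - 2 * a2) := by gcongr
      _ = _ := by ring
  have hhigh : ∫ θ in Ioc (1 / A) b, (1 / rtail G (1 / θ)) ^ 2 * exp (-(c * L * rtail G (1 / θ))) ≤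
      k.factorial / c ^ k * (C2 * 2 * C0 ^ (k + 2)) * (L ^ 2 / A) := by
    have hs := integrable_sigInt G (c := c) (b := b) (k + 2) hc.le (le_refl 0)
      (by positivity : 0 ≤ 1 / rtail G A)
    calc _ ≤ ∫ θ in Ioc (1 / A) b, k.factorial / (c * L) ^ k *
          ((min (1 / rtail G (1 / θ)) (1 / rtail G A)) ^ (k + 2) *
            exp (-(c * 0 * rtail G (1 / θ)))) := by
          refine setIntegral_mono_on (hi.mono_set (Ioc_subset_Ioc_left (by positivity)))
            ((hs.mono_set (Ioc_subset_Ioc_left (by positivity))).const_mul _)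
            measurableSet_Ioc fun θ hθ => ?_
          have hθ0 : 0 < θ := lt_trans (by positivity) hθ.1
          have hv := hG.pos (1 / θ)
          have hle : 1 / θ ≤ A := by
            rw [div_le_iff₀ hθ0, mul_comm, ← div_le_iff₀ hA0]; exact hθ.1.le
          rw [min_eq_left (one_div_le_one_div_of_le hvA (rtail_antitone G hle)), mul_zero, zero_mul,
            neg_zero, exp_zero, mul_one, exp_neg]
          set v := rtail G (1 / θ)
          have hy := Real.pow_div_factorial_le_exp _ (by positivity : 0 ≤ c * L * v) k
          have hinv : (exp (c * L * v))⁻¹ ≤ k.factorial / (c * L * v) ^ k := by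
            rw [← inv_div]; exact inv_anti₀ (by positivity) hy
          calc (1 / v) ^ 2 * (exp (c * L * v))⁻¹ ≤ (1 / v) ^ 2 * (k.factorial / (c * L * v) ^ k) := by
                gcongr
            _ = _ := by rw [mul_pow _ v, pow_add, one_div_pow, one_div_pow]; field_simp
      _ = k.factorial / (c * L) ^ k * ∫ θ in Ioc (1 / A) b,
          ((min (1 / rtail G (1 / θ)) (1 / rtail G A)) ^ (k + 2) *
            exp (-(c * 0 * rtail G (1 / θ)))) := integral_const_mul _ _
      _ ≤ k.factorial / (c * L) ^ k * sigInt G c b (k + 2) 0 (1 / rtail G A) := by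
          refine mul_le_mul_of_nonneg_left ?_ (by positivity)
          refine setIntegral_mono_set hs (ae_of_all _ fun θ => ?_)
            (Ioc_subset_Ioc_left (by positivity)).eventuallyLE
          have hv := hG.pos (1 / θ)
          simp only [Pi.zero_apply]
          positivity
      _ ≤ k.factorial / (c * L) ^ k *
          (C2 * ((1 / rtail G A) ^ (k + 2) + (1 / rtail G A) ^ (k + 2)) / A) := by
          gcongr
          refine hC2' A _ (le_trans ?_ hA1) (by positivity)
          rw [div_le_one (by linarith)]; exact hb
      _ = k.factorial / (c * L) ^ k * (C2 * 2 * (1 / rtail G A) ^ (k + 2) / A) := by ring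
      _ ≤ k.factorial / (c * L) ^ k * (C2 * 2 * (C0 * L) ^ (k + 2) / A) := by gcongr
      _ = _ := by rw [mul_pow c, mul_pow C0, pow_add L]; field_simp
  have hsplit : dInt G c b L = (∫ θ in Ioc 0 (1 / A), (1 / rtail G (1 / θ)) ^ 2 *
      exp (-(c * L * rtail G (1 / θ)))) + ∫ θ in Ioc (1 / A) b, (1 / rtail G (1 / θ)) ^ 2 *
      exp (-(c * L * rtail G (1 / θ))) := by
    rw [dInt, ← Ioc_union_Ioc_eq_Ioc (by positivity : (0 : ℝ) ≤ 1 / A) hAb,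
      setIntegral_union (Ioc_disjoint_Ioc_of_le le_rfl) measurableSet_Ioc
        (hi.mono_set (Ioc_subset_Ioc_right hAb))
        (hi.mono_set (Ioc_subset_Ioc_left (by positivity)))]
  rw [hsplit, add_mul]
  exact add_le_add hlow hhigh

end

section

variable {F G V : Measure ℝ} [IsProbabilityMeasure F] [IsProbabilityMeasure G] [SFinite V]
  {a : ℝ} {L : ℝ → ℝ}

lemma RegVary.le_of_rtail_mul_tendsto {β : ℝ} (hL : RegVary L β) (hG : RegTail G a)
    (hlim : Tendsto (fun x => rtail G x * L x) atTop (𝓝 0)) : β ≤ a := by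
  by_contra! hlt
  have h2 := (hG.lim 2 (by norm_num)).mul (hL.2 2 (by norm_num))
  rw [← rpow_add (by norm_num)] at h2
  have h1 : (1 : ℝ) < 2 ^ (-a + β) := one_lt_rpow (by norm_num) (by linarith)
  obtain ⟨x0, hx0⟩ := eventually_atTop.1
    ((h2.eventually (lt_mem_nhds h1)).and (eventually_gt_atTop 0))
  set g : ℝ → ℝ := fun x => rtail G x * L x with hg
  have hstep (x : ℝ) (hx : x0 ≤ x) : g x ≤ g (2 * x) := by
    obtain ⟨h3, hx⟩ := hx0 x hx
    have hp : 0 < g x := mul_pos (hG.pos x) (hL.1 x hx)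
    rw [div_mul_div_comm, lt_div_iff₀ hp, one_mul] at h3
    exact h3.le
  obtain ⟨-, hx0p⟩ := hx0 x0 le_rfl
  have hiter (n : ℕ) : g x0 ≤ g (2 ^ n * x0) := by
    induction n with
    | zero => simp
    | succ n ih =>
      refine ih.trans ((hstep _ (le_mul_of_one_le_left hx0p.le (one_le_pow₀ (by norm_num)))).trans_eq ?_)
      ring_nf
  have hto : Tendsto (fun n : ℕ => (2 : ℝ) ^ n * x0) atTop atTop :=
    (tendsto_pow_atTop_atTop_of_one_lt (by norm_num)).atTop_mul_const hx0p
  have := ge_of_tendsto' (hlim.comp hto) hiter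
  linarith [mul_pos (hG.pos x0) (hL.1 x0 hx0p)]

lemma RegVary.iterate_le {β β' B : ℝ} (hL : RegVary L β) (hβ : β < β') (hB : 1 < B) :
    ∀ᶠ x in atTop, ∀ j : ℕ, L (B ^ j * x) ≤ (B ^ β') ^ j * L x := by
  have hB0 : 0 < B := by linarith
  obtain ⟨x0, hx0⟩ := eventually_atTop.1 (((hL.2 B hB0).eventually
    (gt_mem_nhds (rpow_lt_rpow_of_exponent_lt hB hβ))).and (eventually_gt_atTop 0))
  filter_upwards [eventually_ge_atTop x0] with x hx j
  have hxp := (hx0 x hx).2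
  induction j with
  | zero => simp
  | succ j ih =>
    have hj : x ≤ B ^ j * x := le_mul_of_one_le_left hxp.le (one_le_pow₀ hB.le)
    obtain ⟨h1, h2⟩ := hx0 (B ^ j * x) (hx.trans hj)
    rw [div_lt_iff₀ (hL.1 _ h2)] at h1
    calc L (B ^ (j + 1) * x) = L (B * (B ^ j * x)) := by ring_nf
      _ ≤ B ^ β' * L (B ^ j * x) := h1.le
      _ ≤ B ^ β' * ((B ^ β') ^ j * L x) := by gcongr
      _ = _ := by ring

lemma exists_grid_exponent {a : ℝ} (ha0 : 0 < a) :
    ∃ ε > 0, ε < a ∧ (a + ε) * (1 / (a - ε) - 2) < 1 - (a + ε) := by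
  have hc : ContinuousAt (fun ε : ℝ => (a + ε) * (1 / (a - ε) - 2) - (1 - (a + ε))) 0 := by
    have : a - 0 ≠ 0 := by simpa using ha0.ne'
    fun_prop (disch := assumption)
  have h0 : (a + 0) * (1 / (a - 0) - 2) - (1 - (a + 0)) < 0 := by
    rw [add_zero, sub_zero, mul_sub, mul_one_div_cancel ha0.ne']; linarith
  have h1 := hc.tendsto.eventually (gt_mem_nhds h0)
  obtain ⟨ε, ⟨h2, h3⟩, h4⟩ := (((h1.and (gt_mem_nhds ha0)).filter_mono
    (nhdsWithin_le_nhds (s := Ioi 0))).and self_mem_nhdsWithin).exists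
  exact ⟨ε, h4, h3, by linarith⟩

lemma jint_criterion_lt_half {aF η h T : ℝ} {ℓ : ℝ → ℝ} (hF : RegTail F aF) (haF : 0 ≤ aF)
    (hG : RegTail G a) (ha0 : 0 < a) (ha : a < 1 / 2) (hT : 0 ≤ T) (hV : ∀ᵐ y ∂V, 0 ≤ y)
    (hGV : ∀ B, MeasurableSet B → B ⊆ Ioi 0 → G B = ∫⁻ y, F ((fun z => -y + z) ⁻¹' B) ∂V)
    (hη0 : 0 < η) (hη : η ≤ 1) (hRT : RightTail G ℓ) (hℓ : ∀ x > 0, 0 < ℓ x) (hLreg : RegVaryAny L)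
    (hL1 : ∀ x, 1 ≤ L x)
    (hlim : Tendsto (fun x => rtail G x * L x) atTop (𝓝 0))
    (hI : (fun x => Iof F h η x T) =o[atTop] fun x => ℓ x ^ 2 * linv ℓ (L x) / L x ^ 2)
    {c b κ ε δ : ℝ} (hc : 0 < c) (hκ : 0 < κ) (hκ2 : κ ≤ 2) (hε : 0 < ε) (hδ : 0 < δ) :
    ∀ᶠ x in atTop, ∃ J, 0 ≤ J ∧ jint G h T (κ * x) (2 * x) ≤ ENNReal.ofReal J ∧
      J * rtail G x ^ 2 * sigInt G c b 2 (L x) (4 * δ / rtail G x) ≤ ε := by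
  obtain ⟨β, hβ⟩ := hLreg
  have hβa := hβ.le_of_rtail_mul_tendsto hG hlim
  obtain ⟨s, hs0, hsa, hs⟩ := exists_grid_exponent ha0
  set τ := (a + s) * (1 / (a - s) - 2) with hτ
  set b' := max b 1 with hb'
  have hb1 : 1 ≤ b' := le_max_right _ _
  have hb0 : 0 < b' := by linarith
  have hL0 (x : ℝ) : 0 ≤ L x := by linarith [hL1 x]
  set B := 1 / (1 - η / 2) with hB
  have hB1 : 1 < B := by rw [hB, one_lt_div (by linarith)]; linarith
  have hB0 : 0 < B := by linarith
  have hBη : (1 - η) * B ≤ 1 := by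
    rw [hB, mul_one_div, div_le_one (by linarith)]; linarith
  set W : ℝ → ℝ := fun x => dInt G c b' (L x) with hW
  have hWpos (x : ℝ) : 0 < W x := hG.dInt_pos ha0.le ha hb0 hc.le (hL0 x)
  obtain ⟨Cm, hCm, hmul⟩ := hG.dInt_le_mul ha (by linarith : 0 < a - s) (by linarith) hb0 hc.le
  obtain ⟨CD, hCD, hD⟩ := hG.dInt_le_linv hRT ha0 ha hb1 hc
  have hW1 : ∃ c0 > 0, ∀ᶠ x in atTop, ∀ j : ℕ, c0 * (B ^ (-τ)) ^ j * W x ≤ W (B ^ j * x) := by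
    refine ⟨1 / Cm, by positivity, ?_⟩
    filter_upwards [hβ.iterate_le (by linarith : β < a + s) hB1] with x hx j
    set lam := (B ^ (a + s)) ^ j with hlam
    have hlam1 : 1 ≤ lam := one_le_pow₀ (one_le_rpow hB1.le (by linarith))
    have hl0 : 0 < lam := by linarith
    have h1 := hmul (L x) lam (hL0 x) hlam1
    have h2 : dInt G c b' (lam * L x) ≤ W (B ^ j * x) :=
      hG.dInt_anti ha0.le ha hb0 hc.le (hL0 _) (hx j)
    have e : lam ^ (1 / (a - s) - 2) = (B ^ τ) ^ j := by
      rw [hlam, ← rpow_pow_comm (by positivity), ← rpow_mul hB0.le]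
    rw [e] at h1
    have hBτ : 0 < (B ^ τ) ^ j := by positivity
    calc 1 / Cm * (B ^ (-τ)) ^ j * W x = W x / (Cm * (B ^ τ) ^ j) := by
          rw [rpow_neg hB0.le, inv_pow]; field_simp
      _ ≤ dInt G c b' (lam * L x) := by
          rw [div_le_iff₀ (by positivity), mul_comm]; exact h1
      _ ≤ _ := h2
  have hW2 : ∃ C2 > 0, ∀ᶠ x in atTop, W x ≤ C2 * W (κ * x) := by
    set lam := κ ^ β + 1 with hlam
    have hl1 : 1 ≤ lam := by have : 0 < κ ^ β := by positivity
                             linarith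
    have hl0 : 0 < lam := by linarith
    refine ⟨Cm * lam ^ (1 / (a - s) - 2), by positivity, ?_⟩
    filter_upwards [(hβ.2 κ hκ).eventually (gt_mem_nhds (lt_add_one _))] with x hx
    rw [div_lt_iff₀ (by linarith [hL1 x])] at hx
    refine (hmul (L x) lam (hL0 x) hl1).trans ?_
    gcongr
    exact hG.dInt_anti ha0.le ha hb0 hc.le (hL0 _) hx.le
  obtain ⟨C1, hC1, htr⟩ := jint_le_of_Iof (a2 := a + s) (q := B ^ (-τ)) (h := h) hF haF hG
    (by linarith) (by linarith) hT hV hGV hη0.le hη hB1 hBη (by positivity)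
    (rpow_lt_rpow_of_exponent_lt hB1 (by linarith)) hκ hκ2
    (Eventually.of_forall hWpos) hW1 hW2
  set e := ε / C1 with he
  have he0 : 0 < e := by positivity
  have hIe : ∀ᶠ x in atTop, Iof F h η x T ≤ e / (rtail G x ^ 2 * W x) := by
    filter_upwards [hI.bound (by positivity : 0 < e / (4 * CD)), hRT.inv_rtail_le hG.pos,
      eventually_gt_atTop 0] with x h1 h2 hx0
    have hv := hG.pos x
    have hA : 0 < linv ℓ (L x) := by linarith [hRT.one_le_linv (L x)]
    have hLx : 0 < L x := by linarith [hL1 x]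
    have hℓx := hℓ x hx0
    have h3 : linv ℓ (L x) / L x ^ 2 ≤ CD / W x := by
      have := hD (L x) (hL1 x)
      rw [← mul_div_assoc, le_div_iff₀ hA] at this
      rw [div_le_div_iff₀ (by positivity) (hWpos x)]; linarith
    rw [Real.norm_eq_abs, Real.norm_eq_abs, abs_of_nonneg (a := ℓ x ^ 2 * _ / _) (by positivity)] at h1
    calc Iof F h η x T ≤ e / (4 * CD) * (ℓ x ^ 2 * linv ℓ (L x) / L x ^ 2) := (le_abs_self _).trans h1
      _ = e / (4 * CD) * (ℓ x ^ 2 * (linv ℓ (L x) / L x ^ 2)) := by ring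
      _ ≤ e / (4 * CD) * ((2 * (1 / rtail G x)) ^ 2 * (CD / W x)) := by
          have := hWpos x
          gcongr
          exact h2.2
      _ = _ := by have := hWpos x
                  field_simp; norm_num
  filter_upwards [htr e he0.le hIe] with x hx
  have hv := hG.pos x
  have hWx := hWpos x
  refine ⟨C1 * e / (rtail G x ^ 2 * W x), by positivity, hx, ?_⟩
  have hsig : sigInt G c b 2 (L x) (4 * δ / rtail G x) ≤ W x :=
    hG.sigInt_le_dInt ha0.le ha (le_max_left _ _) hb0 hc.le (hL0 x) (by positivity)
  calc _ ≤ C1 * e / (rtail G x ^ 2 * W x) * rtail G x ^ 2 * W x := by gcongr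
    _ = C1 * e := by field_simp
    _ = ε := by rw [he]; field_simp
    _ ≤ ε := le_rfl

end

section

variable {G : Measure ℝ} [IsProbabilityMeasure G] {a : ℝ}

/-- Integrand of the truncated second-order tail integral. -/
def wFn (G : Measure ℝ) (s : ℝ) : ℝ := (1 / (rtail G s * s)) ^ 2

/-- Truncated second-order tail integral. -/
def wInt (G : Measure ℝ) (x : ℝ) : ℝ := ∫ s in (1 : ℝ)..x, wFn G s

lemma wFn_nonneg (G : Measure ℝ) (s : ℝ) : 0 ≤ wFn G s := sq_nonneg _

lemma wFn_le (hv : ∀ x, 0 < rtail G x) {p q s : ℝ} (hp : 0 < p) (hps : p ≤ s) (hsq : s ≤ q) :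
    wFn G s ≤ (1 / (rtail G q * p)) ^ 2 := by
  have h1 := hv s
  have h2 := hv q
  have h3 : 0 < s := hp.trans_le hps
  unfold wFn
  gcongr
  exact rtail_antitone G hsq

lemma le_wFn (hv : ∀ x, 0 < rtail G x) {p q s : ℝ} (hp : 0 < p) (hps : p ≤ s) (hsq : s ≤ q) :
    (1 / (rtail G p * q)) ^ 2 ≤ wFn G s := by
  have h1 := hv s
  have h2 := hv p
  have h3 : 0 < s := hp.trans_le hps
  have h4 : 0 < q := h3.trans_le hsq
  unfold wFn
  gcongr
  exact rtail_antitone G hps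

lemma intervalIntegrable_wFn (hv : ∀ x, 0 < rtail G x) {p q : ℝ} (hp : 0 < p) (hq : 0 < q) :
    IntervalIntegrable (wFn G) volume p q := by
  rw [intervalIntegrable_iff]
  have hm : Measurable (wFn G) := by
    have := measurable_rtail G
    unfold wFn
    fun_prop
  refine Measure.integrableOn_of_bounded (M := (1 / (rtail G (max p q) * min p q)) ^ 2)
    (by simp [uIoc]) hm.aestronglyMeasurable ?_
  refine (ae_restrict_iff' measurableSet_uIoc).2 (ae_of_all _ fun s hs => ?_)
  rw [Real.norm_eq_abs, abs_of_nonneg (wFn_nonneg G s)]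
  exact wFn_le hv (lt_min hp hq) hs.1.le hs.2

lemma integral_wFn_le (hv : ∀ x, 0 < rtail G x) {p q : ℝ} (hp : 0 < p) (hpq : p ≤ q) :
    ∫ s in p..q, wFn G s ≤ q * (1 / (rtail G q * p)) ^ 2 := by
  calc _ ≤ ∫ s in p..q, (1 / (rtail G q * p)) ^ 2 :=
        intervalIntegral.integral_mono_on hpq (intervalIntegrable_wFn hv hp (hp.trans_le hpq))
          (by simp) fun s hs => wFn_le hv hp hs.1 hs.2
    _ = (q - p) * (1 / (rtail G q * p)) ^ 2 := by simp
    _ ≤ _ := by gcongr; linarith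

lemma le_integral_wFn (hv : ∀ x, 0 < rtail G x) {p q : ℝ} (hp : 0 < p) (hpq : p ≤ q) :
    (q - p) * (1 / (rtail G p * q)) ^ 2 ≤ ∫ s in p..q, wFn G s := by
  calc _ = ∫ s in p..q, (1 / (rtail G p * q)) ^ 2 := by simp
    _ ≤ _ := intervalIntegral.integral_mono_on hpq (by simp)
      (intervalIntegrable_wFn hv hp (hp.trans_le hpq)) fun s hs => le_wFn hv hp hs.1 hs.2

lemma wInt_add (hv : ∀ x, 0 < rtail G x) {p q : ℝ} (hp : 0 < p) (hq : 0 < q) :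
    wInt G p + ∫ s in p..q, wFn G s = wInt G q :=
  intervalIntegral.integral_add_adjacent_intervals (intervalIntegrable_wFn hv one_pos hp)
    (intervalIntegrable_wFn hv hp hq)

lemma wInt_lt (hv : ∀ x, 0 < rtail G x) {p q : ℝ} (hp : 0 < p) (hpq : p < q) :
    wInt G p < wInt G q := by
  have hq := hp.trans hpq
  rw [← wInt_add hv hp hq]
  have h1 := le_integral_wFn hv hp hpq.le
  have h2 := hv p
  have h3 : 0 < q - p := by linarith
  have : 0 < (q - p) * (1 / (rtail G p * q)) ^ 2 := by positivity
  linarith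

lemma wInt_mono (hv : ∀ x, 0 < rtail G x) {p q : ℝ} (hp : 0 < p) (hpq : p ≤ q) :
    wInt G p ≤ wInt G q := by
  rcases hpq.eq_or_lt with rfl | h
  · exact le_rfl
  · exact (wInt_lt hv hp h).le

lemma wInt_pos (hv : ∀ x, 0 < rtail G x) {x : ℝ} (hx : 1 < x) : 0 < wInt G x := by
  have := wInt_lt hv one_pos hx
  rwa [wInt, intervalIntegral.integral_same] at this

lemma setIntegral_inv_rtail_sq {p q : ℝ} (hp : 0 < p) (hpq : p ≤ q) :
    ∫ θ in Ioc (1 / q) (1 / p), (1 / rtail G (1 / θ)) ^ 2 = ∫ s in p..q, wFn G s := by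
  have hq : 0 < q := hp.trans_le hpq
  have himg : (fun s : ℝ => s⁻¹) '' Ioc p q = Ico (1 / q) (1 / p) := by
    ext θ
    simp only [mem_image, mem_Ioc, mem_Ico, one_div]
    constructor
    · rintro ⟨s, ⟨h1, h2⟩, rfl⟩
      exact ⟨inv_anti₀ (hp.trans h1) h2, inv_strictAnti₀ hp h1⟩
    · rintro ⟨h1, h2⟩
      have hθ : 0 < θ := lt_of_lt_of_le (by positivity) h1
      refine ⟨θ⁻¹, ⟨?_, ?_⟩, inv_inv θ⟩
      · exact (lt_inv_comm₀ hθ hp).1 h2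
      · exact (inv_le_comm₀ (hp.trans_le hpq) hθ).1 h1
  rw [setIntegral_congr_set Ico_ae_eq_Ioc.symm, ← himg,
    integral_image_eq_integral_abs_deriv_smul measurableSet_Ioc (f' := fun s => -(s ^ 2)⁻¹),
    intervalIntegral.integral_of_le hpq]
  · refine setIntegral_congr_fun measurableSet_Ioc fun s hs => ?_
    simp only [abs_neg, smul_eq_mul, wFn, one_div, inv_inv]
    rw [abs_of_nonneg (by positivity), mul_inv, mul_pow, inv_pow s, mul_comm]
  · intro s hs
    exact (hasDerivAt_inv (hp.trans hs.1).ne').hasDerivWithinAt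
  · exact inv_injective.injOn

lemma sigInt_le_wFn (hv : ∀ x, 0 < rtail G x) {b c L M x y : ℝ} (hb : 0 < b) (hc : 0 ≤ c)
    (hL : 0 ≤ L) (hM : 0 ≤ M) (hy : 1 / b ≤ y) (hyx : y ≤ x) :
    sigInt G c b 2 L M ≤ exp (-(c * L * rtail G y)) * (∫ s in (1 / b)..y, wFn G s) +
      (∫ s in y..x, wFn G s) + M ^ 2 / x := by
  have hb' : 0 < 1 / b := by positivity
  have hy0 : 0 < y := hb'.trans_le hy
  have hx0 : 0 < x := hy0.trans_le hyx
  have hxy : 1 / x ≤ 1 / y := by gcongr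
  have hyb : 1 / y ≤ b := by
    rw [div_le_iff₀ hy0]; rwa [div_le_iff₀ hb, mul_comm] at hy
  have hi := integrable_sigInt (b := b) G (c := c) (L := L) 2 hc hL hM
  have hm := measurable_rtail_inv G
  have hintg {p q : ℝ} (hp : 0 < p) :
      IntegrableOn (fun θ => (1 / rtail G (1 / θ)) ^ 2) (Ioc p q) := by
    refine Measure.integrableOn_of_bounded (M := (1 / rtail G (1 / p)) ^ 2) (by simp)
      ((measurable_const.div hm).pow_const 2).aestronglyMeasurable ?_
    refine (ae_restrict_iff' measurableSet_Ioc).2 (ae_of_all _ fun θ hθ => ?_)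
    rw [Real.norm_eq_abs, abs_of_nonneg (by positivity)]
    have := hv (1 / p)
    have := hv (1 / θ)
    gcongr
    exact rtail_antitone G (by gcongr; exact hθ.1.le)
  have hpt (θ : ℝ) : (min (1 / rtail G (1 / θ)) M) ^ 2 ≤ (1 / rtail G (1 / θ)) ^ 2 := by
    have := hv (1 / θ)
    have h0 : 0 ≤ min (1 / rtail G (1 / θ)) M := le_min (by positivity) hM
    gcongr
    exact min_le_left _ _
  have hsplit : sigInt G c b 2 L M = ((∫ θ in Ioc 0 (1 / x), (min (1 / rtail G (1 / θ)) M) ^ 2 *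
      exp (-(c * L * rtail G (1 / θ)))) + ∫ θ in Ioc (1 / x) (1 / y),
      (min (1 / rtail G (1 / θ)) M) ^ 2 * exp (-(c * L * rtail G (1 / θ)))) +
      ∫ θ in Ioc (1 / y) b, (min (1 / rtail G (1 / θ)) M) ^ 2 *
        exp (-(c * L * rtail G (1 / θ))) := by
    rw [← setIntegral_union (Ioc_disjoint_Ioc_of_le le_rfl) measurableSet_Ioc
        (hi.mono_set (Ioc_subset_Ioc_right (hxy.trans hyb)))
        (hi.mono_set (Ioc_subset_Ioc (by positivity) hyb)),
      Ioc_union_Ioc_eq_Ioc (by positivity) hxy,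
      ← setIntegral_union (Ioc_disjoint_Ioc_of_le le_rfl) measurableSet_Ioc
        (hi.mono_set (Ioc_subset_Ioc_right hyb))
        (hi.mono_set (Ioc_subset_Ioc_left (by positivity))),
      Ioc_union_Ioc_eq_Ioc (by positivity) hyb, sigInt]
  have hexp (θ : ℝ) : exp (-(c * L * rtail G (1 / θ))) ≤ 1 := by
    have := hv (1 / θ)
    rw [exp_le_one_iff, neg_nonpos]; positivity
  have h1 : ∫ θ in Ioc 0 (1 / x), (min (1 / rtail G (1 / θ)) M) ^ 2 *
      exp (-(c * L * rtail G (1 / θ))) ≤ M ^ 2 / x := by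
    calc _ ≤ ∫ θ in Ioc 0 (1 / x), M ^ 2 := by
          refine integral_mono (hi.mono_set (Ioc_subset_Ioc_right (hxy.trans hyb)))
            (integrable_const _) fun θ => ?_
          have := hv (1 / θ)
          have h0 : 0 ≤ min (1 / rtail G (1 / θ)) M := le_min (by positivity) hM
          calc _ ≤ M ^ 2 * 1 := by
                gcongr
                · exact min_le_right _ _
                · exact hexp θ
            _ = _ := mul_one _
      _ = _ := by
          rw [integral_const]
          simp [hx0.le]
          ring
  have h2 : ∫ θ in Ioc (1 / x) (1 / y), (min (1 / rtail G (1 / θ)) M) ^ 2 *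
      exp (-(c * L * rtail G (1 / θ))) ≤ ∫ s in y..x, wFn G s := by
    rw [← setIntegral_inv_rtail_sq hy0 hyx]
    refine integral_mono (hi.mono_set (Ioc_subset_Ioc (by positivity) hyb))
      (hintg (by positivity)) fun θ => ?_
    calc _ ≤ (1 / rtail G (1 / θ)) ^ 2 * 1 :=
          mul_le_mul (hpt θ) (hexp θ) (exp_pos _).le (by positivity)
      _ = _ := mul_one _
  have h3 : ∫ θ in Ioc (1 / y) b, (min (1 / rtail G (1 / θ)) M) ^ 2 *
      exp (-(c * L * rtail G (1 / θ))) ≤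
      exp (-(c * L * rtail G y)) * ∫ s in (1 / b)..y, wFn G s := by
    rw [← setIntegral_inv_rtail_sq hb' hy, ← integral_const_mul, one_div_one_div]
    refine setIntegral_mono_on (hi.mono_set (Ioc_subset_Ioc_left (by positivity)))
      ((hintg (by positivity)).const_mul _) measurableSet_Ioc fun θ hθ => ?_
    rw [mul_comm]
    have hθ0 : 0 < θ := lt_trans (by positivity) hθ.1
    refine mul_le_mul (exp_le_exp.2 (neg_le_neg ?_)) (hpt θ) (by positivity) (exp_pos _).le
    gcongr
    refine rtail_antitone G ?_
    rw [div_le_iff₀ hθ0, mul_comm, ← div_le_iff₀ hy0]; exact hθ.1.le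
  rw [hsplit]
  linarith

/-- At the boundary exponent the integrand scale is negligible against its integral. -/
lemma RegTail.inv_sq_div_le_wInt (hG : RegTail G (1 / 2)) {ε : ℝ} (hε : 0 < ε) :
    ∀ᶠ x in atTop, 1 / (rtail G x ^ 2 * x) ≤ ε * wInt G x := by
  obtain ⟨N, hN⟩ := exists_nat_gt (8 / ε)
  have hj (j : ℕ) : ∀ᶠ x in atTop, (rtail G (1 / 2 ^ (j + 1) * x)) ^ 2 ≤
      2 * 2 ^ (j + 1) * rtail G x ^ 2 := by
    have h1 := (hG.lim (1 / 2 ^ (j + 1)) (by positivity)).pow 2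
    have e : ((1 / 2 ^ (j + 1) : ℝ) ^ (-(1 / 2 : ℝ))) ^ 2 = 2 ^ (j + 1) := by
      rw [← rpow_mul_natCast (by positivity)]
      norm_num
      rw [rpow_neg_one, inv_inv]
    rw [e] at h1
    filter_upwards [h1.eventually (gt_mem_nhds
      (by linarith [show (0 : ℝ) < 2 ^ (j + 1) by positivity] :
        (2 : ℝ) ^ (j + 1) < 2 * 2 ^ (j + 1)))] with x hx
    have := hG.pos x
    rw [div_pow, div_lt_iff₀ (by positivity)] at hx
    exact hx.le
  have hall : ∀ᶠ x in atTop, ∀ j ∈ Finset.range N, (rtail G (1 / 2 ^ (j + 1) * x)) ^ 2 ≤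
      2 * 2 ^ (j + 1) * rtail G x ^ 2 := (Filter.eventually_all_finset _).2 fun j _ => hj j
  filter_upwards [hall, eventually_ge_atTop ((2 : ℝ) ^ N), eventually_gt_atTop 1] with x hx hxN hx1
  have hx0 : 0 < x := by linarith
  have hvx := hG.pos x
  set g := 1 / (rtail G x ^ 2 * x) with hg
  have hg0 : 0 < g := by positivity
  have hind (n : ℕ) (hn : n ≤ N) : wInt G (x / 2 ^ n) + n * (g / 8) ≤ wInt G x := by
    induction n with
    | zero => simp
    | succ n ih =>
      refine le_trans ?_ (ih (by omega))
      have h1 := hx n (Finset.mem_range.2 (by omega))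
      set y := 1 / 2 ^ (n + 1) * x with hy
      have hy0 : 0 < y := by positivity
      have hy1 : x / 2 ^ (n + 1) = y := by rw [hy]; ring
      have hy2 : x / 2 ^ n = 2 * y := by rw [hy, pow_succ]; field_simp
      have hvy := hG.pos y
      have h2 := le_integral_wFn hG.pos hy0 (by linarith : y ≤ 2 * y)
      rw [hy1, hy2, ← wInt_add hG.pos hy0 (by positivity : 0 < 2 * y)]
      have h3 : g / 8 ≤ (2 * y - y) * (1 / (rtail G y * (2 * y))) ^ 2 := by
        have : (2 * y - y) * (1 / (rtail G y * (2 * y))) ^ 2 = 1 / (4 * (rtail G y ^ 2 * y)) := by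
          field_simp; ring
        rw [this, hg, div_div]
        refine one_div_le_one_div_of_le (by positivity) ?_
        calc 4 * (rtail G y ^ 2 * y) ≤ 4 * (2 * 2 ^ (n + 1) * rtail G x ^ 2 * y) := by gcongr
          _ = rtail G x ^ 2 * x * 8 := by rw [hy]; field_simp; norm_num
      push_cast
      linarith
  have h1 := hind N le_rfl
  have h2 : 0 ≤ wInt G (x / 2 ^ N) := by
    have := wInt_mono hG.pos one_pos ((one_le_div (by positivity)).2 hxN)
    rwa [wInt, intervalIntegral.integral_same] at this
  rw [div_lt_iff₀ hε] at hN
  have : g * 8 ≤ g * (N * ε) := by gcongr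
  nlinarith

lemma RegTail.wInt_le_mul (hG : RegTail G (1 / 2)) {κ : ℝ} (hκ : 0 < κ) (hκ1 : κ ≤ 1) :
    ∀ᶠ x in atTop, wInt G x ≤ 2 * wInt G (κ * x) := by
  filter_upwards [hG.inv_sq_div_le_wInt (by positivity : 0 < κ ^ 2 / 2), eventually_gt_atTop 0]
    with x hx hx0
  have h1 := wInt_add hG.pos (by positivity : 0 < κ * x) hx0
  have h2 := integral_wFn_le hG.pos (by positivity : 0 < κ * x)
    (by nlinarith : κ * x ≤ x)
  have hv := hG.pos x
  have h3 : x * (1 / (rtail G x * (κ * x))) ^ 2 = 1 / κ ^ 2 * (1 / (rtail G x ^ 2 * x)) := by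
    field_simp
  have h4 : 1 / κ ^ 2 * (1 / (rtail G x ^ 2 * x)) ≤ 1 / κ ^ 2 * (κ ^ 2 / 2 * wInt G x) := by gcongr
  have h5 : 1 / κ ^ 2 * (κ ^ 2 / 2 * wInt G x) = wInt G x / 2 := by field_simp
  linarith

end

section

variable {F G V : Measure ℝ} [IsProbabilityMeasure F] [IsProbabilityMeasure G] [SFinite V]
  {L ℓ : ℝ → ℝ}

/-- Truncated second-order integral of a tail scale function. -/
def uInt (ℓ : ℝ → ℝ) (x : ℝ) : ℝ := ∫ s in (1 : ℝ)..x, (ℓ s / s) ^ 2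

lemma uInt_nonneg (ℓ : ℝ → ℝ) {x : ℝ} (hx : 1 ≤ x) : 0 ≤ uInt ℓ x :=
  intervalIntegral.integral_nonneg hx fun _ _ => sq_nonneg _

lemma intervalIntegrable_of_uInt_ne_zero {x : ℝ} (hx : uInt ℓ x ≠ 0) :
    IntervalIntegrable (fun s => (ℓ s / s) ^ 2) volume 1 x := by
  by_contra h
  exact hx (intervalIntegral.integral_undef h)

lemma uInt_mono {p q : ℝ} (hp : 1 ≤ p) (hpq : p ≤ q)
    (hi : IntervalIntegrable (fun s => (ℓ s / s) ^ 2) volume 1 q) : uInt ℓ p ≤ uInt ℓ q :=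
  intervalIntegral.integral_mono_interval le_rfl hp hpq (ae_of_all _ fun _ => sq_nonneg _) hi

lemma RightTail.uInt_bounds (hRT : RightTail G ℓ) (hv : ∀ x, 0 < rtail G x) :
    ∃ s0 > 1, ∀ p q, s0 ≤ p → p ≤ q →
      IntervalIntegrable (fun s => (ℓ s / s) ^ 2) volume 1 q →
      wInt G q - wInt G p ≤ 4 * (uInt ℓ q - uInt ℓ p) ∧
      uInt ℓ q - uInt ℓ p ≤ 4 * (wInt G q - wInt G p) := by
  obtain ⟨s0, hs0⟩ := eventually_atTop.1 ((hRT.inv_rtail_le hv).and (eventually_gt_atTop 1))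
  refine ⟨s0, (hs0 s0 le_rfl).2, fun p q hp hpq hi => ?_⟩
  have hp1 : 1 < p := (hs0 p hp).2
  have hi1 := hi.mono_set (c := 1) (d := p) (by
    rw [uIcc_of_le hp1.le, uIcc_of_le (hp1.le.trans hpq)]; exact Icc_subset_Icc_right hpq)
  have hi2 := hi.mono_set (c := p) (d := q) (by
    rw [uIcc_of_le hpq, uIcc_of_le (hp1.le.trans hpq)]; exact Icc_subset_Icc_left hp1.le)
  have e1 : uInt ℓ p + ∫ s in p..q, (ℓ s / s) ^ 2 = uInt ℓ q :=
    intervalIntegral.integral_add_adjacent_intervals hi1 hi2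
  have e2 := wInt_add hv (by linarith : 0 < p) (by linarith : 0 < q)
  have hw := intervalIntegrable_wFn hv (by linarith : 0 < p) (by linarith : 0 < q)
  have hb (s : ℝ) (hs : s ∈ Icc p q) :
      wFn G s ≤ 4 * (ℓ s / s) ^ 2 ∧ (ℓ s / s) ^ 2 ≤ 4 * wFn G s := by
    obtain ⟨⟨h1, h2⟩, h3⟩ := hs0 s (hp.trans hs.1)
    have hvs := hv s
    have hs' : 0 < s := by linarith
    have hℓ : 0 ≤ ℓ s := by
      have : 0 < 1 / rtail G s := by positivity
      linarith
    have e : wFn G s = (1 / rtail G s / s) ^ 2 := by rw [wFn, div_div]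
    rw [e]
    constructor
    · calc _ ≤ (2 * ℓ s / s) ^ 2 := by gcongr
        _ = _ := by ring
    · calc _ ≤ (2 * (1 / rtail G s) / s) ^ 2 := by gcongr
        _ = _ := by ring
  have h1 : ∫ s in p..q, wFn G s ≤ ∫ s in p..q, 4 * (ℓ s / s) ^ 2 :=
    intervalIntegral.integral_mono_on hpq hw (hi2.const_mul 4) fun s hs => (hb s hs).1
  have h2 : ∫ s in p..q, (ℓ s / s) ^ 2 ≤ ∫ s in p..q, 4 * wFn G s :=
    intervalIntegral.integral_mono_on hpq hi2 (hw.const_mul 4) fun s hs => (hb s hs).2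
  rw [intervalIntegral.integral_const_mul] at h1 h2
  constructor <;> linarith

lemma RightTail.sq_div_uInt_le (hRT : RightTail G ℓ) (hv : ∀ x, 0 < rtail G x) :
    ∃ C > 0, ∀ᶠ x in atTop, |ℓ x ^ 2 / uInt ℓ x| ≤ C / (rtail G x ^ 2 * wInt G x) := by
  obtain ⟨s0, hs0, hb⟩ := hRT.uInt_bounds hv
  have h0 : 0 < wInt G s0 := wInt_pos hv hs0
  have h1 : wInt G s0 < wInt G (s0 + 1) := wInt_lt hv (by linarith) (by linarith)
  set θ := 1 - wInt G s0 / wInt G (s0 + 1) with hθ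
  have hθ0 : 0 < θ := by rw [hθ, sub_pos, div_lt_one (by linarith)]; exact h1
  refine ⟨16 / θ, by positivity, ?_⟩
  filter_upwards [hRT.inv_rtail_le hv, eventually_ge_atTop (s0 + 1)] with x hx hxs
  have hvx := hv x
  have hW : 0 < wInt G x := wInt_pos hv (by linarith)
  have hu0 := uInt_nonneg ℓ (by linarith : 1 ≤ x)
  rw [abs_of_nonneg (by positivity)]
  by_cases hu : uInt ℓ x = 0
  · rw [hu, div_zero]; positivity
  have hu1 : 0 < uInt ℓ x := lt_of_le_of_ne hu0 (Ne.symm hu)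
  have h2 := (hb s0 x le_rfl (by linarith) (intervalIntegrable_of_uInt_ne_zero hu)).1
  have h3 := uInt_nonneg ℓ hs0.le
  have h4 : wInt G (s0 + 1) ≤ wInt G x := wInt_mono hv (by linarith) hxs
  have h5 : wInt G s0 ≤ wInt G s0 / wInt G (s0 + 1) * wInt G x := by
    rw [div_mul_eq_mul_div, le_div_iff₀ (by linarith)]; gcongr
  have h6 : θ * wInt G x ≤ 4 * uInt ℓ x := by rw [hθ, sub_mul, one_mul]; linarith
  have h7 : 0 ≤ ℓ x := by
    have : 0 < 1 / rtail G x := by positivity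
    linarith [hx.1]
  calc ℓ x ^ 2 / uInt ℓ x ≤ (2 * (1 / rtail G x)) ^ 2 / (θ * wInt G x / 4) := by
        gcongr
        · exact hx.2
        · linarith
    _ = _ := by field_simp; norm_num

lemma RightTail.uInt_le_wInt (hRT : RightTail G ℓ) (hv : ∀ x, 0 < rtail G x) :
    ∃ C > 0, ∀ᶠ x in atTop, uInt ℓ x ≤ C * wInt G x := by
  obtain ⟨s0, hs0, hb⟩ := hRT.uInt_bounds hv
  have h0 : 0 < wInt G s0 := wInt_pos hv hs0
  have h3 := uInt_nonneg ℓ hs0.le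
  refine ⟨uInt ℓ s0 / wInt G s0 + 4, by positivity, ?_⟩
  filter_upwards [eventually_ge_atTop s0] with x hx
  have h4 : wInt G s0 ≤ wInt G x := wInt_mono hv (by linarith) hx
  by_cases hu : uInt ℓ x = 0
  · rw [hu]
    have : 0 ≤ wInt G x := by linarith
    positivity
  have h2 := (hb s0 x le_rfl hx (intervalIntegrable_of_uInt_ne_zero hu)).2
  have h5 : uInt ℓ s0 ≤ uInt ℓ s0 / wInt G s0 * wInt G x := by
    rw [div_mul_eq_mul_div, le_div_iff₀ (by linarith)]; gcongr
  rw [add_mul]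
  linarith

/-- If the truncated integrals at `x` and at `A x ≤ x` are equivalent, then `A x → ∞`. -/
lemma RightTail.tendsto_of_uInt_ratio (hRT : RightTail G ℓ) (hv : ∀ x, 0 < rtail G x) {A : ℝ → ℝ}
    (hA1 : ∀ x, 1 ≤ A x) (hr : Tendsto (fun x => uInt ℓ x / uInt ℓ (A x)) atTop (𝓝 1)) :
    Tendsto A atTop atTop := by
  obtain ⟨s0, hs0, hb⟩ := hRT.uInt_bounds hv
  refine tendsto_atTop.2 fun M0 => ?_
  set M := max M0 s0 with hM
  have hM1 : 1 < M := hs0.trans_le (le_max_right _ _)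
  set d := (wInt G (M + 1) - wInt G M) / 4 with hd
  have hd0 : 0 < d := by
    have := wInt_lt hv (by linarith : 0 < M) (by linarith : M < M + 1)
    rw [hd]; linarith
  have huM := uInt_nonneg ℓ hM1.le
  have hc : (1 : ℝ) < 1 + d / (uInt ℓ M + 1) := by
    have : 0 < d / (uInt ℓ M + 1) := by positivity
    linarith
  filter_upwards [hr.eventually (gt_mem_nhds hc),
    hr.eventually (lt_mem_nhds (by norm_num : (0 : ℝ) < 1)), eventually_ge_atTop (M + 1)]
    with x h1 h2 hx
  by_contra! hlt
  have hAM : A x ≤ M := hlt.le.trans (le_max_left _ _)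
  have huA := uInt_nonneg ℓ (hA1 x)
  have hux : uInt ℓ x ≠ 0 := by rintro h; rw [h, zero_div] at h2; exact lt_irrefl _ h2
  have huA' : 0 < uInt ℓ (A x) :=
    lt_of_le_of_ne huA (by rintro h; rw [← h, div_zero] at h2; exact lt_irrefl _ h2)
  have hi := intervalIntegrable_of_uInt_ne_zero hux
  have hi2 := hi.mono_set (c := 1) (d := M + 1) (by
    rw [uIcc_of_le (by linarith), uIcc_of_le (by linarith)]; exact Icc_subset_Icc_right hx)
  have hi1 := hi.mono_set (c := 1) (d := M) (by
    rw [uIcc_of_le (by linarith), uIcc_of_le (by linarith)]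
    exact Icc_subset_Icc_right (by linarith))
  have h3 := uInt_mono (by linarith) hx hi
  have h4 := uInt_mono (hA1 x) hAM hi1
  have h5 := (hb M (M + 1) (le_max_right _ _) (by linarith) hi2).1
  rw [div_lt_iff₀ huA', add_mul, one_mul, div_mul_eq_mul_div] at h1
  have h6 : d * uInt ℓ (A x) / (uInt ℓ M + 1) ≤ d := by
    rw [div_le_iff₀ (by linarith)]
    gcongr
    linarith
  linarith

lemma RegTail.sigInt_le_wInt (hG : RegTail G (1 / 2)) {c b δ : ℝ} (hb : 0 < b) (hc : 0 ≤ c)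
    (hL0 : ∀ x, 0 ≤ L x) (hδ : 0 < δ) :
    ∃ C > 0, ∀ᶠ x in atTop, sigInt G c b 2 (L x) (4 * δ / rtail G x) ≤ C * wInt G x := by
  have hv := hG.pos
  have h2 : 0 < wInt G 2 := wInt_pos hv (by norm_num)
  refine ⟨1 + |wInt G (1 / b)| / wInt G 2 + 1, by positivity, ?_⟩
  filter_upwards [eventually_ge_atTop 2, eventually_ge_atTop (1 / b),
    hG.inv_sq_div_le_wInt (by positivity : 0 < 1 / (16 * δ ^ 2))] with x hx2 hxb hx
  have hvx := hv x
  have hx0 : 0 < x := by linarith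
  have h1 := sigInt_le_wFn hv hb hc (hL0 x) (by positivity : 0 ≤ 4 * δ / rtail G x) hxb le_rfl
  rw [intervalIntegral.integral_same, add_zero] at h1
  have e1 := wInt_add hv (by positivity : 0 < 1 / b) hx0
  have hW : wInt G 2 ≤ wInt G x := wInt_mono hv (by norm_num) hx2
  have h3 : |wInt G (1 / b)| ≤ |wInt G (1 / b)| / wInt G 2 * wInt G x := by
    rw [div_mul_eq_mul_div, le_div_iff₀ (by linarith)]; gcongr
  have h4 : (4 * δ / rtail G x) ^ 2 / x ≤ wInt G x := by
    calc (4 * δ / rtail G x) ^ 2 / x = 16 * δ ^ 2 * (1 / (rtail G x ^ 2 * x)) := by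
          field_simp; norm_num
      _ ≤ 16 * δ ^ 2 * (1 / (16 * δ ^ 2) * wInt G x) := by gcongr
      _ = _ := by field_simp
  have h5 : exp (-(c * L x * rtail G x)) * (∫ s in (1 / b)..x, wFn G s) ≤
      ∫ s in (1 / b)..x, wFn G s := by
    refine mul_le_of_le_one_left (intervalIntegral.integral_nonneg hxb fun s _ => wFn_nonneg G s) ?_
    rw [exp_le_one_iff, neg_nonpos]
    have := hL0 x
    positivity
  have h6 := neg_abs_le (wInt G (1 / b))
  rw [add_mul, add_mul, one_mul]
  linarith

/-- When the truncated integrals up to `x` and up to `linv ℓ (L x)` are equivalent, the weighted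
tail integral is negligible. -/
lemma RegTail.sigInt_le_small_wInt (hG : RegTail G (1 / 2)) (hRT : RightTail G ℓ) {c b δ : ℝ}
    (hb : 0 < b) (hc : 0 < c) (hL1 : ∀ x, 1 ≤ L x) (hδ : 0 < δ)
    (hlim : Tendsto (fun x => rtail G x * L x) atTop (𝓝 0))
    (hr : Tendsto (fun x => uInt ℓ x / uInt ℓ (linv ℓ (L x))) atTop (𝓝 1)) {s : ℝ} (hs : 0 < s) :
    ∀ᶠ x in atTop, sigInt G c b 2 (L x) (4 * δ / rtail G x) ≤ s * wInt G x := by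
  have hv := hG.pos
  set A : ℝ → ℝ := fun x => linv ℓ (L x) with hA
  have hAt := hRT.tendsto_of_uInt_ratio hv (fun x => hRT.one_le_linv (L x)) hr
  have hAx : ∀ᶠ x in atTop, A x ≤ x := by
    filter_upwards [hlim.eventually (gt_mem_nhds (by norm_num : (0 : ℝ) < 1 / 2)),
      hRT.eventually (lt_mem_nhds (by norm_num : (1 / 2 : ℝ) < 1)), eventually_ge_atTop 1]
      with x h1 h2 hx
    exact csInf_le ⟨1, fun _ ht => ht.1⟩ ⟨hx, lt_of_mul_lt_mul_left (h1.trans h2) (hv x).le⟩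
  obtain ⟨s0, hs0, hbd⟩ := hRT.uInt_bounds hv
  obtain ⟨Cu, hCu, hu⟩ := hRT.uInt_le_wInt hv
  obtain ⟨C0, hC0, hlinv⟩ := hRT.inv_rtail_linv_le hG (by norm_num)
  obtain ⟨C, hC1, hpot⟩ := hG.potter_lower (by norm_num : (1 / 4 : ℝ) < 1 / 2) (by norm_num) one_pos
  have hCp : 0 < C := by linarith
  have h2 : 0 < wInt G 2 := wInt_pos hv (by norm_num)
  set K := 1 + |wInt G (1 / b)| / wInt G 2 with hK
  have hK0 : 0 < K := by positivity
  obtain ⟨R, hR, hR1⟩ : ∃ R : ℝ, exp (-(c / (C * C0) * R ^ (1 / 4 : ℝ))) < s / (4 * K) ∧ 1 ≤ R := by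
    have h1 : Tendsto (fun R : ℝ => exp (-(c / (C * C0) * R ^ (1 / 4 : ℝ)))) atTop (𝓝 0) :=
      tendsto_exp_neg_atTop_nhds_zero.comp
        ((tendsto_rpow_atTop (by norm_num)).const_mul_atTop (by positivity))
    exact ((h1.eventually (gt_mem_nhds (by positivity))).and (eventually_ge_atTop 1)).exists
  have hRp : 0 < R := by linarith
  filter_upwards [hAx, hAt.eventually_ge_atTop s0, hAt.eventually_ge_atTop (R * 1),
    hAt.eventually_ge_atTop (R * (1 / b)), hAt.eventually_ge_atTop 2, hAt.eventually hu,
    hAt.eventually (hG.inv_sq_div_le_wInt (by positivity : 0 < s / (4 * R ^ 2))),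
    hG.inv_sq_div_le_wInt (by positivity : 0 < s / (4 * (16 * δ ^ 2))),
    hr.eventually (gt_mem_nhds (by linarith [show 0 < s / (16 * Cu) by positivity] :
      (1 : ℝ) < 1 + s / (16 * Cu))),
    hr.eventually (lt_mem_nhds (by norm_num : (0 : ℝ) < 1))]
    with x hxA hA0 hAR hARb hA2 hxu hxw hxw' hr1 hr2
  change _ < uInt ℓ x / uInt ℓ (A x) at hr2
  change uInt ℓ x / uInt ℓ (A x) < _ at hr1
  have hAp : 0 < A x := by linarith
  have hxp : 0 < x := by linarith
  have hvx := hv x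
  have hvA := hv (A x)
  have hLx : 0 < L x := by linarith [hL1 x]
  have hux : uInt ℓ x ≠ 0 := by rintro h; rw [h, zero_div] at hr2; exact lt_irrefl _ hr2
  have huA : 0 < uInt ℓ (A x) := lt_of_le_of_ne (uInt_nonneg ℓ (by linarith))
    (by rintro h; rw [← h, div_zero] at hr2; exact lt_irrefl _ hr2)
  set y := A x / R with hy
  have hy1 : 1 ≤ y := by rw [hy, le_div_iff₀ hRp]; linarith
  have hyb : 1 / b ≤ y := by rw [hy, le_div_iff₀ hRp]; linarith
  have hyp : 0 < y := by linarith
  have hyA : y ≤ A x := div_le_self hAp.le hR1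
  have hsig := sigInt_le_wFn hv hb hc.le hLx.le (by positivity : 0 ≤ 4 * δ / rtail G x) hyb
    (hyA.trans hxA)
  have hWA : wInt G (A x) ≤ wInt G x := wInt_mono hv hAp hxA
  have hWy : wInt G y ≤ wInt G (A x) := wInt_mono hv hyp hyA
  have hW2 : wInt G 2 ≤ wInt G x := (wInt_mono hv (by norm_num) hA2).trans hWA
  have hWx : 0 < wInt G x := by linarith
  have e1 := wInt_add hv (by positivity : 0 < 1 / b) hyp
  have e2 := wInt_add hv hyp hAp
  have e3 := wInt_add hv hyp hxp
  have hexp : exp (-(c * L x * rtail G y)) ≤ s / (4 * K) := by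
    refine le_trans (exp_le_exp.2 (neg_le_neg ?_)) hR.le
    have h1 := hpot y (A x) hy1 hyA
    have h3 : A x / y = R := by rw [hy]; field_simp
    rw [h3] at h1
    have h4 := hlinv (L x) (hL1 x)
    rw [div_le_iff₀ hvA] at h4
    calc c / (C * C0) * R ^ (1 / 4 : ℝ) = c / (C * C0) * R ^ (1 / 4 : ℝ) * 1 := (mul_one _).symm
      _ ≤ c / (C * C0) * R ^ (1 / 4 : ℝ) * (C0 * L x * rtail G (A x)) := by gcongr
      _ = c * L x / C * (R ^ (1 / 4 : ℝ) * rtail G (A x)) := by field_simp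
      _ ≤ c * L x / C * (C * rtail G y) := by gcongr
      _ = _ := by field_simp
  have h3 : |wInt G (1 / b)| ≤ |wInt G (1 / b)| / wInt G 2 * wInt G x := by
    rw [div_mul_eq_mul_div, le_div_iff₀ (by linarith)]; gcongr
  have h4 : ∫ s in (1 / b)..y, wFn G s ≤ K * wInt G x := by
    have := neg_abs_le (wInt G (1 / b))
    rw [hK, add_mul, one_mul]
    linarith
  have t1 : exp (-(c * L x * rtail G y)) * (∫ s in (1 / b)..y, wFn G s) ≤ s / 4 * wInt G x := by
    calc _ ≤ s / (4 * K) * (K * wInt G x) := by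
          refine mul_le_mul hexp h4 ?_ (by positivity)
          exact intervalIntegral.integral_nonneg hyb fun s _ => wFn_nonneg G s
      _ = _ := by field_simp
  have t2 : ∫ s in y..A x, wFn G s ≤ s / 4 * wInt G x := by
    calc _ ≤ A x * (1 / (rtail G (A x) * y)) ^ 2 := integral_wFn_le hv hyp hyA
      _ = R ^ 2 * (1 / (rtail G (A x) ^ 2 * A x)) := by rw [hy]; field_simp
      _ ≤ R ^ 2 * (s / (4 * R ^ 2) * wInt G (A x)) := by gcongr
      _ = s / 4 * wInt G (A x) := by field_simp
      _ ≤ _ := by gcongr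
  have t3 : wInt G x - wInt G (A x) ≤ s / 4 * wInt G x := by
    have h5 := (hbd (A x) x hA0 hxA (intervalIntegrable_of_uInt_ne_zero hux)).1
    rw [div_lt_iff₀ huA, add_mul, one_mul] at hr1
    calc _ ≤ 4 * (s / (16 * Cu) * uInt ℓ (A x)) := by linarith
      _ ≤ 4 * (s / (16 * Cu) * (Cu * wInt G x)) := by
          gcongr
          exact hxu.trans (by gcongr)
      _ = _ := by field_simp; norm_num
  have t4 : (4 * δ / rtail G x) ^ 2 / x ≤ s / 4 * wInt G x := by
    calc (4 * δ / rtail G x) ^ 2 / x = 16 * δ ^ 2 * (1 / (rtail G x ^ 2 * x)) := by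
          field_simp; norm_num
      _ ≤ 16 * δ ^ 2 * (s / (4 * (16 * δ ^ 2)) * wInt G x) := by gcongr
      _ = _ := by field_simp
  linarith

lemma jint_criterion_half {aF η h T : ℝ} (hF : RegTail F aF) (haF : 0 ≤ aF)
    (hG : RegTail G (1 / 2)) (hT : 0 ≤ T) (hV : ∀ᵐ y ∂V, 0 ≤ y)
    (hGV : ∀ B, MeasurableSet B → B ⊆ Ioi 0 → G B = ∫⁻ y, F ((fun z => -y + z) ⁻¹' B) ∂V)
    (hη0 : 0 < η) (hη : η ≤ 1) (hRT : RightTail G ℓ) (hL1 : ∀ x, 1 ≤ L x)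
    (hlim : Tendsto (fun x => rtail G x * L x) atTop (𝓝 0))
    (hO : Tendsto (fun x => uInt ℓ x / uInt ℓ (linv ℓ (L x))) atTop (𝓝 1) →
      (fun x => Iof F h η x T) =O[atTop] fun x => ℓ x ^ 2 / uInt ℓ x)
    (ho : ¬ Tendsto (fun x => uInt ℓ x / uInt ℓ (linv ℓ (L x))) atTop (𝓝 1) →
      (fun x => Iof F h η x T) =o[atTop] fun x => ℓ x ^ 2 / uInt ℓ x)
    {c b κ ε δ : ℝ} (hc : 0 < c) (hb : 0 < b) (hκ : 0 < κ) (hκ1 : κ ≤ 1) (hε : 0 < ε)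
    (hδ : 0 < δ) :
    ∀ᶠ x in atTop, ∃ J, 0 ≤ J ∧ jint G h T (κ * x) (2 * x) ≤ ENNReal.ofReal J ∧
      J * rtail G x ^ 2 * sigInt G c b 2 (L x) (4 * δ / rtail G x) ≤ ε := by
  have hv := hG.pos
  set B := 1 / (1 - η / 2) with hB
  have hB1 : 1 < B := by rw [hB, one_lt_div (by linarith)]; linarith
  have hBη : (1 - η) * B ≤ 1 := by
    rw [hB, mul_one_div, div_le_one (by linarith)]; linarith
  have hWpos : ∀ᶠ x in atTop, 0 < wInt G x := by
    filter_upwards [eventually_gt_atTop 1] with x hx using wInt_pos hv hx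
  have hW1 : ∃ c0 > 0, ∀ᶠ x in atTop, ∀ j : ℕ, c0 * 1 ^ j * wInt G x ≤ wInt G (B ^ j * x) := by
    refine ⟨1, one_pos, ?_⟩
    filter_upwards [eventually_gt_atTop 0] with x hx j
    rw [one_pow, one_mul, one_mul]
    exact wInt_mono hv hx (le_mul_of_one_le_left hx.le (one_le_pow₀ hB1.le))
  obtain ⟨C1, hC1, htr⟩ := jint_le_of_Iof (a2 := 3 / 4) (q := 1) (h := h) hF haF hG
    (by norm_num) (by norm_num) hT hV hGV hη0.le hη hB1 hBη one_pos
    (rpow_lt_one_of_one_lt_of_neg hB1 (by norm_num)) hκ (by linarith) hWpos hW1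
    ⟨2, two_pos, hG.wInt_le_mul hκ hκ1⟩
  obtain ⟨Cu, hCu, hu⟩ := hRT.sq_div_uInt_le hv
  have key (e s : ℝ) (he : 0 < e) (hs : 0 < s) (hes : C1 * (e * Cu) * s ≤ ε)
      (hI : ∀ᶠ x in atTop, ‖Iof F h η x T‖ ≤ e * ‖ℓ x ^ 2 / uInt ℓ x‖)
      (hsig : ∀ᶠ x in atTop, sigInt G c b 2 (L x) (4 * δ / rtail G x) ≤ s * wInt G x) :
      ∀ᶠ x in atTop, ∃ J, 0 ≤ J ∧ jint G h T (κ * x) (2 * x) ≤ ENNReal.ofReal J ∧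
        J * rtail G x ^ 2 * sigInt G c b 2 (L x) (4 * δ / rtail G x) ≤ ε := by
    have hI' : ∀ᶠ x in atTop, Iof F h η x T ≤ e * Cu / (rtail G x ^ 2 * wInt G x) := by
      filter_upwards [hI, hu] with x h1 h2
      rw [mul_div_assoc]
      exact (le_abs_self _).trans (h1.trans (by gcongr; exact h2))
    filter_upwards [htr _ (by positivity) hI', hsig, hWpos] with x h1 h2 h3
    have hvx := hv x
    refine ⟨C1 * (e * Cu) / (rtail G x ^ 2 * wInt G x), by positivity, h1, ?_⟩
    calc _ ≤ C1 * (e * Cu) / (rtail G x ^ 2 * wInt G x) * rtail G x ^ 2 * (s * wInt G x) := by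
          gcongr
      _ = C1 * (e * Cu) * s := by field_simp
      _ ≤ ε := hes
  by_cases hr : Tendsto (fun x => uInt ℓ x / uInt ℓ (linv ℓ (L x))) atTop (𝓝 1)
  · obtain ⟨e, he, hbd⟩ := (hO hr).exists_pos
    exact key e (ε / (C1 * (e * Cu))) he (by positivity) (by field_simp; rfl) hbd.bound
      (hG.sigInt_le_small_wInt hRT hb hc hL1 hδ hlim hr (by positivity))
  · obtain ⟨s, hs, hsig⟩ := hG.sigInt_le_wInt hb hc.le (fun x => zero_le_one.trans (hL1 x)) hδ
    exact key (ε / (C1 * Cu * s)) s (by positivity) hs (le_of_eq (by field_simp))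
      ((ho hr).bound (by positivity)) hsig

end

end SRT

open SRT

/-- Theorem 1.7 of the paper: integral criteria for the SRT
for the strict ascending ladder height process. -/
theorem srt_ladder
    (F : Measure ℝ) [IsProbabilityMeasure F] (α h : ℝ) (ℓ : ℝ → ℝ)
    (hα : α ∈ Set.Ioc (0:ℝ) (3/2)) (hℓ : RegVary ℓ α)
    (hRT : RightTail F ℓ) (hTR : TailRatio F) (hspan : SpanOK F h)
    (hq : rtail F 0 ∈ Set.Ioo (0:ℝ) 1)
    (μζ : Measure ℝ) [IsProbabilityMeasure μζ]
    (hweak : WeakLimit F ℓ μζ) (hstable : IsStable μζ) (hnz : μζ ≠ Measure.dirac 0)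
    (ρ : ℝ) (hρ : ρ = (μζ (Set.Ioi (0:ℝ))).toReal)
    (hαρ : α * ρ ∈ Set.Ioc (0:ℝ) (1/2))
    {Ω : Type} [MeasurableSpace Ω] (P : Measure Ω) [IsProbabilityMeasure P]
    (X : ℕ → Ω → ℝ) (hX : IIDseq P F X)
    (Fp : Measure ℝ) (hFp : Fp = P.map (ladderHeight X 1))
    (ℓp : ℝ → ℝ) (hℓp : RegVary ℓp (α * ρ)) (hRTp : RightTail Fp ℓp)
    (L : ℝ → ℝ) (hLreg : RegVaryAny L) (hL1 : ∀ x, 1 ≤ L x)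
    (T : ℝ) (hT : 0 ≤ T) (η : ℝ) (hη : η ∈ Set.Ioc (0:ℝ) 1)
    (ha1 : Tendsto (fun x => rtail Fp x * L x) atTop (nhds 0))
    (ha2 : Tendsto (fun x => x * rtail Fp x *
        ∑ n ∈ Finset.range ⌈L x⌉₊,
          (P {ω | ladderHeight X n ω ∈ Set.Ioc x (x + h)}).toReal)
      atTop (nhds 0))
    (hb : α * ρ < 1/2 →
      (fun x => Iof F h η x T) =o[atTop]
        fun x => ℓp x ^ 2 * linv ℓp (L x) / L x ^ 2)
    (hc1 : α * ρ = 1/2 →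
      Tendsto (fun x => (∫ s in (1:ℝ)..x, (ℓp s / s) ^ 2) /
          ∫ s in (1:ℝ)..(linv ℓp (L x)), (ℓp s / s) ^ 2) atTop (nhds 1) →
      (fun x => Iof F h η x T) =O[atTop]
        fun x => ℓp x ^ 2 / ∫ s in (1:ℝ)..x, (ℓp s / s) ^ 2)
    (hc2 : α * ρ = 1/2 →
      ¬ Tendsto (fun x => (∫ s in (1:ℝ)..x, (ℓp s / s) ^ 2) /
          ∫ s in (1:ℝ)..(linv ℓp (L x)), (ℓp s / s) ^ 2) atTop (nhds 1) →
      (fun x => Iof F h η x T) =o[atTop]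
        fun x => ℓp x ^ 2 / ∫ s in (1:ℝ)..x, (ℓp s / s) ^ 2) :
    Tendsto (fun x : ℝ => x * rtail Fp x * ((renewal Fp) (Set.Ioc x (x + h))).toReal)
      atTop (nhds (h * Real.sin (Real.pi * (α * ρ)) / Real.pi)) := by
  have hρ0 : 0 < μζ (Ioi 0) := by
    rw [pos_iff_ne_zero]
    intro h0
    rw [hρ, h0] at hαρ
    simp at hαρ
  have hF : RegTail F α := RegTail.of_regVary hℓ hRT
  have hunb := hX.ae_unbounded (hweak.exists_le_measure_Ioi hF hα.1 hRT hρ0)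
  have hHm (n : ℕ) : Measurable (ladderHeight X n) := measurable_ladderHeight hX.1 n
  subst hFp
  have : IsProbabilityMeasure (P.map (ladderHeight X 1)) :=
    Measure.isProbabilityMeasure_map (hHm 1).aemeasurable
  have hG : RegTail (P.map (ladderHeight X 1)) (α * ρ) := RegTail.of_regVary hℓp hRTp
  have hG0 : P.map (ladderHeight X 1) (Iio 0) = 0 := by
    rw [Measure.map_apply (hHm 1) measurableSet_Iio]
    refine measure_mono_null ?_ (ae_iff.1 hunb)
    intro ω hω hpos
    exact lt_asymm hω (ladderHeight_one_pos hpos)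
  have hGV (B : Set ℝ) (hB : MeasurableSet B) (hB0 : B ⊆ Ioi 0) :=
    hX.map_ladderHeight_one_apply hB hB0
  have hV : ∀ᵐ y ∂(preLadder P X), 0 ≤ y := ae_preLadder_nonneg hX.1
  refine hG.srt hαρ.1 (by linarith [hαρ.2]) hG0 hspan.1 hT
    (hX.ladder_charFun_ne_one hF.pos hspan) hL1 ?_ fun c hc b hb' κ hκ ε hε =>
      ⟨1, one_pos, fun δ hδ _ => ?_⟩
  · refine ha2.congr fun x => ?_
    congr 1
    refine Finset.sum_congr rfl fun n _ => ?_
    rw [← hX.map_ladderHeight hunb n, measureReal_def,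
      Measure.map_apply (hHm n) measurableSet_Ioc]
    rfl
  have hκ' : 0 < min κ 1 := lt_min hκ one_pos
  have hJ : ∀ᶠ x in atTop, ∃ J, 0 ≤ J ∧
      jint (P.map (ladderHeight X 1)) h T (min κ 1 * x) (2 * x) ≤ ENNReal.ofReal J ∧
      J * rtail (P.map (ladderHeight X 1)) x ^ 2 * sigInt (P.map (ladderHeight X 1)) c b 2 (L x)
        (4 * δ / rtail (P.map (ladderHeight X 1)) x) ≤ ε := by
    rcases hαρ.2.lt_or_eq with hlt | heq
    · exact jint_criterion_lt_half hF hα.1.le hG hαρ.1 hlt hT hV hGV hη.1 hη.2 hRTp hℓp.1 hLreg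
        hL1 ha1 (hb hlt) hc hκ' (by linarith [min_le_right κ 1]) hε hδ
    · exact jint_criterion_half hF hα.1.le (heq ▸ hG) hT hV hGV hη.1 hη.2 hRTp hL1 ha1 (hc1 heq)
        (hc2 heq) hc hb' hκ' (min_le_right _ _) hε hδ
  filter_upwards [hJ, eventually_ge_atTop 0] with x ⟨J, hJ0, hJ1, hJ2⟩ hx
  refine ⟨J, hJ0, le_trans (lintegral_mono_set (Ioc_subset_Ioc_left ?_)) hJ1, hJ2⟩
  gcongr
  exact min_le_left _ _
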